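/- Let α∈ℝ∖{0,1} and let 1<p₁,p₂≤∞ and 2/3<p₃<∞ satisfy 1/p₁+1/p₂=1/p₃. There exists a constant C=C(α,p₁,p₂)>0 such that for all Schwartz functions f,g on ℝ, ‖H_α(f,g)‖_{L^{p₃}(ℝ)} ≤ C‖f‖_{L^{p₁}(ℝ)}‖g‖_{L^{p₂}(ℝ)}. -/

import Mathlib

open MeasureTheory Complex SchwartzMap Filter
open scoped FourierTransform ENNReal NNReal Real

/-- The distribution function of an `ℝ≥0∞`-valued function. -/
noncomputable def distFn {X : Type*} [MeasurableSpace X] (μ : Measure X)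
    (f : X → ℝ≥0∞) (t : ℝ) : ℝ≥0∞ :=
  μ {x | ENNReal.ofReal t < f x}

/-- The Lorentz `L^{p,q}` quasinorm, defined via the distribution function. -/
noncomputable def lorentzNorm {X : Type*} [MeasurableSpace X] (μ : Measure X)
    (p q : ℝ≥0∞) (f : X → ℝ≥0∞) : ℝ≥0∞ :=
  if q = ∞ then ⨆ t ∈ Set.Ioi (0 : ℝ), ENNReal.ofReal t * distFn μ f t ^ (1 / p.toReal)
  else (q * ∫⁻ t in Set.Ioi (0 : ℝ),
      ENNReal.ofReal (t ^ (q.toReal - 1)) * distFn μ f t ^ (q.toReal / p.toReal)) ^ (1 / q.toReal)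

/-- The Lorentz `L^{p,q}` quasinorm of a complex-valued function. -/
noncomputable def lorentzNormC {X : Type*} [MeasurableSpace X] (μ : Measure X)
    (p q : ℝ≥0∞) (f : X → ℂ) : ℝ≥0∞ :=
  lorentzNorm μ p q fun x => (‖f x‖₊ : ℝ≥0∞)

/-- A function is locally bounded if it is bounded on every compact set. -/
def LocallyBounded (m : ℝ × ℝ → ℂ) : Prop :=
  ∀ K : Set (ℝ × ℝ), IsCompact K → ∃ C : ℝ, ∀ z ∈ K, ‖m z‖ ≤ C

/-- The bilinear multiplier operator `C_m`. -/
noncomputable def Cm (m : ℝ × ℝ → ℂ) (f g : 𝓢(ℝ, ℂ)) (x : ℝ) : ℂ :=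
  ∫ ξ : ℝ, ∫ η : ℝ, 𝓕 (f : ℝ → ℂ) ξ * 𝓕 (g : ℝ → ℂ) η * m (ξ, η) *
    Complex.exp (2 * Real.pi * Complex.I * (x : ℂ) * ((ξ : ℂ) + (η : ℂ)))

/-- The trigonometric polynomial with coefficients `a`. -/
noncomputable def trigP (a : ℤ → ℂ) (ξ : ℝ) : ℂ :=
  ∑ᶠ k : ℤ, a k * Complex.exp (-(2 * Real.pi) * Complex.I * (k : ℂ) * (ξ : ℂ))

/-- The discrete bilinear operator `D_{m̃_{t,p}}`. -/
noncomputable def Dop (m : ℝ × ℝ → ℂ) (t p : ℝ) (a b : ℤ → ℂ) (n : ℤ) : ℂ :=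
  ((t ^ (1 / p) : ℝ) : ℂ) *
    ∫ ξ in Set.Icc (-(1/2) : ℝ) (1/2), ∫ η in Set.Icc (-(1/2) : ℝ) (1/2),
      trigP a ξ * trigP b η * m (t * ξ, t * η) *
        Complex.exp (2 * Real.pi * Complex.I * (n : ℂ) * ((ξ : ℂ) + (η : ℂ)))

/-- `InER R f` : `f` is (a representative of) a tempered distribution of exponential type,
i.e. a continuous function of polynomial growth whose distributional Fourier transform is
supported in `[-R, R]`. -/
def InER (R : ℝ) (f : ℝ → ℂ) : Prop :=
  Continuous f ∧ (∃ (C : ℝ) (k : ℕ), ∀ x : ℝ, ‖f x‖ ≤ C * (1 + |x|) ^ k) ∧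
  ∀ φ : 𝓢(ℝ, ℂ), Disjoint (tsupport (φ : ℝ → ℂ)) (Set.Icc (-R) R) →
    ∫ x : ℝ, f x * 𝓕 (φ : ℝ → ℂ) x = 0

/-- The discrete bilinear Hilbert transform. -/
noncomputable def bhtZ (α : ℤ) (a b : ℤ → ℂ) (n : ℤ) : ℂ :=
  ((Real.pi : ℂ))⁻¹ * ∑ᶠ (k : ℤ) (_ : k ≠ 0), a (n - k) * b (n - α * k) * (k : ℂ)⁻¹

/-- `sinc x = sin (π x) / (π x)`, with `sinc 0 = 1`. -/
noncomputable def mySinc (x : ℝ) : ℝ :=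
  if x = 0 then 1 else Real.sin (Real.pi * x) / (Real.pi * x)

section
namespace BHT

/-! ### Weights -/

noncomputable def rho (c R x : ℝ) : ℝ := 1 + ((x - c) / R) ^ 2

lemma one_le_rho (c R x : ℝ) : 1 ≤ rho c R x := by
  unfold rho; nlinarith [sq_nonneg ((x - c) / R)]

lemma rho_pos (c R x : ℝ) : 0 < rho c R x := lt_of_lt_of_le one_pos (one_le_rho c R x)

lemma rho_ne (c R x : ℝ) : rho c R x ≠ 0 := (rho_pos c R x).ne'

lemma continuous_rho (c R : ℝ) : Continuous (rho c R) := by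
  unfold rho; fun_prop

lemma peetre (a b : ℝ) : 1 + (a + b) ^ 2 ≤ 2 * (1 + a ^ 2) * (1 + b ^ 2) := by
  nlinarith [sq_nonneg (a - b), sq_nonneg (a * b), sq_nonneg a, sq_nonneg b]

/-- If `c'` is seen from a smaller scale. -/
lemma rho_peetre {c R c' R' : ℝ} (hR' : 0 < R') (h : R' ≤ R) (x : ℝ) :
    rho c R c' ≤ 2 * rho c R x * rho c' R' x := by
  have hR : 0 < R := lt_of_lt_of_le hR' h
  have h1 : rho c R c' ≤ 2 * rho c R x * (1 + ((c' - x) / R) ^ 2) := by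
    have := peetre ((x - c) / R) ((c' - x) / R)
    have e : (x - c) / R + (c' - x) / R = (c' - c) / R := by ring
    rw [e] at this
    exact this
  have h2 : ((c' - x) / R) ^ 2 ≤ ((x - c') / R') ^ 2 := by
    rw [div_pow, div_pow, show (c' - x) ^ 2 = (x - c') ^ 2 by ring]
    apply div_le_div_of_nonneg_left (sq_nonneg _) (by positivity)
    exact pow_le_pow_left₀ hR'.le h 2
  have h3 : 0 < rho c R x := rho_pos _ _ _
  calc rho c R c' ≤ 2 * rho c R x * (1 + ((c' - x) / R) ^ 2) := h1
    _ ≤ 2 * rho c R x * (rho c' R' x) := by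
      apply mul_le_mul_of_nonneg_left _ (by positivity)
      unfold rho; linarith

lemma rho_peetre' {c R c' R' : ℝ} (hR' : 0 < R') (h : R' ≤ R) (x : ℝ) :
    rho c R x ≤ 2 * rho c R c' * rho c' R' x := by
  have hR : 0 < R := lt_of_lt_of_le hR' h
  have h1 : rho c R x ≤ 2 * rho c R c' * (1 + ((x - c') / R) ^ 2) := by
    have := peetre ((c' - c) / R) ((x - c') / R)
    have e : (c' - c) / R + (x - c') / R = (x - c) / R := by ring
    rw [e] at this
    exact this
  have h2 : ((x - c') / R) ^ 2 ≤ ((x - c') / R') ^ 2 := by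
    rw [div_pow, div_pow]
    apply div_le_div_of_nonneg_left (sq_nonneg _) (by positivity)
    exact pow_le_pow_left₀ hR'.le h 2
  have h3 : 0 < rho c R c' := rho_pos _ _ _
  calc rho c R x ≤ 2 * rho c R c' * (1 + ((x - c') / R) ^ 2) := h1
    _ ≤ 2 * rho c R c' * (rho c' R' x) := by
      apply mul_le_mul_of_nonneg_left _ (by positivity)
      unfold rho; linarith

lemma integrable_inv_rho (c : ℝ) {R : ℝ} (hR : 0 < R) : Integrable (fun x => (rho c R x)⁻¹) := by
  have h := (integrable_inv_one_add_sq.comp_div hR.ne').comp_sub_right c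
  exact h

lemma integral_inv_rho (c : ℝ) {R : ℝ} (hR : 0 < R) : ∫ x, (rho c R x)⁻¹ = R * π := by
  have h1 : ∫ x, (rho c R x)⁻¹ = ∫ x, (fun y : ℝ => (1 + (y / R) ^ 2)⁻¹) (x - c) := rfl
  rw [h1, integral_sub_right_eq_self (fun y : ℝ => (1 + (y / R) ^ 2)⁻¹) c]
  have h2 := Measure.integral_comp_div (fun y : ℝ => (1 + y ^ 2)⁻¹) R
  rw [h2, integral_univ_inv_one_add_sq, abs_of_pos hR, smul_eq_mul]

lemma inv_rho_pow_le (c R x : ℝ) {m n : ℕ} (h : m ≤ n) :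
    ((rho c R x) ^ n)⁻¹ ≤ ((rho c R x) ^ m)⁻¹ :=
  inv_anti₀ (pow_pos (rho_pos _ _ _) _) (pow_le_pow_right₀ (one_le_rho _ _ _) h)

lemma integrable_inv_rho_pow (c : ℝ) {R : ℝ} (hR : 0 < R) {n : ℕ} (hn : 1 ≤ n) :
    Integrable (fun x => ((rho c R x) ^ n)⁻¹) := by
  apply (integrable_inv_rho c hR).mono'
  · exact (((continuous_rho c R).pow n).inv₀ fun x => pow_ne_zero _ (rho_ne _ _ _)).aestronglyMeasurable
  · filter_upwards with x
    rw [Real.norm_of_nonneg (inv_nonneg.2 (pow_nonneg (rho_pos _ _ _).le _))]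
    simpa using inv_rho_pow_le c R x hn

lemma integral_inv_rho_pow_le (c : ℝ) {R : ℝ} (hR : 0 < R) {n : ℕ} (hn : 1 ≤ n) :
    ∫ x, ((rho c R x) ^ n)⁻¹ ≤ R * π := by
  rw [← integral_inv_rho c hR]
  apply integral_mono (integrable_inv_rho_pow c hR hn) (integrable_inv_rho c hR)
  intro x
  simpa using inv_rho_pow_le c R x hn

/-! ### Sums over integers -/

lemma summable_int_inv : Summable (fun n : ℤ => (1 + (n : ℝ) ^ 2)⁻¹) := by
  have h : Summable (fun n : ℤ => 1 / |(n : ℝ)| ^ (2 : ℝ)) :=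
    Real.summable_one_div_int_pow (p := 2) |>.2 (by norm_num) |>.congr (by
      intro n; simp [sq_abs])
  refine Summable.of_norm_bounded_eventually h ?_
  have : ∀ n : ℤ, n ∉ ({0} : Finset ℤ) → ‖(1 + (n : ℝ) ^ 2)⁻¹‖ ≤ 1 / |(n : ℝ)| ^ (2 : ℝ) := by
    intro n hn
    have hn' : (n : ℝ) ≠ 0 := by simpa using hn
    rw [Real.norm_of_nonneg (by positivity)]
    simp only [Real.rpow_ofNat, sq_abs, one_div]
    apply inv_anti₀ (by positivity)
    linarith
  exact (Finset.finite_toSet {0}).subset fun n hn => by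
    by_contra h'
    exact hn (this n h')

/-- Universal constant for sums `∑ 1/(1+(n-a)^2)`. -/
noncomputable def CS : ℝ := 4 * ∑' n : ℤ, (1 + (n : ℝ) ^ 2)⁻¹

lemma CS_pos : 0 < CS := by
  have := summable_int_inv.tsum_pos (fun n => by positivity) 0 (by norm_num)
  unfold CS; linarith

lemma sum_int_le (s : Finset ℤ) (a : ℝ) : ∑ n ∈ s, (1 + ((n : ℝ) - a) ^ 2)⁻¹ ≤ CS := by
  set m : ℤ := ⌊a⌋ with hm
  have h1 : ∀ n : ℤ, (1 + ((n : ℝ) - a) ^ 2)⁻¹ ≤ 4 * (1 + ((n - m : ℤ) : ℝ) ^ 2)⁻¹ := by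
    intro n
    have hf : 0 ≤ a - m := by rw [hm]; linarith [Int.floor_le a]
    have hf' : a - m ≤ 1 := by rw [hm]; linarith [Int.lt_floor_add_one a]
    have := peetre ((n : ℝ) - a) (a - m)
    have e : (n : ℝ) - a + (a - m) = ((n - m : ℤ) : ℝ) := by push_cast; ring
    rw [e] at this
    have h4 : 1 + ((n - m : ℤ) : ℝ) ^ 2 ≤ 4 * (1 + ((n : ℝ) - a) ^ 2) := by
      have hq : (a - m) ^ 2 ≤ 1 := by nlinarith
      have hp : 0 ≤ 1 + ((n : ℝ) - a) ^ 2 := by positivity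
      nlinarith [mul_nonneg hp (sub_nonneg.2 hq)]
    rw [← div_eq_mul_inv, inv_eq_one_div, div_le_div_iff₀ (by positivity) (by positivity)]
    linarith
  calc ∑ n ∈ s, (1 + ((n : ℝ) - a) ^ 2)⁻¹ ≤ ∑ n ∈ s, 4 * (1 + ((n - m : ℤ) : ℝ) ^ 2)⁻¹ :=
        Finset.sum_le_sum fun n _ => h1 n
    _ = 4 * ∑ n ∈ s.map (Equiv.subRight m).toEmbedding, (1 + (n : ℝ) ^ 2)⁻¹ := by
        rw [← Finset.mul_sum, Finset.sum_map]; simp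
    _ ≤ 4 * ∑' n : ℤ, (1 + (n : ℝ) ^ 2)⁻¹ := by
        gcongr
        exact summable_int_inv.sum_le_tsum _ (fun n _ => by positivity)
    _ = CS := rfl

/-! ### Dyadic intervals -/

noncomputable def len (k : ℤ) : ℝ := (2 : ℝ) ^ k

lemma len_pos (k : ℤ) : 0 < len k := by unfold len; positivity

lemma len_ne (k : ℤ) : len k ≠ 0 := (len_pos k).ne'

lemma len_mono {k k' : ℤ} (h : k ≤ k') : len k ≤ len k' :=
  zpow_le_zpow_right₀ (by norm_num) h

lemma len_lt {k k' : ℤ} (h : k < k') : len k < len k' :=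
  zpow_lt_zpow_right₀ (by norm_num) h

lemma len_le_iff {k k' : ℤ} : len k ≤ len k' ↔ k ≤ k' :=
  zpow_le_zpow_iff_right₀ (by norm_num)

lemma len_add (k j : ℤ) : len (k + j) = len k * len j := by
  unfold len; rw [zpow_add₀ (by norm_num)]

lemma len_sub (k j : ℤ) : len (k - j) = len k / len j := by
  unfold len; rw [zpow_sub₀ (by norm_num)]

lemma len_neg (k : ℤ) : len (-k) = (len k)⁻¹ := by
  unfold len; rw [zpow_neg]

lemma len_nat (k : ℕ) : len k = 2 ^ k := by unfold len; simp

lemma len_succ (k : ℤ) : len (k + 1) = 2 * len k := by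
  rw [len_add]; unfold len; norm_num; ring

def dI (k n : ℤ) : Set ℝ := Set.Ico (len k * n) (len k * (n + 1))

noncomputable def cen (k n : ℤ) : ℝ := len k * (n + 1 / 2)

noncomputable def rI (k n : ℤ) (x : ℝ) : ℝ := rho (cen k n) (len k) x

lemma left_mem (k n : ℤ) : len k * n ∈ dI k n := by
  have := len_pos k
  constructor
  · exact le_rfl
  · nlinarith

lemma cen_mem (k n : ℤ) : cen k n ∈ dI k n := by
  have := len_pos k
  unfold cen dI
  constructor <;> nlinarith

lemma dI_nonempty (k n : ℤ) : (dI k n).Nonempty := ⟨_, left_mem k n⟩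

lemma mem_dI_iff {k n : ℤ} {x : ℝ} : x ∈ dI k n ↔ ⌊x / len k⌋ = n := by
  have := len_pos k
  unfold dI
  rw [Int.floor_eq_iff, Set.mem_Ico, le_div_iff₀ this, div_lt_iff₀ this, mul_comm (len k), mul_comm (len k)]

lemma measurableSet_dI (k n : ℤ) : MeasurableSet (dI k n) := measurableSet_Ico

lemma volume_dI (k n : ℤ) : volume (dI k n) = ENNReal.ofReal (len k) := by
  unfold dI; rw [Real.volume_Ico]; congr 1; ring

lemma volume_real_dI (k n : ℤ) : volume.real (dI k n) = len k := by
  rw [measureReal_def, volume_dI, ENNReal.toReal_ofReal (len_pos k).le]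

lemma dI_subset_iff {k n k' n' : ℤ} (h : k ≤ k') :
    dI k n ⊆ dI k' n' ↔ n' * 2 ^ (k' - k).toNat ≤ n ∧ n < (n' + 1) * 2 ^ (k' - k).toNat := by
  have hk := len_pos k
  have e : len k' = len k * 2 ^ (k' - k).toNat := by
    conv_lhs => rw [show k' = k + ((k' - k).toNat : ℤ) by omega]
    rw [len_add, len_nat]
  set m := (k' - k).toNat
  unfold dI
  rw [Set.Ico_subset_Ico_iff (by nlinarith), e]
  constructor
  · rintro ⟨h1, h2⟩
    constructor
    · have : (n' : ℝ) * 2 ^ m ≤ n := by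
        have : len k * ((n' : ℝ) * 2 ^ m) ≤ len k * n := by linarith
        exact le_of_mul_le_mul_left this hk
      exact_mod_cast this
    · have : (n : ℝ) + 1 ≤ (n' + 1) * 2 ^ m := by
        have : len k * ((n : ℝ) + 1) ≤ len k * ((n' + 1) * 2 ^ m) := by linarith
        exact le_of_mul_le_mul_left this hk
      have h3 : n + 1 ≤ (n' + 1) * 2 ^ m := by exact_mod_cast this
      omega
  · rintro ⟨h1, h2⟩
    constructor
    · have : (n' : ℝ) * 2 ^ m ≤ n := by exact_mod_cast h1
      nlinarith
    · have h3 : n + 1 ≤ (n' + 1) * 2 ^ m := by omega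
      have : (n : ℝ) + 1 ≤ (n' + 1) * 2 ^ m := by exact_mod_cast h3
      nlinarith

lemma dI_scale_le {k n k' n' : ℤ} (h : dI k n ⊆ dI k' n') : k ≤ k' := by
  have := measure_mono (μ := volume) h
  rw [volume_dI, volume_dI, ENNReal.ofReal_le_ofReal_iff (len_pos _).le] at this
  exact len_le_iff.1 this

/-- The dyadic ancestor index. -/
def anc (k n k' : ℤ) : ℤ := n / 2 ^ (k' - k).toNat

lemma dI_subset_anc {k k' : ℤ} (n : ℤ) (h : k ≤ k') : dI k n ⊆ dI k' (anc k n k') := by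
  rw [dI_subset_iff h]
  have h2 : (0 : ℤ) < 2 ^ (k' - k).toNat := by positivity
  unfold anc
  constructor
  · exact Int.ediv_mul_le _ h2.ne'
  · exact Int.lt_ediv_add_one_mul_self _ h2

lemma dI_disjoint_of_ne {k n n' : ℤ} (h : n ≠ n') : Disjoint (dI k n) (dI k n') := by
  rw [Set.disjoint_left]
  intro x hx hx'
  rw [mem_dI_iff] at hx hx'
  exact h (hx.symm.trans hx')

lemma dI_eq_of_mem {k n n' : ℤ} {x : ℝ} (h : x ∈ dI k n) (h' : x ∈ dI k n') : n = n' := by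
  rw [mem_dI_iff] at h h'
  exact h.symm.trans h'

lemma dI_subset_or_disjoint {k n k' n' : ℤ} (h : k ≤ k') :
    dI k n ⊆ dI k' n' ∨ Disjoint (dI k n) (dI k' n') := by
  by_cases e : anc k n k' = n'
  · left; rw [← e]; exact dI_subset_anc n h
  · right
    exact (dI_disjoint_of_ne e).mono_left (dI_subset_anc n h)

lemma dI_subset_of_mem {k n k' n' : ℤ} (h : k ≤ k') {x : ℝ} (hx : x ∈ dI k n) (hx' : x ∈ dI k' n') :
    dI k n ⊆ dI k' n' := by
  rcases dI_subset_or_disjoint (n := n) (n' := n') h with h1 | h1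
  · exact h1
  · exact absurd hx' (Set.disjoint_left.1 h1 hx)

lemma abs_sub_cen_le {k n : ℤ} {x : ℝ} (hx : x ∈ dI k n) : |x - cen k n| ≤ len k / 2 := by
  unfold cen
  rw [abs_le]
  obtain ⟨h1, h2⟩ := hx
  constructor <;> nlinarith

lemma one_le_rI (k n : ℤ) (x : ℝ) : 1 ≤ rI k n x := one_le_rho _ _ _
lemma rI_pos (k n : ℤ) (x : ℝ) : 0 < rI k n x := rho_pos _ _ _
lemma rI_ne (k n : ℤ) (x : ℝ) : rI k n x ≠ 0 := rho_ne _ _ _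
lemma continuous_rI (k n : ℤ) : Continuous (rI k n) := continuous_rho _ _

lemma rI_le_two {k n : ℤ} {x : ℝ} (hx : x ∈ dI k n) : rI k n x ≤ 2 := by
  have := abs_sub_cen_le hx
  have h2 := len_pos k
  unfold rI rho
  have h3 : |(x - cen k n) / len k| ≤ 1 := by
    rw [abs_div, abs_of_pos h2, div_le_one h2]; linarith
  have := sq_le_one_iff_abs_le_one ((x - cen k n) / len k) |>.2 h3
  linarith

/-- weight of a larger interval is smaller -/
lemma rI_le_of_subset {k n k' n' : ℤ} (h : dI k n ⊆ dI k' n') (x : ℝ) :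
    rI k' n' x ≤ 4 * rI k n x := by
  have h1 := rho_peetre' (c := cen k' n') (c' := cen k n) (len_pos k) (len_mono (dI_scale_le h)) x
  have h2 := rI_le_two (h (cen_mem k n))
  have h3 := rI_pos k n x
  unfold rI at *
  nlinarith

lemma rI_apply (k n : ℤ) (x : ℝ) : rI k n x = 1 + (x / len k - n - 1 / 2) ^ 2 := by
  unfold rI rho cen
  congr 2
  field_simp [len_ne k]
  ring

lemma sum_inv_rI_le (s : Finset ℤ) (k : ℤ) (x : ℝ) : ∑ n ∈ s, (rI k n x)⁻¹ ≤ CS := by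
  refine le_trans (le_of_eq ?_) (sum_int_le s (x / len k - 1 / 2))
  apply Finset.sum_congr rfl
  intro n _
  rw [rI_apply]; congr 2; ring

end BHT
end

section
namespace BHT

abbrev DI := ℤ × ℤ
abbrev Tile := DI × ℤ

def dS (J : DI) : Set ℝ := dI J.1 J.2
noncomputable def dL (J : DI) : ℝ := len J.1
noncomputable def dR (J : DI) (x : ℝ) : ℝ := rI J.1 J.2 x
noncomputable def dC (J : DI) : ℝ := cen J.1 J.2

lemma dL_pos (J : DI) : 0 < dL J := len_pos _
lemma dL_ne (J : DI) : dL J ≠ 0 := len_ne _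
lemma one_le_dR (J : DI) (x : ℝ) : 1 ≤ dR J x := one_le_rho _ _ _
lemma dR_pos (J : DI) (x : ℝ) : 0 < dR J x := rho_pos _ _ _
lemma dR_ne (J : DI) (x : ℝ) : dR J x ≠ 0 := rho_ne _ _ _
lemma continuous_dR (J : DI) : Continuous (dR J) := continuous_rho _ _
lemma dR_eq (J : DI) : dR J = rho (dC J) (dL J) := rfl

noncomputable def E (z : ℝ) : ℂ := Complex.exp (2 * π * z * Complex.I)

lemma norm_E (z : ℝ) : ‖E z‖ = 1 := by
  unfold E
  have : (2 * π * z * Complex.I : ℂ) = ((2 * π * z : ℝ) : ℂ) * Complex.I := by push_cast; ring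
  rw [this, Complex.norm_exp_ofReal_mul_I]

lemma E_add (z w : ℝ) : E (z + w) = E z * E w := by
  unfold E; rw [← Complex.exp_add]; congr 1; push_cast; ring

lemma E_zero : E 0 = 1 := by unfold E; simp

lemma E_neg_mul (z : ℝ) : E (-z) * E z = 1 := by rw [← E_add]; simp [E_zero]

lemma E_mul_neg (z : ℝ) : E z * E (-z) = 1 := by rw [← E_add]; simp [E_zero]

lemma continuous_E : Continuous E := by unfold E; fun_prop

/-- bounded measurable functions -/
def BM (f : ℝ → ℂ) : Prop := Measurable f ∧ ∃ B : ℝ, ∀ x, ‖f x‖ ≤ B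

/-- frequency of a tile -/
noncomputable def fr (θ : ℝ) (P : Tile) : ℝ := (P.2 + θ) / dL P.1

structure Packet (φ : Tile → ℝ → ℂ) (θ e b0 K C0 : ℝ) : Prop where
  C0pos : 0 < C0
  cont : ∀ P, Continuous (φ P)
  decay : ∀ P x, ‖φ P x‖ ≤ C0 * ((dL P.1)⁻¹ * ((dR P.1 x) ^ 4)⁻¹)
  lip : ∀ P ξ x y, |dL P.1 * ξ - P.2 - θ| ≤ K → |x - y| ≤ dL P.1 →
    ‖φ P x * E (e * ξ * x) - φ P y * E (e * ξ * y)‖ ≤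
      C0 * (|x - y| / dL P.1) * ((dL P.1)⁻¹ * ((dR P.1 x) ^ 4)⁻¹)
  orth : ∀ P P' : Tile, b0 * ((dL P.1)⁻¹ + (dL P'.1)⁻¹) < |fr θ P - fr θ P'| →
    ∀ c R, 0 < R → ∫ x, φ P x * (starRingEnd ℂ) (φ P' x) * ((rho c R x) ^ 2 : ℝ) = 0

/-- coefficient -/
noncomputable def Fc (φ : Tile → ℝ → ℂ) (f : ℝ → ℂ) (P : Tile) : ℂ := ∫ x, f x * φ P x

/-- weighted inner product -/
noncomputable def ip (φ : Tile → ℝ → ℂ) (Q : DI) (P P' : Tile) : ℂ :=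
  ∫ x, φ P x * (starRingEnd ℂ) (φ P' x) * ((dR Q x) ^ 2 : ℝ)

variable {φ : Tile → ℝ → ℂ} {θ e b0 K C0 : ℝ}

lemma integrable_inv_dR_pow (J : DI) {n : ℕ} (hn : 1 ≤ n) :
    Integrable (fun x => ((dR J x) ^ n)⁻¹) := integrable_inv_rho_pow _ (len_pos _) hn

lemma integral_inv_dR_pow_le (J : DI) {n : ℕ} (hn : 1 ≤ n) :
    ∫ x, ((dR J x) ^ n)⁻¹ ≤ dL J * π := integral_inv_rho_pow_le _ (len_pos _) hn

lemma inv_dR_pow_le (J : DI) (x : ℝ) {m n : ℕ} (h : m ≤ n) :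
    ((dR J x) ^ n)⁻¹ ≤ ((dR J x) ^ m)⁻¹ := inv_rho_pow_le _ _ x h

lemma dR_le_of_subset {J Q : DI} (h : dS J ⊆ dS Q) (x : ℝ) : dR Q x ≤ 4 * dR J x :=
  rI_le_of_subset h x

lemma dL_le_of_subset {J Q : DI} (h : dS J ⊆ dS Q) : dL J ≤ dL Q :=
  len_mono (dI_scale_le h)

lemma dR_le_two {J : DI} {x : ℝ} (hx : x ∈ dS J) : dR J x ≤ 2 := rI_le_two hx

lemma inv_dR_ge_half {J : DI} {x : ℝ} (hx : x ∈ dS J) : 1 / 2 ≤ (dR J x)⁻¹ := by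
  rw [one_div]; exact inv_anti₀ (dR_pos _ _) (dR_le_two hx)

/-- basic pointwise pair bound -/
lemma pair_pointwise {P P' Q : DI} (hP : dS P ⊆ dS Q) (hk : dL P' ≤ dL P) (x : ℝ) :
    ((dR P x) ^ 4)⁻¹ * ((dR P' x) ^ 4)⁻¹ * (dR Q x) ^ 2 ≤
      64 * ((dR P (dC P')) ^ 2)⁻¹ * ((dR P' x) ^ 2)⁻¹ := by
  have a := dR_le_of_subset hP x
  have a0 := dR_pos Q x
  have b := rho_peetre (c := dC P) (c' := dC P') (dL_pos P') hk x
  change dR P (dC P') ≤ 2 * dR P x * dR P' x at b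
  have p1 := dR_pos P x
  have p2 := dR_pos P' x
  have p3 := dR_pos P (dC P')
  set u := dR P x
  set v := dR P' x
  set w := dR P (dC P')
  set q := dR Q x
  have h1 : q ^ 2 ≤ 16 * u ^ 2 := by nlinarith
  have h2 : w ^ 2 ≤ 4 * u ^ 2 * v ^ 2 := by nlinarith [mul_pos p1 p2]
  calc (u ^ 4)⁻¹ * (v ^ 4)⁻¹ * q ^ 2 ≤ (u ^ 4)⁻¹ * (v ^ 4)⁻¹ * (16 * u ^ 2) := by gcongr
    _ = 64 * (4 * u ^ 2 * v ^ 2)⁻¹ * (v ^ 2)⁻¹ := by field_simp; norm_num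
    _ ≤ 64 * (w ^ 2)⁻¹ * (v ^ 2)⁻¹ := by gcongr

lemma ip_integrand_bound (hφ : Packet φ θ e b0 K C0) (Q : DI) (P P' : Tile)
    (hP : dS P.1 ⊆ dS Q) (hk : dL P'.1 ≤ dL P.1) (x : ℝ) :
    ‖φ P x * (starRingEnd ℂ) (φ P' x) * ((dR Q x) ^ 2 : ℝ)‖ ≤
      C0 ^ 2 * ((dL P.1)⁻¹ * (dL P'.1)⁻¹) * (64 * ((dR P.1 (dC P'.1)) ^ 2)⁻¹ * ((dR P'.1 x) ^ 2)⁻¹) := by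
  rw [norm_mul, norm_mul, RCLike.norm_conj, Complex.norm_real, Real.norm_of_nonneg (sq_nonneg _)]
  have h1 := hφ.decay P x
  have h2 := hφ.decay P' x
  have h3 := pair_pointwise hP hk x
  have := dL_pos P.1
  have := dL_pos P'.1
  have := hφ.C0pos
  calc ‖φ P x‖ * ‖φ P' x‖ * (dR Q x) ^ 2 ≤ (C0 * ((dL P.1)⁻¹ * ((dR P.1 x) ^ 4)⁻¹)) *
        (C0 * ((dL P'.1)⁻¹ * ((dR P'.1 x) ^ 4)⁻¹)) * (dR Q x) ^ 2 := by
        gcongr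
    _ = C0 ^ 2 * ((dL P.1)⁻¹ * (dL P'.1)⁻¹) *
        (((dR P.1 x) ^ 4)⁻¹ * ((dR P'.1 x) ^ 4)⁻¹ * (dR Q x) ^ 2) := by ring
    _ ≤ _ := by gcongr

lemma ip_swap (φ : Tile → ℝ → ℂ) (Q : DI) (P P' : Tile) :
    ip φ Q P' P = (starRingEnd ℂ) (ip φ Q P P') := by
  unfold ip
  rw [← integral_conj]
  congr 1; ext x
  simp only [map_mul, Complex.conj_conj, Complex.conj_ofReal]
  ring

lemma ip_integrable (hφ : Packet φ θ e b0 K C0) (Q : DI) (P P' : Tile)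
    (hP : dS P.1 ⊆ dS Q) (hP' : dS P'.1 ⊆ dS Q) :
    Integrable (fun x => φ P x * (starRingEnd ℂ) (φ P' x) * ((dR Q x) ^ 2 : ℝ)) := by
  have hc : ∀ P P' : Tile, Continuous (fun x => φ P x * (starRingEnd ℂ) (φ P' x) * ((dR Q x) ^ 2 : ℝ)) := by
    intro P P'
    have := hφ.cont P
    have := hφ.cont P'
    have := continuous_dR Q
    fun_prop
  have main : ∀ P P' : Tile, dS P.1 ⊆ dS Q → dL P'.1 ≤ dL P.1 →
      Integrable (fun x => φ P x * (starRingEnd ℂ) (φ P' x) * ((dR Q x) ^ 2 : ℝ)) := by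
    intro P P' hP hk
    refine Integrable.mono' (((integrable_inv_dR_pow P'.1 (n := 2) (by norm_num)).const_mul
      (64 * ((dR P.1 (dC P'.1)) ^ 2)⁻¹)).const_mul (C0 ^ 2 * ((dL P.1)⁻¹ * (dL P'.1)⁻¹)))
      (hc P P').aestronglyMeasurable ?_
    filter_upwards with x
    exact ip_integrand_bound hφ Q P P' hP hk x
  rcases le_total (dL P'.1) (dL P.1) with h | h
  · exact main P P' hP h
  · have := (main P' P hP' h).norm
    refine Integrable.mono' this (hc P P').aestronglyMeasurable ?_
    filter_upwards with x
    rw [norm_mul, norm_mul, norm_mul, norm_mul, RCLike.norm_conj, RCLike.norm_conj, mul_comm ‖φ P x‖]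

/-- pair bound -/
lemma ip_bound (hφ : Packet φ θ e b0 K C0) (Q : DI) (P P' : Tile)
    (hP : dS P.1 ⊆ dS Q) (hk : dL P'.1 ≤ dL P.1) :
    ‖ip φ Q P P'‖ ≤ 64 * π * C0 ^ 2 * (dL P.1)⁻¹ * ((dR P.1 (dC P'.1)) ^ 2)⁻¹ := by
  have hi := ((integrable_inv_dR_pow P'.1 (n := 2) (by norm_num)).const_mul
      (64 * ((dR P.1 (dC P'.1)) ^ 2)⁻¹)).const_mul (C0 ^ 2 * ((dL P.1)⁻¹ * (dL P'.1)⁻¹))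
  have h1 := norm_integral_le_of_norm_le hi (Eventually.of_forall (ip_integrand_bound hφ Q P P' hP hk))
  unfold ip
  refine h1.trans ?_
  rw [integral_const_mul, integral_const_mul]
  have h2 := integral_inv_dR_pow_le P'.1 (n := 2) (by norm_num)
  have := dL_pos P.1
  have := dL_pos P'.1
  have := dR_pos P.1 (dC P'.1)
  calc _ ≤ C0 ^ 2 * ((dL P.1)⁻¹ * (dL P'.1)⁻¹) *
        (64 * ((dR P.1 (dC P'.1)) ^ 2)⁻¹ * (dL P'.1 * π)) := by gcongr
    _ = _ := by field_simp

/-- Cauchy–Schwarz for integrals -/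
lemma integral_cs {u v : ℝ → ℂ} (hu : MemLp u 2) (hv : MemLp v 2) :
    ‖∫ x, u x * v x‖ ^ 2 ≤ (∫ x, ‖u x‖ ^ 2) * ∫ x, ‖v x‖ ^ 2 := by
  have h := integral_mul_norm_le_Lp_mul_Lq (μ := volume) (f := u) (g := v) (p := 2) (q := 2)
    Real.HolderConjugate.two_two (by simpa using hu) (by simpa using hv)
  have h1 : ‖∫ x, u x * v x‖ ≤ ∫ x, ‖u x‖ * ‖v x‖ := by
    refine (norm_integral_le_integral_norm _).trans (le_of_eq ?_)
    simp
  have hA : 0 ≤ ∫ x, ‖u x‖ ^ 2 := integral_nonneg fun x => sq_nonneg _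
  have hB : 0 ≤ ∫ x, ‖v x‖ ^ 2 := integral_nonneg fun x => sq_nonneg _
  simp only [Real.rpow_ofNat] at h
  rw [← Real.sqrt_eq_rpow, ← Real.sqrt_eq_rpow] at h
  calc ‖∫ x, u x * v x‖ ^ 2 ≤ (√(∫ x, ‖u x‖ ^ 2) * √(∫ x, ‖v x‖ ^ 2)) ^ 2 := by
        gcongr; exact h1.trans h
    _ = _ := by rw [mul_pow, Real.sq_sqrt hA, Real.sq_sqrt hB]

/-- weighted energy -/
noncomputable def En (f : ℝ → ℂ) (Q : DI) : ℝ := ∫ x, ‖f x‖ ^ 2 * ((dR Q x) ^ 2)⁻¹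

lemma En_nonneg (f : ℝ → ℂ) (Q : DI) : 0 ≤ En f Q :=
  integral_nonneg fun x => mul_nonneg (sq_nonneg _) (inv_nonneg.2 (sq_nonneg _))

lemma memLp_div {f : ℝ → ℂ} (hf : BM f) (Q : DI) :
    MemLp (fun x => f x * ((dR Q x)⁻¹ : ℝ)) 2 := by
  obtain ⟨hm, B, hB⟩ := hf
  have hc : Continuous (fun x => (dR Q x)⁻¹) := (continuous_dR Q).inv₀ (dR_ne Q)
  rw [memLp_two_iff_integrable_sq_norm]
  · refine Integrable.mono' ((integrable_inv_dR_pow Q (n := 2) (by norm_num)).const_mul (B ^ 2)) ?_ ?_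
    · exact ((hm.mul (Complex.measurable_ofReal.comp hc.measurable)).norm.pow_const 2).aestronglyMeasurable
    · filter_upwards with x
      rw [norm_mul, Complex.norm_real, mul_pow, norm_mul, Real.norm_of_nonneg (sq_nonneg _), Real.norm_of_nonneg (sq_nonneg _),
        Real.norm_of_nonneg (inv_nonneg.2 (dR_pos _ _).le), ← inv_pow]
      gcongr
      exact hB x
  · exact (hm.mul (Complex.measurable_ofReal.comp hc.measurable)).aestronglyMeasurable

lemma ttstar (hφ : Packet φ θ e b0 K C0) {f : ℝ → ℂ} (hf : BM f) (Q : DI) (S : Finset Tile)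
    (hS : ∀ P ∈ S, dS P.1 ⊆ dS Q) :
    (∑ P ∈ S, dL P.1 * ‖Fc φ f P‖ ^ 2) ^ 2 ≤
      En f Q * ∑ P ∈ S, ∑ P' ∈ S, dL P.1 * dL P'.1 * ‖Fc φ f P‖ * ‖Fc φ f P'‖ * ‖ip φ Q P P'‖ := by
  set a : Tile → ℂ := fun P => (dL P.1 : ℂ) * (starRingEnd ℂ) (Fc φ f P) with ha
  set g : ℝ → ℂ := fun x => f x * ((dR Q x)⁻¹ : ℝ) with hg
  set G : ℝ → ℂ := fun x => ∑ P ∈ S, a P * (φ P x * (dR Q x : ℝ)) with hG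
  have hg2 : MemLp g 2 := memLp_div hf Q
  have hψ2 : ∀ P ∈ S, MemLp (fun x => φ P x * (dR Q x : ℝ)) 2 := by
    intro P hP
    have hc : Continuous (fun x => φ P x * (dR Q x : ℝ)) := by
      have := hφ.cont P
      have := continuous_dR Q
      fun_prop
    rw [memLp_two_iff_integrable_sq_norm hc.aestronglyMeasurable]
    refine (ip_integrable hφ Q P P (hS P hP) (hS P hP)).norm.congr ?_
    filter_upwards with x
    simp only [norm_mul, RCLike.norm_conj, Complex.norm_real, norm_pow]
    ring
  have hG2 : MemLp G 2 := by
    have := memLp_finsetSum S (f := fun P x => a P * (φ P x * (dR Q x : ℝ))) (μ := volume) (p := 2)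
      fun P hP => (hψ2 P hP).const_mul (a P)
    exact this
  have hgψ : ∀ P ∈ S, Integrable (fun x => g x * (φ P x * (dR Q x : ℝ))) := by
    intro P hP
    exact hg2.integrable_mul (hψ2 P hP)
  have h1 : ((∑ P ∈ S, dL P.1 * ‖Fc φ f P‖ ^ 2 : ℝ) : ℂ) = ∫ x, g x * G x := by
    simp only [hG, Finset.mul_sum]
    rw [integral_finsetSum]
    · push_cast
      apply Finset.sum_congr rfl
      intro P hP
      have : ∀ x, g x * (a P * (φ P x * (dR Q x : ℝ))) = a P * (f x * φ P x) := by
        intro x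
        have : ((dR Q x : ℝ) : ℂ) ≠ 0 := by exact_mod_cast dR_ne Q x
        simp only [hg]; push_cast; field_simp
      simp only [this]
      rw [integral_const_mul, ha]
      change _ = (dL P.1 : ℂ) * (starRingEnd ℂ) (Fc φ f P) * (Fc φ f P)
      rw [mul_assoc, Complex.conj_mul']
    · intro P hP
      have := (hgψ P hP).const_mul (a P)
      refine this.congr ?_
      filter_upwards with x
      ring
  have h2 : ((∫ x, ‖G x‖ ^ 2 : ℝ) : ℂ) = ∑ P ∈ S, ∑ P' ∈ S, a P * (starRingEnd ℂ) (a P') * ip φ Q P P' := by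
    rw [← integral_complex_ofReal]
    have : ∀ x, ((‖G x‖ ^ 2 : ℝ) : ℂ) = ∑ P ∈ S, ∑ P' ∈ S, a P * (starRingEnd ℂ) (a P') *
        (φ P x * (starRingEnd ℂ) (φ P' x) * ((dR Q x) ^ 2 : ℝ)) := by
      intro x
      push_cast
      rw [← Complex.mul_conj']
      simp only [hG, map_sum, Finset.sum_mul_sum, map_mul, Complex.conj_ofReal]
      apply Finset.sum_congr rfl; intro P _
      apply Finset.sum_congr rfl; intro P' _
      push_cast
      ring
    simp only [this]
    rw [integral_finsetSum]
    · apply Finset.sum_congr rfl; intro P hP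
      rw [integral_finsetSum]
      · apply Finset.sum_congr rfl; intro P' hP'
        rw [integral_const_mul]; rfl
      · intro P' hP'
        exact (ip_integrable hφ Q P P' (hS P hP) (hS P' hP')).const_mul _
    · intro P hP
      apply integrable_finsetSum
      intro P' hP'
      exact (ip_integrable hφ Q P P' (hS P hP) (hS P' hP')).const_mul _
  have h3 : ∫ x, ‖G x‖ ^ 2 ≤ ∑ P ∈ S, ∑ P' ∈ S, dL P.1 * dL P'.1 * ‖Fc φ f P‖ * ‖Fc φ f P'‖ * ‖ip φ Q P P'‖ := by
    have h0 : 0 ≤ ∫ x, ‖G x‖ ^ 2 := integral_nonneg fun x => sq_nonneg _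
    rw [← Real.norm_of_nonneg h0, ← Complex.norm_real, h2]
    refine (norm_sum_le _ _).trans (Finset.sum_le_sum fun P _ => ?_)
    refine (norm_sum_le _ _).trans (Finset.sum_le_sum fun P' _ => le_of_eq ?_)
    simp only [ha, norm_mul, RCLike.norm_conj, Complex.norm_real]
    rw [Real.norm_of_nonneg (dL_pos _).le, Real.norm_of_nonneg (dL_pos _).le]
    ring
  have h4 : ∫ x, ‖g x‖ ^ 2 = En f Q := by
    unfold En
    congr 1; ext x
    simp only [hg]
    rw [norm_mul, Complex.norm_real, mul_pow, Real.norm_of_nonneg (inv_nonneg.2 (dR_pos _ _).le), ← inv_pow]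
  have h5 := integral_cs hg2 hG2
  rw [← h1, h4, Complex.norm_real, Real.norm_eq_abs, sq_abs] at h5
  exact h5.trans (mul_le_mul_of_nonneg_left h3 (En_nonneg _ _))

lemma dC_div (J : DI) : dC J / dL J = J.2 + 1 / 2 := by
  unfold dC dL cen; field_simp [len_ne J.1]

lemma inv_dR_sq_le_inv (J : DI) (x : ℝ) : ((dR J x) ^ 2)⁻¹ ≤ (dR J x)⁻¹ := by
  simpa using inv_dR_pow_le J x (m := 1) (n := 2) (by norm_num)

/-- sum over intervals of the same scale of the weight -/
lemma sum_inv_dR_center_le (S : Finset DI) (J : DI) (hS : ∀ J' ∈ S, J'.1 = J.1) :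
    ∑ J' ∈ S, (dR J (dC J'))⁻¹ ≤ CS := by
  classical
  have hinj : Set.InjOn (fun J' : DI => J'.2) S := by
    intro A hA B hB h
    exact Prod.ext ((hS A hA).trans (hS B hB).symm) h
  have : ∑ J' ∈ S, (dR J (dC J'))⁻¹ = ∑ n ∈ S.image (fun J' : DI => J'.2), (1 + ((n : ℝ) - J.2) ^ 2)⁻¹ := by
    rw [Finset.sum_image hinj]
    apply Finset.sum_congr rfl
    intro J' hJ'
    have e : J'.1 = J.1 := hS J' hJ'
    have : dL J' = dL J := by unfold dL; rw [e]
    have h2 := dC_div J'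
    rw [this] at h2
    unfold dR; rw [rI_apply]
    change (1 + (dC J' / dL J - J.2 - 1 / 2) ^ 2)⁻¹ = _
    rw [h2]; congr 2; ring
  rw [this]
  exact sum_int_le _ _

/-- Bessel for families which are orthogonal between scales -/
lemma bessel (hφ : Packet φ θ e b0 K C0) {f : ℝ → ℂ} (hf : BM f) (Q : DI) (S : Finset Tile)
    (hS : ∀ P ∈ S, dS P.1 ⊆ dS Q)
    (hl : ∀ P ∈ S, ∀ P' ∈ S, P.1.1 = P'.1.1 → P.2 = P'.2)
    (ho : ∀ P ∈ S, ∀ P' ∈ S, P.1.1 ≠ P'.1.1 → ip φ Q P P' = 0) :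
    ∑ P ∈ S, dL P.1 * ‖Fc φ f P‖ ^ 2 ≤ (64 * π * C0 ^ 2 * CS) * En f Q := by
  classical
  set s := ∑ P ∈ S, dL P.1 * ‖Fc φ f P‖ ^ 2 with hs
  have hs0 : 0 ≤ s := Finset.sum_nonneg fun P _ => mul_nonneg (dL_pos _).le (sq_nonneg _)
  have hC := hφ.C0pos
  have hCS := CS_pos
  have h1 := ttstar hφ hf Q S hS
  rw [← hs] at h1
  have rowsum : ∀ P ∈ S, ∑ P' ∈ S, dL P'.1 * ‖ip φ Q P P'‖ ≤ 64 * π * C0 ^ 2 * CS := by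
    intro P hP
    have : ∀ P' ∈ S, dL P'.1 * ‖ip φ Q P P'‖ ≤
        if P'.1.1 = P.1.1 then (64 * π * C0 ^ 2) * (dR P.1 (dC P'.1))⁻¹ else 0 := by
      intro P' hP'
      split_ifs with h
      · have e : dL P'.1 = dL P.1 := by unfold dL; rw [h]
        have h2 := ip_bound hφ Q P P' (hS P hP) e.le
        have h3 := inv_dR_sq_le_inv P.1 (dC P'.1)
        have h4 := dL_pos P.1
        rw [e]
        calc dL P.1 * ‖ip φ Q P P'‖ ≤ dL P.1 * (64 * π * C0 ^ 2 * (dL P.1)⁻¹ * ((dR P.1 (dC P'.1)) ^ 2)⁻¹) := by gcongr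
          _ = (64 * π * C0 ^ 2) * ((dR P.1 (dC P'.1)) ^ 2)⁻¹ := by field_simp
          _ ≤ _ := by gcongr
      · rw [ho P hP P' hP' (Ne.symm h)]; simp
    refine (Finset.sum_le_sum this).trans ?_
    rw [← Finset.sum_filter, ← Finset.mul_sum]
    apply mul_le_mul_of_nonneg_left _ (by positivity)
    have hinj : Set.InjOn (fun P' : Tile => P'.1) (S.filter (fun P' => P'.1.1 = P.1.1)) := by
      intro A hA B hB h
      simp only [Finset.coe_filter, Set.mem_ofPred_eq] at hA hB
      exact Prod.ext h (hl A hA.1 B hB.1 (hA.2.trans hB.2.symm))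
    rw [← Finset.sum_image (f := fun J => (dR P.1 (dC J))⁻¹) hinj]
    apply sum_inv_dR_center_le
    intro J hJ
    simp only [Finset.mem_image, Finset.mem_filter] at hJ
    obtain ⟨A, hA, rfl⟩ := hJ
    exact hA.2
  have h2 : ∑ P ∈ S, ∑ P' ∈ S, dL P.1 * dL P'.1 * ‖Fc φ f P‖ * ‖Fc φ f P'‖ * ‖ip φ Q P P'‖
      ≤ (64 * π * C0 ^ 2 * CS) * s := by
    have sym : ∀ P P', ‖ip φ Q P' P‖ = ‖ip φ Q P P'‖ := by
      intro P P'; rw [ip_swap φ Q P P', RCLike.norm_conj]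
    have h3 : ∀ P P' : Tile, dL P.1 * dL P'.1 * ‖Fc φ f P‖ * ‖Fc φ f P'‖ * ‖ip φ Q P P'‖ ≤
        1 / 2 * (dL P.1 * ‖Fc φ f P‖ ^ 2 * (dL P'.1 * ‖ip φ Q P P'‖)) +
        1 / 2 * (dL P'.1 * ‖Fc φ f P'‖ ^ 2 * (dL P.1 * ‖ip φ Q P' P‖)) := by
      intro P P'
      rw [sym P P']
      have : 0 ≤ dL P.1 * dL P'.1 * ‖ip φ Q P P'‖ :=
        mul_nonneg (mul_nonneg (dL_pos _).le (dL_pos _).le) (norm_nonneg _)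
      nlinarith [mul_nonneg this (sq_nonneg (‖Fc φ f P‖ - ‖Fc φ f P'‖))]
    have h4 : ∑ P ∈ S, ∑ P' ∈ S, dL P.1 * ‖Fc φ f P‖ ^ 2 * (dL P'.1 * ‖ip φ Q P P'‖)
        ≤ (64 * π * C0 ^ 2 * CS) * s := by
      rw [hs, Finset.mul_sum]
      apply Finset.sum_le_sum
      intro P hP
      rw [← Finset.mul_sum, mul_comm (64 * π * C0 ^ 2 * CS)]
      exact mul_le_mul_of_nonneg_left (rowsum P hP) (mul_nonneg (dL_pos _).le (sq_nonneg _))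
    calc _ ≤ ∑ P ∈ S, ∑ P' ∈ S, (1 / 2 * (dL P.1 * ‖Fc φ f P‖ ^ 2 * (dL P'.1 * ‖ip φ Q P P'‖)) +
        1 / 2 * (dL P'.1 * ‖Fc φ f P'‖ ^ 2 * (dL P.1 * ‖ip φ Q P' P‖))) :=
          Finset.sum_le_sum fun P _ => Finset.sum_le_sum fun P' _ => h3 P P'
      _ = 1 / 2 * (∑ P ∈ S, ∑ P' ∈ S, dL P.1 * ‖Fc φ f P‖ ^ 2 * (dL P'.1 * ‖ip φ Q P P'‖)) +
          1 / 2 * (∑ P' ∈ S, ∑ P ∈ S, dL P'.1 * ‖Fc φ f P'‖ ^ 2 * (dL P.1 * ‖ip φ Q P' P‖)) := by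
          simp only [Finset.sum_add_distrib, Finset.mul_sum]
          congr 1
          exact Finset.sum_comm
      _ ≤ _ := by linarith
  have h5 : s ^ 2 ≤ (64 * π * C0 ^ 2 * CS) * En f Q * s := by
    refine h1.trans ?_
    calc _ ≤ En f Q * ((64 * π * C0 ^ 2 * CS) * s) := mul_le_mul_of_nonneg_left h2 (En_nonneg _ _)
      _ = _ := by ring
  rcases hs0.eq_or_lt with h | h
  · rw [← h]; have := En_nonneg f Q; positivity
  · have : s * s ≤ (64 * π * C0 ^ 2 * CS) * En f Q * s := by rwa [← sq]
    exact le_of_mul_le_mul_right this h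

end BHT
end

section
namespace BHT

/-! ### Dyadic combinatorics -/

lemma anc_anc (n : ℤ) {k k' k'' : ℤ} (h : k ≤ k') (h' : k' ≤ k'') :
    anc k' (anc k n k') k'' = anc k n k'' := by
  unfold anc
  rw [Int.ediv_ediv_of_nonneg (by positivity), ← pow_add]
  congr 2; omega

lemma anc_near {a b : ℤ} {k k' : ℤ} (h : |a - b| ≤ 1) : |anc k a k' - anc k b k'| ≤ 1 := by
  unfold anc
  set m : ℤ := 2 ^ (k' - k).toNat with hm
  have hm0 : 0 < m := by positivity
  rw [abs_le] at h ⊢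
  have h1 : a / m ≤ (b + m * 1) / m := Int.ediv_le_ediv hm0 (by omega)
  have h2 : b / m ≤ (a + m * 1) / m := Int.ediv_le_ediv hm0 (by omega)
  rw [Int.add_mul_ediv_left _ _ hm0.ne'] at h1 h2
  constructor <;> omega

lemma anc_succ (k n : ℤ) : anc k n (k + 1) = n / 2 := by
  unfold anc; simp

lemma anc_self (k n : ℤ) : anc k n k = n := by unfold anc; simp

lemma anc_of_subset {k n k' n' : ℤ} (h : dI k n ⊆ dI k' n') : anc k n k' = n' := by
  have hk := dI_scale_le h
  have h1 := dI_subset_anc n hk (left_mem k n)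
  exact dI_eq_of_mem h1 (h (left_mem k n))

/-- stopping condition -/
def act (T : Finset Tile) (I J : DI) : Prop :=
  ∃ P ∈ T, P.1.1 ≤ J.1 ∧ J.1 ≤ I.1 ∧ |anc P.1.1 P.1.2 J.1 - J.2| ≤ 1

def par (J : DI) : DI := (J.1 + 1, J.2 / 2)

lemma par_eq (J : DI) : par J = (J.1 + 1, anc J.1 J.2 (J.1 + 1)) := by
  unfold par; rw [anc_succ]

lemma subset_par (J : DI) : dS J ⊆ dS (par J) := by
  rw [par_eq]; exact dI_subset_anc _ (by omega)

lemma dL_par (J : DI) : dL (par J) = 2 * dL J := len_succ _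

lemma act_up {T : Finset Tile} {I J : DI} (h : act T I J) {k' : ℤ} (h1 : J.1 ≤ k') (h2 : k' ≤ I.1) :
    act T I (k', anc J.1 J.2 k') := by
  obtain ⟨P, hP, a, b, c⟩ := h
  refine ⟨P, hP, a.trans h1, h2, ?_⟩
  rw [← anc_anc _ a h1]
  exact anc_near c

open Classical in
/-- stopping intervals -/
noncomputable def stp (T : Finset Tile) (I : DI) : Finset DI :=
  (T.biUnion fun P => (Finset.Icc (P.1.1 - 1) I.1 ×ˢ Finset.Icc (0 : ℤ) 5).image
    fun q => (q.1, 2 * anc P.1.1 P.1.2 (q.1 + 1) - 2 + q.2)).filter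
    fun J => ¬ act T I J ∧ act T I (par J)

lemma mem_stp {T : Finset Tile} {I J : DI} : J ∈ stp T I ↔ ¬ act T I J ∧ act T I (par J) := by
  classical
  unfold stp
  rw [Finset.mem_filter]
  constructor
  · exact fun h => h.2
  · intro h
    refine ⟨?_, h⟩
    obtain ⟨P, hP, a, b, c⟩ := h.2
    rw [Finset.mem_biUnion]
    refine ⟨P, hP, ?_⟩
    rw [Finset.mem_image]
    simp only [par] at a b c
    rw [abs_le] at c
    refine ⟨(J.1, J.2 - (2 * anc P.1.1 P.1.2 (J.1 + 1) - 2)), ?_, ?_⟩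
    · simp only [Finset.mem_product, Finset.mem_Icc]
      refine ⟨⟨by omega, by omega⟩, ?_⟩
      omega
    · simp

lemma stp_disjoint {T : Finset Tile} {I : DI} :
    Set.PairwiseDisjoint (stp T I : Set DI) dS := by
  have key : ∀ J J' : DI, J ∈ stp T I → J' ∈ stp T I → J.1 < J'.1 → Disjoint (dS J) (dS J') := by
    intro J J' hJ hJ' hk
    rw [mem_stp] at hJ hJ'
    rcases dI_subset_or_disjoint (n := J.2) (n' := J'.2) hk.le with h | h
    · exfalso
      apply hJ'.1
      have hk' : J'.1 ≤ I.1 := by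
        obtain ⟨P, hP, a, b, c⟩ := hJ'.2
        simp only [par] at b; omega
      have h1 := act_up hJ.2 (k' := J'.1) (by simp only [par]; omega) hk'
      rw [par_eq] at h1
      rw [anc_anc _ (by omega) (by omega), anc_of_subset h] at h1
      exact h1
    · exact h
  intro J hJ J' hJ' hne
  rcases lt_trichotomy J.1 J'.1 with h | h | h
  · exact key J J' hJ hJ' h
  · have : J.2 ≠ J'.2 := fun h' => hne (Prod.ext h h')
    change Disjoint (dI J.1 J.2) (dI J'.1 J'.2)
    rw [← h]
    exact dI_disjoint_of_ne this
  · exact (key J' J hJ' hJ h).symm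

/-- tripled interval -/
def tI (I : DI) : Set ℝ := Set.Ico (dL I * (I.2 - 1)) (dL I * (I.2 + 2))

lemma mem_tI_of_near {I : DI} {n : ℤ} (h : |I.2 - n| ≤ 1) {x : ℝ} (hx : x ∈ dI I.1 n) : x ∈ tI I := by
  have h0 := dL_pos I
  obtain ⟨h1, h2⟩ := hx
  rw [abs_le] at h
  have a : (I.2 : ℝ) - 1 ≤ n := by exact_mod_cast (by omega : I.2 - 1 ≤ n)
  have b : (n : ℝ) + 1 ≤ I.2 + 2 := by exact_mod_cast (by omega : n + 1 ≤ I.2 + 2)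
  change dL I * n ≤ x at h1
  change x < dL I * (n + 1) at h2
  constructor <;> nlinarith

lemma near_of_mem_tI {I : DI} {x : ℝ} (hx : x ∈ tI I) : |I.2 - ⌊x / dL I⌋| ≤ 1 := by
  have h0 := dL_pos I
  obtain ⟨h1, h2⟩ := hx
  have a : ((I.2 - 1 : ℤ) : ℝ) ≤ x / dL I := by
    rw [le_div_iff₀ h0]; push_cast; linarith
  have b : x / dL I < ((I.2 + 2 : ℤ) : ℝ) := by
    rw [div_lt_iff₀ h0]; push_cast; linarith
  have a' := Int.le_floor.2 a
  have b' := Int.floor_lt.2 b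
  rw [abs_le]; omega

lemma stp_subset {T : Finset Tile} {I : DI} (hT : ∀ P ∈ T, dS P.1 ⊆ dS I) {J : DI} (hJ : J ∈ stp T I) :
    dS J ⊆ tI I := by
  rw [mem_stp] at hJ
  obtain ⟨P, hP, a, b, c⟩ := hJ.2
  have e : anc P.1.1 P.1.2 I.1 = I.2 := anc_of_subset (hT P hP)
  have h := anc_near (k := (par J).1) (k' := I.1) c
  rw [anc_anc _ a b, e] at h
  intro x hx
  exact mem_tI_of_near h (dI_subset_anc _ b (subset_par J hx))

lemma stp_cover {T : Finset Tile} {I : DI} (hT : ∀ P ∈ T, dS P.1 ⊆ dS I) (hne : T.Nonempty)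
    {x : ℝ} (hx : x ∈ tI I) : ∃ J ∈ stp T I, x ∈ dS J := by
  classical
  let S : ℤ → Prop := fun k => act T I (k, ⌊x / len k⌋)
  have h1 : S I.1 := by
    obtain ⟨P, hP⟩ := hne
    refine ⟨P, hP, dI_scale_le (hT P hP), le_rfl, ?_⟩
    have : anc P.1.1 P.1.2 I.1 = I.2 := anc_of_subset (hT P hP)
    rw [this]
    exact near_of_mem_tI hx
  obtain ⟨k0, hk0⟩ : ∃ k0 : ℤ, ∀ P ∈ T, k0 ≤ P.1.1 := by
    obtain ⟨m, hm⟩ := (T.image fun P => P.1.1).bddBelow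
    exact ⟨m, fun P hP => hm (by simp only [Finset.coe_image, Set.mem_image]; exact ⟨P, hP, rfl⟩)⟩
  have hb : ∀ z, S z → k0 ≤ z := by
    rintro z ⟨P, hP, a, -, -⟩
    exact (hk0 P hP).trans a
  obtain ⟨m, hm, hmin⟩ := Int.exists_least_of_bdd ⟨k0, hb⟩ ⟨I.1, h1⟩
  refine ⟨(m - 1, ⌊x / len (m - 1)⌋), ?_, mem_dI_iff.2 rfl⟩
  rw [mem_stp]
  constructor
  · intro h
    have := hmin (m - 1) h
    omega
  · have e : par (m - 1, ⌊x / len (m - 1)⌋) = (m, ⌊x / len m⌋) := by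
      have hx1 : x ∈ dS (m - 1, ⌊x / len (m - 1)⌋) := mem_dI_iff.2 rfl
      have hx2 := subset_par _ hx1
      have : (par (m - 1, ⌊x / len (m - 1)⌋)).1 = m := by simp [par]
      refine Prod.ext this ?_
      unfold dS at hx2
      rw [this] at hx2
      exact (mem_dI_iff.1 hx2).symm
    rw [e]; exact hm

lemma volume_dS (J : DI) : volume (dS J) = ENNReal.ofReal (dL J) := volume_dI _ _
lemma volume_real_dS (J : DI) : volume.real (dS J) = dL J := volume_real_dI _ _
lemma measurableSet_dS (J : DI) : MeasurableSet (dS J) := measurableSet_dI _ _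

lemma volume_real_tI (I : DI) : volume.real (tI I) = 3 * dL I := by
  have := dL_pos I
  unfold tI
  rw [Real.volume_real_Ico_of_le (by nlinarith)]; ring

lemma sum_disjoint_le {S : Finset DI} {U : Set ℝ} (hd : Set.PairwiseDisjoint (S : Set DI) dS)
    (hU : ∀ J ∈ S, dS J ⊆ U) (hU' : volume U ≠ ∞) : ∑ J ∈ S, dL J ≤ volume.real U := by
  have h1 : volume.real (⋃ J ∈ S, dS J) = ∑ J ∈ S, volume.real (dS J) :=
    measureReal_biUnion_finset hd (fun J _ => measurableSet_dS J)
      (fun J _ => by rw [volume_dS]; exact ENNReal.ofReal_ne_top)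
  simp only [volume_real_dS] at h1
  rw [← h1]
  exact measureReal_mono (Set.iUnion₂_subset hU) hU'

lemma sum_stp_le {T : Finset Tile} {I : DI} (hT : ∀ P ∈ T, dS P.1 ⊆ dS I) :
    ∑ J ∈ stp T I, dL J ≤ 3 * dL I := by
  rw [← volume_real_tI]
  exact sum_disjoint_le stp_disjoint (fun J hJ => stp_subset hT hJ) (by unfold tI; simp)

/-! ### Sums over scales -/

lemma sum_len_abs (s : Finset ℤ) (m : ℤ) : ∑ k ∈ s, len (-|k - m|) ≤ 4 := by
  have hs : Summable (fun k : ℤ => len (-|k|)) := by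
    refine Summable.of_nat_of_neg ?_ ?_
    · refine (summable_geometric_two).congr fun n => ?_
      simp [len, zpow_neg]
    · refine (summable_geometric_two).congr fun n => ?_
      simp [len, zpow_neg]
  have h1 : ∑ k ∈ s, len (-|k - m|) = ∑ k ∈ s.map (Equiv.subRight m).toEmbedding, len (-|k|) := by
    rw [Finset.sum_map]; simp
  rw [h1]
  refine (hs.sum_le_tsum _ (fun k _ => (len_pos _).le)).trans ?_
  have h2 : (fun k : ℕ => len (-|(k : ℤ)|)) = fun k => (1 / 2 : ℝ) ^ k := by
    ext n; simp [len, zpow_neg]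
  have h3 : (fun k : ℕ => len (-|(-((k : ℤ) + 1))|)) = fun k : ℕ => (1 / 2 : ℝ) * (1 / 2 : ℝ) ^ k := by
    ext n
    have : |(-((n : ℤ) + 1))| = ((n + 1 : ℕ) : ℤ) := by rw [abs_neg]; push_cast; rw [abs_of_nonneg]; omega
    rw [this]
    simp only [len, zpow_neg, zpow_natCast, pow_succ, one_div, inv_pow]
    field_simp
  rw [tsum_of_nat_of_neg_add_one]
  · rw [h2, h3, tsum_mul_left, tsum_geometric_two]; norm_num
  · rw [h2]; exact summable_geometric_two
  · rw [h3]; exact summable_geometric_two.mul_left _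

/-- at most one frequency per scale -/
def oneL (T : Finset Tile) : Prop := ∀ P ∈ T, ∀ P' ∈ T, P.1.1 = P'.1.1 → P.2 = P'.2

lemma sumT (T : Finset Tile) (hl : oneL T) (w : ℤ → ℝ) (hw : ∀ k, 0 ≤ w k) (x : ℝ) :
    ∑ P ∈ T, w P.1.1 * (dR P.1 x)⁻¹ ≤ CS * ∑ k ∈ T.image (fun P => P.1.1), w k := by
  classical
  rw [← Finset.sum_fiberwise_of_maps_to (g := fun P : Tile => P.1.1) (t := T.image (fun P => P.1.1))
    (fun P hP => Finset.mem_image_of_mem _ hP), Finset.mul_sum]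
  apply Finset.sum_le_sum
  intro k _
  have h1 : ∑ P ∈ T with P.1.1 = k, w P.1.1 * (dR P.1 x)⁻¹ = w k * ∑ P ∈ T with P.1.1 = k, (rI k P.1.2 x)⁻¹ := by
    rw [Finset.mul_sum]
    apply Finset.sum_congr rfl
    intro P hP
    rw [Finset.mem_filter] at hP
    unfold dR
    rw [hP.2]
  have hinj : Set.InjOn (fun P : Tile => P.1.2) (T.filter fun P => P.1.1 = k) := by
    intro A hA B hB h
    simp only [Finset.coe_filter, Set.mem_ofPred_eq] at hA hB
    exact Prod.ext (Prod.ext (hA.2.trans hB.2.symm) h) (hl A hA.1 B hB.1 (hA.2.trans hB.2.symm))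
  rw [h1, mul_comm CS]
  apply mul_le_mul_of_nonneg_left _ (hw k)
  rw [← Finset.sum_image (f := fun n => (rI k n x)⁻¹) hinj]
  exact sum_inv_rI_le _ _ _

lemma sumT' (T : Finset Tile) (hl : oneL T) (m : ℤ) (x : ℝ) :
    ∑ P ∈ T, len (-|P.1.1 - m|) * (dR P.1 x)⁻¹ ≤ CS * 4 := by
  refine (sumT T hl (fun k => len (-|k - m|)) (fun k => (len_pos _).le) x).trans ?_
  exact mul_le_mul_of_nonneg_left (sum_len_abs _ _) CS_pos.le

end BHT
end

section
namespace BHT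

variable {φ : Tile → ℝ → ℂ} {θ e b0 K C0 : ℝ}

lemma integrable_mul_packet (hφ : Packet φ θ e b0 K C0) {f : ℝ → ℂ} (hf : BM f) (P : Tile) :
    Integrable (fun x => f x * φ P x) := by
  obtain ⟨hm, B, hB⟩ := hf
  have hC := hφ.C0pos
  have hL := dL_pos P.1
  refine Integrable.mono' (((integrable_inv_dR_pow P.1 (n := 4) (by norm_num)).const_mul
    (dL P.1)⁻¹).const_mul C0 |>.const_mul B) (hm.mul (hφ.cont P).measurable).aestronglyMeasurable ?_
  filter_upwards with x
  rw [norm_mul]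
  exact mul_le_mul (hB x) (hφ.decay P x) (norm_nonneg _) ((norm_nonneg _).trans (hB x))

lemma BM.integrable_inv {f : ℝ → ℂ} (hf : BM f) (J : DI) {n : ℕ} (hn : 1 ≤ n) :
    Integrable (fun x => ‖f x‖ * ((dR J x) ^ n)⁻¹) := by
  obtain ⟨hm, B, hB⟩ := hf
  refine Integrable.mono' ((integrable_inv_dR_pow J hn).const_mul B) ?_ ?_
  · exact (hm.norm.mul (((continuous_dR J).pow n).measurable.inv)).aestronglyMeasurable
  · filter_upwards with x
    have := dR_pos J x
    rw [Real.norm_of_nonneg (by positivity)]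
    gcongr
    exact hB x

lemma BM.sub {f g : ℝ → ℂ} (hf : BM f) (hg : BM g) : BM (fun x => f x - g x) := by
  obtain ⟨hm, B, hB⟩ := hf
  obtain ⟨hm', B', hB'⟩ := hg
  exact ⟨hm.sub hm', B + B', fun x => (norm_sub_le _ _).trans (add_le_add (hB x) (hB' x))⟩

lemma BM.integrableOn {f : ℝ → ℂ} (hf : BM f) {s : Set ℝ} (hs : volume s ≠ ∞) : IntegrableOn f s := by
  obtain ⟨hm, B, hB⟩ := hf
  exact Measure.integrableOn_of_bounded hs hm.aestronglyMeasurable (M := B) (by filter_upwards with x using hB x)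

lemma volume_dS_ne_top (J : DI) : volume (dS J) ≠ ∞ := by rw [volume_dS]; exact ENNReal.ofReal_ne_top

lemma dR_le_four {J : DI} {x : ℝ} (hx : x ∈ tI J) : dR J x ≤ 4 := by
  have h0 := dL_pos J
  obtain ⟨h1, h2⟩ := hx
  unfold dR; rw [rI_apply]
  change 1 + (x / dL J - J.2 - 1 / 2) ^ 2 ≤ 4
  have a : (J.2 : ℝ) - 1 ≤ x / dL J := by rw [le_div_iff₀ h0]; linarith
  have b : x / dL J ≤ J.2 + 2 := by rw [div_le_iff₀ h0]; linarith
  nlinarith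

section size
variable {f : ℝ → ℂ} {T : Finset Tile} {I : DI} {ξ A : ℝ}

/-- modulated averages -/
noncomputable def mJ (f : ℝ → ℂ) (e ξ : ℝ) (J : DI) : ℂ :=
  ((dL J)⁻¹ : ℝ) * ∫ y in dS J, f y * E (-(e * ξ * y))

open Classical in
noncomputable def gS (f : ℝ → ℂ) (e ξ : ℝ) (S : Finset DI) (x : ℝ) : ℂ :=
  ∑ J ∈ S, (dS J).indicator (fun x => E (e * ξ * x) * mJ f e ξ J) x

lemma gS_of_mem {S : Finset DI} (hd : Set.PairwiseDisjoint (S : Set DI) dS) {J : DI} (hJ : J ∈ S)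
    {x : ℝ} (hx : x ∈ dS J) : gS f e ξ S x = E (e * ξ * x) * mJ f e ξ J := by
  unfold gS
  rw [Finset.sum_eq_single J]
  · rw [Set.indicator_of_mem hx]
  · intro J' hJ' hne
    apply Set.indicator_of_notMem
    intro hx'
    exact Set.disjoint_left.1 (hd hJ' hJ hne) hx' hx
  · exact fun h => absurd hJ h

lemma gS_of_notMem {S : Finset DI} {x : ℝ} (hx : ∀ J ∈ S, x ∉ dS J) : gS f e ξ S x = 0 := by
  unfold gS
  exact Finset.sum_eq_zero fun J hJ => Set.indicator_of_notMem (hx J hJ) _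

lemma int_stp_le (hf : BM f) (hT : ∀ P ∈ T, dS P.1 ⊆ dS I)
    (hA : ∀ P ∈ T, ∀ J, dS P.1 ⊆ dS J → dS J ⊆ dS I →
      ∫ x, ‖f x‖ * ((dR J x) ^ 2)⁻¹ ≤ A * dL J) {J : DI} (hJ : J ∈ stp T I) :
    ∫ x in dS J, ‖f x‖ ≤ 32 * A * dL J := by
  rw [mem_stp] at hJ
  obtain ⟨P, hP, a, b, c⟩ := hJ.2
  set J' : DI := ((par J).1, anc P.1.1 P.1.2 (par J).1) with hJ'
  have h1 : dS P.1 ⊆ dS J' := dI_subset_anc _ a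
  have h2 : dS J' ⊆ dS I := by
    apply dI_subset_of_mem b (h1 (left_mem _ _)) (hT P hP (left_mem _ _))
  have h3 := hA P hP J' h1 h2
  have e1 : dL J' = 2 * dL J := dL_par J
  have h4 : ∀ x ∈ dS J, dR J' x ≤ 4 := by
    intro x hx
    apply dR_le_four
    apply mem_tI_of_near (n := (par J).2) c
    exact subset_par J hx
  have h5 : ∫ x in dS J, ‖f x‖ ≤ ∫ x in dS J, 16 * (‖f x‖ * ((dR J' x) ^ 2)⁻¹) := by
    apply setIntegral_mono_on (hf.integrableOn (volume_dS_ne_top J)).norm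
      ((hf.integrable_inv J' (by norm_num)).const_mul 16).integrableOn (measurableSet_dS J)
    intro x hx
    have := h4 x hx
    have hp := dR_pos J' x
    have : (16 : ℝ)⁻¹ ≤ ((dR J' x) ^ 2)⁻¹ := by
      apply inv_anti₀ (by positivity); nlinarith
    nlinarith [norm_nonneg (f x)]
  have h6 : ∫ x in dS J, 16 * (‖f x‖ * ((dR J' x) ^ 2)⁻¹) ≤ ∫ x, 16 * (‖f x‖ * ((dR J' x) ^ 2)⁻¹) := by
    apply setIntegral_le_integral ((hf.integrable_inv J' (by norm_num)).const_mul 16)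
    filter_upwards with x
    have hp := dR_pos J' x
    change (0 : ℝ) ≤ _
    positivity
  rw [integral_const_mul, integral_const_mul] at h6
  rw [integral_const_mul] at h5
  rw [e1] at h3
  linarith

lemma norm_mJ_le {J : DI} (h : ∫ x in dS J, ‖f x‖ ≤ 32 * A * dL J) : ‖mJ f e ξ J‖ ≤ 32 * A := by
  have h0 := dL_pos J
  unfold mJ
  rw [norm_mul, Complex.norm_real, Real.norm_of_nonneg (inv_nonneg.2 h0.le)]
  have h1 : ‖∫ y in dS J, f y * E (-(e * ξ * y))‖ ≤ ∫ x in dS J, ‖f x‖ := by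
    refine (norm_integral_le_integral_norm _).trans (le_of_eq ?_)
    simp [norm_E]
  rw [inv_mul_le_iff₀ h0]
  linarith

lemma gS_meas (S : Finset DI) : Measurable (gS f e ξ S) := by
  unfold gS
  apply Finset.measurable_fun_sum
  intro J _
  apply Measurable.indicator _ (measurableSet_dS J)
  have := continuous_E
  exact (by fun_prop : Continuous fun x => E (e * ξ * x) * mJ f e ξ J).measurable

lemma gS_bound (hA0 : 0 ≤ A) {S : Finset DI} (hd : Set.PairwiseDisjoint (S : Set DI) dS)
    (h : ∀ J ∈ S, ∫ x in dS J, ‖f x‖ ≤ 32 * A * dL J) (x : ℝ) : ‖gS f e ξ S x‖ ≤ 32 * A := by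
  by_cases hx : ∃ J ∈ S, x ∈ dS J
  · obtain ⟨J, hJ, hxJ⟩ := hx
    rw [gS_of_mem hd hJ hxJ, norm_mul, norm_E, one_mul]
    exact norm_mJ_le (h J hJ)
  · push Not at hx
    rw [gS_of_notMem hx]
    simp only [norm_zero]
    positivity

/-- cancellation on one stopping interval -/
lemma cancel (hf : BM f) (J : DI) :
    ∫ x in dS J, (f x - E (e * ξ * x) * mJ f e ξ J) * E (-(e * ξ * x)) = 0 := by
  have h0 := dL_pos J
  have h1 : ∀ x, (f x - E (e * ξ * x) * mJ f e ξ J) * E (-(e * ξ * x)) =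
      f x * E (-(e * ξ * x)) - mJ f e ξ J := by
    intro x
    have := E_mul_neg (e * ξ * x)
    linear_combination (-mJ f e ξ J) * this
  simp only [h1]
  rw [integral_sub]
  · rw [setIntegral_const, volume_real_dS]
    unfold mJ
    have : ((dL J : ℝ) : ℂ) ≠ 0 := by exact_mod_cast h0.ne'
    simp only [Complex.real_smul]
    push_cast
    field_simp
    ring
  · have hb : BM (fun x => f x * E (-(e * ξ * x))) := by
      obtain ⟨hm, B, hB⟩ := hf
      have := continuous_E
      exact ⟨hm.mul (by fun_prop : Continuous fun x => E (-(e * ξ * x))).measurable, B,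
        fun x => by rw [norm_mul, norm_E, mul_one]; exact hB x⟩
    exact hb.integrableOn (volume_dS_ne_top J)
  · exact integrableOn_const (volume_dS_ne_top J)

lemma far_of_not_act {J : DI} {P : Tile} (hP : P ∈ T) (hJ : ¬ act T I J) (hk : P.1.1 ≤ J.1) (hI : J.1 ≤ I.1)
    {x : ℝ} (hx : x ∈ dS J) : dL J ≤ |x - dC P.1| := by
  have h0 := dL_pos J
  have h1 : ¬ |anc P.1.1 P.1.2 J.1 - J.2| ≤ 1 := fun h => hJ ⟨P, hP, hk, hI, h⟩
  have h2 : dC P.1 ∈ dI J.1 (anc P.1.1 P.1.2 J.1) := dI_subset_anc _ hk (cen_mem _ _)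
  set a := anc P.1.1 P.1.2 J.1
  obtain ⟨h3, h4⟩ := h2
  obtain ⟨h5, h6⟩ := hx
  change dL J * a ≤ dC P.1 at h3
  change dC P.1 < dL J * (a + 1) at h4
  change dL J * J.2 ≤ x at h5
  change x < dL J * (J.2 + 1) at h6
  rw [abs_le, not_and_or] at h1
  rcases h1 with h1 | h1
  · have : (a : ℝ) + 2 ≤ J.2 := by exact_mod_cast (by omega : a + 2 ≤ J.2)
    refine le_trans ?_ (le_abs_self _)
    nlinarith
  · have : (J.2 : ℝ) + 2 ≤ a := by exact_mod_cast (by omega : J.2 + 2 ≤ a)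
    refine le_trans ?_ (neg_le_abs _)
    nlinarith

lemma inv_sq_le_inv {u : ℝ} (h : 1 ≤ u) {n : ℕ} (hn : 1 ≤ n) : (u ^ n)⁻¹ ≤ u⁻¹ := by
  apply inv_anti₀ (by linarith)
  exact le_self_pow₀ h (by omega)

lemma one_local (hφ : Packet φ θ e b0 K C0) (hf : BM f) {P : Tile} (hP : P ∈ T)
    (hK : |dL P.1 * ξ - P.2 - θ| ≤ K) {J : DI} (hJ : J ∈ stp T I) (hA0 : 0 ≤ A)
    (hfJ : ∫ x in dS J, ‖f x‖ ≤ 32 * A * dL J) :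
    dL P.1 * ‖∫ x in dS J, (f x - E (e * ξ * x) * mJ f e ξ J) * φ P x‖ ≤
      256 * C0 * A * dL J * (len (-|P.1.1 - J.1|) * (dR P.1 (dC J))⁻¹) := by
  have hC := hφ.C0pos
  have hLP := dL_pos P.1
  have hLJ := dL_pos J
  rw [mem_stp] at hJ
  have hJI : J.1 ≤ I.1 := by
    obtain ⟨P, hP, a, b, c⟩ := hJ.2
    simp only [par] at b; omega
  set b : ℝ → ℂ := fun x => f x - E (e * ξ * x) * mJ f e ξ J with hb
  have hbm : BM b := by
    apply hf.sub
    refine ⟨?_, ‖mJ f e ξ J‖, fun x => by rw [norm_mul, norm_E, one_mul]⟩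
    have := continuous_E
    exact (by fun_prop : Continuous fun x => E (e * ξ * x) * mJ f e ξ J).measurable
  have hbi : IntegrableOn b (dS J) := hbm.integrableOn (volume_dS_ne_top J)
  have hbn : ∫ x in dS J, ‖b x‖ ≤ 64 * A * dL J := by
    have : ∫ x in dS J, ‖b x‖ ≤ ∫ x in dS J, (‖f x‖ + 32 * A) := by
      apply setIntegral_mono_on hbi.norm
      · exact (hf.integrableOn (volume_dS_ne_top J)).norm.add (integrableOn_const (volume_dS_ne_top J))
      · exact measurableSet_dS J
      · intro x _
        refine (norm_sub_le _ _).trans ?_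
        rw [norm_mul, norm_E, one_mul]
        gcongr
        exact norm_mJ_le hfJ
    refine this.trans ?_
    rw [integral_add (hf.integrableOn (volume_dS_ne_top J)).norm (integrableOn_const (volume_dS_ne_top J)),
      setIntegral_const, volume_real_dS, smul_eq_mul]
    linarith
  have hw : 0 < dR P.1 (dC J) := dR_pos _ _
  have hw1 : 1 ≤ dR P.1 (dC J) := one_le_dR _ _
  -- it suffices to have a pointwise bound
  have gen : ∀ (ψ : ℝ → ℂ) (M : ℝ), (∀ x ∈ dS J, ‖ψ x‖ ≤ M) →
      ‖∫ x in dS J, b x * ψ x‖ ≤ 64 * A * dL J * M := by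
    intro ψ M hψ
    have hM : 0 ≤ M := (norm_nonneg _).trans (hψ _ (left_mem _ _))
    have : ‖∫ x in dS J, b x * ψ x‖ ≤ ∫ x in dS J, ‖b x‖ * M := by
      apply norm_integral_le_of_norm_le (hbi.norm.mul_const M)
      filter_upwards [ae_restrict_mem (measurableSet_dS J)] with x hx
      rw [norm_mul]
      exact mul_le_mul_of_nonneg_left (hψ x hx) (norm_nonneg _)
    refine this.trans ?_
    rw [integral_mul_const]
    exact mul_le_mul_of_nonneg_right hbn hM
  rcases le_or_gt J.1 P.1.1 with hk | hk
  · -- small J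
    have hcJ : ∀ x ∈ dS J, |dC J - x| ≤ dL J := by
      intro x hx
      rw [abs_sub_comm]
      exact (abs_sub_cen_le hx).trans (by change dL J / 2 ≤ dL J; linarith)
    have hLL : dL J ≤ dL P.1 := len_mono hk
    set c0 : ℂ := φ P (dC J) * E (e * ξ * dC J) with hc0
    have e1 : ∫ x in dS J, b x * φ P x =
        ∫ x in dS J, b x * (E (-(e * ξ * x)) * (φ P x * E (e * ξ * x) - c0)) := by
      have h1 : ∀ x, b x * φ P x = b x * (E (-(e * ξ * x)) * (φ P x * E (e * ξ * x) - c0)) +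
          (b x * E (-(e * ξ * x))) * c0 := by
        intro x
        have := E_neg_mul (e * ξ * x)
        linear_combination (-b x * φ P x) * this
      have hcE : Continuous fun x => E (-(e * ξ * x)) := by
        have := continuous_E
        fun_prop
      have hI2 : IntegrableOn (fun x => (b x * E (-(e * ξ * x))) * c0) (dS J) := by
        refine Integrable.mul_const ?_ c0
        have hb2 : BM (fun x => b x * E (-(e * ξ * x))) := by
          obtain ⟨hm, B, hB⟩ := hbm
          exact ⟨hm.mul hcE.measurable, B, fun x => by rw [norm_mul, norm_E, mul_one]; exact hB x⟩
        exact hb2.integrableOn (volume_dS_ne_top J)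
      have hI0 : IntegrableOn (fun x => b x * φ P x) (dS J) :=
        (integrable_mul_packet hφ hbm P).integrableOn
      have hI1 : IntegrableOn (fun x => b x * (E (-(e * ξ * x)) * (φ P x * E (e * ξ * x) - c0))) (dS J) := by
        refine (hI0.sub hI2).congr ?_
        filter_upwards with x
        simp only [Pi.sub_apply]
        rw [h1 x]; ring
      rw [integral_congr_ae (Eventually.of_forall h1), integral_add hI1 hI2, integral_mul_const]
      rw [cancel hf J]; simp
    rw [e1]
    have h2 := gen (fun x => E (-(e * ξ * x)) * (φ P x * E (e * ξ * x) - c0))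
      (C0 * (dL J / dL P.1) * ((dL P.1)⁻¹ * ((dR P.1 (dC J)) ^ 4)⁻¹)) (by
        intro x hx
        rw [norm_mul, norm_E, one_mul, norm_sub_rev]
        refine (hφ.lip P ξ (dC J) x hK ((hcJ x hx).trans hLL)).trans ?_
        gcongr
        exact hcJ x hx)
    have h3 : len (-|P.1.1 - J.1|) = dL J / dL P.1 := by
      rw [abs_of_nonneg (by omega), neg_sub, len_sub]; rfl
    have h4 : ((dR P.1 (dC J)) ^ 4)⁻¹ ≤ (dR P.1 (dC J))⁻¹ := inv_sq_le_inv hw1 (by norm_num)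
    rw [h3]
    calc _ ≤ dL P.1 * (64 * A * dL J * (C0 * (dL J / dL P.1) * ((dL P.1)⁻¹ * ((dR P.1 (dC J)) ^ 4)⁻¹))) := by gcongr
      _ = 64 * C0 * A * dL J * ((dL J / dL P.1) * ((dR P.1 (dC J)) ^ 4)⁻¹) := by field_simp
      _ ≤ 256 * C0 * A * dL J * ((dL J / dL P.1) * (dR P.1 (dC J))⁻¹) := by
        gcongr
        norm_num
  · -- large J
    have h3 : len (-|P.1.1 - J.1|) = dL P.1 / dL J := by
      rw [abs_of_neg (by omega), neg_neg, len_sub]; rfl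
    have hLL : dL P.1 ≤ dL J := len_mono hk.le
    have h2 := gen (φ P) (C0 * ((dL P.1)⁻¹ * (4 * ((dL P.1 / dL J) * (dR P.1 (dC J))⁻¹)))) (by
      intro x hx
      refine (hφ.decay P x).trans ?_
      gcongr
      have hfar := far_of_not_act hP hJ.1 hk.le hJI hx
      have hu : 1 ≤ dR P.1 x := one_le_dR _ _
      have hu0 : 0 < dR P.1 x := dR_pos _ _
      have hv : 1 ≤ dL J / dL P.1 := by rw [one_le_div hLP]; exact hLL
      have hxa : (dL J / dL P.1) ≤ |(x - dC P.1) / dL P.1| := by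
        rw [abs_div, abs_of_pos hLP]
        gcongr
      have hb1 : dL J / dL P.1 ≤ dR P.1 x := by
        change _ ≤ 1 + ((x - dC P.1) / dL P.1) ^ 2
        rw [← sq_abs]
        nlinarith
      have hcx : |x - dC J| ≤ dL J / 2 := abs_sub_cen_le hx
      have hb2 : dR P.1 (dC J) ≤ 4 * dR P.1 x := by
        change 1 + ((dC J - dC P.1) / dL P.1) ^ 2 ≤ 4 * (1 + ((x - dC P.1) / dL P.1) ^ 2)
        have : |(dC J - dC P.1) / dL P.1| ≤ 2 * |(x - dC P.1) / dL P.1| := by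
          rw [abs_div, abs_div, abs_of_pos hLP, ← mul_div_assoc]
          gcongr
          have := abs_sub_le (dC J) x (dC P.1)
          rw [abs_sub_comm] at hcx
          linarith
        rw [← sq_abs, ← sq_abs ((x - dC P.1) / dL P.1)]
        nlinarith [abs_nonneg ((dC J - dC P.1) / dL P.1), abs_nonneg ((x - dC P.1) / dL P.1)]
      have hc1 : (dR P.1 x)⁻¹ ≤ dL P.1 / dL J := by
        rw [← inv_div]
        exact inv_anti₀ (by positivity) hb1
      have hc2 : (dR P.1 x)⁻¹ ≤ 4 * (dR P.1 (dC J))⁻¹ := by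
        rw [inv_le_comm₀ hu0 (by positivity), mul_inv, inv_inv]
        linarith
      calc ((dR P.1 x) ^ 4)⁻¹ ≤ ((dR P.1 x) ^ 2)⁻¹ := inv_dR_pow_le _ _ (by norm_num)
        _ = (dR P.1 x)⁻¹ * (dR P.1 x)⁻¹ := by rw [sq, mul_inv]
        _ ≤ (dL P.1 / dL J) * (4 * (dR P.1 (dC J))⁻¹) := by gcongr
        _ = _ := by ring)
    rw [h3]
    calc _ ≤ dL P.1 * (64 * A * dL J * (C0 * ((dL P.1)⁻¹ * (4 * ((dL P.1 / dL J) * (dR P.1 (dC J))⁻¹))))) := by gcongr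
      _ = _ := by field_simp; ring

end size

end BHT
end

section
namespace BHT

variable {φ : Tile → ℝ → ℂ} {θ e b0 K C0 : ℝ}
variable {f : ℝ → ℂ} {T : Finset Tile} {I : DI} {ξ A : ℝ}

lemma measurableSet_tI (I : DI) : MeasurableSet (tI I) := measurableSet_Ico

lemma far_of_notMem_tI {P I : DI} (h : dS P ⊆ dS I) {x : ℝ} (hx : x ∉ tI I) : dL I ≤ |x - dC P| := by
  have h0 := dL_pos I
  obtain ⟨h1, h2⟩ := h (cen_mem _ _ : dC P ∈ dS P)
  change dL I * I.2 ≤ dC P at h1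
  change dC P < dL I * (I.2 + 1) at h2
  unfold tI at hx
  rw [Set.mem_Ico, not_and_or] at hx
  rcases hx with hx | hx
  · refine le_trans ?_ (neg_le_abs _); linarith
  · refine le_trans ?_ (le_abs_self _); linarith

lemma far_weight {P I : DI} (h : dS P ⊆ dS I) {x : ℝ} (hx : x ∉ tI I) :
    ((dR P x) ^ 4)⁻¹ ≤ 16 * ((dR I x) ^ 2)⁻¹ * (len (-|P.1 - I.1|) * (dR P x)⁻¹) := by
  have hLP := dL_pos P
  have hLI := dL_pos I
  have hk : P.1 ≤ I.1 := dI_scale_le h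
  have hLL : dL P ≤ dL I := len_mono hk
  have h3 : len (-|P.1 - I.1|) = dL P / dL I := by
    rw [abs_of_nonpos (by omega), neg_neg, len_sub]; rfl
  have hfar := far_of_notMem_tI h hx
  have hu0 : 0 < dR P x := dR_pos _ _
  have hI0 : 0 < dR I x := dR_pos _ _
  have hv : 1 ≤ dL I / dL P := by rw [one_le_div hLP]; exact hLL
  have hxa : (dL I / dL P) ≤ |(x - dC P) / dL P| := by
    rw [abs_div, abs_of_pos hLP]
    gcongr
  have hb1 : dL I / dL P ≤ dR P x := by
    change _ ≤ 1 + ((x - dC P) / dL P) ^ 2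
    rw [← sq_abs]
    nlinarith
  have hc1 : (dR P x)⁻¹ ≤ dL P / dL I := by
    rw [← inv_div]
    exact inv_anti₀ (by positivity) hb1
  have hb2 := dR_le_of_subset h x
  have hc2 : (dR P x)⁻¹ ≤ 4 * (dR I x)⁻¹ := by
    rw [inv_le_comm₀ hu0 (by positivity), mul_inv, inv_inv]
    linarith
  rw [h3]
  calc ((dR P x) ^ 4)⁻¹ = ((dR P x)⁻¹ * (dR P x)⁻¹) * ((dR P x)⁻¹ * (dR P x)⁻¹) := by
        field_simp
    _ ≤ ((4 * (dR I x)⁻¹) * (4 * (dR I x)⁻¹)) * ((dL P / dL I) * (dR P x)⁻¹) := by gcongr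
    _ = _ := by field_simp; norm_num

lemma norm_Fc_le (hφ : Packet φ θ e b0 K C0) (hf : BM f) (P : Tile) :
    dL P.1 * ‖Fc φ f P‖ ≤ C0 * ∫ x, ‖f x‖ * ((dR P.1 x) ^ 4)⁻¹ := by
  have hL := dL_pos P.1
  have h1 : ‖Fc φ f P‖ ≤ ∫ x, (C0 * (dL P.1)⁻¹) * (‖f x‖ * ((dR P.1 x) ^ 4)⁻¹) := by
    apply norm_integral_le_of_norm_le ((hf.integrable_inv P.1 (by norm_num)).const_mul _)
    filter_upwards with x
    rw [norm_mul]
    have := mul_le_mul_of_nonneg_left (hφ.decay P x) (norm_nonneg (f x))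
    linarith
  rw [integral_const_mul] at h1
  calc _ ≤ dL P.1 * ((C0 * (dL P.1)⁻¹) * ∫ x, ‖f x‖ * ((dR P.1 x) ^ 4)⁻¹) := by gcongr
    _ = _ := by field_simp

lemma norm_Fc_le_of_bdd (hφ : Packet φ θ e b0 K C0) (hf : BM f) {B : ℝ} (hB : ∀ x, ‖f x‖ ≤ B) (P : Tile) :
    ‖Fc φ f P‖ ≤ 4 * C0 * B := by
  have hL := dL_pos P.1
  have hC := hφ.C0pos
  have hB0 : 0 ≤ B := (norm_nonneg _).trans (hB 0)
  have h1 := norm_Fc_le hφ hf P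
  have h2 : ∫ x, ‖f x‖ * ((dR P.1 x) ^ 4)⁻¹ ≤ ∫ x, B * ((dR P.1 x) ^ 4)⁻¹ := by
    apply integral_mono (hf.integrable_inv P.1 (by norm_num))
      ((integrable_inv_dR_pow P.1 (by norm_num)).const_mul _)
    intro x
    have := dR_pos P.1 x
    dsimp only
    gcongr
    exact hB x
  rw [integral_const_mul] at h2
  have h3 := integral_inv_dR_pow_le P.1 (n := 4) (by norm_num)
  have h4 := Real.pi_le_four
  have h5 : dL P.1 * ‖Fc φ f P‖ ≤ dL P.1 * (4 * C0 * B) := by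
    calc _ ≤ C0 * (B * (dL P.1 * 4)) := by
          refine h1.trans ?_
          gcongr
          refine h2.trans ?_
          gcongr
          refine h3.trans ?_
          gcongr
      _ = _ := by ring
  exact le_of_mul_le_mul_left h5 hL

lemma norm_Fc_le_of_avg (hφ : Packet φ θ e b0 K C0) (hf : BM f) (P : Tile)
    (h : ∫ x, ‖f x‖ * ((dR P.1 x) ^ 2)⁻¹ ≤ A * dL P.1) : ‖Fc φ f P‖ ≤ C0 * A := by
  have hL := dL_pos P.1
  have hC := hφ.C0pos
  have h1 := norm_Fc_le hφ hf P
  have h2 : ∫ x, ‖f x‖ * ((dR P.1 x) ^ 4)⁻¹ ≤ ∫ x, ‖f x‖ * ((dR P.1 x) ^ 2)⁻¹ := by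
    apply integral_mono (hf.integrable_inv P.1 (by norm_num)) (hf.integrable_inv P.1 (by norm_num))
    intro x
    exact mul_le_mul_of_nonneg_left (inv_dR_pow_le _ _ (by norm_num)) (norm_nonneg _)
  have h5 : dL P.1 * ‖Fc φ f P‖ ≤ dL P.1 * (C0 * A) := by
    calc _ ≤ C0 * (A * dL P.1) := h1.trans (by gcongr; exact h2.trans h)
      _ = _ := by ring
  exact le_of_mul_le_mul_left h5 hL

lemma Fc_sub (hφ : Packet φ θ e b0 K C0) (hf : BM f) {g : ℝ → ℂ} (hg : BM g) (P : Tile) :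
    Fc φ (fun x => f x - g x) P = Fc φ f P - Fc φ g P := by
  unfold Fc
  rw [← integral_sub (integrable_mul_packet hφ hf P) (integrable_mul_packet hφ hg P)]
  congr 1; ext x; ring

/-- the constant of the size lemma -/
noncomputable def Csz (C0 : ℝ) : ℝ := 2 * (129 * C0 * (3136 * C0 * CS)) + 2 * (64 * π * C0 ^ 2 * CS * (1024 * π))

lemma size_lemma (hφ : Packet φ θ e b0 K C0) (hf : BM f)
    (hT : ∀ P ∈ T, dS P.1 ⊆ dS I) (hl : oneL T) (hK : ∀ P ∈ T, |dL P.1 * ξ - P.2 - θ| ≤ K)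
    (ho : ∀ P ∈ T, ∀ P' ∈ T, P.1.1 ≠ P'.1.1 → ip φ I P P' = 0)
    (hA : ∀ P ∈ T, ∀ J, dS P.1 ⊆ dS J → dS J ⊆ dS I →
      ∫ x, ‖f x‖ * ((dR J x) ^ 2)⁻¹ ≤ A * dL J) :
    ∑ P ∈ T, dL P.1 * ‖Fc φ f P‖ ^ 2 ≤ Csz C0 * A ^ 2 * dL I := by
  have hC := hφ.C0pos
  have hCS := CS_pos
  have hLI := dL_pos I
  have hpi := Real.pi_pos
  rcases T.eq_empty_or_nonempty with h0 | hne
  · rw [h0]; simp only [Finset.sum_empty]; unfold Csz; positivity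
  have hAI : ∫ x, ‖f x‖ * ((dR I x) ^ 2)⁻¹ ≤ A * dL I := by
    obtain ⟨P, hP⟩ := hne
    exact hA P hP I (hT P hP) le_rfl
  have hA0 : 0 ≤ A := by
    have : 0 ≤ ∫ x, ‖f x‖ * ((dR I x) ^ 2)⁻¹ := integral_nonneg fun x => by
      have := dR_pos I x
      change (0 : ℝ) ≤ _
      positivity
    by_contra h
    push Not at h
    nlinarith
  set S := stp T I with hS
  have hd : Set.PairwiseDisjoint (S : Set DI) dS := stp_disjoint
  have hfS : ∀ J ∈ S, ∫ x in dS J, ‖f x‖ ≤ 32 * A * dL J := fun J hJ => int_stp_le hf hT hA hJ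
  set g := gS f e ξ S with hg
  have hgb : ∀ x, ‖g x‖ ≤ 32 * A := gS_bound hA0 hd hfS
  have hgBM : BM g := ⟨gS_meas S, 32 * A, hgb⟩
  have hb : BM (fun x => f x - g x) := hf.sub hgBM
  have hU : tI I = ⋃ J ∈ S, dS J := by
    apply Set.Subset.antisymm
    · intro x hx
      obtain ⟨J, hJ, hxJ⟩ := stp_cover hT hne hx
      simp only [Set.mem_iUnion]
      exact ⟨J, hJ, hxJ⟩
    · exact Set.iUnion₂_subset fun J hJ => stp_subset hT hJ
  -- splitting of the bad part
  have split : ∀ P ∈ T, Fc φ (fun x => f x - g x) P =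
      (∑ J ∈ S, ∫ x in dS J, (f x - E (e * ξ * x) * mJ f e ξ J) * φ P x) + ∫ x in (tI I)ᶜ, f x * φ P x := by
    intro P hP
    have hi := integrable_mul_packet hφ hb P
    unfold Fc
    rw [← integral_add_compl (measurableSet_tI I) hi]
    congr 1
    · rw [hU, integral_biUnion_finset S (fun J _ => measurableSet_dS J) hd (fun J _ => hi.integrableOn)]
      apply Finset.sum_congr rfl
      intro J hJ
      apply setIntegral_congr_fun (measurableSet_dS J)
      intro x hx
      simp only [hg]
      rw [gS_of_mem hd hJ hx]
    · apply setIntegral_congr_fun (measurableSet_tI I).compl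
      intro x hx
      simp only [hg]
      rw [gS_of_notMem, sub_zero]
      intro J hJ hxJ
      exact hx (stp_subset hT hJ hxJ)
  -- far part
  have hDi : ∀ P : Tile, IntegrableOn (fun x => ‖f x‖ * ((dR P.1 x) ^ 4)⁻¹) (tI I)ᶜ := fun P =>
    (hf.integrable_inv P.1 (by norm_num)).integrableOn
  have far1 : ∀ P ∈ T, dL P.1 * ‖∫ x in (tI I)ᶜ, f x * φ P x‖ ≤
      C0 * ∫ x in (tI I)ᶜ, ‖f x‖ * ((dR P.1 x) ^ 4)⁻¹ := by
    intro P hP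
    have hL := dL_pos P.1
    have h1 : ‖∫ x in (tI I)ᶜ, f x * φ P x‖ ≤ ∫ x in (tI I)ᶜ, (C0 * (dL P.1)⁻¹) * (‖f x‖ * ((dR P.1 x) ^ 4)⁻¹) := by
      apply norm_integral_le_of_norm_le ((hDi P).const_mul _)
      filter_upwards with x
      rw [norm_mul]
      have := mul_le_mul_of_nonneg_left (hφ.decay P x) (norm_nonneg (f x))
      linarith
    rw [integral_const_mul] at h1
    calc _ ≤ dL P.1 * ((C0 * (dL P.1)⁻¹) * ∫ x in (tI I)ᶜ, ‖f x‖ * ((dR P.1 x) ^ 4)⁻¹) := by gcongr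
      _ = _ := by field_simp
  have far2 : ∑ P ∈ T, C0 * ∫ x in (tI I)ᶜ, ‖f x‖ * ((dR P.1 x) ^ 4)⁻¹ ≤ 64 * C0 * CS * (A * dL I) := by
    rw [← Finset.mul_sum, ← integral_finsetSum _ (fun P _ => hDi P)]
    have h1 : ∫ x in (tI I)ᶜ, ∑ P ∈ T, ‖f x‖ * ((dR P.1 x) ^ 4)⁻¹ ≤
        ∫ x in (tI I)ᶜ, (64 * CS) * (‖f x‖ * ((dR I x) ^ 2)⁻¹) := by
      apply setIntegral_mono_on (integrable_finsetSum _ fun P _ => hDi P)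
        ((hf.integrable_inv I (by norm_num)).integrableOn.const_mul _) (measurableSet_tI I).compl
      intro x hx
      have hI0 : 0 < dR I x := dR_pos _ _
      calc ∑ P ∈ T, ‖f x‖ * ((dR P.1 x) ^ 4)⁻¹
          ≤ ∑ P ∈ T, ‖f x‖ * (16 * ((dR I x) ^ 2)⁻¹) * (len (-|P.1.1 - I.1|) * (dR P.1 x)⁻¹) := by
            apply Finset.sum_le_sum
            intro P hP
            rw [mul_assoc]
            exact mul_le_mul_of_nonneg_left (far_weight (hT P hP) hx) (norm_nonneg _)
        _ = ‖f x‖ * (16 * ((dR I x) ^ 2)⁻¹) * ∑ P ∈ T, (len (-|P.1.1 - I.1|) * (dR P.1 x)⁻¹) := by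
            rw [Finset.mul_sum]
        _ ≤ ‖f x‖ * (16 * ((dR I x) ^ 2)⁻¹) * (CS * 4) := by
            apply mul_le_mul_of_nonneg_left (sumT' T hl I.1 x)
            positivity
        _ = _ := by ring
    have h2 : ∫ x in (tI I)ᶜ, (64 * CS) * (‖f x‖ * ((dR I x) ^ 2)⁻¹) ≤ ∫ x, (64 * CS) * (‖f x‖ * ((dR I x) ^ 2)⁻¹) := by
      apply setIntegral_le_integral ((hf.integrable_inv I (by norm_num)).const_mul _)
      filter_upwards with x
      have hp := dR_pos I x
      change (0 : ℝ) ≤ _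
      positivity
    rw [integral_const_mul (μ := volume)] at h2
    calc _ ≤ C0 * (64 * CS * ∫ x, ‖f x‖ * ((dR I x) ^ 2)⁻¹) := by gcongr; exact h1.trans h2
      _ ≤ C0 * (64 * CS * (A * dL I)) := by gcongr
      _ = _ := by ring
  -- local part
  have loc : ∑ P ∈ T, ∑ J ∈ S, dL P.1 * ‖∫ x in dS J, (f x - E (e * ξ * x) * mJ f e ξ J) * φ P x‖ ≤
      3072 * C0 * CS * (A * dL I) := by
    rw [Finset.sum_comm]
    calc _ ≤ ∑ J ∈ S, 1024 * C0 * A * CS * dL J := by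
          apply Finset.sum_le_sum
          intro J hJ
          have hLJ := dL_pos J
          calc _ ≤ ∑ P ∈ T, 256 * C0 * A * dL J * (len (-|P.1.1 - J.1|) * (dR P.1 (dC J))⁻¹) :=
                Finset.sum_le_sum fun P hP => one_local hφ hf hP (hK P hP) hJ hA0 (hfS J hJ)
            _ = 256 * C0 * A * dL J * ∑ P ∈ T, (len (-|P.1.1 - J.1|) * (dR P.1 (dC J))⁻¹) := by
                rw [Finset.mul_sum]
            _ ≤ 256 * C0 * A * dL J * (CS * 4) := by
                apply mul_le_mul_of_nonneg_left (sumT' T hl J.1 _)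
                positivity
            _ = _ := by ring
      _ = 1024 * C0 * A * CS * ∑ J ∈ S, dL J := by rw [Finset.mul_sum]
      _ ≤ 1024 * C0 * A * CS * (3 * dL I) := by
          apply mul_le_mul_of_nonneg_left (sum_stp_le hT)
          positivity
      _ = _ := by ring
  have bad1 : ∑ P ∈ T, dL P.1 * ‖Fc φ (fun x => f x - g x) P‖ ≤ 3136 * C0 * CS * (A * dL I) := by
    calc _ ≤ ∑ P ∈ T, (∑ J ∈ S, dL P.1 * ‖∫ x in dS J, (f x - E (e * ξ * x) * mJ f e ξ J) * φ P x‖ +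
          C0 * ∫ x in (tI I)ᶜ, ‖f x‖ * ((dR P.1 x) ^ 4)⁻¹) := by
          apply Finset.sum_le_sum
          intro P hP
          have hL := dL_pos P.1
          rw [split P hP, ← Finset.mul_sum]
          refine (mul_le_mul_of_nonneg_left (norm_add_le _ _) hL.le).trans ?_
          rw [mul_add]
          refine add_le_add ?_ (far1 P hP)
          exact mul_le_mul_of_nonneg_left (norm_sum_le _ _) hL.le
      _ ≤ _ := by
          rw [Finset.sum_add_distrib]
          linarith
  have sup : ∀ P ∈ T, ‖Fc φ (fun x => f x - g x) P‖ ≤ 129 * C0 * A := by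
    intro P hP
    rw [Fc_sub hφ hf hgBM]
    have h1 := norm_Fc_le_of_avg hφ hf P (hA P hP P.1 le_rfl (hT P hP))
    have h2 := norm_Fc_le_of_bdd hφ hgBM hgb P
    have h3 := norm_sub_le (Fc φ f P) (Fc φ g P)
    linarith
  have bad2 : ∑ P ∈ T, dL P.1 * ‖Fc φ (fun x => f x - g x) P‖ ^ 2 ≤
      129 * C0 * A * (3136 * C0 * CS * (A * dL I)) := by
    calc _ ≤ ∑ P ∈ T, 129 * C0 * A * (dL P.1 * ‖Fc φ (fun x => f x - g x) P‖) := by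
          apply Finset.sum_le_sum
          intro P hP
          have hL := dL_pos P.1
          rw [sq]
          have := mul_le_mul_of_nonneg_right (sup P hP) (norm_nonneg (Fc φ (fun x => f x - g x) P))
          have := mul_le_mul_of_nonneg_left this hL.le
          linarith
      _ ≤ _ := by
          rw [← Finset.mul_sum]
          exact mul_le_mul_of_nonneg_left bad1 (by positivity)
  have good : ∑ P ∈ T, dL P.1 * ‖Fc φ g P‖ ^ 2 ≤ 64 * π * C0 ^ 2 * CS * (1024 * π * A ^ 2 * dL I) := by
    refine (bessel hφ hgBM I T hT hl ho).trans ?_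
    gcongr
    have h1 : En g I ≤ ∫ x, (32 * A) ^ 2 * ((dR I x) ^ 2)⁻¹ := by
      unfold En
      apply integral_mono_of_nonneg
      · filter_upwards with x
        have hp := dR_pos I x
        change (0 : ℝ) ≤ _
        positivity
      · exact (integrable_inv_dR_pow I (by norm_num)).const_mul _
      · filter_upwards with x
        have hp := dR_pos I x
        gcongr
        exact hgb x
    rw [integral_const_mul] at h1
    have h2 := integral_inv_dR_pow_le I (n := 2) (by norm_num)
    calc _ ≤ (32 * A) ^ 2 * (dL I * π) := h1.trans (by gcongr)
      _ = _ := by ring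
  calc ∑ P ∈ T, dL P.1 * ‖Fc φ f P‖ ^ 2
      ≤ ∑ P ∈ T, (2 * (dL P.1 * ‖Fc φ (fun x => f x - g x) P‖ ^ 2) + 2 * (dL P.1 * ‖Fc φ g P‖ ^ 2)) := by
        apply Finset.sum_le_sum
        intro P hP
        have hL := dL_pos P.1
        have h1 : ‖Fc φ f P‖ ≤ ‖Fc φ (fun x => f x - g x) P‖ + ‖Fc φ g P‖ := by
          rw [Fc_sub hφ hf hgBM]
          have := norm_add_le (Fc φ f P - Fc φ g P) (Fc φ g P)
          simpa using this
        have h2 : ‖Fc φ f P‖ ^ 2 ≤ 2 * ‖Fc φ (fun x => f x - g x) P‖ ^ 2 + 2 * ‖Fc φ g P‖ ^ 2 := by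
          have h3 := pow_le_pow_left₀ (norm_nonneg _) h1 2
          nlinarith [sq_nonneg (‖Fc φ (fun x => f x - g x) P‖ - ‖Fc φ g P‖)]
        nlinarith
    _ ≤ Csz C0 * A ^ 2 * dL I := by
        rw [Finset.sum_add_distrib, ← Finset.mul_sum, ← Finset.mul_sum]
        unfold Csz
        have e1 : (2 * (129 * C0 * (3136 * C0 * CS)) + 2 * (64 * π * C0 ^ 2 * CS * (1024 * π))) * A ^ 2 * dL I =
          2 * (129 * C0 * A * (3136 * C0 * CS * (A * dL I))) + 2 * (64 * π * C0 ^ 2 * CS * (1024 * π * A ^ 2 * dL I)) := by ring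
        rw [e1]
        linarith

end BHT
end

section
namespace BHT

/-- membership in the maximal tree with top `(ξ, I)` -/
def inO (θ b ξ : ℝ) (I : DI) (P : Tile) : Prop :=
  dS P.1 ⊆ dS I ∧ |dL P.1 * ξ - P.2 - θ| ≤ b

/-- scale separation -/
def gap (K b : ℝ) (T : Finset Tile) : Prop :=
  ∀ P ∈ T, ∀ P' ∈ T, P.1.1 < P'.1.1 → 4 * K * dL P.1 ≤ b * dL P'.1

/-- numerical parameters for a pair `(i,j)` of indices -/
structure Num (θi θj σ b b0 K : ℝ) : Prop where
  bpos : 0 < b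
  blt : b < 1 / 2
  b0nn : 0 ≤ b0
  b0le : 32 * b0 ≤ b
  hσ : σ = 1 ∨ σ = -1
  sep : 4 * b ≤ σ * (θi - θj)
  sepK : σ * (θi - θj) ≤ K - b

variable {θi θj σ b b0 K : ℝ}

lemma Num.abs_mul (h : Num θi θj σ b b0 K) (x : ℝ) : |σ * x| = |x| := by
  rcases h.hσ with h | h <;> simp [h]

lemma lac (h : Num θi θj σ b b0 K) {ξ : ℝ} {I : DI} {P : Tile} (hP : inO θi b ξ I P) :
    3 * b ≤ σ * (dL P.1 * ξ - P.2 - θj) ∧ σ * (dL P.1 * ξ - P.2 - θj) ≤ K := by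
  have h1 := hP.2
  rw [← h.abs_mul, abs_le] at h1
  have := h.sep
  have := h.sepK
  constructor <;> linarith

lemma Num.bK (h : Num θi θj σ b b0 K) : 5 * b ≤ K := by linarith [h.sep, h.sepK]

lemma lac' (h : Num θi θj σ b b0 K) {ξ : ℝ} {I : DI} {P : Tile} (hP : inO θi b ξ I P) :
    3 * b / dL P.1 ≤ σ * (ξ - fr θj P) ∧ σ * (ξ - fr θj P) ≤ K / dL P.1 := by
  have hL := dL_pos P.1
  obtain ⟨h1, h2⟩ := lac h hP
  have e : σ * (ξ - fr θj P) = σ * (dL P.1 * ξ - P.2 - θj) / dL P.1 := by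
    unfold fr; field_simp; ring
  rw [e]
  constructor <;> gcongr

lemma tree_oneL (h : Num θi θj σ b b0 K) {ξ : ℝ} {I : DI} {T : Finset Tile}
    (hT : ∀ P ∈ T, inO θi b ξ I P) : oneL T := by
  intro P hP P' hP' hk
  have h1 := abs_le.1 (hT P hP).2
  have h2 := abs_le.1 (hT P' hP').2
  have e : dL P.1 = dL P'.1 := by unfold dL; rw [hk]
  rw [e] at h1
  have h3 := h.blt
  have a : (P.2 : ℝ) - P'.2 < 1 := by linarith
  have b' : (P'.2 : ℝ) - P.2 < 1 := by linarith
  have a' : P.2 - P'.2 < 1 := by exact_mod_cast a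
  have b'' : P'.2 - P.2 < 1 := by exact_mod_cast b'
  omega

/-- key frequency comparison -/
lemma freq_lt (h : Num θi θj σ b b0 K) {ξ ξ' : ℝ} {I I' : DI} {P P' : Tile}
    (hP : inO θi b ξ I P) (hP' : inO θi b ξ' I' P') (hg : 4 * K * dL P'.1 ≤ b * dL P.1)
    (hc : |fr θj P - fr θj P'| ≤ 4 * b0 / dL P'.1) : σ * ξ < σ * ξ' := by
  have hL := dL_pos P.1
  have hL' := dL_pos P'.1
  have h1 := (lac' h hP).2
  have h2 := (lac' h hP').1
  rw [← h.abs_mul, abs_le] at hc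
  have h3 : K / dL P.1 ≤ b / 4 / dL P'.1 := by
    rw [div_le_div_iff₀ hL hL']; linarith
  have h4 : b / 4 / dL P'.1 + 4 * b0 / dL P'.1 < 3 * b / dL P'.1 := by
    rw [← add_div]
    gcongr
    linarith [h.b0le, h.bpos]
  linarith [hc.1, hc.2]

lemma freq_inO (h : Num θi θj σ b b0 K) {ξ : ℝ} {I : DI} {P P' : Tile}
    (hP : inO θi b ξ I P) (hg : 4 * K * dL P'.1 ≤ b * dL P.1)
    (hc : |fr θj P - fr θj P'| ≤ 4 * b0 / dL P'.1) (hI : dS P'.1 ⊆ dS I) : inO θj b ξ I P' := by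
  refine ⟨hI, ?_⟩
  have hL := dL_pos P.1
  have hL' := dL_pos P'.1
  obtain ⟨h1, h2⟩ := lac' h hP
  have h3 : K / dL P.1 ≤ b / 4 / dL P'.1 := by
    rw [div_le_div_iff₀ hL hL']; linarith
  have h5 : |ξ - fr θj P| ≤ b / 4 / dL P'.1 := by
    rw [← h.abs_mul, abs_le]
    have : 0 ≤ 3 * b / dL P.1 := by have := h.bpos; positivity
    constructor <;> linarith
  have h6 : |ξ - fr θj P'| ≤ b / dL P'.1 := by
    calc |ξ - fr θj P'| ≤ |ξ - fr θj P| + |fr θj P - fr θj P'| := abs_sub_le _ _ _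
      _ ≤ b / 4 / dL P'.1 + 4 * b0 / dL P'.1 := add_le_add h5 hc
      _ = (b / 4 + 4 * b0) / dL P'.1 := by rw [add_div]
      _ ≤ _ := by gcongr; linarith [h.b0le, h.bpos]
  have e : dL P'.1 * ξ - P'.2 - θj = dL P'.1 * (ξ - fr θj P') := by
    unfold fr; field_simp; ring
  rw [e, abs_mul, abs_of_pos hL']
  calc _ ≤ dL P'.1 * (b / dL P'.1) := by gcongr
    _ = b := by field_simp

lemma tree_orth (h : Num θi θj σ b b0 K) {φ : Tile → ℝ → ℂ} {e C0 : ℝ} (hφ : Packet φ θj e b0 K C0)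
    {ξ : ℝ} {I : DI} {T : Finset Tile} (hT : ∀ P ∈ T, inO θi b ξ I P) (hg : gap K b T) (Q : DI) :
    ∀ P ∈ T, ∀ P' ∈ T, P.1.1 ≠ P'.1.1 → ip φ Q P P' = 0 := by
  have key : ∀ P ∈ T, ∀ P' ∈ T, P'.1.1 < P.1.1 → ip φ Q P P' = 0 := by
    intro P hP P' hP' hk
    apply hφ.orth P P' _ _ _ (dL_pos Q)
    by_contra hc
    push Not at hc
    have hL := dL_pos P.1
    have hL' := dL_pos P'.1
    have : dL P'.1 ≤ dL P.1 := len_mono hk.le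
    have h2 : b0 * ((dL P.1)⁻¹ + (dL P'.1)⁻¹) ≤ 4 * b0 / dL P'.1 := by
      have : (dL P.1)⁻¹ ≤ (dL P'.1)⁻¹ := inv_anti₀ hL' this
      have h0 := h.b0nn
      have : 0 < (dL P'.1)⁻¹ := inv_pos.2 hL'
      rw [div_eq_mul_inv]
      nlinarith
    exact lt_irrefl _ (freq_lt h (hT P hP) (hT P' hP') (hg P' hP' P hP hk) (hc.trans h2))
  intro P hP P' hP' hne
  rcases lt_or_gt_of_ne hne with hk | hk
  · rw [ip_swap φ Q P' P, key P' hP' P hP hk]; simp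
  · exact key P hP P' hP' hk

/-- Size lemma for a tree -/
lemma size_tree (h : Num θi θj σ b b0 K) {φ : Tile → ℝ → ℂ} {e C0 : ℝ} (hφ : Packet φ θj e b0 K C0)
    {f : ℝ → ℂ} (hf : BM f) {ξ A : ℝ} {I : DI} {T : Finset Tile} (hT : ∀ P ∈ T, inO θi b ξ I P)
    (hg : gap K b T)
    (hA : ∀ P ∈ T, ∀ J, dS P.1 ⊆ dS J → dS J ⊆ dS I →
      ∫ x, ‖f x‖ * ((dR J x) ^ 2)⁻¹ ≤ A * dL J) :
    ∑ P ∈ T, dL P.1 * ‖Fc φ f P‖ ^ 2 ≤ Csz C0 * A ^ 2 * dL I := by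
  apply size_lemma hφ hf (fun P hP => (hT P hP).1) (tree_oneL h hT) (ξ := ξ) _ (tree_orth h hφ hT hg I) hA
  intro P hP
  obtain ⟨h1, h2⟩ := lac h (hT P hP)
  rw [← h.abs_mul, abs_le]
  have := h.bpos
  have := h.bK
  constructor <;> linarith

/-! ### Energy estimate -/

lemma edge_bound {P I : DI} (h : dS P ⊆ dS I) {x : ℝ} (hx : x ∉ dS I) :
    (dR P x)⁻¹ ≤ (rho (dL I * I.2) (dL P) x)⁻¹ + (rho (dL I * (I.2 + 1)) (dL P) x)⁻¹ := by
  have hL := dL_pos P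
  obtain ⟨h1, h2⟩ := h (cen_mem _ _ : dC P ∈ dS P)
  change dL I * I.2 ≤ dC P at h1
  change dC P < dL I * (I.2 + 1) at h2
  have p1 := inv_pos.2 (rho_pos (dL I * I.2) (dL P) x)
  have p2 := inv_pos.2 (rho_pos (dL I * (I.2 + 1)) (dL P) x)
  have hx' : x < dL I * I.2 ∨ dL I * (I.2 + 1) ≤ x := by
    by_contra hc
    push Not at hc
    exact hx ⟨hc.1, hc.2⟩
  rcases hx' with hx' | hx'
  · have : (dR P x)⁻¹ ≤ (rho (dL I * I.2) (dL P) x)⁻¹ := by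
      apply inv_anti₀ (rho_pos _ _ _)
      change 1 + ((x - dL I * I.2) / dL P) ^ 2 ≤ 1 + ((x - dC P) / dL P) ^ 2
      rw [div_pow, div_pow]
      gcongr 1 + ?_ / _
      nlinarith
    linarith
  · have : (dR P x)⁻¹ ≤ (rho (dL I * (I.2 + 1)) (dL P) x)⁻¹ := by
      apply inv_anti₀ (rho_pos _ _ _)
      change 1 + ((x - dL I * (I.2 + 1)) / dL P) ^ 2 ≤ 1 + ((x - dC P) / dL P) ^ 2
      rw [div_pow, div_pow]
      gcongr 1 + ?_ / _
      nlinarith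
    linarith

lemma sum_len_le (s : Finset ℤ) (m : ℤ) (h : ∀ k ∈ s, k ≤ m) : ∑ k ∈ s, len k ≤ 4 * len m := by
  have h1 : ∑ k ∈ s, len k = len m * ∑ k ∈ s, len (-|k - m|) := by
    rw [Finset.mul_sum]
    apply Finset.sum_congr rfl
    intro k hk
    rw [abs_of_nonpos (by linarith [h k hk]), neg_neg, ← len_add]
    congr 1; ring
  rw [h1, mul_comm 4]
  exact mul_le_mul_of_nonneg_left (sum_len_abs s m) (len_pos m).le

/-- total mass of tile weights outside the top -/
lemma outside_mass {T : Finset Tile} {I : DI} (hT : ∀ P ∈ T, dS P.1 ⊆ dS I) (hl : oneL T) :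
    ∑ P ∈ T, ∫ x in (dS I)ᶜ, ((dR P.1 x) ^ 2)⁻¹ ≤ 32 * CS * dL I := by
  have hI0 := dL_pos I
  have hCS := CS_pos
  have hintg : ∀ P : Tile, IntegrableOn (fun x => ((dR P.1 x) ^ 2)⁻¹) (dS I)ᶜ := fun P =>
    (integrable_inv_dR_pow P.1 (by norm_num)).integrableOn
  rw [← integral_finsetSum _ (fun P _ => hintg P)]
  set w : ℤ → ℝ → ℝ := fun k x => (rho (dL I * I.2) (len k) x)⁻¹ + (rho (dL I * (I.2 + 1)) (len k) x)⁻¹ with hw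
  have hwi : ∀ k, Integrable (w k) := fun k =>
    (integrable_inv_rho _ (len_pos k)).add (integrable_inv_rho _ (len_pos k))
  have hw0 : ∀ k x, 0 ≤ w k x := fun k x =>
    add_nonneg (inv_pos.2 (rho_pos _ _ _)).le (inv_pos.2 (rho_pos _ _ _)).le
  have hwint : ∀ k, ∫ x, w k x = 2 * π * len k := by
    intro k
    rw [hw]
    rw [integral_add (integrable_inv_rho _ (len_pos k)) (integrable_inv_rho _ (len_pos k)),
      integral_inv_rho _ (len_pos k), integral_inv_rho _ (len_pos k)]
    ring
  calc ∫ x in (dS I)ᶜ, ∑ P ∈ T, ((dR P.1 x) ^ 2)⁻¹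
      ≤ ∫ x in (dS I)ᶜ, CS * ∑ k ∈ T.image (fun P => P.1.1), w k x := by
        apply setIntegral_mono_on (integrable_finsetSum _ fun P _ => hintg P)
        · exact ((integrable_finsetSum _ fun k _ => hwi k).const_mul _).integrableOn
        · exact (measurableSet_dS I).compl
        · intro x hx
          refine le_trans ?_ (sumT T hl (fun k => w k x) (fun k => hw0 k x) x)
          apply Finset.sum_le_sum
          intro P hP
          have hp := dR_pos P.1 x
          rw [sq, mul_inv]
          apply mul_le_mul_of_nonneg_right _ (inv_pos.2 hp).le
          exact edge_bound (hT P hP) hx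
    _ ≤ ∫ x, CS * ∑ k ∈ T.image (fun P => P.1.1), w k x := by
        apply setIntegral_le_integral ((integrable_finsetSum _ fun k _ => hwi k).const_mul _)
        filter_upwards with x
        exact mul_nonneg hCS.le (Finset.sum_nonneg fun k _ => hw0 k x)
    _ = CS * ∑ k ∈ T.image (fun P => P.1.1), 2 * π * len k := by
        rw [integral_const_mul, integral_finsetSum _ (fun k _ => hwi k)]
        simp only [hwint]
    _ ≤ CS * (2 * π * (4 * dL I)) := by
        rw [← Finset.mul_sum]
        gcongr
        apply sum_len_le
        intro k hk
        rw [Finset.mem_image] at hk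
        obtain ⟨P, hP, rfl⟩ := hk
        exact dI_scale_le (hT P hP)
    _ ≤ 32 * CS * dL I := by
        have := Real.pi_le_four
        have : CS * dL I * π ≤ CS * dL I * 4 := by gcongr
        linarith

/-- contributions of disjoint smaller intervals outside `I` -/
lemma disjoint_mass {S : Finset Tile} {P I : DI} (hk : ∀ P' ∈ S, dL P'.1 ≤ dL P)
    (hd : Set.PairwiseDisjoint (S : Set Tile) (fun P' => dS P'.1))
    (ho : ∀ P' ∈ S, Disjoint (dS P'.1) (dS I)) :
    ∑ P' ∈ S, dL P'.1 * ((dR P (dC P'.1)) ^ 2)⁻¹ ≤ 16 * ∫ x in (dS I)ᶜ, ((dR P x) ^ 2)⁻¹ := by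
  have hintg : Integrable (fun x => ((dR P x) ^ 2)⁻¹) := integrable_inv_dR_pow P (by norm_num)
  have h1 : ∀ P' ∈ S, dL P'.1 * ((dR P (dC P'.1)) ^ 2)⁻¹ ≤ 16 * ∫ x in dS P'.1, ((dR P x) ^ 2)⁻¹ := by
    intro P' hP'
    have : ∫ x in dS P'.1, ((dR P (dC P'.1)) ^ 2)⁻¹ ≤ ∫ x in dS P'.1, 16 * ((dR P x) ^ 2)⁻¹ := by
      apply setIntegral_mono_on (integrableOn_const (volume_dS_ne_top _)) (hintg.integrableOn.const_mul _)
        (measurableSet_dS _)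
      intro x hx
      have a := rho_peetre' (c := dC P) (c' := dC P'.1) (dL_pos P'.1) (hk P' hP') x
      change dR P x ≤ 2 * dR P (dC P'.1) * dR P'.1 x at a
      have b := dR_le_two hx
      have p1 := dR_pos P x
      have p2 := dR_pos P (dC P'.1)
      have c : dR P x ≤ 4 * dR P (dC P'.1) := by nlinarith
      have d : (dR P x) ^ 2 ≤ 16 * (dR P (dC P'.1)) ^ 2 := by nlinarith
      rw [inv_le_comm₀ (by positivity) (by positivity), mul_inv, inv_inv]
      linarith
    rw [setIntegral_const, volume_real_dS, smul_eq_mul, integral_const_mul] at this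
    exact this
  refine (Finset.sum_le_sum h1).trans ?_
  rw [← Finset.mul_sum]
  gcongr
  rw [← integral_biUnion_finset S (fun P' _ => measurableSet_dS _) hd (fun _ _ => hintg.integrableOn)]
  apply setIntegral_mono_set hintg.integrableOn
  · filter_upwards with x
    have := dR_pos P x
    change (0 : ℝ) ≤ _
    positivity
  · apply HasSubset.Subset.eventuallyLE
    intro x hx
    simp only [Set.mem_iUnion] at hx
    obtain ⟨P', hP', hx'⟩ := hx
    exact Set.disjoint_left.1 (ho P' hP') hx'

lemma row_same {φ : Tile → ℝ → ℂ} {θ e C0 : ℝ} (hφ : Packet φ θ e b0 K C0) (Q : DI) (S : Finset Tile)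
    (hS : ∀ P ∈ S, dS P.1 ⊆ dS Q) {P : Tile} (hP : P ∈ S) :
    ∑ P' ∈ S with P'.1.1 = P.1.1 ∧ P'.2 = P.2, dL P'.1 * ‖ip φ Q P P'‖ ≤ 64 * π * C0 ^ 2 * CS := by
  classical
  have hC := hφ.C0pos
  calc _ ≤ ∑ P' ∈ S with P'.1.1 = P.1.1 ∧ P'.2 = P.2, (64 * π * C0 ^ 2) * (dR P.1 (dC P'.1))⁻¹ := by
        apply Finset.sum_le_sum
        intro P' hP'
        rw [Finset.mem_filter] at hP'
        have e : dL P'.1 = dL P.1 := by unfold dL; rw [hP'.2.1]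
        have h2 := ip_bound hφ Q P P' (hS P hP) e.le
        have h3 := inv_dR_sq_le_inv P.1 (dC P'.1)
        have h4 := dL_pos P.1
        rw [e]
        calc dL P.1 * ‖ip φ Q P P'‖ ≤ dL P.1 * (64 * π * C0 ^ 2 * (dL P.1)⁻¹ * ((dR P.1 (dC P'.1)) ^ 2)⁻¹) := by gcongr
          _ = (64 * π * C0 ^ 2) * ((dR P.1 (dC P'.1)) ^ 2)⁻¹ := by field_simp
          _ ≤ _ := by gcongr
    _ ≤ _ := by
        rw [← Finset.mul_sum]
        apply mul_le_mul_of_nonneg_left _ (by positivity)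
        have hinj : Set.InjOn (fun P' : Tile => P'.1) (S.filter (fun P' => P'.1.1 = P.1.1 ∧ P'.2 = P.2)) := by
          intro A hA B hB h
          simp only [Finset.coe_filter, Set.mem_ofPred_eq] at hA hB
          exact Prod.ext h (hA.2.2.trans hB.2.2.symm)
        rw [← Finset.sum_image (f := fun J => (dR P.1 (dC J))⁻¹) hinj]
        apply sum_inv_dR_center_le
        intro J hJ
        simp only [Finset.mem_image, Finset.mem_filter] at hJ
        obtain ⟨A, hA, rfl⟩ := hJ
        exact hA.2.1

end BHT
end

section
namespace BHT

/-- a finite ordered family of selected trees -/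
structure Forest (θi θj σ b K : ℝ) (Q : DI) {N : ℕ} (ξ : Fin N → ℝ) (I : Fin N → DI)
    (T : Fin N → Finset Tile) : Prop where
  hI : ∀ m, dS (I m) ⊆ dS Q
  hT : ∀ m, ∀ P ∈ T m, inO θi b (ξ m) (I m) P
  hg : ∀ m m', ∀ P ∈ T m, ∀ P' ∈ T m', P.1.1 < P'.1.1 → 4 * K * dL P.1 ≤ b * dL P'.1
  ord : ∀ m m', m < m' → σ * ξ m ≤ σ * ξ m'
  rem : ∀ m m', m < m' → ∀ P ∈ T m', ¬ inO θi b (ξ m) (I m) P ∧ ¬ inO θj b (ξ m) (I m) P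

variable {θi θj σ b b0 K : ℝ} {Q : DI} {N : ℕ} {ξ : Fin N → ℝ} {I : Fin N → DI}
  {T : Fin N → Finset Tile}

lemma Forest.far (h : Num θi θj σ b b0 K) (hF : Forest θi θj σ b K Q ξ I T) {m m' : Fin N} {P P' : Tile}
    (hP : P ∈ T m) (hP' : P' ∈ T m') (hk : P'.1.1 < P.1.1)
    (hc : |fr θj P - fr θj P'| ≤ 4 * b0 / dL P'.1) : Disjoint (dS P'.1) (dS (I m)) := by
  have hg := hF.hg m' m P' hP' P hP hk
  have h1 := freq_lt h (hF.hT m P hP) (hF.hT m' P' hP') hg hc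
  have hm : m < m' := by
    by_contra hc'
    rcases eq_or_lt_of_le (not_lt.1 hc') with e | e
    · rw [e] at h1; exact lt_irrefl _ h1
    · exact absurd (hF.ord m' m e) (not_le.2 h1)
  have hk2 : P'.1.1 ≤ (I m).1 := hk.le.trans (dI_scale_le (hF.hT m P hP).1)
  rcases dI_subset_or_disjoint (n := P'.1.2) (n' := (I m).2) hk2 with hs | hs
  · exact absurd (freq_inO h (hF.hT m P hP) hg hc hs) (hF.rem m m' hm P' hP').2
  · exact hs

lemma same_l (h : Num θi θj σ b b0 K) {P P' : Tile} (hk : P.1.1 = P'.1.1)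
    (hc : |fr θj P - fr θj P'| ≤ 4 * b0 / dL P'.1) : P.2 = P'.2 := by
  have hL := dL_pos P'.1
  have e : dL P.1 = dL P'.1 := by unfold dL; rw [hk]
  have e2 : fr θj P - fr θj P' = ((P.2 : ℝ) - P'.2) / dL P'.1 := by
    unfold fr; rw [e]; ring
  rw [e2, abs_div, abs_of_pos hL, div_le_div_iff_of_pos_right hL, abs_le] at hc
  have := h.b0le
  have := h.blt
  have a : (P.2 : ℝ) - P'.2 < 1 := by linarith [hc.2]
  have b' : (P'.2 : ℝ) - P.2 < 1 := by linarith [hc.1]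
  have a' : P.2 - P'.2 < 1 := by exact_mod_cast a
  have b'' : P'.2 - P.2 < 1 := by exact_mod_cast b'
  omega

lemma Forest.disj (h : Num θi θj σ b b0 K) (hF : Forest θi θj σ b K Q ξ I T) {P P' P'' : Tile} {m' m'' : Fin N}
    (hP' : P' ∈ T m') (hP'' : P'' ∈ T m'') (hne : P' ≠ P'')
    (h1 : |fr θj P - fr θj P'| ≤ 2 * b0 / dL P'.1) (h2 : |fr θj P - fr θj P''| ≤ 2 * b0 / dL P''.1) :
    Disjoint (dS P'.1) (dS P''.1) := by
  have b0n := h.b0nn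
  have key : ∀ {P' P'' : Tile} {m' m'' : Fin N}, P' ∈ T m' → P'' ∈ T m'' → P''.1.1 ≤ P'.1.1 → P' ≠ P'' →
      |fr θj P - fr θj P'| ≤ 2 * b0 / dL P'.1 → |fr θj P - fr θj P''| ≤ 2 * b0 / dL P''.1 →
      Disjoint (dS P'.1) (dS P''.1) := by
    intro P' P'' m' m'' hP' hP'' hk hne h1 h2
    have hL := dL_pos P''.1
    have h3 : dL P''.1 ≤ dL P'.1 := len_mono hk
    have h4 : |fr θj P' - fr θj P''| ≤ 4 * b0 / dL P''.1 := by
      calc _ ≤ |fr θj P' - fr θj P| + |fr θj P - fr θj P''| := abs_sub_le _ _ _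
        _ ≤ 2 * b0 / dL P''.1 + 2 * b0 / dL P''.1 := by
          refine add_le_add ?_ h2
          rw [abs_sub_comm]
          exact h1.trans (by gcongr)
        _ = _ := by ring
    rcases eq_or_lt_of_le hk with e | e
    · have h5 := same_l h e.symm h4
      have : P'.1.2 ≠ P''.1.2 := fun e2 => hne (Prod.ext (Prod.ext e.symm e2) h5)
      have h6 : dS P''.1 = dI P'.1.1 P''.1.2 := by unfold dS; rw [e]
      rw [h6]
      exact dI_disjoint_of_ne this
    · exact ((hF.far h hP' hP'' e h4).mono_right (hF.hT m' P' hP').1).symm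
  rcases le_total P''.1.1 P'.1.1 with hk | hk
  · exact key hP' hP'' hk hne h1 h2
  · exact (key hP'' hP' hk hne.symm h2 h1).symm

/-- constant in the energy estimate -/
noncomputable def Cen (C0 : ℝ) : ℝ := 16388 * (64 * π * C0 ^ 2 * CS)

lemma energy (h : Num θi θj σ b b0 K) (hF : Forest θi θj σ b K Q ξ I T) {φ : Tile → ℝ → ℂ} {e C0 : ℝ}
    (hφ : Packet φ θj e b0 K C0) {f : ℝ → ℂ} (hf : BM f) {A : ℝ}
    (hbig : ∀ m, (A / 2) ^ 2 * dL (I m) ≤ ∑ P ∈ T m, dL P.1 * ‖Fc φ f P‖ ^ 2)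
    (hsm : ∀ m, ∀ P ∈ T m, ‖Fc φ f P‖ ≤ A) :
    A ^ 2 * ∑ m, dL (I m) ≤ Cen C0 * En f Q := by
  classical
  have hC := hφ.C0pos
  have hCS := CS_pos
  have hb0 := h.b0nn
  have hdisj : Set.PairwiseDisjoint ((Finset.univ : Finset (Fin N)) : Set (Fin N)) T := by
    intro m _ m' _ hne
    have key : ∀ m m' : Fin N, m < m' → Disjoint (T m) (T m') := by
      intro m m' hm
      rw [Finset.disjoint_left]
      intro P h1 h2
      exact (hF.rem m m' hm P h2).1 (hF.hT m P h1)
    rcases lt_or_gt_of_ne hne with h' | h'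
    · exact key m m' h'
    · exact (key m' m h').symm
  set S : Finset Tile := Finset.univ.biUnion T with hSdef
  have hmemS : ∀ {P}, P ∈ S ↔ ∃ m, P ∈ T m := by intro P; simp [hSdef]
  have hSQ : ∀ P ∈ S, dS P.1 ⊆ dS Q := by
    intro P hP
    obtain ⟨m, hm⟩ := hmemS.1 hP
    exact (hF.hT m P hm).1.trans (hF.hI m)
  set s := ∑ P ∈ S, dL P.1 * ‖Fc φ f P‖ ^ 2 with hs
  have hsum : s = ∑ m, ∑ P ∈ T m, dL P.1 * ‖Fc φ f P‖ ^ 2 := Finset.sum_biUnion hdisj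
  have hAs : A ^ 2 * ∑ m, dL (I m) ≤ 4 * s := by
    rw [hsum]
    have := Finset.sum_le_sum (fun m (_ : m ∈ Finset.univ) => hbig m)
    rw [← Finset.mul_sum] at this
    linarith
  have hs0 : 0 ≤ s := Finset.sum_nonneg fun P _ => mul_nonneg (dL_pos _).le (sq_nonneg _)
  set C1 := 64 * π * C0 ^ 2 * CS with hC1
  have hC10 : 0 < C1 := by positivity
  set d : Tile → Tile → ℝ := fun P P' => dL P.1 * dL P'.1 * ‖Fc φ f P‖ * ‖Fc φ f P'‖ * ‖ip φ Q P P'‖ with hd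
  have hdsymm : ∀ P P', d P P' = d P' P := by
    intro P P'
    simp only [hd]
    rw [ip_swap φ Q P P', RCLike.norm_conj]
    ring
  have hd0 : ∀ P P', 0 ≤ d P P' := by
    intro P P'
    have := dL_pos P.1
    have := dL_pos P'.1
    simp only [hd]; positivity
  have hover : ∀ P P' : Tile, P'.1.1 ≤ P.1.1 → ip φ Q P P' ≠ 0 → |fr θj P - fr θj P'| ≤ 2 * b0 / dL P'.1 := by
    intro P P' hk hne
    by_contra hc
    push Not at hc
    apply hne
    apply hφ.orth P P' _ _ _ (dL_pos Q)
    refine lt_of_le_of_lt ?_ hc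
    have hL := dL_pos P.1
    have hL' := dL_pos P'.1
    have : dL P'.1 ≤ dL P.1 := len_mono hk
    have : (dL P.1)⁻¹ ≤ (dL P'.1)⁻¹ := inv_anti₀ hL' this
    rw [div_eq_mul_inv]
    nlinarith
  -- same scale
  have hsame : ∑ P ∈ S, ∑ P' ∈ S, (if P'.1.1 = P.1.1 then d P P' else 0) ≤ C1 * s := by
    have h1 : ∀ P P' : Tile, (if P'.1.1 = P.1.1 then d P P' else 0) ≤
        (if P'.1.1 = P.1.1 ∧ P'.2 = P.2 then
          (1/2) * (dL P.1 * ‖Fc φ f P‖ ^ 2) * (dL P'.1 * ‖ip φ Q P P'‖) else 0) +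
        (if P.1.1 = P'.1.1 ∧ P.2 = P'.2 then
          (1/2) * (dL P'.1 * ‖Fc φ f P'‖ ^ 2) * (dL P.1 * ‖ip φ Q P' P‖) else 0) := by
      intro P P'
      by_cases hk : P'.1.1 = P.1.1
      · by_cases hl : P'.2 = P.2
        · simp only [hk, hl, and_self, if_true]
          rw [ip_swap φ Q P P', RCLike.norm_conj]
          have p1 := dL_pos P.1
          have p2 := dL_pos P'.1
          simp only [hd]
          have p3 : 0 ≤ dL P.1 * dL P'.1 * ‖ip φ Q P P'‖ := by positivity
          nlinarith [mul_nonneg p3 (sq_nonneg (‖Fc φ f P‖ - ‖Fc φ f P'‖))]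
        · have : ip φ Q P P' = 0 := by
            by_contra hne
            have := hover P P' hk.le hne
            apply hl
            have hL := dL_pos P'.1
            exact (same_l h hk.symm (this.trans (by gcongr; norm_num))).symm
          simp [hk, hl, Ne.symm hl, hd, this, eq_comm]
      · simp [hk, Ne.symm hk, eq_comm]
    have hrow : ∑ P ∈ S, ∑ P' ∈ S, (if P'.1.1 = P.1.1 ∧ P'.2 = P.2 then
          (1/2) * (dL P.1 * ‖Fc φ f P‖ ^ 2) * (dL P'.1 * ‖ip φ Q P P'‖) else 0) ≤ C1 * s / 2 := by
      calc _ ≤ ∑ P ∈ S, (1/2) * (dL P.1 * ‖Fc φ f P‖ ^ 2) * C1 := by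
            apply Finset.sum_le_sum
            intro P hP
            rw [← Finset.sum_filter, ← Finset.mul_sum]
            have := dL_pos P.1
            apply mul_le_mul_of_nonneg_left _ (by positivity)
            exact row_same hφ Q S hSQ hP
        _ = _ := by rw [← Finset.sum_mul, ← Finset.mul_sum]; ring
    calc _ ≤ _ := Finset.sum_le_sum fun P _ => Finset.sum_le_sum fun P' _ => h1 P P'
      _ ≤ C1 * s / 2 + C1 * s / 2 := by
          simp only [Finset.sum_add_distrib]
          refine add_le_add hrow ?_
          rw [Finset.sum_comm]
          exact hrow
      _ = _ := by ring
  -- smaller scale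
  have hless : ∑ P ∈ S, ∑ P' ∈ S, (if P'.1.1 < P.1.1 then d P P' else 0) ≤ 2048 * C1 * s := by
    have hP1 : ∀ m, ∀ P ∈ T m, ∑ P' ∈ S, (if P'.1.1 < P.1.1 then d P P' else 0) ≤
        A ^ 2 * (64 * π * C0 ^ 2) * (16 * ∫ x in (dS (I m))ᶜ, ((dR P.1 x) ^ 2)⁻¹) := by
      intro m P hP
      have hPS : P ∈ S := hmemS.2 ⟨m, hP⟩
      have hA0 : 0 ≤ A := (norm_nonneg _).trans (hsm m P hP)
      set R := S.filter (fun P' => P'.1.1 < P.1.1 ∧ |fr θj P - fr θj P'| ≤ 2 * b0 / dL P'.1) with hR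
      have hR1 : ∑ P' ∈ R, dL P'.1 * ((dR P.1 (dC P'.1)) ^ 2)⁻¹ ≤ 16 * ∫ x in (dS (I m))ᶜ, ((dR P.1 x) ^ 2)⁻¹ := by
        apply disjoint_mass
        · intro P' hP'
          rw [hR, Finset.mem_filter] at hP'
          exact len_mono hP'.2.1.le
        · intro P' hP' P'' hP'' hne
          simp only [hR, Finset.coe_filter, Set.mem_ofPred_eq] at hP' hP''
          obtain ⟨m', hm'⟩ := hmemS.1 hP'.1
          obtain ⟨m'', hm''⟩ := hmemS.1 hP''.1
          exact hF.disj h hm' hm'' hne hP'.2.2 hP''.2.2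
        · intro P' hP'
          rw [hR, Finset.mem_filter] at hP'
          obtain ⟨m', hm'⟩ := hmemS.1 hP'.1
          have hL := dL_pos P'.1
          exact hF.far h hP hm' hP'.2.1 (hP'.2.2.trans (by gcongr; norm_num))
      refine le_trans ?_ (mul_le_mul_of_nonneg_left hR1 (by positivity))
      rw [Finset.mul_sum, hR, Finset.sum_filter]
      apply Finset.sum_le_sum
      intro P' hP'
      have p1 := dL_pos P.1
      have p2 := dL_pos P'.1
      by_cases hk : P'.1.1 < P.1.1
      · by_cases hc : |fr θj P - fr θj P'| ≤ 2 * b0 / dL P'.1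
        · simp only [hk, hc, and_self, if_true]
          obtain ⟨m', hm'⟩ := hmemS.1 hP'
          have h1 := hsm m P hP
          have h2 := hsm m' P' hm'
          have h3 := ip_bound hφ Q P P' (hSQ P hPS) (len_mono hk.le)
          calc d P P' ≤ dL P.1 * dL P'.1 * A * A * (64 * π * C0 ^ 2 * (dL P.1)⁻¹ * ((dR P.1 (dC P'.1)) ^ 2)⁻¹) := by
                simp only [hd]; gcongr
            _ = _ := by field_simp
        · have : ip φ Q P P' = 0 := by
            by_contra hne
            exact hc (hover P P' hk.le hne)
          simp [hc, hd, this]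
      · simp [hk]
    calc _ = ∑ m, ∑ P ∈ T m, ∑ P' ∈ S, (if P'.1.1 < P.1.1 then d P P' else 0) := Finset.sum_biUnion hdisj
      _ ≤ ∑ m, ∑ P ∈ T m, A ^ 2 * (64 * π * C0 ^ 2) * (16 * ∫ x in (dS (I m))ᶜ, ((dR P.1 x) ^ 2)⁻¹) :=
          Finset.sum_le_sum fun m _ => Finset.sum_le_sum fun P hP => hP1 m P hP
      _ ≤ ∑ m, A ^ 2 * (64 * π * C0 ^ 2) * (16 * (32 * CS * dL (I m))) := by
          apply Finset.sum_le_sum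
          intro m _
          rw [← Finset.mul_sum, ← Finset.mul_sum]
          gcongr
          exact outside_mass (fun P hP => (hF.hT m P hP).1) (tree_oneL h (hF.hT m))
      _ = 512 * C1 * (A ^ 2 * ∑ m, dL (I m)) := by
          rw [Finset.mul_sum, Finset.mul_sum]
          apply Finset.sum_congr rfl
          intro m _
          rw [hC1]; ring
      _ ≤ 512 * C1 * (4 * s) := by gcongr
      _ = _ := by ring
  have htot : ∑ P ∈ S, ∑ P' ∈ S, d P P' ≤ 4097 * C1 * s := by
    have e1 : ∀ P P' : Tile, d P P' = (if P'.1.1 = P.1.1 then d P P' else 0) +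
        (if P'.1.1 < P.1.1 then d P P' else 0) + (if P.1.1 < P'.1.1 then d P' P else 0) := by
      intro P P'
      rcases lt_trichotomy P'.1.1 P.1.1 with hk | hk | hk
      · simp [hk, hk.ne, hk.le]
      · simp [hk]
      · simp [hk, hk.ne', hk.le, hdsymm P P']
    have e2 : ∑ P ∈ S, ∑ P' ∈ S, d P P' = ∑ P ∈ S, ∑ P' ∈ S, (if P'.1.1 = P.1.1 then d P P' else 0) +
        ∑ P ∈ S, ∑ P' ∈ S, (if P'.1.1 < P.1.1 then d P P' else 0) +
        ∑ P ∈ S, ∑ P' ∈ S, (if P.1.1 < P'.1.1 then d P' P else 0) := by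
      rw [← Finset.sum_add_distrib, ← Finset.sum_add_distrib]
      apply Finset.sum_congr rfl
      intro P _
      rw [← Finset.sum_add_distrib, ← Finset.sum_add_distrib]
      exact Finset.sum_congr rfl fun P' _ => e1 P P'
    rw [e2, Finset.sum_comm (f := fun P P' : Tile => (if P.1.1 < P'.1.1 then d P' P else 0))]
    linarith
  have htt := ttstar hφ hf Q S hSQ
  have hE := En_nonneg f Q
  have hfin : s ≤ 4097 * C1 * En f Q := by
    by_contra hc
    push Not at hc
    have hspos : 0 < s := lt_of_le_of_lt (by positivity) hc
    have h2 : s ^ 2 ≤ En f Q * (4097 * C1 * s) := htt.trans (mul_le_mul_of_nonneg_left htot hE)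
    nlinarith
  unfold Cen
  rw [← hC1]
  linarith

end BHT
end

section
namespace BHT

/-- extremal top frequency attached to a tile -/
noncomputable def xt (θi σ b : ℝ) (P : Tile) : ℝ := fr θi P - σ * b / dL P.1

variable {θi θj σ b b0 K : ℝ} {Q : DI}

lemma inO_iff_signed (h : Num θi θj σ b b0 K) {ξ : ℝ} {I : DI} {P : Tile} :
    inO θi b ξ I P ↔ dS P.1 ⊆ dS I ∧ σ * xt θi σ b P ≤ σ * ξ ∧ σ * ξ ≤ σ * xt θi σ b P + 2 * b / dL P.1 := by
  have hL := dL_pos P.1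
  have hss : σ * σ = 1 := by rcases h.hσ with e | e <;> rw [e] <;> norm_num
  unfold inO
  apply and_congr_right
  intro _
  have e1 : σ * xt θi σ b P = (σ * (P.2 + θi) - b) / dL P.1 := by
    unfold xt fr
    rw [mul_sub, sub_div]
    congr 1
    · ring
    · rw [mul_div_assoc', ← mul_assoc, hss, one_mul]
  rw [e1, ← add_div, div_le_iff₀ hL, le_div_iff₀ hL, ← h.abs_mul, abs_le]
  constructor
  · rintro ⟨h1, h2⟩; constructor <;> linarith
  · rintro ⟨h1, h2⟩; constructor <;> linarith

open Classical in
lemma push_top (h : Num θi θj σ b b0 K) {PP : Finset Tile} {w : Tile → ℝ} {A : ℝ} {ξ : ℝ} {I : DI}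
    (hw : ∀ P, 0 ≤ w P)
    (hv : (A / 2) ^ 2 * dL I < ∑ P ∈ PP with inO θi b ξ I P, w P) :
    ∃ ξ' ∈ PP.image (xt θi σ b), (A / 2) ^ 2 * dL I < ∑ P ∈ PP with inO θi b ξ' I P, w P := by
  have hI := dL_pos I
  have hne : (PP.filter (fun P => inO θi b ξ I P)).Nonempty := by
    by_contra hc
    rw [Finset.not_nonempty_iff_eq_empty] at hc
    rw [hc, Finset.sum_empty] at hv
    have : 0 ≤ (A / 2) ^ 2 * dL I := by positivity
    linarith
  obtain ⟨P0, hP0, hmax⟩ := Finset.exists_max_image _ (fun P => σ * xt θi σ b P) hne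
  refine ⟨xt θi σ b P0, Finset.mem_image_of_mem _ (Finset.mem_filter.1 hP0).1, hv.trans_le ?_⟩
  apply Finset.sum_le_sum_of_subset_of_nonneg _ (fun P _ _ => hw P)
  intro P hP
  have h1 := hmax P hP
  have h0 := (inO_iff_signed h).1 (Finset.mem_filter.1 hP0).2
  rw [Finset.mem_filter] at hP ⊢
  obtain ⟨a, b1, c⟩ := (inO_iff_signed h).1 hP.2
  exact ⟨hP.1, (inO_iff_signed h).2 ⟨a, h1, h0.2.1.trans c⟩⟩

open Classical in
lemma select (h : Num θi θj σ b b0 K) (Q : DI) {w : Tile → ℝ} (hw : ∀ P, 0 ≤ w P) (A : ℝ) :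
    ∀ (n : ℕ) (PP : Finset Tile), PP.card = n → gap K b PP →
    ∃ (PP' : Finset Tile) (N : ℕ) (ξ : Fin N → ℝ) (I : Fin N → DI) (T : Fin N → Finset Tile),
      PP' ⊆ PP ∧ Forest θi θj σ b K Q ξ I T ∧ (∀ m, T m ⊆ PP) ∧ (∀ m, ξ m ∈ PP.image (xt θi σ b)) ∧
      (∀ m, (A / 2) ^ 2 * dL (I m) < ∑ P ∈ T m, w P) ∧
      (∀ P ∈ PP, P ∉ PP' → ∃ m, inO θi b (ξ m) (I m) P ∨ inO θj b (ξ m) (I m) P) ∧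
      (∀ η J, dS J ⊆ dS Q → ∑ P ∈ PP' with inO θi b η J P, w P ≤ (A / 2) ^ 2 * dL J) := by
  intro n
  induction n using Nat.strong_induction_on with
  | _ n ih =>
  intro PP hcard hg
  by_cases hgood : ∀ η J, dS J ⊆ dS Q → ∑ P ∈ PP with inO θi b η J P, w P ≤ (A / 2) ^ 2 * dL J
  · refine ⟨PP, 0, Fin.elim0, Fin.elim0, Fin.elim0, subset_rfl, ⟨?_, ?_, ?_, ?_, ?_⟩, ?_, ?_, ?_, ?_, hgood⟩
    all_goals first | exact fun m => m.elim0 | exact fun P hP hn => absurd hP hn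
  push Not at hgood
  obtain ⟨η, J, hJ, hv⟩ := hgood
  obtain ⟨ξ1, hξ1, hv1⟩ := push_top h hw hv
  set V := (PP.image (xt θi σ b)).filter
    (fun ξ => ∃ J, dS J ⊆ dS Q ∧ (A / 2) ^ 2 * dL J < ∑ P ∈ PP with inO θi b ξ J P, w P) with hV
  have hVne : V.Nonempty := ⟨ξ1, Finset.mem_filter.2 ⟨hξ1, J, hJ, hv1⟩⟩
  obtain ⟨ξ0, hξ0, hmin⟩ := Finset.exists_min_image V (fun ξ => σ * ξ) hVne
  obtain ⟨hxim, I0, hI0, hv0⟩ := Finset.mem_filter.1 hξ0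
  set T0 := PP.filter (fun P => inO θi b ξ0 I0 P) with hT0
  set R := PP.filter (fun P => ¬ (inO θi b ξ0 I0 P ∨ inO θj b ξ0 I0 P)) with hR
  have hT0ne : T0.Nonempty := by
    by_contra hc
    rw [Finset.not_nonempty_iff_eq_empty] at hc
    rw [hc, Finset.sum_empty] at hv0
    have := dL_pos I0
    have : 0 ≤ (A / 2) ^ 2 * dL I0 := by positivity
    linarith
  have hRsub : R ⊆ PP := Finset.filter_subset _ _
  have hRlt : R.card < n := by
    rw [← hcard]
    apply Finset.card_lt_card
    refine ⟨hRsub, fun hc => ?_⟩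
    obtain ⟨P, hP⟩ := hT0ne
    have hP2 := Finset.mem_filter.1 hP
    exact (Finset.mem_filter.1 (hc hP2.1)).2 (Or.inl hP2.2)
  obtain ⟨PP', N, ξ, I, T, hsub, hF, hT, hξ, hbig, hrem, hfin⟩ :=
    ih R.card hRlt R rfl (fun P hP P' hP' => hg P (hRsub hP) P' (hRsub hP'))
  have hT' : ∀ m, T m ⊆ PP := fun m => (hT m).trans hRsub
  refine ⟨PP', N + 1, Fin.cons ξ0 ξ, Fin.cons I0 I, Fin.cons T0 T, hsub.trans hRsub, ⟨?_, ?_, ?_, ?_, ?_⟩,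
    ?_, ?_, ?_, ?_, hfin⟩
  · intro m
    refine Fin.cases ?_ (fun m => ?_) m
    · exact hI0
    · exact hF.hI m
  · intro m
    refine Fin.cases ?_ (fun m => ?_) m
    · intro P hP; exact (Finset.mem_filter.1 hP).2
    · exact hF.hT m
  · have hall : ∀ m : Fin (N+1), (Fin.cons T0 T : Fin (N+1) → Finset Tile) m ⊆ PP := by
      intro m
      refine Fin.cases ?_ (fun m => ?_) m
      · exact Finset.filter_subset _ _
      · exact hT' m
    intro m m' P hP P' hP' hk
    exact hg P (hall m hP) P' (hall m' hP') hk
  · intro m m'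
    refine Fin.cases ?_ (fun m => ?_) m
    · refine Fin.cases ?_ (fun m' => ?_) m'
      · intro hlt; exact absurd hlt (lt_irrefl _)
      · intro _
        simp only [Fin.cons_zero, Fin.cons_succ]
        apply hmin
        rw [hV, Finset.mem_filter]
        refine ⟨Finset.image_subset_image hRsub (hξ m'), I m', hF.hI m', (hbig m').trans_le ?_⟩
        apply Finset.sum_le_sum_of_subset_of_nonneg _ (fun P _ _ => hw P)
        intro P hP
        exact Finset.mem_filter.2 ⟨hT' m' hP, hF.hT m' P hP⟩
    · refine Fin.cases ?_ (fun m' => ?_) m'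
      · intro hlt; exact absurd hlt (Fin.not_lt_zero _)
      · intro hlt
        simp only [Fin.cons_succ]
        exact hF.ord m m' (Fin.succ_lt_succ_iff.1 hlt)
  · intro m m'
    refine Fin.cases ?_ (fun m => ?_) m
    · refine Fin.cases ?_ (fun m' => ?_) m'
      · intro hlt; exact absurd hlt (lt_irrefl _)
      · intro _ P hP
        simp only [Fin.cons_zero, Fin.cons_succ] at hP ⊢
        have := (Finset.mem_filter.1 (hT m' hP)).2
        tauto
    · refine Fin.cases ?_ (fun m' => ?_) m'
      · intro hlt; exact absurd hlt (Fin.not_lt_zero _)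
      · intro hlt
        simp only [Fin.cons_succ]
        exact hF.rem m m' (Fin.succ_lt_succ_iff.1 hlt)
  · intro m
    refine Fin.cases ?_ (fun m => ?_) m
    · exact Finset.filter_subset _ _
    · exact hT' m
  · intro m
    refine Fin.cases ?_ (fun m => ?_) m
    · exact hxim
    · exact Finset.image_subset_image hRsub (hξ m)
  · intro m
    refine Fin.cases ?_ (fun m => ?_) m
    · exact hv0
    · exact hbig m
  · intro P hP hn
    by_cases hPR : P ∈ R
    · obtain ⟨m, hm⟩ := hrem P hPR hn
      exact ⟨m.succ, hm⟩
    · refine ⟨0, ?_⟩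
      simp only [Fin.cons_zero]
      by_contra hc
      exact hPR (Finset.mem_filter.2 ⟨hP, hc⟩)

end BHT
end

section
namespace BHT

/-- configuration of three packet families -/
structure Cfg (φ : Fin 3 → Tile → ℝ → ℂ) (θ e : Fin 3 → ℝ) (b b0 K C0 : ℝ) : Prop where
  pk : ∀ i, Packet (φ i) (θ i) (e i) b0 K C0
  num : ∀ i j, i ≠ j → ∃ σ, Num (θ i) (θ j) σ b b0 K

/-- the model form -/
noncomputable def Lam (φ : Fin 3 → Tile → ℝ → ℂ) (f : Fin 3 → ℝ → ℂ) (PP : Finset Tile) : ℝ :=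
  ∑ P ∈ PP, dL P.1 * ∏ i, ‖Fc (φ i) (f i) P‖

open Classical in
/-- size condition of the function index `j` relative to trees of index `i` -/
def SzP (φ : Fin 3 → Tile → ℝ → ℂ) (θ : Fin 3 → ℝ) (b : ℝ) (f : Fin 3 → ℝ → ℂ) (PP : Finset Tile) (Q : DI)
    (i j : Fin 3) (A : ℝ) : Prop :=
  ∀ ξ J, dS J ⊆ dS Q → ∑ P ∈ PP with inO (θ i) b ξ J P, dL P.1 * ‖Fc (φ j) (f j) P‖ ^ 2 ≤ A ^ 2 * dL J

def Sz (φ : Fin 3 → Tile → ℝ → ℂ) (θ : Fin 3 → ℝ) (b : ℝ) (f : Fin 3 → ℝ → ℂ) (PP : Finset Tile) (Q : DI)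
    (j : Fin 3) (A : ℝ) : Prop := ∀ i, i ≠ j → SzP φ θ b f PP Q i j A

variable {φ : Fin 3 → Tile → ℝ → ℂ} {θ e : Fin 3 → ℝ} {b b0 K C0 : ℝ} {f : Fin 3 → ℝ → ℂ}
  {PP PP' : Finset Tile} {Q : DI}

lemma SzP.mono {i j : Fin 3} {A : ℝ} (h : SzP φ θ b f PP Q i j A) (hs : PP' ⊆ PP) : SzP φ θ b f PP' Q i j A := by
  classical
  intro ξ J hJ
  refine le_trans ?_ (h ξ J hJ)
  apply Finset.sum_le_sum_of_subset_of_nonneg (Finset.filter_subset_filter _ hs)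
  intro P _ _
  exact mul_nonneg (dL_pos _).le (sq_nonneg _)

lemma Sz.mono {j : Fin 3} {A : ℝ} (h : Sz φ θ b f PP Q j A) (hs : PP' ⊆ PP) : Sz φ θ b f PP' Q j A :=
  fun i hi => (h i hi).mono hs

lemma Sz.single (hb : 0 ≤ b) {j : Fin 3} {A : ℝ} (hA : 0 ≤ A) (h : Sz φ θ b f PP Q j A) {P : Tile} (hP : P ∈ PP)
    (hPQ : dS P.1 ⊆ dS Q) : ‖Fc (φ j) (f j) P‖ ≤ A := by
  classical
  obtain ⟨i, hi⟩ : ∃ i : Fin 3, i ≠ j := ⟨j + 1, by fin_cases j <;> decide⟩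
  have h1 := h i hi (fr (θ i) P) P.1 hPQ
  have hL := dL_pos P.1
  have h2 : dL P.1 * ‖Fc (φ j) (f j) P‖ ^ 2 ≤ A ^ 2 * dL P.1 := by
    refine le_trans ?_ h1
    apply Finset.single_le_sum (f := fun P => dL P.1 * ‖Fc (φ j) (f j) P‖ ^ 2)
    · intro P _; exact mul_nonneg (dL_pos _).le (sq_nonneg _)
    · rw [Finset.mem_filter]
      refine ⟨hP, subset_rfl, ?_⟩
      have : dL P.1 * fr (θ i) P - P.2 - θ i = 0 := by unfold fr; field_simp; ring
      rw [this, abs_zero]; exact hb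
  have h3 : ‖Fc (φ j) (f j) P‖ ^ 2 ≤ A ^ 2 := by
    have : dL P.1 * ‖Fc (φ j) (f j) P‖ ^ 2 ≤ dL P.1 * A ^ 2 := by linarith
    exact le_of_mul_le_mul_left this hL
  exact abs_le_of_sq_le_sq' h3 hA |>.2

lemma prod_split (i j k : Fin 3) (hij : i ≠ j) (hik : i ≠ k) (hjk : j ≠ k) (a : Fin 3 → ℝ) :
    ∏ l, a l = a i * (a j * a k) := by
  rw [Fin.prod_univ_three]
  fin_cases i <;> fin_cases j <;> fin_cases k <;> simp_all <;> ring

lemma tree_est (hb : 0 ≤ b) {A : Fin 3 → ℝ} (hA : ∀ j, 0 ≤ A j)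
    (hS : ∀ j, Sz φ θ b f PP Q j (A j)) {T : Finset Tile} (hT : T ⊆ PP) (i : Fin 3) {ξ : ℝ} {I : DI}
    (hI : dS I ⊆ dS Q) (hTi : ∀ P ∈ T, inO (θ i) b ξ I P) : Lam φ f T ≤ dL I * ∏ j, A j := by
  classical
  obtain ⟨j, k, hij, hik, hjk⟩ : ∃ j k : Fin 3, i ≠ j ∧ i ≠ k ∧ j ≠ k :=
    ⟨i + 1, i + 2, by fin_cases i <;> decide, by fin_cases i <;> decide, by fin_cases i <;> decide⟩
  have hsz : ∀ j, i ≠ j → ∑ P ∈ T, dL P.1 * ‖Fc (φ j) (f j) P‖ ^ 2 ≤ (A j) ^ 2 * dL I := by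
    intro j hij
    refine le_trans ?_ (hS j i hij ξ I hI)
    apply Finset.sum_le_sum_of_subset_of_nonneg
    · intro P hP; exact Finset.mem_filter.2 ⟨hT hP, hTi P hP⟩
    · intro P _ _; exact mul_nonneg (dL_pos _).le (sq_nonneg _)
  have hI0 := dL_pos I
  have hcs : ∑ P ∈ T, dL P.1 * (‖Fc (φ j) (f j) P‖ * ‖Fc (φ k) (f k) P‖) ≤ A j * A k * dL I := by
    have h1 := Finset.sum_mul_sq_le_sq_mul_sq T (fun P => √(dL P.1) * ‖Fc (φ j) (f j) P‖)
      (fun P => √(dL P.1) * ‖Fc (φ k) (f k) P‖)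
    have e1 : ∀ P : Tile, √(dL P.1) * √(dL P.1) = dL P.1 := fun P => Real.mul_self_sqrt (dL_pos _).le
    have e2 : ∀ P : Tile, √(dL P.1) * ‖Fc (φ j) (f j) P‖ * (√(dL P.1) * ‖Fc (φ k) (f k) P‖) =
        dL P.1 * (‖Fc (φ j) (f j) P‖ * ‖Fc (φ k) (f k) P‖) := by
      intro P; linear_combination (‖Fc (φ j) (f j) P‖ * ‖Fc (φ k) (f k) P‖) * e1 P
    have e3 : ∀ (P : Tile) (x : ℝ), (√(dL P.1) * x) ^ 2 = dL P.1 * x ^ 2 := by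
      intro P x; linear_combination x ^ 2 * e1 P
    simp only [e2, e3] at h1
    have h2 := h1.trans (mul_le_mul (hsz j hij) (hsz k hik)
      (Finset.sum_nonneg fun P _ => mul_nonneg (dL_pos _).le (sq_nonneg _)) (by positivity))
    have h3 : (∑ P ∈ T, dL P.1 * (‖Fc (φ j) (f j) P‖ * ‖Fc (φ k) (f k) P‖)) ^ 2 ≤ (A j * A k * dL I) ^ 2 := by
      refine h2.trans (le_of_eq ?_); ring
    exact (abs_le_of_sq_le_sq' h3 (mul_nonneg (mul_nonneg (hA j) (hA k)) hI0.le)).2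
  unfold Lam
  rw [prod_split i j k hij hik hjk]
  calc _ ≤ ∑ P ∈ T, A i * (dL P.1 * (‖Fc (φ j) (f j) P‖ * ‖Fc (φ k) (f k) P‖)) := by
        apply Finset.sum_le_sum
        intro P hP
        rw [prod_split i j k hij hik hjk (fun l => ‖Fc (φ l) (f l) P‖)]
        have h1 := (hS i).single hb (hA i) (hT hP) ((hTi P hP).1.trans hI)
        have := dL_pos P.1
        calc _ = ‖Fc (φ i) (f i) P‖ * (dL P.1 * (‖Fc (φ j) (f j) P‖ * ‖Fc (φ k) (f k) P‖)) := by ring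
          _ ≤ _ := by gcongr
    _ ≤ A i * (A j * A k * dL I) := by
        rw [← Finset.mul_sum]
        exact mul_le_mul_of_nonneg_left hcs (hA i)
    _ = _ := by ring

lemma Lam_nonneg : 0 ≤ Lam φ f PP :=
  Finset.sum_nonneg fun P _ => mul_nonneg (dL_pos _).le (Finset.prod_nonneg fun _ _ => norm_nonneg _)

lemma sum_biUnion_le' {ι κ : Type*} [DecidableEq ι] [DecidableEq κ] (s : Finset ι) (t : ι → Finset κ) (g : κ → ℝ)
    (hg : ∀ x, 0 ≤ g x) : ∑ x ∈ s.biUnion t, g x ≤ ∑ i ∈ s, ∑ x ∈ t i, g x := by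
  induction s using Finset.induction_on with
  | empty => simp
  | insert a s ha ih =>
    rw [Finset.biUnion_insert, Finset.sum_insert ha]
    have := Finset.sum_union_inter (s₁ := t a) (s₂ := s.biUnion t) (f := g)
    have h2 := Finset.sum_nonneg (s := t a ∩ s.biUnion t) fun x _ => hg x
    linarith

lemma Lam_union_le (S : Finset Tile) {N : ℕ} (S' : Fin N → Finset Tile) (h : PP ⊆ S ∪ Finset.univ.biUnion S') :
    Lam φ f PP ≤ Lam φ f S + ∑ m, Lam φ f (S' m) := by
  classical
  have h0 : ∀ P : Tile, 0 ≤ dL P.1 * ∏ i, ‖Fc (φ i) (f i) P‖ := fun P =>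
    mul_nonneg (dL_pos _).le (Finset.prod_nonneg fun _ _ => norm_nonneg _)
  unfold Lam
  calc _ ≤ ∑ P ∈ S ∪ Finset.univ.biUnion S', dL P.1 * ∏ i, ‖Fc (φ i) (f i) P‖ :=
        Finset.sum_le_sum_of_subset_of_nonneg h fun P _ _ => h0 P
    _ ≤ ∑ P ∈ S, dL P.1 * ∏ i, ‖Fc (φ i) (f i) P‖ +
        ∑ P ∈ Finset.univ.biUnion S', dL P.1 * ∏ i, ‖Fc (φ i) (f i) P‖ := by
        rw [← Finset.sum_union_inter]
        linarith [Finset.sum_nonneg (s := S ∩ Finset.univ.biUnion S') fun P _ => h0 P]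
    _ ≤ _ := by
        gcongr
        exact sum_biUnion_le' Finset.univ S' _ (fun P => h0 P)

end BHT
end

section
namespace BHT

variable {φ : Fin 3 → Tile → ℝ → ℂ} {θ e : Fin 3 → ℝ} {b b0 K C0 : ℝ} {f : Fin 3 → ℝ → ℂ}
  {PP PP' : Finset Tile} {Q : DI}

lemma gap.mono {K b : ℝ} {T T' : Finset Tile} (h : gap K b T) (hs : T' ⊆ T) : gap K b T' :=
  fun P hP P' hP' => h P (hs hP) P' (hs hP')

lemma Cen_pos {C0 : ℝ} (h : 0 < C0) : 0 < Cen C0 := by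
  have := CS_pos
  unfold Cen; positivity

lemma one_pair (hC : Cfg φ θ e b b0 K C0) (hf : ∀ i, BM (f i)) (hg : gap K b PP)
    (hQ : ∀ P ∈ PP, dS P.1 ⊆ dS Q) {S : Fin 3 → ℝ} (hS0 : ∀ l, 0 ≤ S l) (hS : ∀ l, Sz φ θ b f PP Q l (S l))
    {i j : Fin 3} (hij : i ≠ j) {x B : ℝ} (hx : 0 < x) (hB : 0 < B)
    (hSz : Sz φ θ b f PP Q j (x * B)) (hE : En (f j) Q ≤ B ^ 2 * dL Q) :
    ∃ PP' ⊆ PP, SzP φ θ b f PP' Q i j (x * B / 2) ∧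
      Lam φ f PP ≤ Lam φ f PP' + 2 * Cen C0 * (x ^ 2)⁻¹ * dL Q * ∏ l, S l := by
  classical
  obtain ⟨σ, h⟩ := hC.num i j hij
  have hb := h.bpos
  have hCen := Cen_pos (hC.pk j).C0pos
  have hPi : 0 ≤ ∏ l, S l := Finset.prod_nonneg fun l _ => hS0 l
  obtain ⟨PP', N, ξ, I, T, hsub, hF, hT, -, hbig, hrem, hfin⟩ :=
    select h Q (w := fun P => dL P.1 * ‖Fc (φ j) (f j) P‖ ^ 2)
      (fun P => mul_nonneg (dL_pos _).le (sq_nonneg _)) (x * B) PP.card PP rfl hg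
  refine ⟨PP', hsub, fun ξ J hJ => hfin ξ J hJ, ?_⟩
  have hen := energy h hF (hC.pk j) (hf j) (fun m => (hbig m).le)
    (fun m P hP => hSz.single hb.le (by positivity) (hT m hP) (hQ P (hT m hP)))
  have hsumI : ∑ m, dL (I m) ≤ Cen C0 * (x ^ 2)⁻¹ * dL Q := by
    have h1 : (x * B) ^ 2 * ∑ m, dL (I m) ≤ Cen C0 * (B ^ 2 * dL Q) := hen.trans (by gcongr)
    have h2 : (x * B) ^ 2 * (Cen C0 * (x ^ 2)⁻¹ * dL Q) = Cen C0 * (B ^ 2 * dL Q) := by field_simp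
    rw [← h2] at h1
    exact le_of_mul_le_mul_left h1 (by positivity)
  have h1 : Lam φ f PP ≤ Lam φ f PP' + ∑ m, Lam φ f (PP.filter fun P =>
      inO (θ i) b (ξ m) (I m) P ∨ inO (θ j) b (ξ m) (I m) P) := by
    apply Lam_union_le
    intro P hP
    by_cases hP' : P ∈ PP'
    · exact Finset.mem_union_left _ hP'
    · obtain ⟨m, hm⟩ := hrem P hP hP'
      apply Finset.mem_union_right
      rw [Finset.mem_biUnion]
      exact ⟨m, Finset.mem_univ _, Finset.mem_filter.2 ⟨hP, hm⟩⟩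
  have h2 : ∀ m, Lam φ f (PP.filter fun P =>
      inO (θ i) b (ξ m) (I m) P ∨ inO (θ j) b (ξ m) (I m) P) ≤ 2 * (∏ l, S l) * dL (I m) := by
    intro m
    have a := tree_est (f := f) hb.le hS0 hS (Finset.filter_subset (fun P => inO (θ i) b (ξ m) (I m) P) PP) i (hF.hI m)
      (fun P hP => (Finset.mem_filter.1 hP).2)
    have c := tree_est (f := f) hb.le hS0 hS (Finset.filter_subset (fun P => inO (θ j) b (ξ m) (I m) P) PP) j (hF.hI m)
      (fun P hP => (Finset.mem_filter.1 hP).2)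
    rw [Finset.filter_or]
    have d : Lam φ f (PP.filter (fun P => inO (θ i) b (ξ m) (I m) P) ∪ PP.filter (fun P => inO (θ j) b (ξ m) (I m) P)) ≤
        Lam φ f (PP.filter (fun P => inO (θ i) b (ξ m) (I m) P)) +
        Lam φ f (PP.filter (fun P => inO (θ j) b (ξ m) (I m) P)) := by
      unfold Lam
      rw [← Finset.sum_union_inter]
      have : 0 ≤ Lam φ f (PP.filter (fun P => inO (θ i) b (ξ m) (I m) P) ∩
        PP.filter (fun P => inO (θ j) b (ξ m) (I m) P)) := Lam_nonneg
      unfold Lam at this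
      linarith
    linarith
  calc _ ≤ _ := h1
    _ ≤ Lam φ f PP' + ∑ m, 2 * (∏ l, S l) * dL (I m) := by gcongr with m; exact h2 m
    _ ≤ Lam φ f PP' + 2 * (∏ l, S l) * (Cen C0 * (x ^ 2)⁻¹ * dL Q) := by
        rw [← Finset.mul_sum]; gcongr
    _ = _ := by ring

lemma all_pairs (hC : Cfg φ θ e b b0 K C0) (hf : ∀ i, BM (f i)) (hg : gap K b PP)
    (hQ : ∀ P ∈ PP, dS P.1 ⊆ dS Q) {S : Fin 3 → ℝ} (hS0 : ∀ l, 0 ≤ S l) (hS : ∀ l, Sz φ θ b f PP Q l (S l))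
    {x : ℝ} {B : Fin 3 → ℝ} (hx : 0 < x) (hB : ∀ j, 0 < B j)
    (hSz : ∀ j, Sz φ θ b f PP Q j (x * B j)) (hE : ∀ j, En (f j) Q ≤ B j ^ 2 * dL Q)
    (F : Finset (Fin 3 × Fin 3)) (hF : ∀ q ∈ F, q.1 ≠ q.2) :
    ∃ PP' ⊆ PP, (∀ q ∈ F, SzP φ θ b f PP' Q q.1 q.2 (x * B q.2 / 2)) ∧
      Lam φ f PP ≤ Lam φ f PP' + F.card * (2 * Cen C0 * (x ^ 2)⁻¹ * dL Q * ∏ l, S l) := by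
  classical
  induction F using Finset.induction_on with
  | empty => exact ⟨PP, subset_rfl, by simp, by simp⟩
  | insert q F hq ih =>
    obtain ⟨P1, h1, h2, h3⟩ := ih (fun q hq => hF q (Finset.mem_insert_of_mem hq))
    obtain ⟨P2, h4, h5, h6⟩ := one_pair hC hf (hg.mono h1) (fun P hP => hQ P (h1 hP)) hS0
      (fun l => (hS l).mono h1) (hF q (Finset.mem_insert_self _ _)) hx (hB q.2) ((hSz q.2).mono h1) (hE q.2)
    refine ⟨P2, h4.trans h1, ?_, ?_⟩
    · intro q' hq'
      rcases Finset.mem_insert.1 hq' with e | e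
      · rw [e]; exact h5
      · exact (h2 q' e).mono h4
    · rw [Finset.card_insert_of_notMem hq]
      push_cast
      linarith

lemma one_step (hC : Cfg φ θ e b b0 K C0) (hf : ∀ i, BM (f i)) (hg : gap K b PP)
    (hQ : ∀ P ∈ PP, dS P.1 ⊆ dS Q) {S : Fin 3 → ℝ} (hS0 : ∀ l, 0 ≤ S l) (hS : ∀ l, Sz φ θ b f PP Q l (S l))
    {x : ℝ} {B : Fin 3 → ℝ} (hx : 0 < x) (hB : ∀ j, 0 < B j)
    (hSz : ∀ j, Sz φ θ b f PP Q j (x * B j)) (hE : ∀ j, En (f j) Q ≤ B j ^ 2 * dL Q) :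
    ∃ PP' ⊆ PP, (∀ j, Sz φ θ b f PP' Q j (x * B j / 2)) ∧
      Lam φ f PP ≤ Lam φ f PP' + 12 * Cen C0 * (x ^ 2)⁻¹ * dL Q * ∏ l, S l := by
  obtain ⟨PP', h1, h2, h3⟩ := all_pairs hC hf hg hQ hS0 hS hx hB hSz hE
    (Finset.univ.filter fun q : Fin 3 × Fin 3 => q.1 ≠ q.2) (fun q hq => (Finset.mem_filter.1 hq).2)
  refine ⟨PP', h1, fun j i hij => h2 (i, j) (by simpa using hij), ?_⟩
  have : (Finset.univ.filter fun q : Fin 3 × Fin 3 => q.1 ≠ q.2).card = 6 := by decide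
  rw [this] at h3
  push_cast at h3
  linarith

lemma iterate (hC : Cfg φ θ e b b0 K C0) (hf : ∀ i, BM (f i)) {A B : Fin 3 → ℝ} (hA : ∀ l, 0 ≤ A l)
    (hB : ∀ j, 0 < B j) (hE : ∀ j, En (f j) Q ≤ B j ^ 2 * dL Q) (M : ℕ) :
    ∀ (n : ℤ) (PP : Finset Tile), gap K b PP → (∀ P ∈ PP, dS P.1 ⊆ dS Q) →
      (∀ l, Sz φ θ b f PP Q l (A l)) → (∀ j, Sz φ θ b f PP Q j (len (-n) * B j)) →
      ∃ PP' ⊆ PP, (∀ j, Sz φ θ b f PP' Q j (len (-(n + M)) * B j)) ∧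
        Lam φ f PP ≤ Lam φ f PP' + 12 * Cen C0 * dL Q *
          ∑ m ∈ Finset.range M, (len (n + m)) ^ 2 * ∏ l, min (A l) (len (-(n + m)) * B l) := by
  induction M with
  | zero => intro n PP _ _ _ h; exact ⟨PP, subset_rfl, by simpa using h, by simp⟩
  | succ M ih =>
    intro n PP hg hQ hA1 hB1
    obtain ⟨P1, h1, h2, h3⟩ := ih n PP hg hQ hA1 hB1
    have hmin : ∀ l, Sz φ θ b f P1 Q l (min (A l) (len (-(n + M)) * B l)) := by
      intro l
      rcases min_choice (A l) (len (-(n + M)) * B l) with e | e <;> rw [e]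
      · exact (hA1 l).mono h1
      · exact h2 l
    obtain ⟨P2, h4, h5, h6⟩ := one_step hC hf (hg.mono h1) (fun P hP => hQ P (h1 hP))
      (fun l => le_min (hA l) (mul_nonneg (len_pos _).le (hB l).le)) hmin (len_pos (-(n + M))) hB h2 hE
    refine ⟨P2, h4.trans h1, ?_, ?_⟩
    · intro j
      have := h5 j
      have e1 : len (-(n + (M + 1 : ℕ))) * B j = len (-(n + M)) * B j / 2 := by
        have : len (-(n + M)) = 2 * len (-(n + (M + 1 : ℕ))) := by
          rw [← len_succ]; congr 1; push_cast; ring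
        rw [this]; ring
      rw [e1]; exact this
    · rw [Finset.sum_range_succ, mul_add]
      have e2 : ((len (-(n + M))) ^ 2)⁻¹ = len (n + M) ^ 2 := by
        rw [len_neg, inv_pow, inv_inv]
      rw [e2] at h6
      linarith

end BHT
end

section
namespace BHT

noncomputable def qq (τ : ℝ) : ℝ := max (1 / 4) (2 ^ (2 - τ))

lemma qq_pos (τ : ℝ) : 0 < qq τ := lt_of_lt_of_le (by norm_num) (le_max_left _ _)

lemma qq_lt {τ : ℝ} (h : 2 < τ) : qq τ < 1 :=
  max_lt (by norm_num) (Real.rpow_lt_one_of_one_lt_of_neg (by norm_num) (by linarith))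

lemma summable_qq {τ : ℝ} (h : 2 < τ) : Summable (fun n : ℤ => (qq τ) ^ n.natAbs) := by
  have h1 := summable_geometric_of_lt_one (qq_pos τ).le (qq_lt h)
  apply Summable.of_nat_of_neg
  · simpa using h1
  · simpa using h1

noncomputable def cq (τ : ℝ) : ℝ := ∑' n : ℤ, (qq τ) ^ n.natAbs

lemma cq_pos {τ : ℝ} (h : 2 < τ) : 0 < cq τ :=
  (summable_qq h).tsum_pos (fun n => (pow_pos (qq_pos τ) _).le) 0 (by simp)

lemma min_le_interp {a y t : ℝ} (ha : 0 < a) (hy : 0 < y) (h0 : 0 ≤ t) (h1 : t ≤ 1) :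
    min a y ≤ a ^ (1 - t) * y ^ t := by
  have hm : 0 < min a y := lt_min ha hy
  calc min a y = (min a y) ^ (1 - t) * (min a y) ^ t := by
        rw [← Real.rpow_add hm]; simp
    _ ≤ _ := by
        gcongr
        · exact min_le_left _ _
        · exact min_le_right _ _

lemma term_bound {A B t : Fin 3 → ℝ} (hA : ∀ l, 0 < A l) (hB : ∀ l, 0 < B l) (ht : ∀ l, 0 ≤ t l)
    (ht1 : ∀ l, t l ≤ 1) (n : ℤ) :
    (len n) ^ 2 * ∏ l, min (A l) (len (-n) * B l) ≤
      (∏ l, A l + ∏ l, (A l) ^ (1 - t l) * (B l) ^ (t l)) * (qq (∑ l, t l)) ^ n.natAbs := by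
  have hG1 : 0 < ∏ l, A l := Finset.prod_pos fun l _ => hA l
  have hG2 : 0 < ∏ l, (A l) ^ (1 - t l) * (B l) ^ (t l) := Finset.prod_pos fun l _ =>
    mul_pos (Real.rpow_pos_of_pos (hA l) _) (Real.rpow_pos_of_pos (hB l) _)
  have hq := qq_pos (∑ l, t l)
  have hm0 : ∀ l, 0 ≤ min (A l) (len (-n) * B l) := fun l =>
    le_min (hA l).le (mul_pos (len_pos _) (hB l)).le
  rcases le_or_gt 0 n with hn | hn
  · obtain ⟨k, rfl⟩ := Int.eq_ofNat_of_zero_le hn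
    have h1 : ∏ l, min (A l) (len (-k) * B l) ≤
        ∏ l, ((A l) ^ (1 - t l) * (B l) ^ (t l)) * ((2:ℝ) ^ (-(k:ℝ))) ^ (t l) := by
      apply Finset.prod_le_prod (fun l _ => hm0 l)
      intro l _
      refine (min_le_interp (hA l) (mul_pos (len_pos _) (hB l)) (ht l) (ht1 l)).trans (le_of_eq ?_)
      have e : len (-k) = (2:ℝ) ^ (-(k:ℝ)) := by
        unfold len; rw [← Real.rpow_intCast]; push_cast; rfl
      rw [Real.mul_rpow (len_pos _).le (hB l).le, e]; ring
    have h2 : ∏ l, ((2:ℝ) ^ (-(k:ℝ))) ^ (t l) = (2:ℝ) ^ (-(k:ℝ) * ∑ l, t l) := by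
      rw [← Real.rpow_sum_of_pos (by positivity), ← Real.rpow_mul (by norm_num)]
    rw [Finset.prod_mul_distrib, h2] at h1
    have h3 : (len k) ^ 2 = (2:ℝ) ^ (2 * (k:ℝ)) := by
      rw [len_nat, ← pow_mul, ← Real.rpow_natCast]; push_cast; ring_nf
    have h4 : (2:ℝ) ^ (2 * (k:ℝ)) * (2:ℝ) ^ (-(k:ℝ) * ∑ l, t l) = ((2:ℝ) ^ (2 - ∑ l, t l)) ^ k := by
      rw [← Real.rpow_add (by norm_num), ← Real.rpow_natCast, ← Real.rpow_mul (by norm_num)]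
      congr 1; ring
    have h5 : ((2:ℝ) ^ (2 - ∑ l, t l)) ^ k ≤ qq (∑ l, t l) ^ k :=
      pow_le_pow_left₀ (by positivity) (le_max_right _ _) k
    rw [Int.natAbs_natCast]
    calc _ ≤ (len k) ^ 2 * ((∏ l, (A l) ^ (1 - t l) * (B l) ^ (t l)) * (2:ℝ) ^ (-(k:ℝ) * ∑ l, t l)) := by
          gcongr
      _ = (∏ l, (A l) ^ (1 - t l) * (B l) ^ (t l)) * ((2:ℝ) ^ (2 - ∑ l, t l)) ^ k := by rw [h3, ← h4]; ring
      _ ≤ (∏ l, (A l) ^ (1 - t l) * (B l) ^ (t l)) * qq (∑ l, t l) ^ k := by gcongr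
      _ ≤ _ := by gcongr; linarith
  · have h1 : ∏ l, min (A l) (len (-n) * B l) ≤ ∏ l, A l :=
      Finset.prod_le_prod (fun l _ => hm0 l) fun l _ => min_le_left _ _
    have h2 : (len n) ^ 2 = (1/4 : ℝ) ^ n.natAbs := by
      have : n = -(n.natAbs : ℤ) := by omega
      conv_lhs => rw [this]
      rw [len_neg, len_nat, inv_pow, ← pow_mul, mul_comm, pow_mul, one_div, inv_pow]
      norm_num
    have h3 : (1/4 : ℝ) ^ n.natAbs ≤ qq (∑ l, t l) ^ n.natAbs :=
      pow_le_pow_left₀ (by norm_num) (le_max_left _ _) _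
    rw [h2]
    calc _ ≤ qq (∑ l, t l) ^ n.natAbs * ∏ l, A l := by gcongr; exact Finset.prod_nonneg fun l _ => hm0 l
      _ = (∏ l, A l) * qq (∑ l, t l) ^ n.natAbs := by ring
      _ ≤ _ := by gcongr; linarith

variable {φ : Fin 3 → Tile → ℝ → ℂ} {θ e : Fin 3 → ℝ} {b b0 K C0 : ℝ} {f : Fin 3 → ℝ → ℂ}
  {PP PP' : Finset Tile} {Q : DI}

lemma Sz.le {j : Fin 3} {A A' : ℝ} (h : Sz φ θ b f PP Q j A) (hA : 0 ≤ A) (hs : A ≤ A') : Sz φ θ b f PP Q j A' := by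
  intro i hi ξ J hJ
  refine (h i hi ξ J hJ).trans ?_
  have := dL_pos J
  gcongr

lemma star2 (hC : Cfg φ θ e b b0 K C0) (hf : ∀ i, BM (f i)) (hg : gap K b PP)
    (hQ : ∀ P ∈ PP, dS P.1 ⊆ dS Q) {A B t : Fin 3 → ℝ} (hA : ∀ l, 0 < A l) (hB : ∀ l, 0 < B l)
    (ht : ∀ l, 0 ≤ t l) (ht1 : ∀ l, t l ≤ 1) (hτ : 2 < ∑ l, t l)
    (hS : ∀ l, Sz φ θ b f PP Q l (A l)) (hE : ∀ j, En (f j) Q ≤ B j ^ 2 * dL Q) :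
    Lam φ f PP ≤ 12 * Cen C0 * cq (∑ l, t l) * dL Q *
      (∏ l, A l + ∏ l, (A l) ^ (1 - t l) * (B l) ^ (t l)) := by
  obtain ⟨σ, hnum⟩ := hC.num 0 1 (by decide)
  have hb := hnum.bpos
  have hCen := Cen_pos (hC.pk 0).C0pos
  have hQ0 := dL_pos Q
  set G := ∏ l, A l + ∏ l, (A l) ^ (1 - t l) * (B l) ^ (t l) with hG
  have hG0 : 0 < G := add_pos (Finset.prod_pos fun l _ => hA l) (Finset.prod_pos fun l _ =>
    mul_pos (Real.rpow_pos_of_pos (hA l) _) (Real.rpow_pos_of_pos (hB l) _))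
  obtain ⟨k, hk⟩ : ∃ k : ℕ, ∀ l, A l ≤ 2 ^ k * B l := by
    obtain ⟨k, hk⟩ := pow_unbounded_of_one_lt (∑ l, A l / B l) (by norm_num : (1:ℝ) < 2)
    refine ⟨k, fun l => ?_⟩
    rw [← div_le_iff₀ (hB l)]
    refine le_trans ?_ hk.le
    exact Finset.single_le_sum (f := fun l => A l / B l) (fun l _ => (div_pos (hA l) (hB l)).le) (Finset.mem_univ l)
  set n : ℤ := -(k : ℤ) with hn
  have hstart : ∀ j, Sz φ θ b f PP Q j (len (-n) * B j) := by
    intro j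
    apply (hS j).le (hA j).le
    rw [hn, neg_neg, len_nat]
    exact hk j
  set D := (∑ P ∈ PP, dL P.1) * (len (-n) ^ 3 * ∏ l, B l) with hD
  have hmain : ∀ M : ℕ, Lam φ f PP ≤ D * (1/8) ^ M + 12 * Cen C0 * cq (∑ l, t l) * dL Q * G := by
    intro M
    obtain ⟨P', h1, h2, h3⟩ := iterate hC hf (fun l => (hA l).le) hB hE M n PP hg hQ hS hstart
    have h4 : Lam φ f P' ≤ D * (1/8) ^ M := by
      have hx : len (-(n + M)) = len (-n) * (1/2) ^ M := by
        rw [show -(n + (M:ℤ)) = -n - M by ring, len_sub, len_nat, div_eq_mul_inv, one_div, inv_pow]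
      calc Lam φ f P' ≤ ∑ P ∈ P', dL P.1 * (len (-(n + M)) ^ 3 * ∏ l, B l) := by
            apply Finset.sum_le_sum
            intro P hP
            have := dL_pos P.1
            have h5 : ∏ l, ‖Fc (φ l) (f l) P‖ ≤ ∏ l, len (-(n + M)) * B l := by
              apply Finset.prod_le_prod (fun l _ => norm_nonneg _)
              intro l _
              exact (h2 l).single hb.le (mul_pos (len_pos _) (hB l)).le hP (hQ P (h1 hP))
            rw [Finset.prod_mul_distrib, Finset.prod_const, Finset.card_univ, Fintype.card_fin] at h5
            gcongr
        _ ≤ ∑ P ∈ PP, dL P.1 * (len (-(n + M)) ^ 3 * ∏ l, B l) := by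
            apply Finset.sum_le_sum_of_subset_of_nonneg h1
            intro P _ _
            have := dL_pos P.1
            have := len_pos (-(n + M))
            have : 0 < ∏ l, B l := Finset.prod_pos fun l _ => hB l
            positivity
        _ = _ := by
            rw [← Finset.sum_mul, hx, hD, mul_pow, ← pow_mul, mul_comm M 3, pow_mul]
            norm_num
            ring
    have h6 : ∑ m ∈ Finset.range M, (len (n + m)) ^ 2 * ∏ l, min (A l) (len (-(n + m)) * B l) ≤ G * cq (∑ l, t l) := by
      calc _ ≤ ∑ m ∈ Finset.range M, G * (qq (∑ l, t l)) ^ (n + m).natAbs :=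
            Finset.sum_le_sum fun m _ => term_bound hA hB ht ht1 (n + m)
        _ = G * ∑ m ∈ Finset.range M, (qq (∑ l, t l)) ^ (n + m).natAbs := by rw [Finset.mul_sum]
        _ ≤ _ := by
            gcongr
            have hinj : Set.InjOn (fun m : ℕ => n + (m:ℤ)) (Finset.range M) := by
              intro a _ c _ h; simpa using h
            rw [← Finset.sum_image (f := fun z : ℤ => (qq (∑ l, t l)) ^ z.natAbs) hinj]
            exact (summable_qq hτ).sum_le_tsum _ (fun z _ => (pow_pos (qq_pos _) _).le)
    calc _ ≤ _ := h3
      _ ≤ D * (1/8) ^ M + 12 * Cen C0 * dL Q * (G * cq (∑ l, t l)) := by gcongr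
      _ = _ := by ring
  have hlim : Tendsto (fun M : ℕ => D * (1/8 : ℝ) ^ M + 12 * Cen C0 * cq (∑ l, t l) * dL Q * G) atTop
      (nhds (D * 0 + 12 * Cen C0 * cq (∑ l, t l) * dL Q * G)) :=
    ((tendsto_pow_atTop_nhds_zero_of_lt_one (by norm_num) (by norm_num)).const_mul D).add_const _
  have := ge_of_tendsto' hlim hmain
  simpa using this

end BHT
end

section
namespace BHT

open Classical in
/-- level pieces of a function -/
noncomputable def lv (A : ℝ) (f : ℝ → ℂ) : ℕ → ℝ → ℂ
  | 0 => fun x => if ‖f x‖ ≤ A then f x else 0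
  | (k + 1) => fun x => if 2 ^ k * A < ‖f x‖ ∧ ‖f x‖ ≤ 2 ^ (k + 1) * A then f x else 0

variable {f : ℝ → ℂ} {A : ℝ}

lemma sum_lv (hA : 0 < A) (M : ℕ) (x : ℝ) :
    ∑ k ∈ Finset.range (M + 1), lv A f k x = if ‖f x‖ ≤ 2 ^ M * A then f x else 0 := by
  induction M with
  | zero => simp [lv]
  | succ M ih =>
    rw [Finset.sum_range_succ, ih]
    simp only [lv]
    have h2 : (2:ℝ) ^ M * A ≤ 2 ^ (M + 1) * A := by rw [pow_succ]; have : 0 < (2:ℝ) ^ M * A := by positivity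
                                                    linarith
    by_cases h : ‖f x‖ ≤ 2 ^ M * A
    · simp [h, h.trans h2, not_lt.2 h]
    · simp [h, not_le.1 h]

lemma BM.lv (hf : BM f) (k : ℕ) : BM (lv A f k) := by
  classical
  obtain ⟨hm, B, hB⟩ := hf
  have hB0 : 0 ≤ B := (norm_nonneg _).trans (hB 0)
  have hn : Measurable fun x => ‖f x‖ := hm.norm
  cases k with
  | zero =>
    refine ⟨Measurable.ite (measurableSet_le hn measurable_const) hm measurable_const, B, fun x => ?_⟩
    simp only [BHT.lv]; split_ifs
    · exact hB x
    · simpa using hB0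
  | succ k =>
    refine ⟨Measurable.ite ((measurableSet_lt measurable_const hn).inter (measurableSet_le hn measurable_const)) hm measurable_const, B, fun x => ?_⟩
    simp only [BHT.lv]; split_ifs
    · exact hB x
    · simpa using hB0

lemma lv_one {r : ℝ} (hA : 0 < A) (hr : 1 < r) (k : ℕ) (x : ℝ) :
    ‖lv A f (k + 1) x‖ ≤ ‖f x‖ ^ r * (2 ^ k * A) ^ (1 - r) := by
  simp only [lv]
  split_ifs with h
  · have hc : 0 < (2:ℝ) ^ k * A := by positivity
    have hy : 0 < ‖f x‖ := hc.trans h.1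
    calc ‖f x‖ = ‖f x‖ ^ r * ‖f x‖ ^ (1 - r) := by rw [← Real.rpow_add hy]; simp
      _ ≤ _ := by
        apply mul_le_mul_of_nonneg_left _ (by positivity)
        exact Real.rpow_le_rpow_of_nonpos hc h.1.le (by linarith)
  · rw [norm_zero]; positivity

lemma lv_two {r : ℝ} (hA : 0 < A) (hr2 : r < 2) (k : ℕ) (x : ℝ) :
    ‖lv A f (k + 1) x‖ ^ 2 ≤ ‖f x‖ ^ r * (2 ^ (k + 1) * A) ^ (2 - r) := by
  simp only [lv]
  split_ifs with h
  · have hc : 0 < (2:ℝ) ^ k * A := by positivity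
    have hy : 0 < ‖f x‖ := hc.trans h.1
    calc ‖f x‖ ^ 2 = ‖f x‖ ^ r * ‖f x‖ ^ (2 - r) := by
          rw [← Real.rpow_add hy, ← Real.rpow_natCast]; congr 1; push_cast; ring
      _ ≤ _ := by
        gcongr
        exact h.2
  · rw [norm_zero, zero_pow two_ne_zero]; positivity

lemma BM.integrable_rpow (hf : BM f) {r : ℝ} (hr : 0 ≤ r) (J : DI) :
    Integrable (fun x => ‖f x‖ ^ r * ((dR J x) ^ 2)⁻¹) := by
  obtain ⟨hm, B, hB⟩ := hf
  have hi := (integrable_inv_dR_pow J (by norm_num : 1 ≤ 2)).const_mul (B ^ r)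
  refine hi.mono' ?_ ?_
  · have : Measurable fun x => ‖f x‖ ^ r := hm.norm.pow_const r
    exact (this.mul ((continuous_dR J).measurable.pow_const 2).inv).aestronglyMeasurable
  · filter_upwards with x
    have := dR_pos J x
    rw [Real.norm_of_nonneg (by positivity)]
    have := hB x
    gcongr

lemma lv_L1 (hf : BM f) {r : ℝ} (hA : 0 < A) (hr : 1 < r) (hr2 : r < 2) {J : DI}
    (hJ : ∫ x, ‖f x‖ ^ r * ((dR J x) ^ 2)⁻¹ ≤ A ^ r * dL J) (k : ℕ) :
    ∫ x, ‖lv A f k x‖ * ((dR J x) ^ 2)⁻¹ ≤ (4 * A * (2:ℝ) ^ (-(k:ℝ) * (r - 1))) * dL J := by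
  have hL := dL_pos J
  cases k with
  | zero =>
    calc _ ≤ ∫ x, A * ((dR J x) ^ 2)⁻¹ := by
          apply integral_mono (hf.lv 0 |>.integrable_inv J (by norm_num))
            ((integrable_inv_dR_pow J (by norm_num)).const_mul _)
          intro x
          have := dR_pos J x
          have h1 : ‖lv A f 0 x‖ ≤ A := by
            simp only [lv]; split_ifs with h
            · exact h
            · rw [norm_zero]; exact hA.le
          change _ * _ ≤ _ * _
          gcongr
      _ ≤ A * (dL J * π) := by
          rw [integral_const_mul]
          gcongr
          exact integral_inv_dR_pow_le J (by norm_num)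
      _ ≤ _ := by
          have := Real.pi_le_four
          simp
          have : A * dL J * π ≤ A * dL J * 4 := by gcongr
          linarith
  | succ k =>
    calc _ ≤ ∫ x, (2 ^ k * A) ^ (1 - r) * (‖f x‖ ^ r * ((dR J x) ^ 2)⁻¹) := by
          apply integral_mono (hf.lv (k+1) |>.integrable_inv J (by norm_num))
            ((hf.integrable_rpow (by linarith) J).const_mul _)
          intro x
          have := dR_pos J x
          have h1 := lv_one (f := f) hA hr k x
          change _ * _ ≤ _ * _
          rw [← mul_assoc, mul_comm ((2 ^ k * A) ^ (1 - r))]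
          gcongr
      _ ≤ (2 ^ k * A) ^ (1 - r) * (A ^ r * dL J) := by
          rw [integral_const_mul]; gcongr
      _ = (A * ((2:ℝ) ^ (1 - r)) ^ k) * dL J := by
          rw [Real.mul_rpow (by positivity) hA.le]
          have : A ^ (1 - r) * A ^ r = A := by rw [← Real.rpow_add hA]; simp
          have e2 : ((2:ℝ) ^ k) ^ (1 - r) = ((2:ℝ) ^ (1 - r)) ^ k := by
            rw [← Real.rpow_natCast, ← Real.rpow_natCast, ← Real.rpow_mul (by norm_num), ← Real.rpow_mul (by norm_num),
              mul_comm]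
          rw [e2]
          linear_combination (((2:ℝ) ^ (1 - r)) ^ k * dL J) * this
      _ ≤ _ := by
          apply mul_le_mul_of_nonneg_right _ hL.le
          have e1 : (2:ℝ) ^ (-((k + 1 : ℕ):ℝ) * (r - 1)) = ((2:ℝ) ^ (1 - r)) ^ k * (2:ℝ) ^ (1 - r) := by
            rw [← pow_succ, ← Real.rpow_natCast, ← Real.rpow_mul (by norm_num)]
            congr 1; push_cast; ring
          have e3 : (1/2 : ℝ) ≤ (2:ℝ) ^ (1 - r) := by
            calc (1/2 : ℝ) = (2:ℝ) ^ (-1 : ℝ) := by rw [Real.rpow_neg_one]; norm_num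
              _ ≤ _ := by
                apply Real.rpow_le_rpow_of_exponent_le (by norm_num); linarith
          rw [e1]
          have e4 : 0 < A * ((2:ℝ) ^ (1 - r)) ^ k := by positivity
          nlinarith

lemma lv_L2 (hf : BM f) {r : ℝ} (hA : 0 < A) (hr : 1 < r) (hr2 : r < 2) {J : DI}
    (hJ : ∫ x, ‖f x‖ ^ r * ((dR J x) ^ 2)⁻¹ ≤ A ^ r * dL J) (k : ℕ) :
    En (lv A f k) J ≤ (4 * A * (2:ℝ) ^ ((k:ℝ) * (1 - r / 2))) ^ 2 * dL J := by
  have hL := dL_pos J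
  unfold En
  have hintg : ∀ k, Integrable (fun x => ‖lv A f k x‖ ^ 2 * ((dR J x) ^ 2)⁻¹) := by
    intro k
    have := (hf.lv (A := A) k).integrable_rpow (r := 2) (by norm_num) J
    simpa using this
  cases k with
  | zero =>
    calc _ ≤ ∫ x, A ^ 2 * ((dR J x) ^ 2)⁻¹ := by
          apply integral_mono (hintg 0) ((integrable_inv_dR_pow J (by norm_num)).const_mul _)
          intro x
          have := dR_pos J x
          have h1 : ‖lv A f 0 x‖ ≤ A := by
            simp only [lv]; split_ifs with h
            · exact h
            · rw [norm_zero]; exact hA.le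
          change _ * _ ≤ _ * _
          gcongr
      _ ≤ A ^ 2 * (dL J * π) := by
          rw [integral_const_mul]
          gcongr
          exact integral_inv_dR_pow_le J (by norm_num)
      _ ≤ _ := by
          have := Real.pi_le_four
          simp
          have : A ^ 2 * dL J * π ≤ A ^ 2 * dL J * 4 := by gcongr
          have : 0 < A ^ 2 * dL J := by positivity
          nlinarith
  | succ k =>
    calc _ ≤ ∫ x, (2 ^ (k+1) * A) ^ (2 - r) * (‖f x‖ ^ r * ((dR J x) ^ 2)⁻¹) := by
          apply integral_mono (hintg (k+1)) ((hf.integrable_rpow (by linarith) J).const_mul _)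
          intro x
          have := dR_pos J x
          have h1 := lv_two (f := f) hA hr2 k x
          change _ * _ ≤ _ * _
          rw [← mul_assoc, mul_comm ((2 ^ (k+1) * A) ^ (2 - r))]
          gcongr
      _ ≤ (2 ^ (k+1) * A) ^ (2 - r) * (A ^ r * dL J) := by
          rw [integral_const_mul]; gcongr
      _ = (A ^ 2 * ((2:ℝ) ^ (k+1)) ^ (2 - r)) * dL J := by
          rw [Real.mul_rpow (by positivity) hA.le]
          have : A ^ (2 - r) * A ^ r = A ^ 2 := by
            rw [← Real.rpow_add hA, ← Real.rpow_natCast]; congr 1; push_cast; ring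
          linear_combination (((2:ℝ) ^ (k+1)) ^ (2 - r) * dL J) * this
      _ ≤ _ := by
          gcongr
          have e1 : ((2:ℝ) ^ (((k + 1 : ℕ):ℝ) * (1 - r / 2))) ^ 2 = ((2:ℝ) ^ (k+1)) ^ (2 - r) := by
            rw [← Real.rpow_natCast, ← Real.rpow_natCast, ← Real.rpow_mul (by norm_num), ← Real.rpow_mul (by norm_num)]
            congr 1; push_cast; ring
          rw [mul_pow, mul_pow, e1]
          have : 0 < A ^ 2 * ((2:ℝ) ^ (k+1)) ^ (2 - r) := by positivity
          linarith

end BHT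
end

section
namespace BHT

variable {φ : Fin 3 → Tile → ℝ → ℂ} {θ e : Fin 3 → ℝ} {b b0 K C0 : ℝ} {f : Fin 3 → ℝ → ℂ}
  {PP PP' : Finset Tile} {Q : DI}

noncomputable def DD (C0 : ℝ) : ℝ := 4 * (1 + √(Csz C0))

lemma DD_ge (C0 : ℝ) : 4 ≤ DD C0 := by
  unfold DD
  have := Real.sqrt_nonneg (Csz C0)
  linarith

lemma Csz_le (C0 : ℝ) : Csz C0 * 16 ≤ DD C0 ^ 2 := by
  unfold DD
  have h0 := Real.sqrt_nonneg (Csz C0)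
  rcases le_total 0 (Csz C0) with h | h
  · have := Real.sq_sqrt h
    nlinarith
  · nlinarith

lemma level_bound (hC : Cfg φ θ e b b0 K C0) (hf : ∀ i, BM (f i)) (hg : gap K b PP)
    (hQ : ∀ P ∈ PP, dS P.1 ⊆ dS Q) (hne : PP.Nonempty) {A t r : Fin 3 → ℝ} (hA : ∀ l, 0 < A l)
    (hr : ∀ l, 1 < r l) (hr2 : ∀ l, r l < 2)
    (ht : ∀ l, 0 ≤ t l) (ht1 : ∀ l, t l ≤ 1) (hτ : 2 < ∑ l, t l)
    (h : ∀ l, ∀ P ∈ PP, ∀ J, dS P.1 ⊆ dS J → dS J ⊆ dS Q →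
      ∫ x, ‖f l x‖ ^ r l * ((dR J x) ^ 2)⁻¹ ≤ A l ^ r l * dL J) (κ : Fin 3 → ℕ) :
    Lam φ (fun l => lv (A l) (f l) (κ l)) PP ≤ 12 * Cen C0 * cq (∑ l, t l) * dL Q *
      (2 * ∏ l, (DD C0 * A l * (2:ℝ) ^ (-((r l - 1) - t l * r l / 2) * (κ l : ℝ)))) := by
  classical
  have hD : 0 < DD C0 := by linarith [DD_ge C0]
  set A' : Fin 3 → ℝ := fun l => DD C0 * A l * (2:ℝ) ^ (-(κ l:ℝ) * (r l - 1)) with hA'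
  set B' : Fin 3 → ℝ := fun l => DD C0 * A l * (2:ℝ) ^ ((κ l:ℝ) * (1 - r l / 2)) with hB'
  have hA'0 : ∀ l, 0 < A' l := fun l => mul_pos (mul_pos hD (hA l)) (Real.rpow_pos_of_pos (by norm_num) _)
  have hB'0 : ∀ l, 0 < B' l := fun l => mul_pos (mul_pos hD (hA l)) (Real.rpow_pos_of_pos (by norm_num) _)
  have hS : ∀ l, Sz φ θ b (fun l => lv (A l) (f l) (κ l)) PP Q l (A' l) := by
    intro l i hi ξ J hJ
    obtain ⟨σ, hnum⟩ := hC.num i l hi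
    have hT : ∀ P ∈ PP.filter (inO (θ i) b ξ J), inO (θ i) b ξ J P := fun P hP => (Finset.mem_filter.1 hP).2
    have := size_tree hnum (hC.pk l) ((hf l).lv (A := A l) (κ l)) hT (hg.mono (Finset.filter_subset _ _))
      (A := 4 * A l * (2:ℝ) ^ (-(κ l:ℝ) * (r l - 1))) (by
        intro P hP I h1 h2
        exact lv_L1 (hf l) (hA l) (hr l) (hr2 l) (h l P (Finset.mem_filter.1 hP).1 I h1 (h2.trans hJ)) (κ l))
    refine this.trans ?_
    apply mul_le_mul_of_nonneg_right _ (dL_pos J).le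
    simp only [hA']
    have h1 := Csz_le C0
    have h2 : 0 ≤ (A l * (2:ℝ) ^ (-(κ l:ℝ) * (r l - 1))) ^ 2 := sq_nonneg _
    calc _ = Csz C0 * 16 * (A l * (2:ℝ) ^ (-(κ l:ℝ) * (r l - 1))) ^ 2 := by ring
      _ ≤ DD C0 ^ 2 * (A l * (2:ℝ) ^ (-(κ l:ℝ) * (r l - 1))) ^ 2 := by gcongr
      _ = _ := by ring
  obtain ⟨P0, hP0⟩ := hne
  have hE : ∀ l, En (lv (A l) (f l) (κ l)) Q ≤ B' l ^ 2 * dL Q := by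
    intro l
    refine (lv_L2 (hf l) (hA l) (hr l) (hr2 l) (h l P0 hP0 Q (hQ P0 hP0) subset_rfl) (κ l)).trans ?_
    apply mul_le_mul_of_nonneg_right _ (dL_pos Q).le
    have := hA l
    have := DD_ge C0
    simp only [hB']
    gcongr
  have main := star2 hC (fun l => (hf l).lv (A := A l) (κ l)) hg hQ hA'0 hB'0 ht ht1 hτ hS hE
  refine main.trans ?_
  have hCen := Cen_pos (hC.pk 0).C0pos
  have hcq := cq_pos hτ
  have hQ0 := dL_pos Q
  apply mul_le_mul_of_nonneg_left _ (by positivity)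
  rw [two_mul]
  apply add_le_add
  · apply Finset.prod_le_prod (fun l _ => (hA'0 l).le)
    intro l _
    simp only [hA']
    apply mul_le_mul_of_nonneg_left _ (mul_pos hD (hA l)).le
    apply Real.rpow_le_rpow_of_exponent_le (by norm_num)
    have h1 : 0 ≤ t l * r l / 2 * (κ l : ℝ) := by
      have := ht l; have := hr l; positivity
    nlinarith
  · apply le_of_eq
    apply Finset.prod_congr rfl
    intro l _
    have hW : 0 < DD C0 * A l := mul_pos hD (hA l)
    simp only [hA', hB']
    rw [Real.mul_rpow hW.le (by positivity), Real.mul_rpow hW.le (by positivity)]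
    rw [← Real.rpow_mul (by norm_num), ← Real.rpow_mul (by norm_num)]
    have e1 : (DD C0 * A l) ^ (1 - t l) * (DD C0 * A l) ^ (t l) = DD C0 * A l := by
      rw [← Real.rpow_add hW]; simp
    have e2 : (2:ℝ) ^ (-((r l - 1) - t l * r l / 2) * (κ l : ℝ)) =
        (2:ℝ) ^ (-(κ l:ℝ) * (r l - 1) * (1 - t l)) * (2:ℝ) ^ ((κ l:ℝ) * (1 - r l / 2) * t l) := by
      rw [← Real.rpow_add (by norm_num)]; congr 1; ring
    rw [e2]
    linear_combination ((2:ℝ) ^ (-(κ l:ℝ) * (r l - 1) * (1 - t l)) * (2:ℝ) ^ ((κ l:ℝ) * (1 - r l / 2) * t l)) * e1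

lemma Fc_sum_lv {φ : ℝ → ℂ} {f : ℝ → ℂ} {A : ℝ} (hA : 0 < A) {M : ℕ} (hM : ∀ x, ‖f x‖ ≤ 2 ^ M * A)
    (hi : ∀ k, Integrable fun x => lv A f k x * φ x) :
    ‖∫ x, f x * φ x‖ ≤ ∑ k ∈ Finset.range (M + 1), ‖∫ x, lv A f k x * φ x‖ := by
  have : ∫ x, f x * φ x = ∑ k ∈ Finset.range (M + 1), ∫ x, lv A f k x * φ x := by
    rw [← integral_finsetSum _ (fun k _ => hi k)]
    apply integral_congr_ae
    filter_upwards with x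
    rw [← Finset.sum_mul, sum_lv hA, if_pos (hM x)]
  rw [this]
  exact norm_sum_le _ _

lemma star {r : Fin 3 → ℝ} (hr : ∀ l, 1 < r l) (hr2 : ∀ l, r l < 2) (hrs : ∑ l, 1 / r l < 2) (C0 : ℝ) (hC0 : 0 < C0) :
    ∃ C : ℝ, 0 < C ∧ ∀ (φ : Fin 3 → Tile → ℝ → ℂ) (θ e : Fin 3 → ℝ) (b b0 K : ℝ) (f : Fin 3 → ℝ → ℂ)
      (PP : Finset Tile) (Q : DI) (A : Fin 3 → ℝ), Cfg φ θ e b b0 K C0 → (∀ i, BM (f i)) → gap K b PP →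
      (∀ P ∈ PP, dS P.1 ⊆ dS Q) → (∀ l, 0 < A l) →
      (∀ l, ∀ P ∈ PP, ∀ J, dS P.1 ⊆ dS J → dS J ⊆ dS Q →
        ∫ x, ‖f l x‖ ^ r l * ((dR J x) ^ 2)⁻¹ ≤ A l ^ r l * dL J) →
      Lam φ f PP ≤ C * dL Q * ∏ l, A l := by
  classical
  set m : Fin 3 → ℝ := fun l => 2 - 2 / r l with hm
  have hm0 : ∀ l, 0 < m l := fun l => by
    have := hr l
    have : 2 / r l < 2 := by rw [div_lt_iff₀ (by linarith)]; linarith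
    simp only [hm]; linarith
  have hm1 : ∀ l, m l ≤ 1 := fun l => by
    have := hr l; have := hr2 l
    have : 1 ≤ 2 / r l := by rw [le_div_iff₀ (by linarith)]; linarith
    simp only [hm]; linarith
  have hms : 2 < ∑ l, m l := by
    simp only [hm, Fin.sum_univ_three] at hrs ⊢
    have : ∀ l, 2 / r l = 2 * (1 / r l) := fun l => by ring
    rw [this, this, this]; linarith
  set Sm := ∑ l, m l with hSm
  set s : ℝ := (2 / Sm + 1) / 2 with hs
  have hq : 0 < 2 / Sm := by positivity
  have hq1 : 2 / Sm < 1 := by rw [div_lt_one (by linarith)]; exact hms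
  have hs0 : 0 < s := by rw [hs]; linarith
  have hs1 : s < 1 := by rw [hs]; linarith
  set t : Fin 3 → ℝ := fun l => s * m l with ht
  have ht0 : ∀ l, 0 ≤ t l := fun l => (mul_pos hs0 (hm0 l)).le
  have htm : ∀ l, t l < m l := fun l => by
    simp only [ht]; nlinarith [hm0 l]
  have hts : 2 < ∑ l, t l := by
    simp only [ht, ← Finset.mul_sum]
    rw [← hSm, hs]
    have : 2 / Sm * Sm = 2 := by field_simp
    nlinarith
  set ε : Fin 3 → ℝ := fun l => (r l - 1) - t l * r l / 2 with hε
  have hε0 : ∀ l, 0 < ε l := fun l => by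
    have h1 := htm l
    have h2 := hr l
    have : t l * r l < m l * r l := by gcongr
    have h3 : m l * r l = 2 * r l - 2 := by simp only [hm]; field_simp
    simp only [hε]; linarith
  set q : Fin 3 → ℝ := fun l => (2:ℝ) ^ (-ε l) with hqd
  have hq0 : ∀ l, 0 < q l := fun l => Real.rpow_pos_of_pos (by norm_num) _
  have hq1 : ∀ l, q l < 1 := fun l => Real.rpow_lt_one_of_one_lt_of_neg (by norm_num) (by linarith [hε0 l])
  have hCen := Cen_pos hC0
  have hcq := cq_pos hts
  have hD : 0 < DD C0 := by linarith [DD_ge C0]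
  have hqs : ∀ l, 0 < (1 - q l)⁻¹ := fun l => inv_pos.2 (by linarith [hq1 l])
  refine ⟨12 * Cen C0 * cq (∑ l, t l) * 2 * ∏ l, (DD C0 * (1 - q l)⁻¹), ?_, ?_⟩
  · have : 0 < ∏ l, (DD C0 * (1 - q l)⁻¹) := Finset.prod_pos fun l _ => mul_pos hD (hqs l)
    positivity
  intro φ θ e b b0 K f PP Q A hC hf hg hQ hA h
  have hL := dL_pos Q
  rcases PP.eq_empty_or_nonempty with rfl | hne
  · have h1 : 0 < ∏ l, (DD C0 * (1 - q l)⁻¹) := Finset.prod_pos fun l _ => mul_pos hD (hqs l)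
    have h2 : 0 < ∏ l, A l := Finset.prod_pos fun l _ => hA l
    simp only [Lam, Finset.sum_empty]
    positivity
  obtain ⟨M, hM⟩ : ∃ M : ℕ, ∀ l x, ‖f l x‖ ≤ 2 ^ M * A l := by
    choose hmeas B hB using hf
    obtain ⟨M, hM⟩ := pow_unbounded_of_one_lt (∑ l, B l / A l) (by norm_num : (1:ℝ) < 2)
    refine ⟨M, fun l x => ?_⟩
    rw [← div_le_iff₀ (hA l)]
    refine le_trans ?_ hM.le
    refine le_trans ?_ (Finset.single_le_sum (f := fun l => B l / A l)
      (fun l _ => div_nonneg ((norm_nonneg _).trans (hB l 0)) (hA l).le) (Finset.mem_univ l))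
    have := hA l
    have := hB l x
    gcongr
  have key : Lam φ f PP ≤ ∑ κ ∈ Fintype.piFinset (fun _ : Fin 3 => Finset.range (M + 1)),
      Lam φ (fun l => lv (A l) (f l) (κ l)) PP := by
    unfold Lam
    rw [Finset.sum_comm]
    apply Finset.sum_le_sum
    intro P hP
    rw [← Finset.mul_sum]
    apply mul_le_mul_of_nonneg_left _ (dL_pos _).le
    rw [← Finset.prod_univ_sum (fun _ : Fin 3 => Finset.range (M + 1))
      (fun l k => ‖Fc (φ l) (lv (A l) (f l) k) P‖)]
    apply Finset.prod_le_prod (fun l _ => norm_nonneg _)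
    intro l _
    exact Fc_sum_lv (hA l) (hM l) (fun k => integrable_mul_packet (hC.pk l) ((hf l).lv k) P)
  refine key.trans ?_
  calc _ ≤ ∑ κ ∈ Fintype.piFinset (fun _ : Fin 3 => Finset.range (M + 1)),
        12 * Cen C0 * cq (∑ l, t l) * dL Q * (2 * ∏ l, (DD C0 * A l * q l ^ κ l)) := by
        apply Finset.sum_le_sum
        intro κ _
        refine (level_bound hC hf hg hQ hne hA hr hr2 ht0 (fun l => (htm l).le.trans (hm1 l)) hts h κ).trans (le_of_eq ?_)
        congr 2
        apply Finset.prod_congr rfl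
        intro l _
        congr 1
        simp only [hqd, hε]
        rw [← Real.rpow_natCast, ← Real.rpow_mul (by norm_num)]
    _ = 12 * Cen C0 * cq (∑ l, t l) * dL Q * (2 * ∏ l, ∑ k ∈ Finset.range (M+1), (DD C0 * A l * q l ^ k)) := by
        rw [← Finset.mul_sum, Finset.prod_univ_sum]; congr 1; rw [Finset.mul_sum]
    _ ≤ 12 * Cen C0 * cq (∑ l, t l) * dL Q * (2 * ∏ l, (DD C0 * A l * (1 - q l)⁻¹)) := by
        apply mul_le_mul_of_nonneg_left _ (by positivity)
        apply mul_le_mul_of_nonneg_left _ (by norm_num)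
        apply Finset.prod_le_prod
        · intro l _
          apply Finset.sum_nonneg
          intro k _
          have := hA l; have := hq0 l
          positivity
        intro l _
        rw [← Finset.mul_sum]
        apply mul_le_mul_of_nonneg_left _ (mul_pos hD (hA l)).le
        rw [← tsum_geometric_of_lt_one (hq0 l).le (hq1 l)]
        exact (summable_geometric_of_lt_one (hq0 l).le (hq1 l)).sum_le_tsum _ (fun k _ => (pow_pos (hq0 l) k).le)
    _ = _ := by
        simp only [Fin.prod_univ_three]; ring

end BHT
end

section
namespace BHT

lemma dS_scale_le {J Q : DI} (h : dS J ⊆ dS Q) : J.1 ≤ Q.1 := dI_scale_le h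

lemma DI_ext {J Q : DI} (h1 : J.1 = Q.1) (h : dS J ⊆ dS Q) : J = Q := by
  obtain ⟨k, n⟩ := J
  obtain ⟨k', n'⟩ := Q
  simp only at h1
  subst h1
  rw [dI_eq_of_mem (h (left_mem k n)) (left_mem k n) |>.symm]

open Classical in
noncomputable def maxI (S : Finset DI) : Finset DI := S.filter fun Q => ∀ J ∈ S, dS Q ⊆ dS J → J = Q

lemma maxI_subset (S : Finset DI) : maxI S ⊆ S := by
  classical
  exact Finset.filter_subset _ _

lemma exists_maxI {S : Finset DI} {J : DI} (hJ : J ∈ S) : ∃ Q ∈ maxI S, dS J ⊆ dS Q := by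
  classical
  obtain ⟨Q, hQ, hmax⟩ := Finset.exists_max_image (S.filter fun Q => dS J ⊆ dS Q) (fun Q => Q.1)
    ⟨J, Finset.mem_filter.2 ⟨hJ, subset_rfl⟩⟩
  rw [Finset.mem_filter] at hQ
  refine ⟨Q, Finset.mem_filter.2 ⟨hQ.1, fun J' hJ' hs => ?_⟩, hQ.2⟩
  have h1 := hmax J' (Finset.mem_filter.2 ⟨hJ', hQ.2.trans hs⟩)
  exact (DI_ext (le_antisymm (dS_scale_le hs) h1) hs).symm

lemma maxI_disjoint {S : Finset DI} {Q Q' : DI} (hQ : Q ∈ maxI S) (hQ' : Q' ∈ maxI S) (hne : Q ≠ Q') :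
    Disjoint (dS Q) (dS Q') := by
  classical
  unfold maxI at hQ hQ'
  rw [Finset.mem_filter] at hQ hQ'
  rcases le_total Q.1 Q'.1 with h | h
  · rcases dI_subset_or_disjoint (n := Q.2) (n' := Q'.2) h with h1 | h1
    · exact absurd (hQ.2 Q' hQ'.1 h1).symm hne
    · exact h1
  · rcases dI_subset_or_disjoint (n := Q'.2) (n' := Q.2) h with h1 | h1
    · exact absurd (hQ'.2 Q hQ.1 h1) hne
    · exact h1.symm

/-- data of a grouping of dyadic intervals -/
structure Grp {ι : Type} (f : Fin 3 → ℝ → ℂ) (r : Fin 3 → ℝ) (G : DI → ι) (A : Fin 3 → ι → ℝ) (W : ℝ → ℝ≥0∞) : Prop where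
  conv : ∀ I J Q, dS I ⊆ dS J → dS J ⊆ dS Q → G I = G Q → G J = G Q
  pos : ∀ l m, 0 < A l m
  avg : ∀ l J, ∫ x, ‖f l x‖ ^ r l * ((dR J x) ^ 2)⁻¹ ≤ A l (G J) ^ r l * dL J
  sum : ∀ x, ∀ S : Finset ι, (∀ m ∈ S, ∃ J, G J = m ∧ x ∈ dS J) → ∑ m ∈ S, ENNReal.ofReal (∏ l, A l m) ≤ W x

lemma group_est {r : Fin 3 → ℝ} (hr : ∀ l, 1 < r l) (hr2 : ∀ l, r l < 2) (hrs : ∑ l, 1 / r l < 2) (C0 : ℝ) (hC0 : 0 < C0) :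
    ∃ C : ℝ, 0 < C ∧ ∀ (φ : Fin 3 → Tile → ℝ → ℂ) (θ e : Fin 3 → ℝ) (b b0 K : ℝ) (f : Fin 3 → ℝ → ℂ)
      (PP : Finset Tile) (ι : Type) (G : DI → ι) (A : Fin 3 → ι → ℝ) (W : ℝ → ℝ≥0∞),
      Cfg φ θ e b b0 K C0 → (∀ i, BM (f i)) → gap K b PP → Grp f r G A W →
      ENNReal.ofReal (Lam φ f PP) ≤ ENNReal.ofReal C * ∫⁻ x, W x := by
  classical
  obtain ⟨C, hC, hstar⟩ := star hr hr2 hrs C0 hC0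
  refine ⟨C, hC, ?_⟩
  intro φ θ e b b0 K f PP ι G A W hcfg hf hg hG
  set Pm : ι → Finset Tile := fun m => PP.filter fun P => G P.1 = m with hPm
  set D : ι → Finset DI := fun m => maxI ((Pm m).image fun P => P.1) with hD
  set S := PP.image fun P => G P.1 with hS
  have h0 : ∀ P : Tile, 0 ≤ dL P.1 * ∏ i, ‖Fc (φ i) (f i) P‖ := fun P =>
    mul_nonneg (dL_pos _).le (Finset.prod_nonneg fun _ _ => norm_nonneg _)
  have hGD : ∀ m, ∀ Q ∈ D m, G Q = m := by
    intro m Q hQ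
    obtain ⟨P, hP, rfl⟩ := Finset.mem_image.1 (maxI_subset _ hQ)
    exact (Finset.mem_filter.1 hP).2
  have hprod : ∀ m, 0 < ∏ l, A l m := fun m => Finset.prod_pos fun l _ => hG.pos l m
  have hmain : ∀ m, Lam φ f (Pm m) ≤ ∑ Q ∈ D m, C * dL Q * ∏ l, A l m := by
    intro m
    calc Lam φ f (Pm m) ≤ ∑ P ∈ (D m).biUnion (fun Q => (Pm m).filter fun P => dS P.1 ⊆ dS Q),
          dL P.1 * ∏ i, ‖Fc (φ i) (f i) P‖ := by
          apply Finset.sum_le_sum_of_subset_of_nonneg _ (fun P _ _ => h0 P)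
          intro P hP
          obtain ⟨Q, hQ, hs⟩ := exists_maxI (Finset.mem_image_of_mem (fun P : Tile => P.1) hP)
          exact Finset.mem_biUnion.2 ⟨Q, hQ, Finset.mem_filter.2 ⟨hP, hs⟩⟩
      _ ≤ ∑ Q ∈ D m, ∑ P ∈ (Pm m).filter (fun P => dS P.1 ⊆ dS Q), dL P.1 * ∏ i, ‖Fc (φ i) (f i) P‖ :=
          sum_biUnion_le' _ _ _ h0
      _ ≤ _ := by
          apply Finset.sum_le_sum
          intro Q hQ
          apply hstar φ θ e b b0 K f _ Q (fun l => A l m) hcfg hf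
            (hg.mono ((Finset.filter_subset _ _).trans (Finset.filter_subset _ _)))
            (fun P hP => (Finset.mem_filter.1 hP).2) (fun l => hG.pos l m)
          intro l P hP J h1 h2
          have h3 : G P.1 = m := (Finset.mem_filter.1 (Finset.mem_filter.1 hP).1).2
          have h4 : G J = m := by rw [hG.conv P.1 J Q h1 h2 (h3.trans (hGD m Q hQ).symm), hGD m Q hQ]
          have := hG.avg l J
          rwa [h4] at this
  have hLam : Lam φ f PP = ∑ m ∈ S, Lam φ f (Pm m) :=
    (Finset.sum_fiberwise_of_maps_to (fun P hP => Finset.mem_image_of_mem (fun P : Tile => G P.1) hP) _).symm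
  calc ENNReal.ofReal (Lam φ f PP) ≤ ENNReal.ofReal (∑ m ∈ S, ∑ Q ∈ D m, C * dL Q * ∏ l, A l m) := by
        apply ENNReal.ofReal_le_ofReal
        rw [hLam]
        exact Finset.sum_le_sum fun m _ => hmain m
    _ = ∑ m ∈ S, ∑ Q ∈ D m, ENNReal.ofReal C * (ENNReal.ofReal (∏ l, A l m) * volume (dS Q)) := by
        rw [ENNReal.ofReal_sum_of_nonneg]
        · apply Finset.sum_congr rfl
          intro m _
          rw [ENNReal.ofReal_sum_of_nonneg]
          · apply Finset.sum_congr rfl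
            intro Q _
            have := dL_pos Q
            have := hprod m
            rw [volume_dS, ENNReal.ofReal_mul (by positivity), ENNReal.ofReal_mul hC.le]
            ring
          · intro Q _
            have := dL_pos Q
            have := hprod m
            positivity
        · intro m _
          apply Finset.sum_nonneg
          intro Q _
          have := dL_pos Q
          have := hprod m
          positivity
    _ = ENNReal.ofReal C * ∑ m ∈ S, ∑ Q ∈ D m, ∫⁻ x, (dS Q).indicator (fun _ => ENNReal.ofReal (∏ l, A l m)) x := by
        rw [Finset.mul_sum]
        apply Finset.sum_congr rfl
        intro m _
        rw [Finset.mul_sum]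
        apply Finset.sum_congr rfl
        intro Q _
        rw [lintegral_indicator_const (measurableSet_dS Q)]
    _ = ENNReal.ofReal C * ∫⁻ x, ∑ m ∈ S, ∑ Q ∈ D m, (dS Q).indicator (fun _ => ENNReal.ofReal (∏ l, A l m)) x := by
        rw [lintegral_finsetSum]
        · congr 1
          apply Finset.sum_congr rfl
          intro m _
          rw [lintegral_finsetSum]
          intro Q _
          exact measurable_const.indicator (measurableSet_dS Q)
        · intro m _
          apply Finset.measurable_sum
          intro Q _
          exact measurable_const.indicator (measurableSet_dS Q)
    _ ≤ _ := by
        gcongr with x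
        have hx := hG.sum x (S.filter fun m => ∃ Q ∈ D m, x ∈ dS Q) (by
          intro m hm
          obtain ⟨Q, hQ, hxQ⟩ := (Finset.mem_filter.1 hm).2
          exact ⟨Q, hGD m Q hQ, hxQ⟩)
        refine le_trans ?_ hx
        rw [Finset.sum_filter]
        apply Finset.sum_le_sum
        intro m _
        split_ifs with h
        · obtain ⟨Q, hQ, hxQ⟩ := h
          rw [Finset.sum_eq_single_of_mem Q hQ]
          · exact Set.indicator_le_self _ _ x
          · intro Q' hQ' hne
            apply Set.indicator_of_notMem
            intro hx'
            exact Set.disjoint_left.1 (maxI_disjoint hQ' hQ hne) hx' hxQ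
        · apply le_of_eq
          apply Finset.sum_eq_zero
          intro Q hQ
          apply Set.indicator_of_notMem
          intro hx'
          exact h ⟨Q, hQ, hx'⟩

lemma group_all {r : Fin 3 → ℝ} (hr : ∀ l, 1 < r l) (hr2 : ∀ l, r l < 2) (hrs : ∑ l, 1 / r l < 2) (C0 : ℝ) (hC0 : 0 < C0)
    (b K : ℝ) (hb : 0 < b) :
    ∃ C : ℝ, 0 < C ∧ ∀ (φ : Fin 3 → Tile → ℝ → ℂ) (θ e : Fin 3 → ℝ) (b0 : ℝ) (f : Fin 3 → ℝ → ℂ)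
      (ι : Type) (G : DI → ι) (A : Fin 3 → ι → ℝ) (W : ℝ → ℝ≥0∞),
      Cfg φ θ e b b0 K C0 → (∀ i, BM (f i)) → Grp f r G A W →
      ∑' P : Tile, ENNReal.ofReal (dL P.1 * ∏ i, ‖Fc (φ i) (f i) P‖) ≤ ENNReal.ofReal C * ∫⁻ x, W x := by
  classical
  obtain ⟨C, hC, hest⟩ := group_est hr hr2 hrs C0 hC0
  obtain ⟨N, hN⟩ := pow_unbounded_of_one_lt (4 * K / b) (by norm_num : (1:ℝ) < 2)
  have hN1 : 0 < (N + 1 : ℕ) := Nat.succ_pos N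
  refine ⟨(N + 1 : ℕ) * C, by positivity, ?_⟩
  intro φ θ e b0 f ι G A W hcfg hf hG
  rw [ENNReal.tsum_eq_iSup_sum]
  apply iSup_le
  intro T
  have h0 : ∀ P : Tile, 0 ≤ dL P.1 * ∏ i, ‖Fc (φ i) (f i) P‖ := fun P =>
    mul_nonneg (dL_pos _).le (Finset.prod_nonneg fun _ _ => norm_nonneg _)
  set c : Tile → ℕ := fun P => (P.1.1 % ((N + 1 : ℕ) : ℤ)).toNat with hc
  have hcz : ∀ P : Tile, ((c P : ℕ) : ℤ) = P.1.1 % ((N + 1 : ℕ) : ℤ) := fun P =>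
    Int.toNat_of_nonneg (Int.emod_nonneg _ (by omega))
  have hcl : ∀ P ∈ T, c P ∈ Finset.range (N + 1) := by
    intro P _
    have h1 := Int.emod_lt_of_pos P.1.1 (b := ((N + 1 : ℕ) : ℤ)) (by omega)
    have h2 := hcz P
    rw [Finset.mem_range]; omega
  rw [← Finset.sum_fiberwise_of_maps_to hcl]
  calc _ ≤ ∑ j ∈ Finset.range (N + 1), ENNReal.ofReal C * ∫⁻ x, W x := by
        apply Finset.sum_le_sum
        intro j _
        have := hest φ θ e b b0 K f (T.filter fun P => c P = j) ι G A W hcfg hf (by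
          intro P hP P' hP' hlt
          have h1 := (Finset.mem_filter.1 hP).2
          have h2 := (Finset.mem_filter.1 hP').2
          have h3 := hcz P
          have h4 := hcz P'
          rw [h1] at h3
          rw [h2] at h4
          have h5 : P.1.1 + N ≤ P'.1.1 := by
            have h6 : ((N + 1 : ℕ) : ℤ) ∣ P'.1.1 - P.1.1 :=
              Int.ModEq.dvd (show P.1.1 ≡ P'.1.1 [ZMOD ((N+1:ℕ):ℤ)] from h3.symm.trans h4)
            have := Int.le_of_dvd (by omega) h6
            push_cast at this
            omega
          have h6 : len P.1.1 * 2 ^ N ≤ dL P'.1 := by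
            rw [← len_nat, ← len_add]; exact len_mono h5
          have h7 := len_pos P.1.1
          have h8 : 4 * K ≤ b * 2 ^ N := by
            rw [div_lt_iff₀ hb] at hN; linarith
          calc 4 * K * dL P.1 ≤ b * 2 ^ N * dL P.1 := mul_le_mul_of_nonneg_right h8 h7.le
            _ = b * (len P.1.1 * 2 ^ N) := by unfold dL; ring
            _ ≤ _ := mul_le_mul_of_nonneg_left h6 hb.le) hG
        refine le_trans (le_of_eq ?_) this
        unfold Lam
        rw [ENNReal.ofReal_sum_of_nonneg (fun P _ => h0 P)]
    _ = _ := by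
        rw [Finset.sum_const, Finset.card_range, nsmul_eq_mul, ENNReal.ofReal_mul (by positivity), mul_assoc,
          ENNReal.ofReal_natCast]

end BHT
end

section
namespace BHT

/-- weighted average -/
noncomputable def X (f : ℝ → ℂ) (r c R : ℝ) : ℝ := R⁻¹ * ∫ x, ‖f x‖ ^ r * ((rho c R x) ^ 2)⁻¹

/-- maximal function -/
noncomputable def MX (f : ℝ → ℂ) (r x : ℝ) : ℝ≥0∞ := ⨆ (c : ℝ) (R : ℝ) (_ : |x - c| < R), ENNReal.ofReal (X f r c R)

noncomputable def Y (f : ℝ → ℂ) (r : ℝ) (J : DI) : ℝ≥0∞ :=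
  ⨆ (c : ℝ) (R : ℝ) (_ : ∀ x ∈ dS J, |x - c| < R), ENNReal.ofReal (X f r c R)

variable {f : ℝ → ℂ} {r : ℝ}

lemma integrable_X (hf : BM f) (hr : 0 ≤ r) (c : ℝ) {R : ℝ} (hR : 0 < R) :
    Integrable (fun x => ‖f x‖ ^ r * ((rho c R x) ^ 2)⁻¹) := by
  obtain ⟨hm, B, hB⟩ := hf
  have hi := (integrable_inv_rho_pow c hR (by norm_num : 1 ≤ 2)).const_mul (B ^ r)
  refine hi.mono' ?_ ?_
  · have : Measurable fun x => ‖f x‖ ^ r := hm.norm.pow_const r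
    exact (this.mul ((continuous_rho c R).measurable.pow_const 2).inv).aestronglyMeasurable
  · filter_upwards with x
    have := rho_pos c R x
    rw [Real.norm_of_nonneg (by positivity)]
    have := hB x
    gcongr

lemma X_nonneg (c : ℝ) {R : ℝ} (hR : 0 < R) : 0 ≤ X f r c R := by
  unfold X
  apply mul_nonneg (inv_pos.2 hR).le
  apply integral_nonneg
  intro x
  have := rho_pos c R x
  change 0 ≤ _ * _
  positivity

lemma X_le {B : ℝ} (hf : BM f) (hB : ∀ x, ‖f x‖ ≤ B) (hr : 0 ≤ r) (c : ℝ) {R : ℝ} (hR : 0 < R) : X f r c R ≤ B ^ r * π := by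
  unfold X
  have hB0 : 0 ≤ B := (norm_nonneg _).trans (hB 0)
  rw [inv_mul_le_iff₀ hR]
  calc _ ≤ ∫ x, B ^ r * ((rho c R x) ^ 2)⁻¹ := by
        apply integral_mono (integrable_X hf hr c hR) ((integrable_inv_rho_pow c hR (by norm_num)).const_mul _)
        intro x
        have := rho_pos c R x
        have := hB x
        change _ * _ ≤ _ * _
        gcongr
    _ ≤ B ^ r * (R * π) := by
        rw [integral_const_mul]
        gcongr
        exact integral_inv_rho_pow_le c hR (by norm_num)
    _ = _ := by ring

lemma X_mono_scale (hf : BM f) (hr : 0 ≤ r) (c : ℝ) {R w : ℝ} (hR : 0 < R) (hw : 1 ≤ w) :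
    X f r c R ≤ w * X f r c (R * w) := by
  have hRw : 0 < R * w := by positivity
  unfold X
  have h1 : ∫ x, ‖f x‖ ^ r * ((rho c R x) ^ 2)⁻¹ ≤ ∫ x, ‖f x‖ ^ r * ((rho c (R * w) x) ^ 2)⁻¹ := by
    apply integral_mono (integrable_X hf hr c hR) (integrable_X hf hr c hRw)
    intro x
    have h2 : rho c (R * w) x ≤ rho c R x := by
      unfold rho
      rw [div_pow, div_pow, mul_pow]
      have : R ^ 2 ≤ R ^ 2 * w ^ 2 := by nlinarith [sq_nonneg R, one_le_pow₀ (n := 2) hw]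
      have h3 : (x - c) ^ 2 / (R ^ 2 * w ^ 2) ≤ (x - c) ^ 2 / R ^ 2 := by gcongr
      linarith
    have := rho_pos c (R * w) x
    change _ * _ ≤ _ * _
    gcongr
  calc _ ≤ R⁻¹ * ∫ x, ‖f x‖ ^ r * ((rho c (R * w) x) ^ 2)⁻¹ := by gcongr
    _ = _ := by field_simp

lemma le_MX {c R x : ℝ} (h : |x - c| < R) : ENNReal.ofReal (X f r c R) ≤ MX f r x := by
  unfold MX
  exact le_iSup_of_le c (le_iSup_of_le R (le_iSup_of_le h le_rfl))

lemma le_Y {c R : ℝ} {J : DI} (h : ∀ x ∈ dS J, |x - c| < R) : ENNReal.ofReal (X f r c R) ≤ Y f r J := by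
  unfold Y
  exact le_iSup_of_le c (le_iSup_of_le R (le_iSup_of_le h le_rfl))

lemma Y_le_MX {J : DI} {x : ℝ} (hx : x ∈ dS J) : Y f r J ≤ MX f r x := by
  unfold Y
  exact iSup_le fun c => iSup_le fun R => iSup_le fun h => le_MX (h x hx)

lemma Y_anti {I J : DI} (h : dS I ⊆ dS J) : Y f r J ≤ Y f r I := by
  unfold Y
  exact iSup_le fun c => iSup_le fun R => iSup_le fun h' => le_Y fun x hx => h' x (h hx)

lemma measurable_MX : Measurable (MX f r) := by
  apply LowerSemicontinuous.measurable
  unfold MX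
  apply lowerSemicontinuous_iSup; intro c
  apply lowerSemicontinuous_iSup; intro R
  intro x y hy
  by_cases h : |x - c| < R
  · have h1 : ∀ᶠ x' in nhds x, |x' - c| < R :=
      (isOpen_lt (by fun_prop : Continuous fun x' : ℝ => |x' - c|) continuous_const).mem_nhds h
    filter_upwards [h1] with x' hx'
    simpa [h, hx'] using hy
  · simp [h] at hy

lemma dS_lt {J : DI} {x : ℝ} (hx : x ∈ dS J) : |x - dC J| < dL J := by
  have := abs_sub_cen_le hx
  have h2 := dL_pos J
  unfold dC dL at *
  linarith

lemma MX_lt_top (hf : BM f) (hr : 0 ≤ r) (x : ℝ) : MX f r x < ∞ := by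
  obtain ⟨B, hB⟩ := hf.2
  apply lt_of_le_of_lt _ (ENNReal.ofReal_lt_top (r := B ^ r * π))
  unfold MX
  refine iSup_le fun c => iSup_le fun R => iSup_le fun h => ENNReal.ofReal_le_ofReal ?_
  exact X_le hf hB hr c ((abs_nonneg _).trans_lt h)

lemma dC_mem (J : DI) : dC J ∈ dS J := cen_mem _ _

lemma Y_lt_top (hf : BM f) (hr : 0 ≤ r) (J : DI) : Y f r J < ∞ :=
  (Y_le_MX (dC_mem J)).trans_lt (MX_lt_top hf hr _)

lemma Y_avg (hf : BM f) (hr : 0 ≤ r) (J : DI) :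
    ∫ x, ‖f x‖ ^ r * ((dR J x) ^ 2)⁻¹ ≤ (Y f r J).toReal * dL J := by
  have hL := dL_pos J
  have h1 : ENNReal.ofReal (X f r (dC J) (dL J)) ≤ Y f r J := le_Y fun x hx => dS_lt hx
  have h2 := (ENNReal.ofReal_le_iff_le_toReal (Y_lt_top hf hr J).ne).1 h1
  unfold X at h2
  rw [inv_mul_le_iff₀ hL] at h2
  rw [mul_comm]
  exact h2

lemma Y_pos (hf : BM f) (hr : 0 < r) (hne : ¬ f =ᵐ[volume] 0) (J : DI) : 0 < (Y f r J).toReal := by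
  have hL := dL_pos J
  by_contra hcon
  have h1 := Y_avg hf hr.le J
  have h2 : ∫ x, ‖f x‖ ^ r * ((dR J x) ^ 2)⁻¹ = 0 := by
    apply le_antisymm
    · exact h1.trans (mul_nonpos_of_nonpos_of_nonneg (not_lt.1 hcon) hL.le)
    · apply integral_nonneg
      intro x
      have := dR_pos J x
      change 0 ≤ _ * _
      positivity
  rw [integral_eq_zero_iff_of_nonneg] at h2
  · apply hne
    filter_upwards [h2] with x hx
    have h3 := dR_pos J x
    simp only [Pi.zero_apply, mul_eq_zero, inv_eq_zero, pow_eq_zero_iff two_ne_zero, h3.ne', or_false] at hx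
    rw [Real.rpow_eq_zero (norm_nonneg _) hr.ne'] at hx
    simpa using hx
  · intro x
    have := dR_pos J x
    change 0 ≤ _ * _
    positivity
  · exact hf.integrable_rpow hr.le J

lemma Y_le_dR (hf : BM f) (hr : 0 ≤ r) (J : DI) (x : ℝ) :
    (Y f r J).toReal ≤ √(5 * dR J x) * (MX f r x).toReal := by
  have hL := dL_pos J
  have hs : 0 ≤ √(5 * dR J x) := Real.sqrt_nonneg _
  rw [← ENNReal.toReal_ofReal hs, ← ENNReal.toReal_mul]
  apply ENNReal.toReal_mono (ENNReal.mul_ne_top ENNReal.ofReal_ne_top (MX_lt_top hf hr x).ne)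
  unfold Y
  refine iSup_le fun c => iSup_le fun R => iSup_le fun h => ?_
  have hc := h _ (dC_mem J)
  have hR : 0 < R := (abs_nonneg _).trans_lt hc
  set ζ := |x - dC J| / dL J with hζ
  have hζ0 : 0 ≤ ζ := by positivity
  have hLR : dL J ≤ 2 * R := by
    by_contra hcon
    push Not at hcon
    have hd1 : dC J - dL J / 2 ∈ dS J := by
      have : dC J - dL J / 2 = len J.1 * J.2 := by unfold dC dL cen; ring
      rw [this]; exact left_mem _ _
    have hd2 : dC J - dL J / 2 + (dL J + 2 * R) / 2 ∈ dS J := by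
      have : dC J - dL J / 2 = len J.1 * J.2 := by unfold dC dL cen; ring
      rw [this]
      unfold dS dI
      constructor
      · linarith
      · have : len J.1 * (J.2 + 1) = len J.1 * J.2 + dL J := by unfold dL; ring
        linarith
    have h1 := h _ hd1
    have h2 := h _ hd2
    rw [abs_lt] at h1 h2
    linarith [h1.1, h2.2]
  have hx : |x - c| < R * (1 + 2 * ζ) := by
    have h1 : |x - c| ≤ |x - dC J| + |dC J - c| := abs_sub_le _ _ _
    have h2 : |x - dC J| = ζ * dL J := by rw [hζ]; field_simp
    have h3 : ζ * dL J ≤ ζ * (2 * R) := by gcongr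
    linarith
  have hw : 1 ≤ 1 + 2 * ζ := by linarith
  have hw5 : 1 + 2 * ζ ≤ √(5 * dR J x) := by
    apply Real.le_sqrt_of_sq_le
    have : dR J x = 1 + ζ ^ 2 := by
      rw [dR_eq, hζ, div_pow, sq_abs, ← div_pow]; rfl
    rw [this]
    nlinarith [sq_nonneg (ζ - 2)]
  calc ENNReal.ofReal (X f r c R) ≤ ENNReal.ofReal (√(5 * dR J x) * X f r c (R * (1 + 2 * ζ))) := by
        apply ENNReal.ofReal_le_ofReal
        refine (X_mono_scale hf hr c hR hw).trans ?_
        have := X_nonneg (f := f) (r := r) c (R := R * (1 + 2 * ζ)) (by positivity)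
        gcongr
    _ ≤ _ := by
        rw [ENNReal.ofReal_mul hs]
        gcongr
        exact le_MX hx

/-! real valued versions -/
noncomputable def Zr (f : ℝ → ℂ) (r : ℝ) (J : DI) : ℝ := (Y f r J).toReal ^ (1 / r)
noncomputable def Mr (f : ℝ → ℂ) (r x : ℝ) : ℝ := (MX f r x).toReal ^ (1 / r)

lemma Mr_nonneg (x : ℝ) : 0 ≤ Mr f r x := Real.rpow_nonneg ENNReal.toReal_nonneg _

lemma measurable_Mr : Measurable (Mr f r) := measurable_MX.ennreal_toReal.pow_const _

lemma Zr_pos (hf : BM f) (hr : 0 < r) (hne : ¬ f =ᵐ[volume] 0) (J : DI) : 0 < Zr f r J :=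
  Real.rpow_pos_of_pos (Y_pos hf hr hne J) _

lemma Zr_anti (hf : BM f) (hr : 0 ≤ r) {I J : DI} (h : dS I ⊆ dS J) : Zr f r J ≤ Zr f r I :=
  Real.rpow_le_rpow ENNReal.toReal_nonneg (ENNReal.toReal_mono (Y_lt_top hf hr I).ne (Y_anti h)) (by positivity)

lemma Zr_le_Mr (hf : BM f) (hr : 0 ≤ r) {J : DI} {x : ℝ} (hx : x ∈ dS J) : Zr f r J ≤ Mr f r x :=
  Real.rpow_le_rpow ENNReal.toReal_nonneg (ENNReal.toReal_mono (MX_lt_top hf hr x).ne (Y_le_MX hx)) (by positivity)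

lemma Zr_avg (hf : BM f) (hr : 0 < r) (J : DI) :
    ∫ x, ‖f x‖ ^ r * ((dR J x) ^ 2)⁻¹ ≤ Zr f r J ^ r * dL J := by
  have := Y_avg hf hr.le J
  unfold Zr
  rwa [← Real.rpow_mul ENNReal.toReal_nonneg, one_div, inv_mul_cancel₀ hr.ne', Real.rpow_one]

lemma Zr_le_dR (hf : BM f) (hr : 0 < r) (J : DI) (x : ℝ) :
    Zr f r J ≤ (5 * dR J x) ^ (1 / (2 * r)) * Mr f r x := by
  have hd := dR_pos J x
  unfold Zr Mr
  calc _ ≤ (√(5 * dR J x) * (MX f r x).toReal) ^ (1 / r) :=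
        Real.rpow_le_rpow ENNReal.toReal_nonneg (Y_le_dR hf hr.le J x) (by positivity)
    _ = _ := by
        rw [Real.mul_rpow (Real.sqrt_nonneg _) ENNReal.toReal_nonneg, Real.sqrt_eq_rpow, ← Real.rpow_mul (by positivity)]
        congr 2
        field_simp

lemma Mr_pos (hf : BM f) (hr : 0 < r) (hne : ¬ f =ᵐ[volume] 0) (x : ℝ) : 0 < Mr f r x := by
  have h1 := Zr_le_dR hf hr (0, 0) x
  have h2 := Zr_pos hf hr hne (0, 0)
  have hd := dR_pos (0, 0) x
  have h3 : 0 < (5 * dR (0, 0) x) ^ (1 / (2 * r)) := Real.rpow_pos_of_pos (by positivity) _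
  by_contra hcon
  nlinarith [not_lt.1 hcon]

/-! labels -/
noncomputable def lab (z : ℝ) : ℤ := ⌈Real.logb 2 z⌉

lemma len_rpow (m : ℤ) : len m = (2:ℝ) ^ (m:ℝ) := by
  unfold len; rw [Real.rpow_intCast]

lemma le_len_lab {z : ℝ} (hz : 0 < z) : z ≤ len (lab z) := by
  rw [len_rpow, ← Real.logb_le_iff_le_rpow (by norm_num) hz]
  exact Int.le_ceil _

lemma len_lab_lt {z : ℝ} (hz : 0 < z) : len (lab z - 1) < z := by
  rw [len_rpow, ← Real.lt_logb_iff_rpow_lt (by norm_num) hz]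
  have := Int.ceil_lt_add_one (Real.logb 2 z)
  push_cast
  unfold lab
  linarith

lemma lab_mono {z w : ℝ} (hz : 0 < z) (h : z ≤ w) : lab z ≤ lab w := by
  unfold lab
  exact Int.ceil_mono (Real.logb_le_logb_of_le (by norm_num) hz h)

noncomputable def cp (q : ℝ) : ℝ := 2 ^ q * (1 - 2 ^ (-q))⁻¹

lemma cp_pos {q : ℝ} (hq : 0 < q) : 0 < cp q := by
  unfold cp
  have : (2:ℝ) ^ (-q) < 1 := Real.rpow_lt_one_of_one_lt_of_neg (by norm_num) (by linarith)
  have : 0 < (1 - (2:ℝ) ^ (-q))⁻¹ := inv_pos.2 (by linarith)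
  positivity

lemma sum_len_rpow {q M : ℝ} (hq : 0 < q) (hM : 0 ≤ M) (S : Finset ℤ) (hS : ∀ m ∈ S, len (m - 1) ≤ M) :
    ∑ m ∈ S, len m ^ q ≤ cp q * M ^ q := by
  rcases S.eq_empty_or_nonempty with rfl | hne
  · have := cp_pos hq
    simp; positivity
  obtain ⟨m0, hm0, hmax⟩ := S.exists_max_image id hne
  have hq1 : (2:ℝ) ^ (-q) < 1 := Real.rpow_lt_one_of_one_lt_of_neg (by norm_num) (by linarith)
  have hq0 : 0 < (2:ℝ) ^ (-q) := by positivity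
  have e1 : ∀ m ∈ S, len m ^ q = len m0 ^ q * ((2:ℝ) ^ (-q)) ^ (m0 - m).toNat := by
    intro m hm
    have h1 : m ≤ m0 := hmax m hm
    have h2 : (((m0 - m).toNat : ℕ) : ℤ) = m0 - m := Int.toNat_of_nonneg (by omega)
    have h3 : (((m0 - m).toNat : ℕ) : ℝ) = (m0:ℝ) - m := by exact_mod_cast h2
    rw [len_rpow, len_rpow, ← Real.rpow_natCast, ← Real.rpow_mul (by norm_num), ← Real.rpow_mul (by norm_num),
      ← Real.rpow_mul (by norm_num), ← Real.rpow_add (by norm_num), h3]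
    congr 1; ring
  rw [Finset.sum_congr rfl e1, ← Finset.mul_sum]
  have h1 : ∑ m ∈ S, ((2:ℝ) ^ (-q)) ^ (m0 - m).toNat ≤ (1 - 2 ^ (-q))⁻¹ := by
    rw [← tsum_geometric_of_lt_one hq0.le hq1]
    rw [← Finset.sum_image (s := S) (g := fun m => (m0 - m).toNat) (f := fun n => ((2:ℝ) ^ (-q)) ^ n)]
    · exact (summable_geometric_of_lt_one hq0.le hq1).sum_le_tsum _ (fun k _ => (pow_pos hq0 k).le)
    · intro a ha b hb hab
      have h1 : a ≤ m0 := hmax a ha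
      have h2 : b ≤ m0 := hmax b hb
      simp only at hab
      omega
  have h2 : len m0 ≤ 2 * M := by
    have h3 := hS m0 hm0
    have h4 : len m0 = 2 * len (m0 - 1) := by rw [← len_succ]; congr 1; ring
    linarith
  have hl := len_pos m0
  calc len m0 ^ q * ∑ m ∈ S, ((2:ℝ) ^ (-q)) ^ (m0 - m).toNat ≤ (2 * M) ^ q * (1 - 2 ^ (-q))⁻¹ := by
        gcongr
    _ = _ := by
        rw [Real.mul_rpow (by norm_num) hM]
        unfold cp; ring

end BHT
end

section
namespace BHT

lemma lab_conv {f : ℝ → ℂ} {r : ℝ} (hf : BM f) (hr : 0 < r) (hne : ¬ f =ᵐ[volume] 0) {I J Q : DI} (h1 : dS I ⊆ dS J)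
    (h2 : dS J ⊆ dS Q) (h : lab (Zr f r I) = lab (Zr f r Q)) : lab (Zr f r J) = lab (Zr f r Q) := by
  apply le_antisymm
  · rw [← h]; exact lab_mono (Zr_pos hf hr hne J) (Zr_anti hf hr.le h1)
  · exact lab_mono (Zr_pos hf hr hne Q) (Zr_anti hf hr.le h2)

lemma lab_avg {f : ℝ → ℂ} {r : ℝ} (hf : BM f) (hr : 0 < r) (hne : ¬ f =ᵐ[volume] 0) (J : DI) :
    ∫ x, ‖f x‖ ^ r * ((dR J x) ^ 2)⁻¹ ≤ len (lab (Zr f r J)) ^ r * dL J := by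
  refine (Zr_avg hf hr J).trans ?_
  have h1 := Zr_pos hf hr hne J
  have h2 := le_len_lab h1
  have := dL_pos J
  gcongr

lemma lab_Mr {f : ℝ → ℂ} {r : ℝ} (hf : BM f) (hr : 0 < r) (hne : ¬ f =ᵐ[volume] 0) {J : DI} {x : ℝ} (hx : x ∈ dS J) :
    len (lab (Zr f r J) - 1) ≤ Mr f r x :=
  (len_lab_lt (Zr_pos hf hr hne J)).le.trans (Zr_le_Mr hf hr.le hx)

lemma grp_big {f : Fin 3 → ℝ → ℂ} {r : Fin 3 → ℝ} (hf : ∀ l, BM (f l)) (hr : ∀ l, 0 < r l)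
    (hne : ∀ l, ¬ f l =ᵐ[volume] 0) :
    Grp f r (fun J l => lab (Zr (f l) (r l) J)) (fun l (m : Fin 3 → ℤ) => len (m l))
      (fun x => ENNReal.ofReal (∏ l, (cp 1 * Mr (f l) (r l) x))) where
  conv := by
    intro I J Q h1 h2 h
    funext l
    exact lab_conv (hf l) (hr l) (hne l) h1 h2 (congrFun h l)
  pos := fun l m => len_pos _
  avg := fun l J => lab_avg (hf l) (hr l) (hne l) J
  sum := by
    classical
    intro x S hS
    have hp : ∀ m : Fin 3 → ℤ, 0 ≤ ∏ l, len (m l) := fun m => Finset.prod_nonneg fun l _ => (len_pos _).le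
    rw [← ENNReal.ofReal_sum_of_nonneg fun m _ => hp m]
    apply ENNReal.ofReal_le_ofReal
    calc ∑ m ∈ S, ∏ l, len (m l) ≤ ∑ m ∈ Fintype.piFinset (fun l => S.image fun m => m l), ∏ l, len (m l) := by
          apply Finset.sum_le_sum_of_subset_of_nonneg _ (fun m _ _ => hp m)
          intro m hm
          rw [Fintype.mem_piFinset]
          exact fun l => Finset.mem_image_of_mem _ hm
      _ = ∏ l, ∑ k ∈ S.image (fun m => m l), len k := by
          rw [Finset.prod_univ_sum]
      _ ≤ _ := by
          apply Finset.prod_le_prod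
          · intro l _
            exact Finset.sum_nonneg fun k _ => (len_pos k).le
          intro l _
          have := sum_len_rpow (q := 1) (M := Mr (f l) (r l) x) one_pos (Mr_nonneg x) (S.image fun m => m l) (by
            intro k hk
            obtain ⟨m, hm, rfl⟩ := Finset.mem_image.1 hk
            obtain ⟨J, hJ, hx⟩ := hS m hm
            rw [← hJ]
            exact lab_Mr (hf l) (hr l) (hne l) hx)
          simpa using this

lemma small_avg {f g h : ℝ → ℂ} {r1 r2 r3 p : ℝ} (hf : BM f) (hg : BM g) (hh : BM h) (hr1 : 1 < r1) (hr2 : 1 < r2) (hr3 : 1 < r3)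
    (hr32 : r3 < 2) (hp : 2 / 3 < p) (hp1 : p ≤ 1) (hnf : ¬ f =ᵐ[volume] 0) (hng : ¬ g =ᵐ[volume] 0)
    (hb : ∀ x, ‖h x‖ ≤ (Mr f r1 x * Mr g r2 x) ^ (-(1 - p))) (J : DI) :
    ∫ x, ‖h x‖ ^ r3 * ((dR J x) ^ 2)⁻¹ ≤
      (16 * (len (lab (Zr f r1 J) - 1) * len (lab (Zr g r2 J) - 1)) ^ (-(1 - p))) ^ r3 * dL J := by
  have hL := dL_pos J
  have h1 := Zr_pos hf (by linarith : 0 < r1) hnf J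
  have h2 := Zr_pos hg (by linarith : 0 < r2) hng J
  set w := (len (lab (Zr f r1 J) - 1) * len (lab (Zr g r2 J) - 1)) with hw
  have hl1 := len_pos (lab (Zr f r1 J) - 1)
  have hl2 := len_pos (lab (Zr g r2 J) - 1)
  have hw0 : 0 < w := by positivity
  have hwZ : w ≤ Zr f r1 J * Zr g r2 J := by
    have := (len_lab_lt h1).le
    have := (len_lab_lt h2).le
    rw [hw]; gcongr
  have hpt : ∀ x, ‖h x‖ ^ r3 ≤ (w ^ (-(1 - p))) ^ r3 * (5 * dR J x) := by
    intro x
    have hd := dR_pos J x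
    have hd1 := one_le_dR J x
    have hM1 := Mr_pos hf (by linarith : 0 < r1) hnf x
    have hM2 := Mr_pos hg (by linarith : 0 < r2) hng x
    set u := (5 * dR J x) ^ (1 / (2 * r1)) * (5 * dR J x) ^ (1 / (2 * r2)) with hu
    have hu0 : 0 < u := by rw [hu]; positivity
    have hM : w ≤ u * (Mr f r1 x * Mr g r2 x) := by
      refine hwZ.trans ?_
      calc _ ≤ ((5 * dR J x) ^ (1 / (2 * r1)) * Mr f r1 x) * ((5 * dR J x) ^ (1 / (2 * r2)) * Mr g r2 x) := by
            have := Zr_le_dR hf (by linarith : 0 < r1) J x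
            have := Zr_le_dR hg (by linarith : 0 < r2) J x
            gcongr
        _ = _ := by rw [hu]; ring
    have e1 : (Mr f r1 x * Mr g r2 x) ^ (-(1 - p)) ≤ w ^ (-(1 - p)) * u ^ (1 - p) := by
      calc _ ≤ (w / u) ^ (-(1 - p)) := by
            apply Real.rpow_le_rpow_of_nonpos (by positivity) _ (by linarith)
            rw [div_le_iff₀ hu0]; linarith
        _ = _ := by
            rw [Real.div_rpow hw0.le hu0.le, Real.rpow_neg hu0.le, div_inv_eq_mul]
    have e2 : (u ^ (1 - p)) ^ r3 ≤ 5 * dR J x := by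
      rw [hu, ← Real.rpow_add (by positivity), ← Real.rpow_mul (by positivity), ← Real.rpow_mul (by positivity)]
      calc _ ≤ (5 * dR J x) ^ (1:ℝ) := by
            apply Real.rpow_le_rpow_of_exponent_le (by linarith)
            have a1 : 1 / (2 * r1) ≤ 1 / 2 := by
              apply one_div_le_one_div_of_le <;> linarith
            have a2 : 1 / (2 * r2) ≤ 1 / 2 := by
              apply one_div_le_one_div_of_le <;> linarith
            have a3 : 0 < 1 / (2 * r1) := by positivity
            have a4 : 0 < 1 / (2 * r2) := by positivity
            calc (1 / (2 * r1) + 1 / (2 * r2)) * ((1 - p) * r3) ≤ 1 * ((1 / 3) * 2) := by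
                  gcongr <;> linarith
              _ ≤ 1 := by norm_num
        _ = _ := Real.rpow_one _
    calc ‖h x‖ ^ r3 ≤ (w ^ (-(1 - p)) * u ^ (1 - p)) ^ r3 := by
          have := (hb x).trans e1
          gcongr
      _ = (w ^ (-(1 - p))) ^ r3 * (u ^ (1 - p)) ^ r3 := Real.mul_rpow (by positivity) (by positivity)
      _ ≤ _ := by gcongr
  calc _ ≤ ∫ x, ((w ^ (-(1 - p))) ^ r3 * 5) * (dR J x)⁻¹ := by
        apply integral_mono (hh.integrable_rpow (by linarith) J)
        · have := (integrable_inv_dR_pow J (le_refl 1)).const_mul ((w ^ (-(1 - p))) ^ r3 * 5)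
          simpa using this
        intro x
        have hd := dR_pos J x
        change _ * _ ≤ _ * _
        calc _ ≤ ((w ^ (-(1 - p))) ^ r3 * (5 * dR J x)) * ((dR J x) ^ 2)⁻¹ := by
              have := hpt x
              gcongr
          _ = _ := by field_simp
    _ ≤ ((w ^ (-(1 - p))) ^ r3 * 5) * (dL J * π) := by
        rw [integral_const_mul]
        have := integral_inv_dR_pow_le J (le_refl 1)
        simp only [pow_one] at this
        gcongr
    _ ≤ (w ^ (-(1 - p))) ^ r3 * 16 * dL J := by
        have h3 := Real.pi_lt_d2
        have h4 : 5 * π ≤ 16 := by linarith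
        have h5 : 0 < (w ^ (-(1 - p))) ^ r3 * dL J := by positivity
        nlinarith
    _ ≤ _ := by
        rw [Real.mul_rpow (x := 16) (y := w ^ (-(1 - p))) (by norm_num) (by positivity), mul_comm ((16:ℝ) ^ r3)]
        gcongr
        calc (16:ℝ) = 16 ^ (1:ℝ) := (Real.rpow_one _).symm
          _ ≤ _ := Real.rpow_le_rpow_of_exponent_le (by norm_num) hr3.le

noncomputable def csm (p : ℝ) : ℝ := 16 * 4 ^ (1 - p) * cp p ^ 2

lemma csm_pos {p : ℝ} (hp : 0 < p) : 0 < csm p := by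
  unfold csm; have := cp_pos hp; positivity

lemma grp_small {f : Fin 3 → ℝ → ℂ} {r : Fin 3 → ℝ} {p : ℝ} (hf : ∀ l, BM (f l)) (hr : ∀ l, 1 < r l) (hr2 : r 2 < 2)
    (hp : 2 / 3 < p) (hp1 : p ≤ 1) (hnf : ¬ f 0 =ᵐ[volume] 0) (hng : ¬ f 1 =ᵐ[volume] 0)
    (hb : ∀ x, ‖f 2 x‖ ≤ (Mr (f 0) (r 0) x * Mr (f 1) (r 1) x) ^ (-(1 - p))) :
    Grp f r (fun J => (lab (Zr (f 0) (r 0) J), lab (Zr (f 1) (r 1) J)))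
      (fun l (m : ℤ × ℤ) => ![len m.1, len m.2, 16 * (len (m.1 - 1) * len (m.2 - 1)) ^ (-(1 - p))] l)
      (fun x => ENNReal.ofReal (csm p * (Mr (f 0) (r 0) x * Mr (f 1) (r 1) x) ^ p)) where
  conv := by
    intro I J Q h1 h2 h
    rw [Prod.mk.injEq] at h ⊢
    have := hr 0
    have := hr 1
    exact ⟨lab_conv (hf 0) (by linarith) hnf h1 h2 h.1, lab_conv (hf 1) (by linarith) hng h1 h2 h.2⟩
  pos := by
    intro l m
    have := len_pos m.1
    have := len_pos m.2
    have := len_pos (m.1 - 1)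
    have := len_pos (m.2 - 1)
    fin_cases l <;> simp <;> positivity
  avg := by
    intro l J
    have a0 := hr 0
    have a1 := hr 1
    fin_cases l
    · exact lab_avg (hf 0) (zero_lt_one.trans a0) hnf J
    · exact lab_avg (hf 1) (zero_lt_one.trans a1) hng J
    · exact small_avg (hf 0) (hf 1) (hf 2) (hr 0) (hr 1) (hr 2) hr2 hp hp1 hnf hng hb J
  sum := by
    classical
    intro x S hS
    have h0 : 0 < p := by linarith
    have hcp := cp_pos h0
    have e1 : ∀ m : ℤ × ℤ, ∏ l, ![len m.1, len m.2, 16 * (len (m.1 - 1) * len (m.2 - 1)) ^ (-(1 - p))] l =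
        16 * 4 ^ (1 - p) * (len m.1 ^ p * len m.2 ^ p) := by
      intro m
      have a1 := len_pos m.1
      have a2 := len_pos m.2
      rw [Fin.prod_univ_three]
      simp only [Matrix.cons_val_zero, Matrix.cons_val_one, Matrix.cons_val]
      have e2 : ∀ k : ℤ, len (k - 1) = len k / 2 := fun k => by
        rw [len_sub]; congr 1; unfold len; norm_num
      rw [e2, e2, show len m.1 / 2 * (len m.2 / 2) = (len m.1 * len m.2) / 4 by ring]
      rw [Real.div_rpow (by positivity) (by norm_num), Real.rpow_neg (by norm_num : (0:ℝ) ≤ 4), div_inv_eq_mul,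
        Real.mul_rpow a1.le a2.le]
      have e3 : ∀ y : ℝ, 0 < y → y * y ^ (-(1 - p)) = y ^ p := by
        intro y hy
        nth_rewrite 1 [← Real.rpow_one y]
        rw [← Real.rpow_add hy]; congr 1; ring
      rw [← e3 _ a1, ← e3 _ a2]; ring
    simp only [e1]
    have hp' : ∀ m : ℤ × ℤ, 0 ≤ 16 * (4:ℝ) ^ (1 - p) * (len m.1 ^ p * len m.2 ^ p) := by
      intro m
      have := len_pos m.1
      have := len_pos m.2
      positivity
    rw [← ENNReal.ofReal_sum_of_nonneg fun m _ => hp' m]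
    apply ENNReal.ofReal_le_ofReal
    rw [← Finset.mul_sum]
    have hr0 := hr 0
    have hr1 := hr 1
    have s1 := sum_len_rpow (q := p) (M := Mr (f 0) (r 0) x) h0 (Mr_nonneg x) (S.image Prod.fst) (by
      intro k hk
      obtain ⟨m, hm, rfl⟩ := Finset.mem_image.1 hk
      obtain ⟨J, hJ, hx⟩ := hS m hm
      rw [← hJ]
      exact lab_Mr (hf 0) (by linarith) hnf hx)
    have s2 := sum_len_rpow (q := p) (M := Mr (f 1) (r 1) x) h0 (Mr_nonneg x) (S.image Prod.snd) (by
      intro k hk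
      obtain ⟨m, hm, rfl⟩ := Finset.mem_image.1 hk
      obtain ⟨J, hJ, hx⟩ := hS m hm
      rw [← hJ]
      exact lab_Mr (hf 1) (by linarith) hng hx)
    have hnn : ∀ k : ℤ, 0 ≤ len k ^ p := fun k => Real.rpow_nonneg (len_pos k).le _
    calc _ ≤ 16 * (4:ℝ) ^ (1 - p) * ∑ m ∈ S.image Prod.fst ×ˢ S.image Prod.snd, len m.1 ^ p * len m.2 ^ p := by
          apply mul_le_mul_of_nonneg_left _ (by positivity)
          apply Finset.sum_le_sum_of_subset_of_nonneg Finset.subset_product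
          intro m _ _
          exact mul_nonneg (hnn _) (hnn _)
      _ = 16 * (4:ℝ) ^ (1 - p) * ((∑ k ∈ S.image Prod.fst, len k ^ p) * ∑ k ∈ S.image Prod.snd, len k ^ p) := by
          rw [Finset.sum_product, Finset.sum_mul_sum]
      _ ≤ 16 * (4:ℝ) ^ (1 - p) * ((cp p * Mr (f 0) (r 0) x ^ p) * (cp p * Mr (f 1) (r 1) x ^ p)) := by
          apply mul_le_mul_of_nonneg_left _ (by positivity)
          exact mul_le_mul s1 s2 (Finset.sum_nonneg fun k _ => hnn k)
            (mul_nonneg hcp.le (Real.rpow_nonneg (Mr_nonneg x) _))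
      _ = _ := by
          rw [Real.mul_rpow (Mr_nonneg x) (Mr_nonneg x)]
          unfold csm; ring

end BHT
end

section
namespace BHT

lemma weak_type {g : ℝ → ℝ≥0∞} {s : ℝ≥0∞} {S : Set ℝ}
    (hS : ∀ x ∈ S, ∃ c R : ℝ, |x - c| < R ∧ s * ENNReal.ofReal (2 * R) < ∫⁻ y in Metric.closedBall c R, g y) :
    s * volume S ≤ 5 * ∫⁻ y, g y := by
  classical
  set T : Set (ℝ × ℝ) := {q | 0 < q.2 ∧ s * ENNReal.ofReal (2 * q.2) < ∫⁻ y in Metric.closedBall q.1 q.2, g y} with hT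
  set U : Set ℝ := ⋃ q ∈ T, Metric.ball q.1 q.2 with hU
  have hUo : IsOpen U := isOpen_biUnion fun q _ => Metric.isOpen_ball
  have hSU : S ⊆ U := by
    intro x hx
    obtain ⟨c, R, h1, h2⟩ := hS x hx
    have : 0 < R := (abs_nonneg _).trans_lt h1
    rw [hU, Set.mem_iUnion₂]
    exact ⟨(c, R), ⟨this, h2⟩, by simpa [Real.dist_eq] using h1⟩
  have key : s * volume U ≤ 5 * ∫⁻ y, g y := by
    rw [hUo.measure_eq_iSup_isCompact, ENNReal.mul_iSup]
    refine iSup_le fun Kc => ?_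
    rw [ENNReal.mul_iSup]
    refine iSup_le fun hKU => ?_
    rw [ENNReal.mul_iSup]
    refine iSup_le fun hK => ?_
    obtain ⟨b, hbT, hbf, hKb⟩ := hK.elim_finite_subcover_image (fun q _ => Metric.isOpen_ball) hKU
    obtain ⟨M, hM⟩ : ∃ M : ℝ, ∀ q ∈ b, q.2 ≤ M := by
      obtain ⟨M, hM⟩ := (hbf.image Prod.snd).bddAbove
      exact ⟨M, fun q hq => hM (Set.mem_image_of_mem _ hq)⟩
    obtain ⟨u, hub, hud, huc⟩ := Vitali.exists_disjoint_subfamily_covering_enlargement_closedBall b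
      (fun q : ℝ × ℝ => q.1) (fun q => q.2) M hM 5 (by norm_num)
    have huf : u.Finite := hbf.subset hub
    have hKu : Kc ⊆ ⋃ q ∈ huf.toFinset, Metric.closedBall q.1 (5 * q.2) := by
      intro x hx
      obtain ⟨q, hq, hxq⟩ := Set.mem_iUnion₂.1 (hKb hx)
      obtain ⟨q', hq', hs⟩ := huc q hq
      exact Set.mem_iUnion₂.2 ⟨q', by simpa using hq', hs (Metric.ball_subset_closedBall hxq)⟩
    calc s * volume Kc ≤ s * ∑ q ∈ huf.toFinset, volume (Metric.closedBall q.1 (5 * q.2)) := by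
          gcongr
          exact (measure_mono hKu).trans (measure_biUnion_finset_le _ _)
      _ = ∑ q ∈ huf.toFinset, 5 * (s * ENNReal.ofReal (2 * q.2)) := by
          rw [Finset.mul_sum]
          refine Finset.sum_congr rfl fun q _ => ?_
          rw [Real.volume_closedBall, show 2 * (5 * q.2) = 5 * (2 * q.2) by ring, ENNReal.ofReal_mul (by norm_num)]
          rw [show ENNReal.ofReal 5 = 5 by norm_num]
          ring
      _ ≤ ∑ q ∈ huf.toFinset, 5 * ∫⁻ y in Metric.closedBall q.1 q.2, g y := by
          refine Finset.sum_le_sum fun q hq => ?_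
          gcongr
          exact (hbT (hub (by simpa using hq))).2.le
      _ = 5 * ∫⁻ y in ⋃ q ∈ huf.toFinset, Metric.closedBall q.1 q.2, g y := by
          rw [← Finset.mul_sum, lintegral_biUnion_finset _ (fun q _ => Metric.isClosed_closedBall.measurableSet)]
          simpa using hud
      _ ≤ 5 * ∫⁻ y, g y := by
          gcongr
          exact Measure.restrict_le_self
  exact le_trans (by gcongr) key

lemma inv_rho_le_tsum (c y : ℝ) {R : ℝ} (hR : 0 < R) :
    ENNReal.ofReal (((rho c R y) ^ 2)⁻¹) ≤ ∑' j : ℕ, (Metric.closedBall c (2 ^ j * R)).indicator (fun _ => ENNReal.ofReal (4 * (4⁻¹) ^ j)) y := by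
  classical
  have hex : ∃ j : ℕ, |y - c| ≤ 2 ^ j * R := by
    obtain ⟨j, hj⟩ := pow_unbounded_of_one_lt (|y - c| / R) (one_lt_two : (1 : ℝ) < 2)
    exact ⟨j, by rw [div_lt_iff₀ hR] at hj; exact hj.le⟩
  set j := Nat.find hex with hj
  have h1 : |y - c| ≤ 2 ^ j * R := Nat.find_spec hex
  refine le_trans ?_ (ENNReal.le_tsum j)
  rw [Set.indicator_of_mem (by simpa [Real.dist_eq] using h1)]
  apply ENNReal.ofReal_le_ofReal
  have h3 := one_le_rho c R y
  rcases Nat.eq_zero_or_pos j with h0 | h0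
  · rw [h0]
    have : ((rho c R y) ^ 2)⁻¹ ≤ 1 := inv_le_one_of_one_le₀ (one_le_pow₀ h3)
    norm_num
    linarith
  · obtain ⟨i, hi⟩ : ∃ i, j = i + 1 := ⟨j - 1, by omega⟩
    have h2 : 2 ^ i * R < |y - c| := by
      have := Nat.find_min hex (show i < j by omega)
      exact not_le.1 this
    have h4 : (4 : ℝ) ^ i ≤ rho c R y := by
      unfold rho
      have : (2 : ℝ) ^ i ≤ |y - c| / R := by rw [le_div_iff₀ hR]; exact h2.le
      have h5 : ((2 : ℝ) ^ i) ^ 2 ≤ (|y - c| / R) ^ 2 := by gcongr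
      rw [div_pow, sq_abs, ← div_pow] at h5
      rw [show (4 : ℝ) = 2 ^ 2 by norm_num, pow_right_comm]
      linarith
    rw [hi, pow_succ, inv_pow]
    calc ((rho c R y) ^ 2)⁻¹ ≤ (rho c R y)⁻¹ := by
          apply inv_anti₀ (by linarith); nlinarith
      _ ≤ ((4 : ℝ) ^ i)⁻¹ := inv_anti₀ (by positivity) h4
      _ = _ := by ring

lemma shell {g : ℝ → ℝ≥0∞} (hg : Measurable g) {s : ℝ} (hs : 0 ≤ s) (c : ℝ) {R : ℝ} (hR : 0 < R)
    (h : ∀ R', R ≤ R' → ∫⁻ y in Metric.closedBall c R', g y ≤ ENNReal.ofReal s * ENNReal.ofReal (2 * R')) :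
    ∫⁻ y, g y * ENNReal.ofReal (((rho c R y) ^ 2)⁻¹) ≤ ENNReal.ofReal (16 * s * R) := by
  calc _ ≤ ∫⁻ y, ∑' j : ℕ, g y * (Metric.closedBall c (2 ^ j * R)).indicator (fun _ => ENNReal.ofReal (4 * (4⁻¹) ^ j)) y := by
        apply lintegral_mono
        intro y
        beta_reduce
        rw [ENNReal.tsum_mul_left]
        gcongr
        exact inv_rho_le_tsum c y hR
    _ = ∑' j : ℕ, ∫⁻ y, g y * (Metric.closedBall c (2 ^ j * R)).indicator (fun _ => ENNReal.ofReal (4 * (4⁻¹) ^ j)) y := by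
        rw [lintegral_tsum]
        intro j
        exact (hg.mul (measurable_const.indicator Metric.isClosed_closedBall.measurableSet)).aemeasurable
    _ ≤ ∑' j : ℕ, ENNReal.ofReal (8 * s * R * (1 / 2) ^ j) := by
        apply ENNReal.tsum_le_tsum
        intro j
        have e : (fun y => g y * (Metric.closedBall c (2 ^ j * R)).indicator (fun _ => ENNReal.ofReal (4 * (4⁻¹) ^ j)) y)
            = (Metric.closedBall c (2 ^ j * R)).indicator (fun y => g y * ENNReal.ofReal (4 * (4⁻¹) ^ j)) := by
          ext y
          by_cases hy : y ∈ Metric.closedBall c (2 ^ j * R) <;> simp [hy, Set.indicator]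
        rw [e, lintegral_indicator Metric.isClosed_closedBall.measurableSet, lintegral_mul_const _ hg]
        have h1 : R ≤ 2 ^ j * R := le_mul_of_one_le_left hR.le (one_le_pow₀ (by norm_num))
        calc _ ≤ ENNReal.ofReal s * ENNReal.ofReal (2 * (2 ^ j * R)) * ENNReal.ofReal (4 * (4⁻¹) ^ j) := by
              gcongr; exact h _ h1
          _ = _ := by
              rw [← ENNReal.ofReal_mul hs, ← ENNReal.ofReal_mul (by positivity)]
              congr 1
              have : (4⁻¹ : ℝ) ^ j * 2 ^ j = (1 / 2) ^ j := by rw [← mul_pow]; norm_num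
              rw [← this]; ring
    _ = _ := by
        have hsum : Summable fun j : ℕ => 8 * s * R * (1 / 2 : ℝ) ^ j := summable_geometric_two.mul_left _
        rw [← ENNReal.ofReal_tsum_of_nonneg (fun j => by positivity) hsum, tsum_mul_left, tsum_geometric_two]
        congr 1; ring

variable {f : ℝ → ℂ} {r : ℝ}

lemma ofReal_X (hf : BM f) (hr : 0 ≤ r) (c : ℝ) {R : ℝ} (hR : 0 < R) :
    ENNReal.ofReal R * ENNReal.ofReal (X f r c R) = ∫⁻ y, ENNReal.ofReal (‖f y‖ ^ r) * ENNReal.ofReal (((rho c R y) ^ 2)⁻¹) := by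
  rw [← ENNReal.ofReal_mul hR.le]
  unfold X
  rw [mul_inv_cancel_left₀ hR.ne', ofReal_integral_eq_lintegral_ofReal (integrable_X hf hr c hR)]
  · refine lintegral_congr fun y => ?_
    rw [ENNReal.ofReal_mul (by positivity)]
  · filter_upwards with y
    have := rho_pos c R y
    change 0 ≤ _ * _
    positivity

lemma weak_MX (hf : BM f) (hr : 0 ≤ r) {t : ℝ} (ht : 0 < t) :
    ENNReal.ofReal t * volume {x | ENNReal.ofReal t < MX f r x} ≤
      160 * ∫⁻ y in {y | t < 2 * π * ‖f y‖ ^ r}, ENNReal.ofReal (‖f y‖ ^ r) := by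
  have hfm := hf.1
  have hGm : Measurable fun y => ‖f y‖ ^ r := hfm.norm.pow_const r
  set A : Set ℝ := {y | t < 2 * π * ‖f y‖ ^ r} with hA
  have hAm : MeasurableSet A := measurableSet_lt measurable_const (hGm.const_mul _)
  set g : ℝ → ℝ≥0∞ := A.indicator fun y => ENNReal.ofReal (‖f y‖ ^ r) with hg
  have hgm : Measurable g := hGm.ennreal_ofReal.indicator hAm
  have hw := weak_type (g := g) (s := ENNReal.ofReal (t / 32)) (S := {x | ENNReal.ofReal t < MX f r x}) ?_
  · rw [← lintegral_indicator hAm]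
    have : ENNReal.ofReal t = 32 * ENNReal.ofReal (t / 32) := by
      rw [show (32 : ℝ≥0∞) = ENNReal.ofReal 32 by norm_num, ← ENNReal.ofReal_mul (by norm_num)]
      congr 1; ring
    calc _ = 32 * (ENNReal.ofReal (t / 32) * volume {x | ENNReal.ofReal t < MX f r x}) := by
          rw [← mul_assoc, ← this]
      _ ≤ 32 * (5 * ∫⁻ y, g y) := mul_le_mul_right hw _
      _ = 160 * ∫⁻ y, g y := by rw [← mul_assoc]; norm_num
  · intro x hx
    simp only [Set.mem_ofPred_eq, MX, lt_iSup_iff] at hx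
    obtain ⟨c, R, hxc, hX⟩ := hx
    have hR : 0 < R := (abs_nonneg _).trans_lt hxc
    by_contra hcon
    push Not at hcon
    have hsh := shell hgm (s := t / 32) (by positivity) c hR (fun R' hR' => hcon c R' (hxc.trans_le hR'))
    have h1 : ENNReal.ofReal R * ENNReal.ofReal (X f r c R) ≤ ENNReal.ofReal (R * t) := by
      rw [ofReal_X hf hr c hR]
      calc _ ≤ ∫⁻ y, (ENNReal.ofReal (t / (2 * π)) * ENNReal.ofReal (((rho c R y) ^ 2)⁻¹) + g y * ENNReal.ofReal (((rho c R y) ^ 2)⁻¹)) := by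
            apply lintegral_mono
            intro y
            beta_reduce
            rw [← add_mul]
            gcongr
            by_cases hy : y ∈ A
            · simp [hg, hy]
            · simp only [hg, hy, not_false_eq_true, Set.indicator_of_notMem, add_zero]
              apply ENNReal.ofReal_le_ofReal
              rw [le_div_iff₀ (by positivity)]
              simp only [hA, Set.mem_ofPred_eq, not_lt] at hy
              linarith
        _ ≤ ENNReal.ofReal (t / (2 * π)) * ENNReal.ofReal (R * π) + ENNReal.ofReal (16 * (t / 32) * R) := by
            have hrm : Measurable fun y => ENNReal.ofReal (((rho c R y) ^ 2)⁻¹) :=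
              ((continuous_rho c R).measurable.pow_const 2).inv.ennreal_ofReal
            rw [lintegral_add_left (hrm.const_mul _), lintegral_const_mul _ hrm]
            gcongr
            rw [← ofReal_integral_eq_lintegral_ofReal (integrable_inv_rho_pow c hR (by norm_num))]
            · exact ENNReal.ofReal_le_ofReal (integral_inv_rho_pow_le c hR (by norm_num))
            · filter_upwards with y
              have := rho_pos c R y
              change 0 ≤ _
              positivity
        _ = _ := by
            rw [← ENNReal.ofReal_mul (by positivity), ← ENNReal.ofReal_add (by positivity) (by positivity)]
            congr 1
            field_simp
            ring
    rw [ENNReal.ofReal_mul hR.le] at h1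
    have h2 := (ENNReal.mul_le_mul_iff_right (by simpa using hR) ENNReal.ofReal_ne_top).1 h1
    exact absurd hX (not_lt.2 h2)

lemma strong_MX {r q : ℝ} (hr : 0 < r) (hq : 1 < q) : ∃ C : ℝ, 0 < C ∧ ∀ f : ℝ → ℂ, BM f →
    ∫⁻ x, ENNReal.ofReal ((MX f r x).toReal ^ q) ≤ ENNReal.ofReal C * ∫⁻ x, ENNReal.ofReal (‖f x‖ ^ (r * q)) := by
  have hq1 : 0 < q - 1 := by linarith
  refine ⟨q * (160 * ((q - 1)⁻¹ * (2 * π) ^ (q - 1))), by positivity, fun f hf => ?_⟩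
  have hGm : Measurable fun y => ‖f y‖ ^ r := hf.1.norm.pow_const r
  have hgm : Measurable fun y => ENNReal.ofReal (‖f y‖ ^ r) := hGm.ennreal_ofReal
  set μ : Measure ℝ := volume.withDensity fun y => ENNReal.ofReal (‖f y‖ ^ r) with hμ
  have hG0 : 0 ≤ᵐ[μ] fun y => 2 * π * ‖f y‖ ^ r := by
    filter_upwards with y
    change 0 ≤ _
    positivity
  have e2 := lintegral_rpow_eq_lintegral_meas_lt_mul μ hG0 (hGm.const_mul _).aemeasurable hq1
  rw [lintegral_rpow_eq_lintegral_meas_lt_mul volume (by filter_upwards with y; exact ENNReal.toReal_nonneg)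
    (measurable_MX.ennreal_toReal).aemeasurable (by linarith : 0 < q)]
  have h1 : ∫⁻ t in Set.Ioi (0:ℝ), volume {a | t < (MX f r a).toReal} * ENNReal.ofReal (t ^ (q - 1))
      ≤ 160 * ∫⁻ t in Set.Ioi (0:ℝ), μ {a | t < 2 * π * ‖f a‖ ^ r} * ENNReal.ofReal (t ^ (q - 1 - 1)) := by
    rw [← lintegral_const_mul' _ _ (by norm_num)]
    apply setLIntegral_mono' measurableSet_Ioi
    intro t ht
    have ht : 0 < t := ht
    have h2 := weak_MX hf hr.le ht
    have e : {a | t < (MX f r a).toReal} = {x | ENNReal.ofReal t < MX f r x} := by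
      ext x
      simp only [Set.mem_ofPred_eq]
      rw [ENNReal.ofReal_lt_iff_lt_toReal ht.le (MX_lt_top hf hr.le x).ne]
    rw [hμ, withDensity_apply _ (measurableSet_lt measurable_const (hGm.const_mul _)), e, ← mul_assoc]
    have e3 : t ^ (q - 1) = t * t ^ (q - 1 - 1) := by
      rw [Real.rpow_sub_one ht.ne' (q - 1)]; field_simp
    rw [e3, ENNReal.ofReal_mul ht.le, ← mul_assoc]
    refine mul_le_mul_left ?_ _
    rw [mul_comm]
    exact h2
  have hq0 : ENNReal.ofReal (q - 1) ≠ 0 := by simpa using hq1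
  have e4 : ∫⁻ t in Set.Ioi (0:ℝ), μ {a | t < 2 * π * ‖f a‖ ^ r} * ENNReal.ofReal (t ^ (q - 1 - 1))
      = ENNReal.ofReal ((q - 1)⁻¹ * (2 * π) ^ (q - 1)) * ∫⁻ x, ENNReal.ofReal (‖f x‖ ^ (r * q)) := by
    have e5 : ∫⁻ ω, ENNReal.ofReal ((2 * π * ‖f ω‖ ^ r) ^ (q - 1)) ∂μ =
        ENNReal.ofReal ((2 * π) ^ (q - 1)) * ∫⁻ x, ENNReal.ofReal (‖f x‖ ^ (r * q)) := by
      rw [hμ, lintegral_withDensity_eq_lintegral_mul _ hgm ((hGm.const_mul _).pow_const _).ennreal_ofReal,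
        ← lintegral_const_mul' _ _ ENNReal.ofReal_ne_top]
      refine lintegral_congr fun x => ?_
      simp only [Pi.mul_apply]
      rw [← ENNReal.ofReal_mul (by positivity), ← ENNReal.ofReal_mul (by positivity)]
      congr 1
      rw [Real.mul_rpow (by positivity) (by positivity), Real.rpow_mul (by positivity)]
      rcases eq_or_lt_of_le (show 0 ≤ ‖f x‖ ^ r by positivity) with h0 | h0
      · rw [← h0, Real.zero_rpow (by linarith : q ≠ 0)]; simp
      · rw [Real.rpow_sub_one h0.ne' q]; field_simp
    rw [ENNReal.ofReal_mul (by positivity), mul_assoc, ← e5, e2, ← mul_assoc, ← ENNReal.ofReal_mul (by positivity),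
      inv_mul_cancel₀ hq1.ne']
    simp
  rw [e4] at h1
  calc _ ≤ ENNReal.ofReal q * (160 * (ENNReal.ofReal ((q - 1)⁻¹ * (2 * π) ^ (q - 1)) * ∫⁻ x, ENNReal.ofReal (‖f x‖ ^ (r * q)))) := by
        gcongr
    _ = _ := by
        rw [ENNReal.ofReal_mul (by linarith : 0 ≤ q), ENNReal.ofReal_mul (by norm_num : (0:ℝ) ≤ 160)]
        rw [show ENNReal.ofReal 160 = 160 by norm_num]
        ring

/-- Maximal theorem -/
lemma maximal {r p : ℝ} (hr : 0 < r) (hp : r < p) : ∃ C : ℝ, 0 < C ∧ ∀ f : ℝ → ℂ, BM f →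
    ∫⁻ x, ENNReal.ofReal (Mr f r x ^ p) ≤ ENNReal.ofReal C * ∫⁻ x, ENNReal.ofReal (‖f x‖ ^ p) := by
  obtain ⟨C, hC, h⟩ := strong_MX hr (show 1 < p / r by rw [one_lt_div hr]; exact hp)
  refine ⟨C, hC, fun f hf => ?_⟩
  have := h f hf
  rw [mul_div_cancel₀ _ hr.ne'] at this
  refine le_trans (le_of_eq ?_) this
  refine lintegral_congr fun x => ?_
  unfold Mr
  rw [← Real.rpow_mul ENNReal.toReal_nonneg]
  congr 2; field_simp

lemma maximal_top {B : ℝ} (hr : 0 < r) (hf : BM f) (hB : ∀ x, ‖f x‖ ≤ B) (x : ℝ) :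
    Mr f r x ≤ π ^ (1 / r) * B := by
  have hB0 : 0 ≤ B := (norm_nonneg _).trans (hB 0)
  have h1 : MX f r x ≤ ENNReal.ofReal (B ^ r * π) := by
    unfold MX
    refine iSup_le fun c => iSup_le fun R => iSup_le fun h => ENNReal.ofReal_le_ofReal ?_
    exact X_le hf hB hr.le c ((abs_nonneg _).trans_lt h)
  have h2 : (MX f r x).toReal ≤ B ^ r * π := ENNReal.toReal_le_of_le_ofReal (by positivity) h1
  unfold Mr
  calc _ ≤ (B ^ r * π) ^ (1 / r) := by gcongr
    _ = _ := by
      rw [Real.mul_rpow (by positivity) (by positivity), ← Real.rpow_mul hB0, mul_one_div_cancel hr.ne', Real.rpow_one, mul_comm]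

end BHT
end

section
namespace BHT

variable {f : ℝ → ℂ} {r : ℝ}

lemma X_le_ae {B : ℝ} (hf : BM f) (hB : ∀ᵐ x, ‖f x‖ ≤ B) (hr : 0 ≤ r) (c : ℝ) {R : ℝ} (hR : 0 < R) : X f r c R ≤ B ^ r * π := by
  unfold X
  have hB0 : 0 ≤ B := by
    obtain ⟨x, hx⟩ := hB.exists
    exact (norm_nonneg _).trans hx
  rw [inv_mul_le_iff₀ hR]
  calc _ ≤ ∫ x, B ^ r * ((rho c R x) ^ 2)⁻¹ := by
        apply integral_mono_ae (integrable_X hf hr c hR) ((integrable_inv_rho_pow c hR (by norm_num)).const_mul _)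
        filter_upwards [hB] with x hx
        have := rho_pos c R x
        gcongr
    _ ≤ B ^ r * (R * π) := by
        rw [integral_const_mul]
        gcongr
        exact integral_inv_rho_pow_le c hR (by norm_num)
    _ = _ := by ring

lemma max_eLp {r : ℝ} (hr : 0 < r) {P : ℝ≥0∞} (hP : ENNReal.ofReal r < P) : ∃ C : ℝ, 0 < C ∧ ∀ f : ℝ → ℂ, BM f →
    eLpNorm (Mr f r) P volume ≤ ENNReal.ofReal C * eLpNorm f P volume := by
  by_cases hT : P = ∞
  · subst hT
    refine ⟨π ^ (1 / r), by positivity, fun f hf => ?_⟩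
    rw [eLpNorm_exponent_top, eLpNorm_exponent_top]
    obtain ⟨B, hB⟩ := hf.2
    set S := eLpNormEssSup f volume with hS
    have hSf : S < ∞ := eLpNormEssSup_lt_top_of_ae_bound (Eventually.of_forall hB)
    have h1 : ∀ᵐ x, ‖f x‖ ≤ S.toReal := by
      filter_upwards [enorm_ae_le_eLpNormEssSup f volume] with x hx
      rw [← toReal_enorm]
      exact ENNReal.toReal_mono hSf.ne hx
    have h3 : ∀ x, Mr f r x ≤ π ^ (1 / r) * S.toReal := by
      intro x
      have h1 : MX f r x ≤ ENNReal.ofReal (S.toReal ^ r * π) := by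
        unfold MX
        refine iSup_le fun c => iSup_le fun R => iSup_le fun h => ENNReal.ofReal_le_ofReal ?_
        exact X_le_ae hf h1 hr.le c ((abs_nonneg _).trans_lt h)
      have h2 : (MX f r x).toReal ≤ S.toReal ^ r * π := ENNReal.toReal_le_of_le_ofReal (by positivity) h1
      unfold Mr
      calc _ ≤ (S.toReal ^ r * π) ^ (1 / r) := by gcongr
        _ = _ := by
          rw [Real.mul_rpow (by positivity) (by positivity), ← Real.rpow_mul (by positivity), mul_one_div_cancel hr.ne', Real.rpow_one, mul_comm]
    have h4 := eLpNormEssSup_le_of_ae_bound (f := Mr f r) (μ := volume) (C := π ^ (1 / r) * S.toReal)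
      (Eventually.of_forall fun x => by rw [Real.norm_of_nonneg (Mr_nonneg x)]; exact h3 x)
    rwa [ENNReal.ofReal_mul (by positivity), ENNReal.ofReal_toReal hSf.ne] at h4
  · have hp : r < P.toReal := by rwa [ENNReal.ofReal_lt_iff_lt_toReal hr.le hT] at hP
    have hp0 : 0 < P.toReal := hr.trans hp
    have hP0 : P ≠ 0 := by rintro rfl; simp at hP
    obtain ⟨C, hC, h⟩ := maximal hr hp
    refine ⟨C ^ (1 / P.toReal), by positivity, fun f hf => ?_⟩
    rw [eLpNorm_eq_lintegral_rpow_enorm_toReal hP0 hT, eLpNorm_eq_lintegral_rpow_enorm_toReal hP0 hT,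
      ← ENNReal.ofReal_rpow_of_pos hC, ← ENNReal.mul_rpow_of_nonneg _ _ (by positivity)]
    gcongr
    refine le_trans (le_of_eq ?_) ((h f hf).trans (le_of_eq ?_))
    · refine lintegral_congr fun x => ?_
      rw [Real.enorm_of_nonneg (Mr_nonneg x), ENNReal.ofReal_rpow_of_nonneg (Mr_nonneg x) hp0.le]
    · congr 1
      refine lintegral_congr fun x => ?_
      rw [← ofReal_norm, ENNReal.ofReal_rpow_of_nonneg (norm_nonneg _) hp0.le]

lemma choose_r (x : Fin 3 → ℝ) (h1 : ∀ l, x l < 1) (hs : ∑ l, max (x l) (1 / 2) < 2) :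
    ∃ r : Fin 3 → ℝ, (∀ l, 1 < r l) ∧ (∀ l, r l < 2) ∧ ∑ l, 1 / r l < 2 ∧ ∀ l, x l < 1 / r l := by
  set a : Fin 3 → ℝ := fun l => max (x l) (1 / 2) with ha
  have ha1 : ∀ l, a l < 1 := fun l => max_lt (h1 l) (by norm_num)
  have ha2 : ∀ l, 1 / 2 ≤ a l := fun l => le_max_right _ _
  have ha3 : ∀ l, x l ≤ a l := fun l => le_max_left _ _
  change ∑ l, a l < 2 at hs
  rw [Fin.sum_univ_three] at hs
  obtain ⟨δ, hδ, h0, h1', h2, h3⟩ : ∃ δ > 0, a 0 + δ < 1 ∧ a 1 + δ < 1 ∧ a 2 + δ < 1 ∧ a 0 + a 1 + a 2 + 3 * δ < 2 := by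
    refine ⟨min (min ((1 - a 0) / 2) ((1 - a 1) / 2)) (min ((1 - a 2) / 2) ((2 - (a 0 + a 1 + a 2)) / 6)), ?_, ?_, ?_, ?_, ?_⟩
    · have := ha1 0; have := ha1 1; have := ha1 2
      refine lt_min (lt_min ?_ ?_) (lt_min ?_ ?_) <;> linarith
    all_goals
      have e1 := min_le_left (min ((1 - a 0) / 2) ((1 - a 1) / 2)) (min ((1 - a 2) / 2) ((2 - (a 0 + a 1 + a 2)) / 6))
      have e2 := min_le_right (min ((1 - a 0) / 2) ((1 - a 1) / 2)) (min ((1 - a 2) / 2) ((2 - (a 0 + a 1 + a 2)) / 6))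
      have e3 := min_le_left ((1 - a 0) / 2) ((1 - a 1) / 2)
      have e4 := min_le_right ((1 - a 0) / 2) ((1 - a 1) / 2)
      have e5 := min_le_left ((1 - a 2) / 2) ((2 - (a 0 + a 1 + a 2)) / 6)
      have e6 := min_le_right ((1 - a 2) / 2) ((2 - (a 0 + a 1 + a 2)) / 6)
      have := ha1 0; have := ha1 1; have := ha1 2
      linarith
  have hall : ∀ l, a l + δ < 1 := by intro l; fin_cases l <;> assumption
  refine ⟨fun l => 1 / (a l + δ), ?_, ?_, ?_, ?_⟩
  · intro l
    have := ha2 l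
    change 1 < 1 / (a l + δ)
    rw [lt_div_iff₀ (by linarith)]; linarith [hall l]
  · intro l
    have := ha2 l
    change 1 / (a l + δ) < 2
    rw [div_lt_iff₀ (by linarith)]; linarith
  · simp only [one_div_one_div]
    rw [Fin.sum_univ_three]; linarith
  · intro l
    simp only [one_div_one_div]
    linarith [ha3 l]

/-- consequence of the model sum estimate for the bilinear operator -/
def Red (f g F : ℝ → ℂ) (r : Fin 3 → ℝ) (Cr : ℝ) : Prop :=
  ∀ h, BM h → (∃ R : ℝ, ∀ x, R < |x| → h x = 0) → ∀ (ι : Type) (G : DI → ι) (A : Fin 3 → ι → ℝ) (W : ℝ → ℝ≥0∞),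
    Grp ![f, g, h] r G A W → ‖∫ x, F x * h x‖ₑ ≤ ENNReal.ofReal Cr * ∫⁻ x, W x

lemma lintegral_le_of_Icc {φ : ℝ → ℝ≥0∞} {B : ℝ≥0∞} (h : ∀ n : ℕ, ∫⁻ x in Set.Icc (-(n:ℝ)) n, φ x ≤ B) :
    ∫⁻ x, φ x ≤ B := by
  have e : (⋃ n : ℕ, Set.Icc (-(n:ℝ)) n) = Set.univ := by
    ext x
    simp only [Set.mem_iUnion, Set.mem_univ, iff_true]
    obtain ⟨n, hn⟩ := exists_nat_ge |x|
    exact ⟨n, by rw [Set.mem_Icc]; exact abs_le.1 hn⟩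
  rw [← setLIntegral_univ, ← e, setLIntegral_iUnion_of_directed]
  · exact iSup_le h
  · apply Monotone.directed_le
    intro m n hmn
    have : (m:ℝ) ≤ n := by exact_mod_cast hmn
    exact Set.Icc_subset_Icc (by linarith) this

/-- the dual function -/
noncomputable def dualF (F : ℝ → ℂ) (v : ℝ → ℝ) (R : ℝ) (x : ℝ) : ℂ :=
  (Set.Icc (-R) R).indicator (fun x => (starRingEnd ℂ) (F x) / (‖F x‖ : ℂ) * (v x : ℂ)) x

lemma norm_dualF_le (F : ℝ → ℂ) (v : ℝ → ℝ) (R x : ℝ) (hv : 0 ≤ v x) : ‖dualF F v R x‖ ≤ v x := by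
  unfold dualF
  by_cases hx : x ∈ Set.Icc (-R) R
  · rw [Set.indicator_of_mem hx, norm_mul, norm_div, RCLike.norm_conj, Complex.norm_real, Complex.norm_real, norm_norm,
      Real.norm_of_nonneg hv]
    exact mul_le_of_le_one_left hv (div_self_le_one _)
  · rw [Set.indicator_of_notMem hx]; simpa using hv

lemma norm_dualF_le_ind (F : ℝ → ℂ) (v : ℝ → ℝ) (R x : ℝ) (hv : 0 ≤ v x) : ‖dualF F v R x‖ ≤ (Set.Icc (-R) R).indicator v x := by
  by_cases hx : x ∈ Set.Icc (-R) R
  · rw [Set.indicator_of_mem hx]; exact norm_dualF_le F v R x hv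
  · unfold dualF; rw [Set.indicator_of_notMem hx, Set.indicator_of_notMem hx]; simp

lemma measurable_dualF {F : ℝ → ℂ} (hF : Measurable F) {v : ℝ → ℝ} (hv : Measurable v) (R : ℝ) : Measurable (dualF F v R) := by
  unfold dualF
  refine Measurable.indicator ?_ measurableSet_Icc
  have h1 : Measurable fun x => (starRingEnd ℂ) (F x) := (Complex.continuous_conj.measurable).comp hF
  have h2 : Measurable fun x => ((‖F x‖ : ℝ) : ℂ) := Complex.continuous_ofReal.measurable.comp hF.norm
  exact (h1.div h2).mul (Complex.continuous_ofReal.measurable.comp hv)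

lemma mul_dualF (F : ℝ → ℂ) (v : ℝ → ℝ) (R x : ℝ) :
    F x * dualF F v R x = (((Set.Icc (-R) R).indicator (fun x => ‖F x‖ * v x) x : ℝ) : ℂ) := by
  unfold dualF
  by_cases hx : x ∈ Set.Icc (-R) R
  · rw [Set.indicator_of_mem hx, Set.indicator_of_mem hx]
    push_cast
    by_cases h0 : F x = 0
    · simp [h0]
    · have : (‖F x‖ : ℂ) ≠ 0 := by exact_mod_cast norm_ne_zero_iff.2 h0
      have e : F x * (starRingEnd ℂ) (F x) = (‖F x‖ : ℂ) ^ 2 := Complex.mul_conj' (F x)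
      field_simp
      rw [← e]
  · rw [Set.indicator_of_notMem hx, Set.indicator_of_notMem hx]; simp

lemma enorm_int_dualF {F : ℝ → ℂ} (hF : Measurable F) {v : ℝ → ℝ} (hv : Measurable v) (hv0 : ∀ x, 0 ≤ v x) (R B : ℝ)
    (hB : ∀ x ∈ Set.Icc (-R) R, ‖F x‖ * v x ≤ B) :
    ‖∫ x, F x * dualF F v R x‖ₑ = ∫⁻ x in Set.Icc (-R) R, ENNReal.ofReal (‖F x‖ * v x) := by
  simp_rw [mul_dualF]
  rw [integral_complex_ofReal]
  have hintg : IntegrableOn (fun x => ‖F x‖ * v x) (Set.Icc (-R) R) := by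
    refine Integrable.of_bound (C := B) (hF.norm.mul hv).aestronglyMeasurable ?_
    filter_upwards [ae_restrict_mem measurableSet_Icc] with x hx
    rw [Real.norm_of_nonneg (mul_nonneg (norm_nonneg _) (hv0 x))]
    exact hB x hx
  rw [integral_indicator measurableSet_Icc, ← ofReal_norm, Complex.norm_real,
    Real.norm_of_nonneg (integral_nonneg fun x => mul_nonneg (norm_nonneg _) (hv0 x)),
    ofReal_integral_eq_lintegral_ofReal hintg]
  filter_upwards with x
  exact mul_nonneg (norm_nonneg _) (hv0 x)

end BHT
end

section
namespace BHT

lemma Mr_lower {f : ℝ → ℂ} {r : ℝ} (hf : BM f) (hr : 0 < r) (hne : ¬ f =ᵐ[volume] 0) (R : ℝ) :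
    ∃ c > 0, ∀ x ∈ Set.Icc (-R) R, c ≤ Mr f r x := by
  have hcont : Continuous fun x => (5 * dR (0, 0) x) ^ (1 / (2 * r)) := by
    refine Continuous.rpow_const ?_ ?_
    · exact continuous_const.mul (continuous_rho _ _)
    · intro x; left; have := dR_pos (0, 0) x; positivity
  obtain ⟨D, hD⟩ := (isCompact_Icc (a := -R) (b := R)).exists_bound_of_continuousOn hcont.continuousOn
  have hZ := Zr_pos hf hr hne (0, 0)
  refine ⟨Zr f r (0, 0) / (|D| + 1), by positivity, fun x hx => ?_⟩
  rw [div_le_iff₀ (by positivity)]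
  refine (Zr_le_dR hf hr (0, 0) x).trans ?_
  rw [mul_comm]
  have h1 := hD x hx
  have h2 := le_abs_self ((5 * dR (0, 0) x) ^ (1 / (2 * r)))
  rw [Real.norm_eq_abs] at h1
  have h3 := le_abs_self D
  have := Mr_nonneg (f := f) (r := r) x
  gcongr
  linarith

lemma dualF_zero (F : ℝ → ℂ) (v : ℝ → ℝ) (R x : ℝ) (hx : R < |x|) : dualF F v R x = 0 := by
  unfold dualF
  rw [Set.indicator_of_notMem]
  intro h
  exact absurd (abs_le.2 h) (not_le.2 hx)

lemma endgame_small {p Cr : ℝ} (hp : 2 / 3 < p) (hp1 : p ≤ 1) (hCr : 0 < Cr) {r : Fin 3 → ℝ} (hr : ∀ l, 1 < r l) (hr2 : r 2 < 2)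
    {f g F : ℝ → ℂ} (hf : BM f) (hg : BM g) (hF : BM F) (hnf : ¬ f =ᵐ[volume] 0) (hng : ¬ g =ᵐ[volume] 0)
    (hred : Red f g F r Cr) :
    eLpNorm F (ENNReal.ofReal p) volume ≤ ENNReal.ofReal (Cr * csm p) *
      eLpNorm (fun x => Mr f (r 0) x * Mr g (r 1) x) (ENNReal.ofReal p) volume := by
  have hp0 : 0 < p := by linarith
  set m : ℝ → ℝ := fun x => Mr f (r 0) x * Mr g (r 1) x with hm
  have hr0 : 0 < r 0 := by linarith [hr 0]
  have hr1 : 0 < r 1 := by linarith [hr 1]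
  have hmpos : ∀ x, 0 < m x := fun x => mul_pos (Mr_pos hf hr0 hnf x) (Mr_pos hg hr1 hng x)
  have hmm : Measurable m := measurable_Mr.mul measurable_Mr
  set v : ℝ → ℝ := fun x => m x ^ (-(1 - p)) with hv
  have hvm : Measurable v := hmm.pow_const _
  have hvpos : ∀ x, 0 < v x := fun x => Real.rpow_pos_of_pos (hmpos x) _
  set w : ℝ≥0∞ := ∫⁻ x, ENNReal.ofReal (m x ^ p) with hw
  obtain ⟨B, hB⟩ := hF.2
  have hB0 : 0 ≤ B := (norm_nonneg _).trans (hB 0)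
  have hC := csm_pos hp0
  have key : ∫⁻ x, ENNReal.ofReal (‖F x‖ * v x) ≤ ENNReal.ofReal (Cr * csm p) * w := by
    apply lintegral_le_of_Icc
    intro n
    obtain ⟨c1, hc1, h1⟩ := Mr_lower hf hr0 hnf n
    obtain ⟨c2, hc2, h2⟩ := Mr_lower hg hr1 hng n
    have hvb : ∀ x ∈ Set.Icc (-(n:ℝ)) n, v x ≤ (c1 * c2) ^ (-(1 - p)) := by
      intro x hx
      apply Real.rpow_le_rpow_of_nonpos (by positivity) _ (by linarith)
      exact mul_le_mul (h1 x hx) (h2 x hx) hc2.le (Mr_nonneg x)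
    have hbm : BM (dualF F v n) := by
      refine ⟨measurable_dualF hF.1 hvm n, (c1 * c2) ^ (-(1 - p)), fun x => ?_⟩
      by_cases hx : x ∈ Set.Icc (-(n:ℝ)) n
      · exact (norm_dualF_le F v n x (hvpos x).le).trans (hvb x hx)
      · unfold dualF; rw [Set.indicator_of_notMem hx, norm_zero]; positivity
    have hG := grp_small (f := ![f, g, dualF F v n]) (r := r) (p := p) (by intro l; fin_cases l <;> assumption) hr hr2 hp hp1 hnf hng
      (fun x => norm_dualF_le F v n x (hvpos x).le)
    have := hred _ hbm ⟨n, fun x hx => dualF_zero F v n x hx⟩ _ _ _ _ hG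
    rw [enorm_int_dualF hF.1 hvm (fun x => (hvpos x).le) n (B * (c1 * c2) ^ (-(1 - p)))
      (fun x hx => mul_le_mul (hB x) (hvb x hx) (hvpos x).le hB0)] at this
    refine this.trans (le_of_eq ?_)
    rw [ENNReal.ofReal_mul hCr.le, mul_assoc, hw]
    congr 1
    rw [← lintegral_const_mul' _ _ ENNReal.ofReal_ne_top]
    refine lintegral_congr fun x => ?_
    rw [← ENNReal.ofReal_mul hC.le]
    rfl
  have h3 : ∫⁻ x, ‖F x‖ₑ ^ p ≤ ENNReal.ofReal (Cr * csm p) ^ p * w := by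
    calc _ = ∫⁻ x, ENNReal.ofReal (‖F x‖ * v x) ^ p * ENNReal.ofReal (m x ^ p) ^ (1 - p) := by
          refine lintegral_congr fun x => ?_
          have := hmpos x
          rw [ENNReal.ofReal_rpow_of_nonneg (mul_nonneg (norm_nonneg _) (hvpos x).le) hp0.le,
            ENNReal.ofReal_rpow_of_nonneg (by positivity) (by linarith), ← ofReal_norm,
            ENNReal.ofReal_rpow_of_nonneg (by positivity) hp0.le, ← ENNReal.ofReal_mul (by positivity)]
          congr 1
          rw [Real.mul_rpow (norm_nonneg _) (hvpos x).le, hv, ← Real.rpow_mul this.le, ← Real.rpow_mul this.le, mul_assoc,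
            ← Real.rpow_add this]
          ring_nf
          simp
      _ ≤ (∫⁻ x, ENNReal.ofReal (‖F x‖ * v x)) ^ p * w ^ (1 - p) := by
          apply ENNReal.lintegral_mul_norm_pow_le _ _ hp0.le (by linarith) (by ring)
          · exact (hF.1.norm.mul hvm).ennreal_ofReal.aemeasurable
          · exact (hmm.pow_const p).ennreal_ofReal.aemeasurable
      _ ≤ (ENNReal.ofReal (Cr * csm p) * w) ^ p * w ^ (1 - p) := by gcongr
      _ = _ := by
          rw [ENNReal.mul_rpow_of_nonneg _ _ hp0.le, mul_assoc, ← ENNReal.rpow_add_of_nonneg _ _ hp0.le (by linarith)]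
          simp
  have hP0 : ENNReal.ofReal p ≠ 0 := by simpa using hp0
  rw [eLpNorm_eq_lintegral_rpow_enorm_toReal hP0 ENNReal.ofReal_ne_top, eLpNorm_eq_lintegral_rpow_enorm_toReal hP0 ENNReal.ofReal_ne_top,
    ENNReal.toReal_ofReal hp0.le]
  have e : ∫⁻ x, ‖m x‖ₑ ^ p = w := by
    refine lintegral_congr fun x => ?_
    rw [Real.enorm_of_nonneg (hmpos x).le, ENNReal.ofReal_rpow_of_nonneg (hmpos x).le hp0.le]
  rw [e]
  calc _ ≤ (ENNReal.ofReal (Cr * csm p) ^ p * w) ^ (1 / p) := by gcongr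
    _ = _ := by
      rw [ENNReal.mul_rpow_of_nonneg _ _ (by positivity), ← ENNReal.rpow_mul, mul_one_div_cancel hp0.ne', ENNReal.rpow_one]

lemma endgame_big {p q Cr : ℝ} (hpq : p.HolderConjugate q) (hCr : 0 < Cr) {r : Fin 3 → ℝ} (hr : ∀ l, 1 < r l) (hrq : r 2 < q) :
    ∃ D : ℝ, 0 < D ∧ ∀ f g F : ℝ → ℂ, BM f → BM g → BM F → (¬ f =ᵐ[volume] 0) → (¬ g =ᵐ[volume] 0) →
    Red f g F r Cr →
    eLpNorm F (ENNReal.ofReal p) volume ≤ ENNReal.ofReal D *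
      eLpNorm (fun x => Mr f (r 0) x * Mr g (r 1) x) (ENNReal.ofReal p) volume := by
  have hp1 : 1 < p := hpq.lt
  have hp0 : 0 < p := by linarith
  have hq0 : 0 < q := hpq.symm.pos
  have hr20 : 0 < r 2 := by linarith [hr 2]
  obtain ⟨C3, hC3, hmax⟩ := max_eLp hr20 (P := ENNReal.ofReal q) ((ENNReal.ofReal_lt_ofReal_iff hq0).2 hrq)
  have hcp := cp_pos (q := 1) (by norm_num)
  refine ⟨Cr * (cp 1) ^ 3 * C3, by positivity, ?_⟩
  intro f g F hf hg hF hnf hng hred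
  set m : ℝ → ℝ := fun x => Mr f (r 0) x * Mr g (r 1) x with hm
  have hr0 : 0 < r 0 := by linarith [hr 0]
  have hr1 : 0 < r 1 := by linarith [hr 1]
  have hm0 : ∀ x, 0 ≤ m x := fun x => mul_nonneg (Mr_nonneg x) (Mr_nonneg x)
  have hmm : Measurable m := measurable_Mr.mul measurable_Mr
  set D := Cr * (cp 1) ^ 3 * C3 with hD
  set v : ℝ → ℝ := fun x => ‖F x‖ ^ (p - 1) with hv
  have hvm : Measurable v := hF.1.norm.pow_const _
  have hv0 : ∀ x, 0 ≤ v x := fun x => Real.rpow_nonneg (norm_nonneg _) _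
  obtain ⟨B, hB⟩ := hF.2
  have hB0 : 0 ≤ B := (norm_nonneg _).trans (hB 0)
  have hvb : ∀ x, v x ≤ B ^ (p - 1) := fun x => Real.rpow_le_rpow (norm_nonneg _) (hB x) (by linarith)
  have hFv : ∀ x, ‖F x‖ * v x = ‖F x‖ ^ p := by
    intro x
    simp only [hv]
    rcases eq_or_lt_of_le (norm_nonneg (F x)) with h | h
    · rw [← h, Real.zero_rpow hp0.ne']; simp
    · rw [Real.rpow_sub_one h.ne']; field_simp
  have hP0 : ENNReal.ofReal p ≠ 0 := by simpa using hp0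
  have hQ0 : ENNReal.ofReal q ≠ 0 := by simpa using hq0
  set N := eLpNorm m (ENNReal.ofReal p) volume with hN
  have key : ∫⁻ x, ‖F x‖ₑ ^ p ≤ (ENNReal.ofReal D * N) ^ p := by
    apply lintegral_le_of_Icc
    intro n
    set S := ∫⁻ x in Set.Icc (-(n:ℝ)) n, ‖F x‖ₑ ^ p with hS
    set h := dualF F v n with hh
    have hbm : BM h := ⟨measurable_dualF hF.1 hvm n, B ^ (p - 1), fun x => (norm_dualF_le F v n x (hv0 x)).trans (hvb x)⟩
    have eS : ‖∫ x, F x * h x‖ₑ = S := by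
      rw [hh, enorm_int_dualF hF.1 hvm hv0 n (B * B ^ (p - 1)) (fun x _ => mul_le_mul (hB x) (hvb x) (hv0 x) hB0), hS]
      refine lintegral_congr fun x => ?_
      rw [hFv, ← ofReal_norm, ENNReal.ofReal_rpow_of_nonneg (norm_nonneg _) hp0.le]
    have hSf : S ≠ ∞ := by rw [← eS]; exact enorm_ne_top
    by_cases hS0 : S = 0
    · rw [hS0]; exact zero_le
    have hnh : ¬ h =ᵐ[volume] 0 := by
      intro h0
      apply hS0
      rw [← eS]
      have : ∫ x, F x * h x = 0 := by
        rw [← integral_zero ℝ ℂ (μ := volume)]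
        apply integral_congr_ae
        filter_upwards [h0] with x hx
        rw [hx]; simp
      rw [this]; simp
    have hG := grp_big (f := ![f, g, h]) (r := r) (by intro l; fin_cases l <;> assumption) (fun l => by linarith [hr l])
      (by intro l; fin_cases l <;> assumption)
    have h1 := hred _ hbm ⟨n, fun x hx => dualF_zero F v n x hx⟩ _ _ _ _ hG
    rw [eS] at h1
    have h2 : ∫⁻ x, ENNReal.ofReal (∏ l, (cp 1 * Mr (![f, g, h] l) (r l) x)) = ENNReal.ofReal (cp 1 ^ 3) *
        eLpNorm (m • Mr h (r 2)) 1 volume := by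
      rw [eLpNorm_one_eq_lintegral_enorm, ← lintegral_const_mul' _ _ ENNReal.ofReal_ne_top]
      refine lintegral_congr fun x => ?_
      rw [Pi.smul_apply', smul_eq_mul, Real.enorm_of_nonneg (mul_nonneg (hm0 x) (Mr_nonneg x)), ← ENNReal.ofReal_mul (by positivity),
        Fin.prod_univ_three]
      congr 1
      simp only [hm, Matrix.cons_val]
      ring
    have hT : ENNReal.HolderTriple (ENNReal.ofReal p) (ENNReal.ofReal q) 1 := by
      constructor
      rw [← ENNReal.ofReal_inv_of_pos hp0, ← ENNReal.ofReal_inv_of_pos hq0, ← ENNReal.ofReal_add (by positivity) (by positivity),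
        hpq.inv_add_inv_eq_one]
      simp
    have h4 : eLpNorm (m • Mr h (r 2)) 1 volume ≤ N * (ENNReal.ofReal C3 * eLpNorm h (ENNReal.ofReal q) volume) := by
      refine (eLpNorm_smul_le_mul_eLpNorm (p := ENNReal.ofReal p) (q := ENNReal.ofReal q) measurable_Mr.aestronglyMeasurable
        hmm.aestronglyMeasurable).trans ?_
      gcongr
      exact hmax h hbm
    have h5 : eLpNorm h (ENNReal.ofReal q) volume ≤ S ^ (1 / q) := by
      rw [eLpNorm_eq_lintegral_rpow_enorm_toReal hQ0 ENNReal.ofReal_ne_top, ENNReal.toReal_ofReal hq0.le]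
      gcongr
      rw [hS, ← lintegral_indicator measurableSet_Icc]
      apply lintegral_mono
      intro x
      by_cases hx : x ∈ Set.Icc (-(n:ℝ)) n
      · simp only [Set.indicator_of_mem hx]
        rw [← ofReal_norm, ← ofReal_norm, ENNReal.ofReal_rpow_of_nonneg (norm_nonneg _) hp0.le,
          ENNReal.ofReal_rpow_of_nonneg (norm_nonneg _) hq0.le]
        apply ENNReal.ofReal_le_ofReal
        calc ‖h x‖ ^ q ≤ (‖F x‖ ^ (p - 1)) ^ q := by
              gcongr
              exact norm_dualF_le F v n x (hv0 x)
          _ = _ := by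
              rw [← Real.rpow_mul (norm_nonneg _), hpq.sub_one_mul_conj]
      · have : h x = 0 := by rw [hh]; unfold dualF; rw [Set.indicator_of_notMem hx]
        simp [this, hq0]
    have h6 : S ≤ (ENNReal.ofReal D * N) * S ^ (1 / q) := by
      calc S ≤ ENNReal.ofReal Cr * (ENNReal.ofReal (cp 1 ^ 3) * (N * (ENNReal.ofReal C3 * S ^ (1 / q)))) := by
            rw [h2] at h1
            refine h1.trans ?_
            gcongr
            refine h4.trans ?_
            gcongr
        _ = _ := by
            rw [hD, ENNReal.ofReal_mul (by positivity), ENNReal.ofReal_mul hCr.le]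
            ring
    have h7 : S ^ (1 / p) * S ^ (1 / q) = S := by
      rw [← ENNReal.rpow_add _ _ hS0 hSf, one_div, one_div, hpq.inv_add_inv_eq_one, ENNReal.rpow_one]
    have h8 : S ^ (1 / p) ≤ ENNReal.ofReal D * N := by
      rw [← ENNReal.mul_le_mul_iff_left (c := S ^ (1 / q)), h7]
      · exact h6
      · simp [hS0, hSf]
      · exact ENNReal.rpow_ne_top_of_nonneg (by positivity) hSf
    calc S = (S ^ (1 / p)) ^ p := by rw [← ENNReal.rpow_mul, one_div_mul_cancel hp0.ne', ENNReal.rpow_one]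
      _ ≤ _ := by gcongr
  rw [eLpNorm_eq_lintegral_rpow_enorm_toReal hP0 ENNReal.ofReal_ne_top, ENNReal.toReal_ofReal hp0.le]
  calc _ ≤ ((ENNReal.ofReal D * N) ^ p) ^ (1 / p) := by gcongr
    _ = _ := by rw [← ENNReal.rpow_mul, mul_one_div_cancel hp0.ne', ENNReal.rpow_one]

end BHT
end

section
namespace BHT

lemma ofReal_lt_of_inv {r : ℝ} (hr : 0 < r) {P : ℝ≥0∞} (hP : 1 < P) (h : (P⁻¹).toReal < 1 / r) : ENNReal.ofReal r < P := by
  have h1 : P⁻¹ ≠ ∞ := by simpa using (zero_lt_one.trans hP).ne'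
  have h2 : P⁻¹ < ENNReal.ofReal (1 / r) := by
    rw [ENNReal.lt_ofReal_iff_toReal_lt h1]; exact h
  rw [one_div, ENNReal.ofReal_inv_of_pos hr] at h2
  exact ENNReal.inv_lt_inv.1 h2

theorem endgame (p₁ p₂ p₃ : ℝ≥0∞) (h₁ : 1 < p₁) (h₂ : 1 < p₂) (h₃ : 2/3 < p₃) (h₃' : p₃ < ∞)
    (hsum : 1/p₁ + 1/p₂ = 1/p₃) :
    ∃ r : Fin 3 → ℝ, (∀ l, 1 < r l) ∧ (∀ l, r l < 2) ∧ ∑ l, 1 / r l < 2 ∧ ∀ Cr : ℝ, 0 < Cr → ∃ C : ℝ, 0 < C ∧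
      ∀ f g F : ℝ → ℂ, BM f → BM g → BM F → (¬ f =ᵐ[volume] 0) → (¬ g =ᵐ[volume] 0) → Red f g F r Cr →
        eLpNorm F p₃ volume ≤ ENNReal.ofReal C * (eLpNorm f p₁ volume * eLpNorm g p₂ volume) := by
  have hp0 : p₁ ≠ 0 := (zero_lt_one.trans h₁).ne'
  have hq0 : p₂ ≠ 0 := (zero_lt_one.trans h₂).ne'
  set p := p₃.toReal with hp
  have hp3 : p₃ = ENNReal.ofReal p := (ENNReal.ofReal_toReal h₃'.ne).symm
  have hp23 : 2 / 3 < p := by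
    have : (2 / 3 : ℝ≥0∞) = ENNReal.ofReal (2 / 3) := by
      rw [ENNReal.ofReal_div_of_pos (by norm_num)]; norm_num
    rw [this, ENNReal.ofReal_lt_iff_lt_toReal (by norm_num) h₃'.ne] at h₃
    exact h₃
  have hppos : 0 < p := by linarith
  set x := (p₁⁻¹).toReal with hx
  set y := (p₂⁻¹).toReal with hy
  have hx0 : 0 ≤ x := ENNReal.toReal_nonneg
  have hy0 : 0 ≤ y := ENNReal.toReal_nonneg
  have hx1 : x < 1 := by
    rw [hx, ← ENNReal.toReal_one]
    exact ENNReal.toReal_strict_mono (by simp) (ENNReal.inv_lt_one.2 h₁)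
  have hy1 : y < 1 := by
    rw [hy, ← ENNReal.toReal_one]
    exact ENNReal.toReal_strict_mono (by simp) (ENNReal.inv_lt_one.2 h₂)
  have hxy : x + y = 1 / p := by
    rw [one_div, one_div, one_div] at hsum
    rw [hx, hy, ← ENNReal.toReal_add (by simpa using hp0) (by simpa using hq0), hsum, ENNReal.toReal_inv, one_div]
  have hT : ENNReal.HolderTriple p₁ p₂ p₃ := ⟨by simpa [one_div] using hsum⟩
  set z : ℝ := max 0 (1 - 1 / p) with hz
  have hip : 1 / p < 3 / 2 := by rw [div_lt_iff₀ hppos]; linarith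
  have hipp : 0 < 1 / p := by positivity
  obtain ⟨r, hr1, hr2, hrs, hrx⟩ := choose_r ![x, y, z] (by
      intro l
      fin_cases l
      · exact hx1
      · exact hy1
      · exact max_lt (by norm_num) (by linarith)) (by
      rw [Fin.sum_univ_three]
      simp only [Matrix.cons_val]
      rcases le_total x (1 / 2) with a1 | a1 <;> rcases le_total y (1 / 2) with a2 | a2 <;>
        rcases le_total (1 - 1 / p) 0 with a3 | a3 <;> rcases le_total (1 - 1 / p) (1 / 2) with a4 | a4 <;>
        simp only [hz, a1, a2, a3, a4, max_eq_left, max_eq_right] <;>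
        (try rw [max_eq_right (by norm_num : (0:ℝ) ≤ 1 / 2)]) <;> linarith)
  refine ⟨r, hr1, hr2, hrs, fun Cr hCr => ?_⟩
  have hrp : ∀ l, 0 < r l := fun l => by linarith [hr1 l]
  obtain ⟨C1, hC1, hm1⟩ := max_eLp (hrp 0) (ofReal_lt_of_inv (hrp 0) h₁ (hrx 0))
  obtain ⟨C2, hC2, hm2⟩ := max_eLp (hrp 1) (ofReal_lt_of_inv (hrp 1) h₂ (hrx 1))
  have hol : ∀ f g : ℝ → ℂ, BM f → BM g → eLpNorm (fun x => Mr f (r 0) x * Mr g (r 1) x) (ENNReal.ofReal p) volume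
      ≤ ENNReal.ofReal (C1 * C2) * (eLpNorm f p₁ volume * eLpNorm g p₂ volume) := by
    intro f g hf hg
    have h5 := eLpNorm_smul_le_mul_eLpNorm (μ := volume) (p := p₁) (q := p₂) (r := p₃) (f := Mr g (r 1)) (φ := Mr f (r 0))
      measurable_Mr.aestronglyMeasurable measurable_Mr.aestronglyMeasurable
    rw [← hp3]
    refine h5.trans ((mul_le_mul' (hm1 f hf) (hm2 g hg)).trans (le_of_eq ?_))
    rw [ENNReal.ofReal_mul hC1.le]
    ring
  have fin : ∃ D : ℝ, 0 < D ∧ ∀ f g F : ℝ → ℂ, BM f → BM g → BM F → (¬ f =ᵐ[volume] 0) → (¬ g =ᵐ[volume] 0) →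
    Red f g F r Cr →
    eLpNorm F (ENNReal.ofReal p) volume ≤ ENNReal.ofReal D *
      eLpNorm (fun x => Mr f (r 0) x * Mr g (r 1) x) (ENNReal.ofReal p) volume := by
    by_cases hle : p ≤ 1
    · exact ⟨Cr * csm p, mul_pos hCr (csm_pos hppos), fun f g F hf hg hF hnf hng hred =>
        endgame_small hp23 hle hCr hr1 (hr2 2) hf hg hF hnf hng hred⟩
    · push Not at hle
      have hpq : p.HolderConjugate (Real.conjExponent p) := Real.HolderConjugate.conjExponent hle
      refine endgame_big hpq hCr hr1 ?_
      have h6 : 1 - 1 / p < 1 / r 2 := lt_of_le_of_lt (le_max_right _ _) (hrx 2)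
      have h7 : 1 - 1 / p = 1 / Real.conjExponent p := by
        have := hpq.inv_add_inv_eq_one
        rw [one_div, one_div]; linarith
      rw [h7] at h6
      exact (one_div_lt_one_div hpq.symm.pos (hrp 2)).1 h6
  obtain ⟨D, hD, hfin⟩ := fin
  refine ⟨D * (C1 * C2), by positivity, fun f g F hf hg hF hnf hng hred => ?_⟩
  rw [hp3, ENNReal.ofReal_mul hD.le, mul_assoc]
  exact (hfin f g F hf hg hF hnf hng hred).trans (by gcongr; exact hol f g hf hg)

end BHT
end

section
namespace BHT

/-! ### Bump functions and kernels -/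

lemma four_eq (f : ℝ → ℂ) (w : ℝ) : 𝓕 f w = ∫ v, f v * E (-(v * w)) := by
  rw [Real.fourier_real_eq_integral_exp_smul]
  congr 1; ext v
  rw [smul_eq_mul, mul_comm]; unfold E; congr 2; push_cast; ring

lemma fourInv_eq (f : ℝ → ℂ) (w : ℝ) : 𝓕⁻ f w = ∫ v, f v * E (v * w) := by
  rw [Real.fourierInv_eq_fourier_neg, four_eq]
  congr 1; ext v; congr 2; ring

lemma schwartz_inv (f : 𝓢(ℝ, ℂ)) (x : ℝ) : f x = ∫ ξ, (𝓕 f) ξ * E (ξ * x) := by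
  have h : 𝓕⁻ (𝓕 f) = f := FourierTransform.fourierInv_fourier_eq f
  conv_lhs => rw [← h]
  rw [SchwartzMap.fourierInv_coe, fourInv_eq]

lemma schwartz_decay (f : 𝓢(ℝ, ℂ)) : ∃ C : ℝ, 0 < C ∧ ∀ x, ‖f x‖ ≤ C * ((1 + x ^ 2) ^ 4)⁻¹ := by
  have h := fun x => one_add_le_sup_seminorm_apply (𝕜 := ℝ) (m := (8, 0)) (k := 8) (n := 0) le_rfl le_rfl f x
  set C := (2:ℝ) ^ 8 * (Finset.Iic ((8 : ℕ), (0 : ℕ))).sup (fun m => SchwartzMap.seminorm ℝ m.1 m.2) f with hC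
  have hC0 : 0 ≤ C := le_trans (by positivity) (h 0)
  refine ⟨C + 1, by linarith, fun x => ?_⟩
  have h1 := h x
  rw [norm_iteratedFDeriv_zero] at h1
  have h2 : (1 + x ^ 2) ^ 4 ≤ (1 + ‖x‖) ^ 8 := by
    have : 1 + x ^ 2 ≤ (1 + ‖x‖) ^ 2 := by
      rw [Real.norm_eq_abs]; nlinarith [sq_abs x, abs_nonneg x]
    calc (1 + x ^ 2) ^ 4 ≤ ((1 + ‖x‖) ^ 2) ^ 4 := pow_le_pow_left₀ (by positivity) this 4
      _ = _ := by ring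
  rw [← div_eq_mul_inv, le_div_iff₀ (by positivity), mul_comm]
  calc (1 + x ^ 2) ^ 4 * ‖f x‖ ≤ (1 + ‖x‖) ^ 8 * ‖f x‖ := by gcongr
    _ ≤ C := h1
    _ ≤ C + 1 := by linarith

structure Bump (Φ : ℝ → ℝ) (φ φ' : ℝ → ℂ) (a C : ℝ) : Prop where
  apos : 0 < a
  Cpos : 0 < C
  cont : Continuous Φ
  nonneg : ∀ z, 0 ≤ Φ z
  le_one : ∀ z, Φ z ≤ 1
  zero : Φ 0 = 1
  supp : ∀ z, a ≤ |z| → Φ z = 0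
  phi_cont : Continuous φ
  phi_decay : ∀ z, ‖φ z‖ ≤ C * ((1 + z ^ 2) ^ 4)⁻¹
  phi_deriv : ∀ z, HasDerivAt φ (φ' z) z
  phi_decay' : ∀ z, ‖φ' z‖ ≤ C * ((1 + z ^ 2) ^ 4)⁻¹
  inv : ∀ z, ∫ w, φ w * E (w * z) = Φ z
  four : ∀ w, φ w = ∫ z, (Φ z : ℂ) * E (-(z * w))

lemma exists_bump (a : ℝ) (ha : 0 < a) : ∃ Φ φ φ' C, Bump Φ φ φ' a C := by
  let B : ContDiffBump (0 : ℝ) := ⟨a / 2, a, by linarith, by linarith⟩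
  have h2 : ContDiff ℝ (⊤ : ℕ∞) (fun z => ((B z : ℝ) : ℂ)) := Complex.ofRealCLM.contDiff.comp B.contDiff
  have h1 : HasCompactSupport (fun z => ((B z : ℝ) : ℂ)) :=
    B.hasCompactSupport.comp_left (g := fun r : ℝ => (r : ℂ)) (by simp)
  let S : 𝓢(ℝ, ℂ) := h1.toSchwartzMap h2
  have hS : ∀ z, S z = ((B z : ℝ) : ℂ) := fun z => rfl
  obtain ⟨C1, hC1, hd1⟩ := schwartz_decay (𝓕 S)
  obtain ⟨C2, hC2, hd2⟩ := schwartz_decay (derivCLM ℝ ℂ (𝓕 S))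
  refine ⟨B, ⇑(𝓕 S : 𝓢(ℝ, ℂ)), derivCLM ℝ ℂ (𝓕 S), C1 + C2, ha, by linarith, B.continuous, fun z => B.nonneg, fun z => B.le_one,
    ?_, ?_, (𝓕 S).continuous, ?_, ?_, ?_, ?_, ?_⟩
  · exact B.one_of_mem_closedBall (by simp; exact (show (0:ℝ) < a / 2 by linarith).le)
  · intro z hz
    exact B.zero_of_le_dist (by simpa [Real.dist_eq] using hz)
  · intro z; refine (hd1 z).trans ?_
    gcongr; linarith
  · intro z; exact (𝓕 S).differentiableAt.hasDerivAt
  · intro z; refine (hd2 z).trans ?_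
    gcongr; linarith
  · intro z; rw [← schwartz_inv S z, hS]
  · intro w; rw [SchwartzMap.fourier_coe, four_eq]; rfl

variable {Φ : ℝ → ℝ} {φ φ' : ℝ → ℂ} {a C : ℝ}

noncomputable def kk (φ : ℝ → ℂ) (t m u : ℝ) : ℂ := (t⁻¹ : ℝ) * φ (u / t) * E (m * u)

lemma Bump.kk_cont (h : Bump Φ φ φ' a C) (t m : ℝ) : Continuous (kk φ t m) := by
  unfold kk
  have := h.phi_cont
  have := continuous_E
  fun_prop

lemma Bump.kk_le (h : Bump Φ φ φ' a C) {t : ℝ} (ht : 0 < t) (m u : ℝ) :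
    ‖kk φ t m u‖ ≤ C * (t⁻¹ * ((rho 0 t u) ^ 4)⁻¹) := by
  unfold kk rho
  rw [norm_mul, norm_mul, norm_E, mul_one, Complex.norm_real, Real.norm_of_nonneg (inv_nonneg.2 ht.le), sub_zero]
  have := mul_le_mul_of_nonneg_left (h.phi_decay (u / t)) (inv_nonneg.2 ht.le)
  linarith

lemma Bump.kk_int (h : Bump Φ φ φ' a C) {t : ℝ} (ht : 0 < t) (m : ℝ) : Integrable (kk φ t m) := by
  apply (((integrable_inv_rho_pow 0 ht (n := 4) (by norm_num)).const_mul t⁻¹).const_mul C).mono'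
    (h.kk_cont t m).aestronglyMeasurable
  filter_upwards with u using h.kk_le ht m u

lemma Bump.kk_four (h : Bump Φ φ φ' a C) {t : ℝ} (ht : 0 < t) (m ν : ℝ) :
    ∫ u, kk φ t m u * E (u * ν) = Φ (t * (m + ν)) := by
  rw [← h.inv]
  have h2 := Measure.integral_comp_div (fun w : ℝ => φ w * E (w * (t * (m + ν)))) t
  rw [abs_of_pos ht] at h2
  have h3 : ∀ u, kk φ t m u * E (u * ν) = (t⁻¹ : ℂ) * (φ (u / t) * E (u / t * (t * (m + ν)))) := by
    intro u
    have : u / t * (t * (m + ν)) = m * u + u * ν := by field_simp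
    rw [this, E_add]; unfold kk; push_cast; ring
  simp_rw [h3]
  rw [integral_const_mul, h2, Complex.real_smul, ← mul_assoc, inv_mul_cancel₀ (by exact_mod_cast ht.ne'), one_mul]

lemma Bump.kk_four_sub (h : Bump Φ φ φ' a C) {t : ℝ} (ht : 0 < t) (m ν y : ℝ) :
    ∫ x, kk φ t m (y - x) * E (-(x * ν)) = E (-(y * ν)) * Φ (t * (m + ν)) := by
  rw [← h.kk_four ht, ← integral_const_mul,
    ← integral_sub_left_eq_self (fun u => E (-(y * ν)) * (kk φ t m u * E (u * ν))) volume y]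
  congr 1; ext x
  have : -(x * ν) = -(y * ν) + (y - x) * ν := by ring
  rw [this, E_add]; ring

end BHT
end

section
namespace BHT

variable {Φ : ℝ → ℝ} {φ φ' : ℝ → ℂ} {a C : ℝ}

/-- the wave packets -/
noncomputable def wp (φ : ℝ → ℂ) (s u θ e : ℝ) (P : Tile) (x : ℝ) : ℂ :=
  kk φ (dL P.1 * s) (e * fr θ P) (dL P.1 * (P.1.2 + u) - x)

lemma dR_le_rho {s u : ℝ} (hs1 : 1 ≤ s) (hs2 : s ≤ 2) (hu0 : 0 ≤ u) (hu1 : u ≤ 1) (J : DI) (x : ℝ) :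
    dR J x ≤ 10 * rho 0 (dL J * s) (dL J * (J.2 + u) - x) := by
  have hL := dL_pos J
  have h1 := peetre (u - 1 / 2) ((x - dL J * (J.2 + u)) / dL J)
  have e1 : u - 1 / 2 + (x - dL J * (J.2 + u)) / dL J = (x - dC J) / dL J := by
    have : dC J = dL J * (J.2 + 1 / 2) := rfl
    rw [this]; field_simp; ring
  rw [e1] at h1
  have h2 : ((x - dL J * (J.2 + u)) / dL J) ^ 2 ≤ 4 * ((dL J * (J.2 + u) - x - 0) / (dL J * s)) ^ 2 := by
    set w := (x - dL J * (J.2 + u)) / dL J with hw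
    have e2 : ((dL J * (J.2 + u) - x - 0) / (dL J * s)) ^ 2 = w ^ 2 / s ^ 2 := by
      rw [hw, div_pow, div_pow, div_div, ← mul_pow]; congr 1; ring
    rw [e2, ← mul_div_assoc, le_div_iff₀ (by positivity)]
    have : s ^ 2 ≤ 4 := by nlinarith
    nlinarith [mul_le_mul_of_nonneg_left this (sq_nonneg w)]
  have h3 : (u - 1 / 2) ^ 2 ≤ 1 / 4 := by nlinarith
  have h4 : dR J x = 1 + ((x - dC J) / dL J) ^ 2 := rfl
  rw [h4]
  unfold rho
  set A := ((x - dL J * (J.2 + u)) / dL J) ^ 2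
  set B := ((dL J * (J.2 + u) - x - 0) / (dL J * s)) ^ 2
  have hA : 0 ≤ A := sq_nonneg _
  nlinarith

lemma dR_near {J : DI} {x z : ℝ} (h : |x - z| ≤ dL J) : dR J x ≤ 4 * dR J z := by
  have hL := dL_pos J
  have h1 := peetre ((z - dC J) / dL J) ((x - z) / dL J)
  have e1 : (z - dC J) / dL J + (x - z) / dL J = (x - dC J) / dL J := by ring
  rw [e1] at h1
  have h2 : ((x - z) / dL J) ^ 2 ≤ 1 := by
    rw [sq_le_one_iff_abs_le_one, abs_div, abs_of_pos hL]
    exact (div_le_one hL).2 h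
  have h4 : dR J x = 1 + ((x - dC J) / dL J) ^ 2 := rfl
  have h5 : dR J z = 1 + ((z - dC J) / dL J) ^ 2 := rfl
  rw [h4, h5]
  nlinarith [sq_nonneg ((z - dC J) / dL J)]

lemma inv_rho_le_dR {s u : ℝ} (hs1 : 1 ≤ s) (hs2 : s ≤ 2) (hu0 : 0 ≤ u) (hu1 : u ≤ 1) (J : DI) (x : ℝ) :
    ((rho 0 (dL J * s) (dL J * (J.2 + u) - x)) ^ 4)⁻¹ ≤ 10 ^ 4 * ((dR J x) ^ 4)⁻¹ := by
  have h := dR_le_rho hs1 hs2 hu0 hu1 J x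
  have h1 : (dR J x) ^ 4 ≤ 10 ^ 4 * (rho 0 (dL J * s) (dL J * (J.2 + u) - x)) ^ 4 := by
    rw [← mul_pow]; exact pow_le_pow_left₀ (dR_pos _ _).le h 4
  rw [← div_eq_mul_inv, le_div_iff₀ (pow_pos (dR_pos _ _) _), ← div_eq_inv_mul,
    div_le_iff₀ (pow_pos (rho_pos _ _ _) _)]
  exact h1

lemma wp_decay (h : Bump Φ φ φ' a C) {s u : ℝ} (hs1 : 1 ≤ s) (hs2 : s ≤ 2) (hu0 : 0 ≤ u) (hu1 : u ≤ 1) (θ e : ℝ)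
    (P : Tile) (x : ℝ) : ‖wp φ s u θ e P x‖ ≤ C * 10 ^ 4 * ((dL P.1)⁻¹ * ((dR P.1 x) ^ 4)⁻¹) := by
  have hL := dL_pos P.1
  have hC := h.Cpos
  have h1 := h.kk_le (t := dL P.1 * s) (by positivity) (e * fr θ P) (dL P.1 * (P.1.2 + u) - x)
  refine h1.trans ?_
  have h2 := inv_rho_le_dR hs1 hs2 hu0 hu1 P.1 x
  have h3 : (dL P.1 * s)⁻¹ ≤ (dL P.1)⁻¹ := inv_anti₀ hL (by nlinarith)
  calc C * ((dL P.1 * s)⁻¹ * ((rho 0 (dL P.1 * s) (dL P.1 * (P.1.2 + u) - x)) ^ 4)⁻¹)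
      ≤ C * ((dL P.1)⁻¹ * (10 ^ 4 * ((dR P.1 x) ^ 4)⁻¹)) := by
        have := pow_pos (rho_pos 0 (dL P.1 * s) (dL P.1 * (P.1.2 + u) - x)) 4
        gcongr
    _ = _ := by ring

lemma hasDerivAt_E_lin (A B x : ℝ) : HasDerivAt (fun x : ℝ => E (A + B * x)) (2 * π * B * Complex.I * E (A + B * x)) x := by
  have h1 : HasDerivAt (fun x : ℝ => (2 * π * ((A + B * x : ℝ) : ℂ) * Complex.I : ℂ)) (2 * π * B * Complex.I) x := by
    have : HasDerivAt (fun x : ℝ => A + B * x) B x := by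
      simpa using ((hasDerivAt_id x).const_mul B).const_add A
    exact ((this.ofReal_comp.const_mul (2 * π : ℂ)).mul_const Complex.I)
  have h2 := h1.cexp
  unfold E
  convert h2 using 1
  ring

lemma wp_deriv (h : Bump Φ φ φ' a C) {s u : ℝ} (hs1 : 1 ≤ s) (hs2 : s ≤ 2) (hu0 : 0 ≤ u) (hu1 : u ≤ 1) (θ e K ξ : ℝ)
    (P : Tile) (hξ : |dL P.1 * ξ - P.2 - θ| ≤ K) (z : ℝ) :
    ∃ D, HasDerivAt (fun x => wp φ s u θ e P x * E (e * ξ * x)) D z ∧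
      ‖D‖ ≤ (dL P.1)⁻¹ * (dL P.1)⁻¹ * (C * (1 + 2 * π * |e| * K) * (10 ^ 4 * ((dR P.1 z) ^ 4)⁻¹)) := by
  have hL := dL_pos P.1
  have hC := h.Cpos
  set L := dL P.1 with hLd
  set t := L * s with ht
  have htp : 0 < t := by positivity
  set y := L * (P.1.2 + u) with hy
  set m := e * fr θ P with hm
  have hE : ∀ x, wp φ s u θ e P x * E (e * ξ * x) = (t⁻¹ : ℝ) * (φ ((y - x) / t) * E (m * y + (e * ξ - m) * x)) := by
    intro x
    have : m * y + (e * ξ - m) * x = m * (y - x) + e * ξ * x := by ring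
    rw [this, E_add]; unfold wp kk; ring
  have hd1 : HasDerivAt (fun x : ℝ => (y - x) / t) (-(t⁻¹)) z := by
    have := ((hasDerivAt_id z).const_sub y).div_const t
    simpa [neg_div] using this
  have hd2 : HasDerivAt (fun x => φ ((y - x) / t)) ((-(t⁻¹) : ℝ) • φ' ((y - z) / t)) z :=
    (h.phi_deriv ((y - z) / t)).scomp z hd1
  have hd3 := (hd2.mul (hasDerivAt_E_lin (m * y) (e * ξ - m) z)).const_mul ((t⁻¹ : ℝ) : ℂ)
  have hd4 := hd3.congr_of_eventuallyEq (f₁ := fun x => wp φ s u θ e P x * E (e * ξ * x))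
    (Eventually.of_forall hE)
  refine ⟨_, hd4, ?_⟩
  · have hr := inv_rho_le_dR hs1 hs2 hu0 hu1 P.1 z
    have hr' : (1 + ((y - z) / t) ^ 2) = rho 0 t (y - z) := by unfold rho; rw [sub_zero]
    set Q := 10 ^ 4 * ((dR P.1 z) ^ 4)⁻¹ with hQ
    have hQ0 : 0 ≤ Q := by have := dR_pos P.1 z; positivity
    have ha1 : ‖φ ((y - z) / t)‖ ≤ C * Q := (h.phi_decay _).trans (by rw [hr']; gcongr)
    have ha2 : ‖φ' ((y - z) / t)‖ ≤ C * Q := (h.phi_decay' _).trans (by rw [hr']; gcongr)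
    have hti : t⁻¹ ≤ L⁻¹ := inv_anti₀ hL (by rw [ht]; nlinarith)
    have hti0 : 0 ≤ t⁻¹ := inv_nonneg.2 htp.le
    have hfm : |e * ξ - m| ≤ |e| * K * L⁻¹ := by
      have : e * ξ - m = e * ((L * ξ - P.2 - θ) * L⁻¹) := by
        rw [hm]; unfold fr; rw [← hLd]; field_simp; ring
      rw [this, abs_mul, abs_mul, abs_of_pos (inv_pos.2 hL), mul_assoc]
      gcongr
    have hK : 0 ≤ K := (abs_nonneg _).trans hξ
    rw [norm_mul, Complex.norm_real, Real.norm_of_nonneg hti0]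
    have n1 : ‖(-(t⁻¹) : ℝ) • φ' ((y - z) / t) * E (m * y + (e * ξ - m) * z)‖ ≤ L⁻¹ * (C * Q) := by
      rw [norm_mul, norm_E, mul_one, norm_smul, norm_neg, Real.norm_of_nonneg hti0]
      gcongr
    have n2 : ‖φ ((y - z) / t) * (2 * π * ((e * ξ - m : ℝ) : ℂ) * Complex.I * E (m * y + (e * ξ - m) * z))‖
        ≤ C * Q * (2 * π * (|e| * K * L⁻¹)) := by
      rw [norm_mul, norm_mul, norm_mul, norm_mul, norm_mul, norm_E, Complex.norm_I, Complex.norm_real, Complex.norm_real,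
        Real.norm_of_nonneg Real.pi_pos.le, Real.norm_eq_abs, mul_one, mul_one, Complex.norm_ofNat]
      have := Real.pi_pos
      gcongr
    calc t⁻¹ * ‖_‖ ≤ L⁻¹ * (L⁻¹ * (C * Q) + C * Q * (2 * π * (|e| * K * L⁻¹))) := by
          gcongr
          exact (norm_add_le _ _).trans (add_le_add n1 n2)
      _ = _ := by ring

lemma wp_lip (h : Bump Φ φ φ' a C) {s u : ℝ} (hs1 : 1 ≤ s) (hs2 : s ≤ 2) (hu0 : 0 ≤ u) (hu1 : u ≤ 1) (θ e K ξ : ℝ)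
    (P : Tile) (hξ : |dL P.1 * ξ - P.2 - θ| ≤ K) (x y : ℝ) (hxy : |x - y| ≤ dL P.1) :
    ‖wp φ s u θ e P x * E (e * ξ * x) - wp φ s u θ e P y * E (e * ξ * y)‖ ≤
      C * (1 + 2 * π * |e| * K) * 40 ^ 4 * (|x - y| / dL P.1) * ((dL P.1)⁻¹ * ((dR P.1 x) ^ 4)⁻¹) := by
  have hL := dL_pos P.1
  have hC := h.Cpos
  have hK : 0 ≤ K := (abs_nonneg _).trans hξ
  choose D hD hDb using fun z => wp_deriv h hs1 hs2 hu0 hu1 θ e K ξ P hξ z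
  have hπ := Real.pi_pos
  have hx := dR_pos P.1 x
  set B := (dL P.1)⁻¹ * (dL P.1)⁻¹ * (C * (1 + 2 * π * |e| * K) * (40 ^ 4 * ((dR P.1 x) ^ 4)⁻¹)) with hB
  have hb : ∀ z ∈ Set.uIcc y x, ‖D z‖ ≤ B := by
    intro z hz
    refine (hDb z).trans ?_
    have hzx : |x - z| ≤ dL P.1 := by
      have := Set.abs_sub_right_of_mem_uIcc hz
      exact this.trans hxy
    have h1 := dR_near hzx
    have h2 : (dR P.1 x) ^ 4 ≤ 4 ^ 4 * (dR P.1 z) ^ 4 := by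
      rw [← mul_pow]; exact pow_le_pow_left₀ hx.le h1 4
    have h3 : ((dR P.1 z) ^ 4)⁻¹ ≤ 4 ^ 4 * ((dR P.1 x) ^ 4)⁻¹ := by
      rw [← div_eq_mul_inv, le_div_iff₀ (pow_pos hx _), ← div_eq_inv_mul,
        div_le_iff₀ (pow_pos (dR_pos _ _) _)]
      exact h2
    rw [hB]
    have : 10 ^ 4 * ((dR P.1 z) ^ 4)⁻¹ ≤ 40 ^ 4 * ((dR P.1 x) ^ 4)⁻¹ := by
      calc 10 ^ 4 * ((dR P.1 z) ^ 4)⁻¹ ≤ 10 ^ 4 * (4 ^ 4 * ((dR P.1 x) ^ 4)⁻¹) := by gcongr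
        _ = _ := by ring
    gcongr
  have := (convex_uIcc y x).norm_image_sub_le_of_norm_hasDerivWithin_le
    (fun z _ => (hD z).hasDerivWithinAt) hb (Set.left_mem_uIcc) (Set.right_mem_uIcc)
  refine this.trans (le_of_eq ?_)
  rw [hB, Real.norm_eq_abs]
  ring

end BHT
end

section
namespace BHT

variable {Φ : ℝ → ℝ} {φ φ' : ℝ → ℂ} {a C : ℝ}

lemma moment_int {q : ℝ → ℂ} (hq : Continuous q) {B y t : ℝ} (ht : 0 < t)
    (hb : ∀ x, ‖q x‖ ≤ B * ((rho y t x) ^ 4)⁻¹) {n : ℕ} (hn : n ≤ 4) : Integrable (fun x => x ^ n • q x) := by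
  set M := 2 * (1 + y ^ 2) * (1 + t ^ 2) with hM
  have hB : 0 ≤ B := by
    have h0 := (norm_nonneg _).trans (hb 0)
    exact nonneg_of_mul_nonneg_left h0 (inv_pos.2 (pow_pos (rho_pos _ _ _) _))
  have hM0 : 0 < M := by positivity
  apply ((integrable_inv_rho_pow y ht (n := 2) (by norm_num)).const_mul (B * M ^ 2)).mono'
  · exact (by fun_prop : Continuous (fun x => x ^ n • q x)).aestronglyMeasurable
  · filter_upwards with x
    have hr := rho_pos y t x
    have h1 : 1 + x ^ 2 ≤ M * rho y t x := by
      have h := peetre y (x - y)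
      have e : y + (x - y) = x := by ring
      rw [e] at h
      have h2 : 1 + (x - y) ^ 2 ≤ (1 + t ^ 2) * rho y t x := by
        unfold rho
        have : (x - y) ^ 2 = t ^ 2 * ((x - y) / t) ^ 2 := by field_simp
        nlinarith [sq_nonneg ((x - y) / t), sq_nonneg t]
      calc 1 + x ^ 2 ≤ 2 * (1 + y ^ 2) * (1 + (x - y) ^ 2) := h
        _ ≤ 2 * (1 + y ^ 2) * ((1 + t ^ 2) * rho y t x) := by gcongr
        _ = _ := by rw [hM]; ring
    have h2 : |x| ^ n ≤ (M * rho y t x) ^ 2 := by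
      have ha : |x| ≤ 1 + x ^ 2 := by nlinarith [sq_abs x, sq_nonneg (|x| - 1), abs_nonneg x]
      have h3 : |x| ^ n ≤ (1 + x ^ 2) ^ 2 := by
        rcases le_or_gt |x| 1 with hx | hx
        · exact (pow_le_one₀ (abs_nonneg _) hx).trans (one_le_pow₀ (by nlinarith [sq_nonneg x]))
        · calc |x| ^ n ≤ |x| ^ 4 := pow_le_pow_right₀ hx.le hn
            _ = (x ^ 2) ^ 2 := by rw [← sq_abs x]; ring
            _ ≤ (1 + x ^ 2) ^ 2 := by gcongr; linarith
      exact h3.trans (pow_le_pow_left₀ (by positivity) h1 2)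
    rw [norm_smul, norm_pow, Real.norm_eq_abs]
    calc |x| ^ n * ‖q x‖ ≤ (M * rho y t x) ^ 2 * (B * ((rho y t x) ^ 4)⁻¹) := by
          gcongr; exact hb x
      _ = _ := by field_simp

lemma moment_zero {q : ℝ → ℂ} (hq : Continuous q) {B y t : ℝ} (ht : 0 < t)
    (hb : ∀ x, ‖q x‖ ≤ B * ((rho y t x) ^ 4)⁻¹) (hF : 𝓕 q =ᶠ[nhds 0] fun _ => 0) {n : ℕ} (hn : n ≤ 4) :
    ∫ x, ((x ^ n : ℝ) : ℂ) * q x = 0 := by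
  have h1 := Real.iteratedDeriv_fourier (f := q) (N := 4) (n := n)
    (fun k hk => moment_int hq ht hb (by exact_mod_cast hk)) (by exact_mod_cast hn)
  have h2 : iteratedDeriv n (𝓕 q) 0 = 0 := by
    rw [hF.iteratedDeriv_eq n]; simp
  rw [h1, four_eq] at h2
  have h3 : ∀ v : ℝ, ((-2 * π * Complex.I * v) ^ n • q v) * E (-(v * 0)) =
      (-2 * π * Complex.I : ℂ) ^ n * (((v ^ n : ℝ) : ℂ) * q v) := by
    intro v
    rw [mul_zero, neg_zero, E_zero, mul_one, smul_eq_mul, mul_pow]; push_cast; ring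
  simp_rw [h3] at h2
  rw [integral_const_mul] at h2
  have h4 : (-2 * π * Complex.I : ℂ) ^ n ≠ 0 := by
    apply pow_ne_zero
    simp [Real.pi_ne_zero]
  exact (mul_eq_zero.1 h2).resolve_left h4

lemma weight_zero {q : ℝ → ℂ} (hq : Continuous q) {B y t : ℝ} (ht : 0 < t)
    (hb : ∀ x, ‖q x‖ ≤ B * ((rho y t x) ^ 4)⁻¹) (hF : 𝓕 q =ᶠ[nhds 0] fun _ => 0) (c R : ℝ) :
    ∫ x, q x * ((rho c R x) ^ 2 : ℝ) = 0 := by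
  set cf : ℕ → ℝ := fun n => if n = 0 then (1 + c ^ 2 * R⁻¹ ^ 2) ^ 2 else if n = 1 then 2 * (1 + c ^ 2 * R⁻¹ ^ 2) * (-2 * c * R⁻¹ ^ 2)
    else if n = 2 then (-2 * c * R⁻¹ ^ 2) ^ 2 + 2 * (1 + c ^ 2 * R⁻¹ ^ 2) * R⁻¹ ^ 2 else if n = 3 then 2 * (-2 * c * R⁻¹ ^ 2) * R⁻¹ ^ 2
    else R⁻¹ ^ 4 with hcf
  have h1 : ∀ x, q x * ((rho c R x) ^ 2 : ℝ) = ∑ n ∈ Finset.range 5, (cf n : ℂ) * (((x ^ n : ℝ) : ℂ) * q x) := by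
    intro x
    have : (rho c R x) ^ 2 = ∑ n ∈ Finset.range 5, cf n * x ^ n := by
      simp only [Finset.sum_range_succ, hcf, Finset.sum_range_zero]
      norm_num
      unfold rho
      rw [div_eq_mul_inv]
      ring
    rw [this]; push_cast
    rw [Finset.mul_sum]
    exact Finset.sum_congr rfl fun n _ => by ring
  simp_rw [h1]
  rw [integral_finsetSum]
  · apply Finset.sum_eq_zero
    intro n hn
    rw [integral_const_mul, moment_zero hq ht hb hF (by have := Finset.mem_range.1 hn; omega), mul_zero]
  · intro n hn
    apply Integrable.const_mul
    have := moment_int hq ht hb (n := n) (by have := Finset.mem_range.1 hn; omega)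
    simpa [Complex.real_smul] using this

lemma conj_E (z : ℝ) : (starRingEnd ℂ) (E z) = E (-z) := by
  unfold E; rw [← Complex.exp_conj]; congr 1
  simp only [map_mul, Complex.conj_ofReal, Complex.conj_I, map_ofNat]
  push_cast; ring

lemma Bump.phi_int (h : Bump Φ φ φ' a C) : Integrable (fun z => (Φ z : ℂ)) := by
  have : HasCompactSupport Φ := by
    apply HasCompactSupport.of_support_subset_isCompact (isCompact_Icc (a := -a) (b := a))
    intro z hz
    by_contra hn
    apply hz
    apply h.supp
    by_contra hlt
    push Not at hlt
    exact hn ⟨(abs_lt.1 hlt).1.le, (abs_lt.1 hlt).2.le⟩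
  exact (h.cont.integrable_of_hasCompactSupport this).ofReal

/-- Fourier support separation -/
lemma kk_orth (h : Bump Φ φ φ' a C) {t t' m m' y y' : ℝ} (ht : 0 < t) (ht' : 0 < t')
    (hsep : a * t⁻¹ + a * t'⁻¹ < |m - m'|) (c R : ℝ) :
    ∫ x, kk φ t m (y - x) * (starRingEnd ℂ) (kk φ t' m' (y' - x)) * ((rho c R x) ^ 2 : ℝ) = 0 := by
  have hC := h.Cpos
  have hc1 : Continuous fun x => kk φ t m (y - x) := (h.kk_cont t m).comp (by fun_prop)
  have hc2 : Continuous fun x => kk φ t' m' (y' - x) := (h.kk_cont t' m').comp (by fun_prop)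
  have hrr : ∀ x, rho 0 t (y - x) = rho y t x := by
    intro x; unfold rho; rw [sub_zero, div_pow, div_pow]; congr 2; ring
  have hb1 : ∀ x, ‖kk φ t m (y - x)‖ ≤ C * t⁻¹ * ((rho y t x) ^ 4)⁻¹ := by
    intro x
    have := h.kk_le ht m (y - x)
    rw [hrr] at this; linarith
  have hb2 : ∀ x, ‖kk φ t' m' (y' - x)‖ ≤ C * t'⁻¹ := by
    intro x
    refine (h.kk_le ht' m' (y' - x)).trans ?_
    gcongr
    have : ((rho 0 t' (y' - x)) ^ 4)⁻¹ ≤ 1 := inv_le_one_of_one_le₀ (one_le_pow₀ (one_le_rho _ _ _))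
    calc t'⁻¹ * ((rho 0 t' (y' - x)) ^ 4)⁻¹ ≤ t'⁻¹ * 1 := by gcongr
      _ = t'⁻¹ := mul_one _
  have hcq : Continuous fun x => kk φ t m (y - x) * (starRingEnd ℂ) (kk φ t' m' (y' - x)) :=
    hc1.mul (Complex.continuous_conj.comp hc2)
  apply weight_zero hcq ht (B := C * t⁻¹ * (C * t'⁻¹)) (y := y)
  · intro x
    rw [norm_mul, RCLike.norm_conj]
    have h1 := hb1 x
    have h2 := hb2 x
    have hr := rho_pos y t x
    calc ‖kk φ t m (y - x)‖ * ‖kk φ t' m' (y' - x)‖ ≤ (C * t⁻¹ * ((rho y t x) ^ 4)⁻¹) * (C * t'⁻¹) := by gcongr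
      _ = _ := by ring
  · have hδ : 0 < |m - m'| - (a * t⁻¹ + a * t'⁻¹) := by linarith
    filter_upwards [Metric.ball_mem_nhds (0:ℝ) hδ] with ζ hζ
    rw [Metric.mem_ball, Real.dist_eq, sub_zero] at hζ
    rw [four_eq]
    have hconj : ∀ x, (starRingEnd ℂ) (kk φ t' m' (y' - x)) =
        ∫ ξ, ((t'⁻¹ : ℝ) : ℂ) * ((Φ ξ : ℂ) * E (ξ / t' * (y' - x)) * E (-(m' * (y' - x)))) := by
      intro x
      unfold kk
      rw [map_mul, map_mul, conj_E, Complex.conj_ofReal, h.four, ← integral_conj, integral_const_mul, mul_assoc,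
        integral_mul_const]
      congr 3
      ext ξ
      rw [map_mul, conj_E, Complex.conj_ofReal]
      congr 2; ring
    have hE : ∀ x ξ : ℝ, kk φ t m (y - x) * (((t'⁻¹ : ℝ) : ℂ) * ((Φ ξ : ℂ) * E (ξ / t' * (y' - x)) * E (-(m' * (y' - x))))) * E (-(x * ζ))
        = ((t'⁻¹ : ℝ) : ℂ) * (Φ ξ : ℂ) * E ((ξ / t' - m') * y') * (kk φ t m (y - x) * E (-(x * (ξ / t' - m' + ζ)))) := by
      intro x ξ
      have e1 : E (ξ / t' * (y' - x)) * E (-(m' * (y' - x))) * E (-(x * ζ)) =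
          E ((ξ / t' - m') * y') * E (-(x * (ξ / t' - m' + ζ))) := by
        rw [← E_add, ← E_add, ← E_add]; congr 1; ring
      linear_combination (kk φ t m (y - x) * ((t'⁻¹ : ℝ) : ℂ) * (Φ ξ : ℂ)) * e1
    calc ∫ x, kk φ t m (y - x) * (starRingEnd ℂ) (kk φ t' m' (y' - x)) * E (-(x * ζ))
        = ∫ x, ∫ ξ, ((t'⁻¹ : ℝ) : ℂ) * (Φ ξ : ℂ) * E ((ξ / t' - m') * y') * (kk φ t m (y - x) * E (-(x * (ξ / t' - m' + ζ)))) := by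
          congr 1; ext x
          rw [hconj, ← integral_const_mul, ← integral_mul_const]
          congr 1; ext ξ; rw [hE]
      _ = ∫ ξ, ∫ x, ((t'⁻¹ : ℝ) : ℂ) * (Φ ξ : ℂ) * E ((ξ / t' - m') * y') * (kk φ t m (y - x) * E (-(x * (ξ / t' - m' + ζ)))) := by
          apply integral_integral_swap
          have hi1 : Integrable fun x => kk φ t m (y - x) := (h.kk_int ht m).comp_sub_left y
          have := (hi1.mul_prod h.phi_int)
          apply (this.const_mul ((t'⁻¹ : ℝ) : ℂ)).norm.mono'
          · have := continuous_E
            have := h.cont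
            have := h.kk_cont t m
            simp only [Function.uncurry_def]
            exact (by fun_prop : Continuous (fun p : ℝ × ℝ => ((t'⁻¹ : ℝ) : ℂ) * (Φ p.2 : ℂ) * E ((p.2 / t' - m') * y') * (kk φ t m (y - p.1) * E (-(p.1 * (p.2 / t' - m' + ζ)))))).aestronglyMeasurable
          · filter_upwards with z
            simp only [Function.uncurry, norm_mul, norm_E]
            apply le_of_eq; ring
      _ = ∫ ξ : ℝ, 0 := by
          congr 1; ext ξ
          rw [integral_const_mul, h.kk_four_sub ht]
          rcases le_or_gt a |ξ| with h1 | h1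
          · rw [h.supp _ h1]; simp
          · rw [h.supp (t * (m + (ξ / t' - m' + ζ)))]
            · simp
            · by_contra hlt
              push Not at hlt
              rw [abs_mul, abs_of_pos ht] at hlt
              have h3 : |m + (ξ / t' - m' + ζ)| < a * t⁻¹ := by
                rw [← div_eq_mul_inv, lt_div_iff₀ ht]; linarith
              have h4 : |ξ / t'| < a * t'⁻¹ := by
                rw [abs_div, abs_of_pos ht', div_eq_mul_inv]; gcongr
              have h5 : m - m' = (m + (ξ / t' - m' + ζ)) - ξ / t' - ζ := by ring
              have h6 : |m - m'| ≤ |m + (ξ / t' - m' + ζ)| + |ξ / t'| + |ζ| := by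
                rw [h5]
                exact (abs_sub _ _).trans (by gcongr; exact abs_sub _ _)
              linarith
      _ = 0 := by simp

lemma wp_packet (h : Bump Φ φ φ' a C) {s u : ℝ} (hs1 : 1 ≤ s) (hs2 : s ≤ 2) (hu0 : 0 ≤ u) (hu1 : u ≤ 1) (θ e K b0 C0 : ℝ)
    (hK : 0 ≤ K) (ha : a ≤ |e| * b0) (hC0 : C * (1 + 2 * π * |e| * K) * 40 ^ 4 ≤ C0) :
    Packet (wp φ s u θ e) θ e b0 K C0 := by
  have hC := h.Cpos
  have hπ := Real.pi_pos
  have hp : 0 ≤ 2 * π * |e| * K := by positivity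
  have hC1 : C * 10 ^ 4 ≤ C0 := by
    refine le_trans ?_ hC0
    have h1 : C * 1 ≤ C * (1 + 2 * π * |e| * K) := by gcongr; linarith
    nlinarith
  refine ⟨by nlinarith, ?_, ?_, ?_, ?_⟩
  · intro P
    exact (h.kk_cont _ _).comp (by fun_prop)
  · intro P x
    refine (wp_decay h hs1 hs2 hu0 hu1 θ e P x).trans ?_
    have := dL_pos P.1; have := dR_pos P.1 x
    gcongr
  · intro P ξ x y hξ hxy
    refine (wp_lip h hs1 hs2 hu0 hu1 θ e K ξ P hξ x y hxy).trans ?_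
    have := dL_pos P.1; have := dR_pos P.1 x
    gcongr
  · intro P P' hfr c R hR
    have hL := dL_pos P.1
    have hL' := dL_pos P'.1
    apply kk_orth h (by positivity) (by positivity)
    have h1 : (dL P.1 * s)⁻¹ ≤ (dL P.1)⁻¹ := inv_anti₀ hL (by nlinarith)
    have h2 : (dL P'.1 * s)⁻¹ ≤ (dL P'.1)⁻¹ := inv_anti₀ hL' (by nlinarith)
    have ha0 := h.apos
    rw [← mul_sub, abs_mul]
    have he : 0 < |e| := by
      rcases (abs_nonneg e).eq_or_lt with h0 | h0
      · rw [← h0] at ha; linarith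
      · exact h0
    calc a * (dL P.1 * s)⁻¹ + a * (dL P'.1 * s)⁻¹ ≤ a * (dL P.1)⁻¹ + a * (dL P'.1)⁻¹ := by gcongr
      _ = a * ((dL P.1)⁻¹ + (dL P'.1)⁻¹) := by ring
      _ ≤ |e| * b0 * ((dL P.1)⁻¹ + (dL P'.1)⁻¹) := by gcongr
      _ = |e| * (b0 * ((dL P.1)⁻¹ + (dL P'.1)⁻¹)) := by ring
      _ < _ := by gcongr

end BHT
end

section
namespace BHT

variable {Φ : ℝ → ℝ} {φ φ' : ℝ → ℂ} {a C : ℝ}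

noncomputable def eV (α : ℝ) : Fin 3 → ℝ := ![-α, 1, α - 1]
noncomputable def bV : Fin 3 → ℝ := ![1, 0, -1]
noncomputable def gV (α : ℝ) : Fin 3 → ℝ := fun i => bV i / eV α i

lemma eV_ne {α : ℝ} (h0 : α ≠ 0) (h1 : α ≠ 1) (i : Fin 3) : eV α i ≠ 0 := by
  fin_cases i <;> simp [eV, h0, sub_ne_zero, h1]

lemma gV_inj {α : ℝ} (h0 : α ≠ 0) (h1 : α ≠ 1) : Function.Injective (gV α) := by
  have h2 : α - 1 ≠ 0 := sub_ne_zero.2 h1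
  have h3 : (1 : ℝ) / -α ≠ 0 := by simp [h0]
  have h4 : (-1 : ℝ) / (α - 1) ≠ 0 := by simp [h2]
  have h5 : (1 : ℝ) / -α ≠ -1 / (α - 1) := by
    intro h
    rw [div_eq_div_iff (neg_ne_zero.2 h0) h2] at h
    linarith
  intro i j hij
  have e0 : gV α 0 = 1 / -α := by simp [gV, bV, eV]
  have e1 : gV α 1 = 0 := by simp [gV, bV, eV]
  have e2 : gV α 2 = -1 / (α - 1) := by simp [gV, bV, eV]
  fin_cases i <;> fin_cases j <;> simp only [Fin.zero_eta, Fin.mk_one, Fin.reduceFinMk, e0, e1, e2] at hij ⊢ <;>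
    first | rfl | exact absurd hij h3 | exact absurd hij.symm h3 | exact absurd hij h4 | exact absurd hij.symm h4 |
      exact absurd hij h5 | exact absurd hij.symm h5

lemma exists_sep (γ : Fin 3 → ℝ) (hγ : Function.Injective γ) :
    ∃ d D : ℝ, 0 < d ∧ ∀ i j, i ≠ j → d ≤ |γ i - γ j| ∧ |γ i - γ j| ≤ D := by
  have hp : ∀ i j, i ≠ j → 0 < |γ i - γ j| := fun i j h => abs_pos.2 (sub_ne_zero.2 fun e => h (hγ e))
  refine ⟨min (min |γ 0 - γ 1| |γ 0 - γ 2|) |γ 1 - γ 2|, |γ 0 - γ 1| + |γ 0 - γ 2| + |γ 1 - γ 2|,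
    lt_min (lt_min (hp _ _ (by decide)) (hp _ _ (by decide))) (hp _ _ (by decide)), ?_⟩
  have h1 := abs_nonneg (γ 0 - γ 1)
  have h2 := abs_nonneg (γ 0 - γ 2)
  have h3 := abs_nonneg (γ 1 - γ 2)
  have s1 : min (min |γ 0 - γ 1| |γ 0 - γ 2|) |γ 1 - γ 2| ≤ |γ 0 - γ 1| := (min_le_left _ _).trans (min_le_left _ _)
  have s2 : min (min |γ 0 - γ 1| |γ 0 - γ 2|) |γ 1 - γ 2| ≤ |γ 0 - γ 2| := (min_le_left _ _).trans (min_le_right _ _)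
  have s3 : min (min |γ 0 - γ 1| |γ 0 - γ 2|) |γ 1 - γ 2| ≤ |γ 1 - γ 2| := min_le_right _ _
  have c1 := abs_sub_comm (γ 0) (γ 1)
  have c2 := abs_sub_comm (γ 0) (γ 2)
  have c3 := abs_sub_comm (γ 1) (γ 2)
  intro i j hij
  fin_cases i <;> fin_cases j <;> simp only [Fin.zero_eta, Fin.mk_one, Fin.reduceFinMk, ne_eq, not_true] at hij ⊢ <;>
    first | exact ⟨s1, by linarith⟩ | exact ⟨s2, by linarith⟩ | exact ⟨s3, by linarith⟩ |
      exact ⟨s1.trans c1.le, by linarith⟩ | exact ⟨s2.trans c2.le, by linarith⟩ | exact ⟨s3.trans c3.le, by linarith⟩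

lemma exists_cfg {α : ℝ} (h0 : α ≠ 0) (h1 : α ≠ 1) : ∃ (b b0 K C0 a C : ℝ) (Φ : ℝ → ℝ) (φ φ' : ℝ → ℂ), 0 < b ∧ 0 < C0 ∧
    Bump Φ φ φ' a C ∧ a * (1 + |α|) ≤ 1 / 2 ∧
    ∀ s u v : ℝ, 1 ≤ s → s ≤ 2 → 0 ≤ u → u ≤ 1 →
      Cfg (fun i => wp φ s u (v + gV α i / s) (eV α i)) (fun i => v + gV α i / s) (eV α) b b0 K C0 := by
  obtain ⟨d, D, hd, hdD⟩ := exists_sep (gV α) (gV_inj h0 h1)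
  set b := min (d / 8) (1 / 4) with hb
  have hb0 : 0 < b := lt_min (by linarith) (by norm_num)
  have hb1 : b ≤ d / 8 := min_le_left _ _
  have hb2 : b ≤ 1 / 4 := min_le_right _ _
  have hD : 0 ≤ D := (abs_nonneg _).trans (hdD 0 1 (by decide)).2
  set K := D + 1 with hK
  set ee := min (min |eV α 0| |eV α 1|) |eV α 2| with hee
  have hee0 : 0 < ee := lt_min (lt_min (abs_pos.2 (eV_ne h0 h1 0)) (abs_pos.2 (eV_ne h0 h1 1))) (abs_pos.2 (eV_ne h0 h1 2))
  have heei : ∀ i, ee ≤ |eV α i| := by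
    intro i
    fin_cases i
    · exact (min_le_left _ _).trans (min_le_left _ _)
    · exact (min_le_left _ _).trans (min_le_right _ _)
    · exact min_le_right _ _
  set a := min (ee * (b / 32)) (1 / 2 / (1 + |α|)) with ha
  have hα : 0 < 1 + |α| := by positivity
  have ha0 : 0 < a := lt_min (by positivity) (by positivity)
  obtain ⟨Φ, φ, φ', C, hB⟩ := exists_bump a ha0
  have hC := hB.Cpos
  have hπ := Real.pi_pos
  have hsum : ∀ i, |eV α i| ≤ ∑ j, |eV α j| := fun i =>
    Finset.single_le_sum (f := fun j => |eV α j|) (fun j _ => abs_nonneg _) (Finset.mem_univ i)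
  refine ⟨b, b / 32, K, C * (1 + 2 * π * (∑ j, |eV α j|) * K) * 40 ^ 4, a, C, Φ, φ, φ', hb0, ?_, hB, ?_, ?_⟩
  · have : 0 ≤ ∑ j, |eV α j| := Finset.sum_nonneg fun _ _ => abs_nonneg _
    positivity
  · rw [← le_div_iff₀ hα]; exact min_le_right _ _
  · intro s u v hs1 hs2 hu0 hu1
    refine ⟨fun i => ?_, fun i j hij => ?_⟩
    · apply wp_packet hB hs1 hs2 hu0 hu1
      · positivity
      · refine (min_le_left _ _).trans ?_
        have := heei i
        gcongr
      · have := hsum i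
        gcongr
    · obtain ⟨g1, g2⟩ := hdD i j hij
      have hs : 0 < s := by linarith
      have e1 : v + gV α i / s - (v + gV α j / s) = (gV α i - gV α j) / s := by ring
      have key : ∀ x, d ≤ x → x ≤ D → 4 * b ≤ x / s ∧ x / s ≤ K - b := by
        intro x hx1 hx2
        constructor
        · rw [le_div_iff₀ hs]; nlinarith
        · rw [div_le_iff₀ hs]
          have : D ≤ K - b := by linarith
          nlinarith
      rcases le_total 0 (gV α i - gV α j) with hc | hc
      · rw [abs_of_nonneg hc] at g1 g2
        refine ⟨1, hb0, by linarith, by positivity, by linarith, Or.inl rfl, ?_, ?_⟩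
        · rw [one_mul, e1]; exact (key _ g1 g2).1
        · rw [one_mul, e1]; exact (key _ g1 g2).2
      · rw [abs_of_nonpos hc] at g1 g2
        refine ⟨-1, hb0, by linarith, by positivity, by linarith, Or.inr rfl, ?_, ?_⟩
        · rw [e1, neg_one_mul, ← neg_div]; exact (key _ g1 g2).1
        · rw [e1, neg_one_mul, ← neg_div]; exact (key _ g1 g2).2

/-! ### Discretization -/

lemma lintegral_scale (ψ : ℝ → ℝ≥0∞) {L : ℝ} (hL : 0 < L) :
    ∫⁻ x, ψ x = ENNReal.ofReal L * ∫⁻ x, ψ (L * x) := by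
  have h := Real.smul_map_volume_mul_left (a := L) hL.ne'
  rw [abs_of_pos hL] at h
  conv_lhs => rw [← h]
  rw [lintegral_smul_measure, smul_eq_mul]
  congr 1
  exact lintegral_map_equiv ψ (Homeomorph.mulLeft₀ L hL.ne').toMeasurableEquiv

lemma lintegral_unit (ψ : ℝ → ℝ≥0∞) (hψ : Measurable ψ) {L : ℝ} (hL : 0 < L) :
    ∫⁻ x, ψ x = ∫⁻ u in Set.Ico (0:ℝ) 1, ∑' n : ℤ, ENNReal.ofReal L * ψ (L * (n + u)) := by
  rw [lintegral_scale ψ hL]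
  rw [lintegral_tsum (fun n => by fun_prop)]
  have h1 : ∀ n : ℤ, ∫⁻ u in Set.Ico (0:ℝ) 1, ENNReal.ofReal L * ψ (L * (n + u)) =
      ENNReal.ofReal L * ∫⁻ u in Set.Ico (n:ℝ) (n + 1), ψ (L * u) := by
    intro n
    rw [lintegral_const_mul _ (by fun_prop)]
    congr 1
    rw [← lintegral_indicator measurableSet_Ico, ← lintegral_indicator measurableSet_Ico,
      ← lintegral_add_left_eq_self ((Set.Ico (n:ℝ) (n + 1)).indicator fun u => ψ (L * u)) (n : ℝ)]
    congr 1; ext u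
    by_cases hu : u ∈ Set.Ico (0:ℝ) 1
    · rw [Set.indicator_of_mem hu, Set.indicator_of_mem]
      exact ⟨by linarith [hu.1], by linarith [hu.2]⟩
    · rw [Set.indicator_of_notMem hu, Set.indicator_of_notMem]
      intro h; exact hu ⟨by linarith [h.1], by linarith [h.2]⟩
  simp_rw [h1]
  rw [ENNReal.tsum_mul_left]
  congr 1
  rw [← lintegral_iUnion (fun n => measurableSet_Ico) (Set.pairwise_disjoint_Ico_intCast ℝ), iUnion_Ico_intCast,
    Measure.restrict_univ]

lemma lintegral_dyadic (ψ : ℝ → ℝ≥0∞) (hψ : Measurable ψ) :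
    ∫⁻ x in Set.Ioi (0:ℝ), ψ x = ∫⁻ s in Set.Ico (1:ℝ) 2, ∑' k : ℤ, ENNReal.ofReal (len k) * ψ (len k * s) := by
  rw [lintegral_tsum (fun n => by fun_prop)]
  have h1 : ∀ k : ℤ, ∫⁻ s in Set.Ico (1:ℝ) 2, ENNReal.ofReal (len k) * ψ (len k * s) =
      ∫⁻ u in Set.Ico (len k) (len (k + 1)), ψ u := by
    intro k
    have hk := len_pos k
    have hk1 : len (k + 1) = 2 * len k := by rw [len_add, len]; unfold len; norm_num; ring
    rw [lintegral_const_mul _ (by fun_prop)]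
    rw [← lintegral_indicator measurableSet_Ico, ← lintegral_indicator measurableSet_Ico,
      lintegral_scale ((Set.Ico (len k) (len (k + 1))).indicator fun u => ψ u) hk]
    congr 2; ext u
    by_cases hu : u ∈ Set.Ico (1:ℝ) 2
    · rw [Set.indicator_of_mem hu, Set.indicator_of_mem]
      exact ⟨by nlinarith [hu.1], by nlinarith [hu.2]⟩
    · rw [Set.indicator_of_notMem hu, Set.indicator_of_notMem]
      intro h; exact hu ⟨by nlinarith [h.1], by nlinarith [h.2]⟩
  simp_rw [h1]
  rw [← lintegral_iUnion (fun n => measurableSet_Ico)]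
  · congr 2
    ext x
    simp only [Set.mem_Ioi, Set.mem_iUnion]
    constructor
    · intro hx
      obtain ⟨k, hk⟩ := exists_mem_Ico_zpow hx (one_lt_two)
      exact ⟨k, hk⟩
    · rintro ⟨k, hk⟩
      exact lt_of_lt_of_le (len_pos k) hk.1
  · intro i j hij
    rw [Function.onFun, Set.disjoint_left]
    intro x hi hj
    apply hij
    have q1 : len i < len (j + 1) := lt_of_le_of_lt hi.1 hj.2
    have q2 : len j < len (i + 1) := lt_of_le_of_lt hj.1 hi.2
    have r1 : i < j + 1 := by by_contra hc; exact absurd (len_mono (not_lt.1 hc)) (not_le.2 q1)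
    have r2 : j < i + 1 := by by_contra hc; exact absurd (len_mono (not_lt.1 hc)) (not_le.2 q2)
    omega

end BHT
end

section
namespace BHT

variable {Φ : ℝ → ℝ} {φ φ' : ℝ → ℂ} {a C : ℝ}

lemma setLIntegral_le_unit {ψ : ℝ → ℝ≥0∞} {B : ℝ≥0∞} {c : ℝ} (h : ∀ x ∈ Set.Ico c (c + 1), ψ x ≤ B) :
    ∫⁻ x in Set.Ico c (c + 1), ψ x ≤ B := by
  calc ∫⁻ x in Set.Ico c (c + 1), ψ x ≤ ∫⁻ x in Set.Ico c (c + 1), B := setLIntegral_mono' measurableSet_Ico h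
    _ = B := by rw [setLIntegral_const, Real.volume_Ico]; simp

lemma disc (Ψ : ℝ × ℝ × ℝ → ℝ≥0∞) (hΨ : Measurable Ψ) (B : ℝ≥0∞)
    (h : ∀ s v u : ℝ, 1 ≤ s → s ≤ 2 → 0 ≤ v → v ≤ 1 → 0 ≤ u → u ≤ 1 →
      ∑' P : Tile, ENNReal.ofReal (dL P.1) * Ψ (dL P.1 * s, (dL P.1)⁻¹ * (P.2 + v), dL P.1 * (P.1.2 + u)) ≤ B) :
    ∫⁻ t in Set.Ioi (0:ℝ), ∫⁻ η, ∫⁻ y, Ψ (t, η, y) ≤ B := by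
  have m1 : Measurable fun p : ℝ × ℝ => ∫⁻ y, Ψ (p.1, p.2, y) := by
    apply Measurable.lintegral_prod_right' (f := fun q : (ℝ × ℝ) × ℝ => Ψ (q.1.1, q.1.2, q.2))
    fun_prop
  have m2 : Measurable fun t : ℝ => ∫⁻ η, ∫⁻ y, Ψ (t, η, y) :=
    Measurable.lintegral_prod_right' (f := fun p : ℝ × ℝ => ∫⁻ y, Ψ (p.1, p.2, y)) m1
  rw [lintegral_dyadic _ m2]
  have e2 : (2:ℝ) = 1 + 1 := by norm_num
  rw [e2]
  apply setLIntegral_le_unit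
  intro s hs
  have h1 : ∀ k : ℤ, ENNReal.ofReal (len k) * ∫⁻ η, ∫⁻ y, Ψ (len k * s, η, y) =
      ∫⁻ v in Set.Ico (0:ℝ) (0 + 1), ∑' l : ℤ, ∫⁻ y, Ψ (len k * s, (len k)⁻¹ * (l + v), y) := by
    intro k
    have hk := len_pos k
    have m3 : Measurable fun η => ∫⁻ y, Ψ (len k * s, η, y) := m1.comp (by fun_prop : Measurable fun η : ℝ => (len k * s, η))
    rw [lintegral_unit _ m3 (inv_pos.2 hk), ← lintegral_const_mul, zero_add]
    · congr 1; ext v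
      rw [ENNReal.tsum_mul_left, ← mul_assoc, ← ENNReal.ofReal_mul hk.le, mul_inv_cancel₀ hk.ne', ENNReal.ofReal_one, one_mul]
    · apply Measurable.tsum
      intro l
      apply Measurable.const_mul
      exact m3.comp (by fun_prop)
  simp_rw [h1]
  have m4 : ∀ k l : ℤ, Measurable fun v : ℝ => ∫⁻ y, Ψ (len k * s, (len k)⁻¹ * (l + v), y) := fun k l =>
    m1.comp (by fun_prop : Measurable fun v : ℝ => (len k * s, (len k)⁻¹ * (l + v)))
  rw [← lintegral_tsum (fun k => (Measurable.tsum fun l => m4 k l).aemeasurable)]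
  apply setLIntegral_le_unit
  intro v hv
  have h2 : ∀ k l : ℤ, ∫⁻ y, Ψ (len k * s, (len k)⁻¹ * (l + v), y) =
      ∫⁻ u in Set.Ico (0:ℝ) (0 + 1), ∑' n : ℤ, ENNReal.ofReal (len k) * Ψ (len k * s, (len k)⁻¹ * (l + v), len k * (n + u)) := by
    intro k l
    rw [lintegral_unit (fun y => Ψ (len k * s, (len k)⁻¹ * (l + v), y))
      (hΨ.comp (by fun_prop : Measurable fun y : ℝ => (len k * s, (len k)⁻¹ * (l + v), y))) (len_pos k), zero_add]
  simp_rw [h2]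
  have m5 : ∀ k l n : ℤ, Measurable fun u : ℝ => ENNReal.ofReal (len k) * Ψ (len k * s, (len k)⁻¹ * (l + v), len k * (n + u)) := by
    intro k l n
    apply Measurable.const_mul
    exact hΨ.comp (by fun_prop)
  have m6 : ∀ k l : ℤ, Measurable fun u : ℝ => ∑' n : ℤ, ENNReal.ofReal (len k) * Ψ (len k * s, (len k)⁻¹ * (l + v), len k * (n + u)) :=
    fun k l => Measurable.tsum fun n => m5 k l n
  have h3 : ∀ k : ℤ, ∑' l : ℤ, ∫⁻ u in Set.Ico (0:ℝ) (0 + 1), ∑' n : ℤ, ENNReal.ofReal (len k) * Ψ (len k * s, (len k)⁻¹ * (l + v), len k * (n + u))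
      = ∫⁻ u in Set.Ico (0:ℝ) (0 + 1), ∑' l : ℤ, ∑' n : ℤ, ENNReal.ofReal (len k) * Ψ (len k * s, (len k)⁻¹ * (l + v), len k * (n + u)) :=
    fun k => (lintegral_tsum fun l => (m6 k l).aemeasurable).symm
  simp_rw [h3]
  rw [← lintegral_tsum (fun k => (Measurable.tsum fun l => m6 k l).aemeasurable)]
  apply setLIntegral_le_unit
  intro u hu
  refine le_trans (le_of_eq ?_) (h s v u hs.1 (by linarith [hs.2]) hv.1 (by linarith [hv.2]) hu.1 (by linarith [hu.2]))
  rw [ENNReal.tsum_prod', ENNReal.tsum_prod']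
  apply tsum_congr; intro k
  rw [ENNReal.tsum_comm]
  rfl

/-- continuous coefficients -/
noncomputable def Fi (φ : ℝ → ℂ) (f : ℝ → ℂ) (e β t η y : ℝ) : ℂ := ∫ x, f x * kk φ t (e * η + β / t) (y - x)

lemma Fi_meas (hφ : Continuous φ) {f : ℝ → ℂ} (hf : Measurable f) (e β : ℝ) :
    Measurable fun p : ℝ × ℝ × ℝ => Fi φ f e β p.1 p.2.1 p.2.2 := by
  have hm : Measurable fun q : (ℝ × ℝ × ℝ) × ℝ => f q.2 * kk φ q.1.1 (e * q.1.2.1 + β / q.1.1) (q.1.2.2 - q.2) := by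
    unfold kk
    have h1 := hφ.measurable
    have h2 := continuous_E.measurable
    fun_prop
  exact (hm.stronglyMeasurable.integral_prod_right (ν := volume)
    (f := fun (p : ℝ × ℝ × ℝ) (x : ℝ) => f x * kk φ p.1 (e * p.2.1 + β / p.1) (p.2.2 - x))).measurable

lemma Fi_eq_Fc {α : ℝ} (h0 : α ≠ 0) (h1 : α ≠ 1) (f : ℝ → ℂ) {s : ℝ} (hs : 0 < s) (v u : ℝ) (P : Tile) (i : Fin 3) :
    Fi φ f (eV α i) (bV i) (dL P.1 * s) ((dL P.1)⁻¹ * (P.2 + v)) (dL P.1 * (P.1.2 + u)) =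
      Fc (wp φ s u (v + gV α i / s) (eV α i)) f P := by
  unfold Fi Fc wp
  have hL := dL_pos P.1
  have he := eV_ne h0 h1 i
  have : eV α i * ((dL P.1)⁻¹ * (P.2 + v)) + bV i / (dL P.1 * s) = eV α i * fr (v + gV α i / s) P := by
    unfold fr gV; field_simp; ring
  rw [this]

/-- model bound -/
theorem model {α : ℝ} (h0 : α ≠ 0) (h1 : α ≠ 1) : ∃ (a C : ℝ) (Φ : ℝ → ℝ) (φ φ' : ℝ → ℂ),
    Bump Φ φ φ' a C ∧ a * (1 + |α|) ≤ 1 / 2 ∧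
    ∀ r : Fin 3 → ℝ, (∀ l, 1 < r l) → (∀ l, r l < 2) → ∑ l, 1 / r l < 2 → ∃ Cr : ℝ, 0 < Cr ∧
      ∀ (f : Fin 3 → ℝ → ℂ) (ι : Type) (G : DI → ι) (A : Fin 3 → ι → ℝ) (W : ℝ → ℝ≥0∞), (∀ i, BM (f i)) → Grp f r G A W →
      ∫⁻ t in Set.Ioi (0:ℝ), ∫⁻ η, ∫⁻ y, ‖∏ i, Fi φ (f i) (eV α i) (bV i) t η y‖ₑ ≤ ENNReal.ofReal Cr * ∫⁻ x, W x := by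
  obtain ⟨b, b0, K, C0, a, C, Φ, φ, φ', hb, hC0, hB, ha, hcfg⟩ := exists_cfg h0 h1
  refine ⟨a, C, Φ, φ, φ', hB, ha, fun r hr hr2 hrs => ?_⟩
  obtain ⟨Cr, hCr, hgrp⟩ := group_all hr hr2 hrs C0 hC0 b K hb
  refine ⟨Cr, hCr, fun f ι G A W hf hG => ?_⟩
  apply disc (fun p => ‖∏ i, Fi φ (f i) (eV α i) (bV i) p.1 p.2.1 p.2.2‖ₑ)
  · apply Measurable.enorm
    apply Finset.measurable_prod
    intro i _
    exact Fi_meas hB.phi_cont (hf i).1 _ _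
  · intro s v u hs1 hs2 hv0 hv1 hu0 hu1
    refine le_trans (le_of_eq ?_) (hgrp _ _ _ b0 f ι G A W (hcfg s u v hs1 hs2 hu0 hu1) hf hG)
    apply tsum_congr; intro P
    rw [ENNReal.ofReal_mul (dL_pos _).le, ← norm_prod, ofReal_norm]
    congr 3
    ext i
    exact Fi_eq_Fc h0 h1 (f i) (by linarith) v u P i

end BHT
end

section
namespace BHT

variable {Φ : ℝ → ℝ} {φ φ' : ℝ → ℂ} {a C α : ℝ}

/-- the localized symbol -/
noncomputable def kap (Φ : ℝ → ℝ) (α t η ξ1 ξ2 : ℝ) : ℝ :=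
  Φ (t * (eV α 0 * η + bV 0 / t - ξ1)) * Φ (t * (eV α 1 * η + bV 1 / t - ξ2)) *
    Φ (t * (eV α 2 * η + bV 2 / t + (ξ1 + ξ2)))

noncomputable def VV (Φ : ℝ → ℝ) (α r : ℝ) : ℝ≥0∞ :=
  ∫⁻ w, ENNReal.ofReal (Φ (1 - r - α * w) * Φ w * Φ (r - 1 + (α - 1) * w))

lemma kap_nonneg (h : Bump Φ φ φ' a C) (t η ξ1 ξ2 : ℝ) : 0 ≤ kap Φ α t η ξ1 ξ2 :=
  mul_nonneg (mul_nonneg (h.nonneg _) (h.nonneg _)) (h.nonneg _)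

lemma kap_le_one (h : Bump Φ φ φ' a C) (t η ξ1 ξ2 : ℝ) : kap Φ α t η ξ1 ξ2 ≤ 1 :=
  mul_le_one₀ (mul_le_one₀ (h.le_one _) (h.nonneg _) (h.le_one _)) (h.nonneg _) (h.le_one _)

lemma kap_meas (h : Bump Φ φ φ' a C) :
    Measurable fun q : (ℝ × ℝ) × (ℝ × ℝ) => kap Φ α q.2.1 q.2.2 q.1.1 q.1.2 := by
  unfold kap
  have := h.cont.measurable
  fun_prop

lemma kap_inner (h : Bump Φ φ φ' a C) {t : ℝ} (ht : 0 < t) (ξ1 ξ2 : ℝ) :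
    ∫⁻ η, ENNReal.ofReal (kap Φ α t η ξ1 ξ2) = ENNReal.ofReal t⁻¹ * VV Φ α (t * (ξ1 + α * ξ2)) := by
  rw [← lintegral_add_left_eq_self _ ξ2, lintegral_scale _ (inv_pos.2 ht)]
  congr 1
  unfold VV kap eV bV
  congr 1; ext w
  congr 2
  · congr 1
    · congr 1
      simp; field_simp; ring
    · congr 1
      simp; field_simp
  · congr 1
    simp; field_simp; ring

lemma VV_meas (h : Bump Φ φ φ' a C) : Measurable (VV Φ α) := by
  have hm : Measurable fun q : ℝ × ℝ => ENNReal.ofReal (Φ (1 - q.1 - α * q.2) * Φ q.2 * Φ (q.1 - 1 + (α - 1) * q.2)) := by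
    have := h.cont.measurable
    fun_prop
  exact hm.lintegral_prod_right'

lemma VV_zero (h : Bump Φ φ φ' a C) (ha : a * (1 + |α|) ≤ 1 / 2) {r : ℝ} (hr : 1 / 2 < |1 - r|) : VV Φ α r = 0 := by
  unfold VV
  rw [← lintegral_zero (μ := (volume : Measure ℝ))]
  congr 1; ext w
  rcases le_or_gt a |w| with h1 | h1
  · rw [h.supp w h1]; simp
  · rw [h.supp (1 - r - α * w)]
    · simp
    · by_contra hlt
      push Not at hlt
      have h2 : |1 - r| ≤ |1 - r - α * w| + |α| * |w| := by
        rw [← abs_mul]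
        calc |1 - r| = |(1 - r - α * w) + α * w| := by congr 1; ring
          _ ≤ _ := abs_add_le _ _
      have h3 : |α| * |w| ≤ |α| * a := by gcongr
      linarith

lemma VV_le (h : Bump Φ φ φ' a C) (r : ℝ) : VV Φ α r ≤ ENNReal.ofReal (2 * a) := by
  have ha := h.apos
  calc VV Φ α r ≤ ∫⁻ w, (Set.Icc (-a) a).indicator (fun _ => 1) w := by
        apply lintegral_mono
        intro w
        by_cases hw : w ∈ Set.Icc (-a) a
        · rw [Set.indicator_of_mem hw]
          rw [← ENNReal.ofReal_one]
          exact ENNReal.ofReal_le_ofReal (mul_le_one₀ (mul_le_one₀ (h.le_one _) (h.nonneg _) (h.le_one _)) (h.nonneg _) (h.le_one _))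
        · beta_reduce
          rw [h.supp w]
          · simp
          · by_contra hlt
            push Not at hlt
            exact hw ⟨(abs_lt.1 hlt).1.le, (abs_lt.1 hlt).2.le⟩
    _ = _ := by
      rw [lintegral_indicator measurableSet_Icc, setLIntegral_one, Real.volume_Icc]; congr 1; ring

/-- the constant -/
noncomputable def cK (Φ : ℝ → ℝ) (α : ℝ) : ℝ≥0∞ := ∫⁻ r in Set.Ioi (0:ℝ), ENNReal.ofReal r⁻¹ * VV Φ α r

lemma cK_ne_top (h : Bump Φ φ φ' a C) (ha : a * (1 + |α|) ≤ 1 / 2) : cK Φ α ≠ ∞ := by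
  apply ne_of_lt
  calc cK Φ α ≤ ∫⁻ r, (Set.Icc (1/2:ℝ) (3/2)).indicator (fun _ => ENNReal.ofReal 2 * ENNReal.ofReal (2 * a)) r := by
        unfold cK
        rw [← lintegral_indicator measurableSet_Ioi]
        apply lintegral_mono
        intro r
        by_cases hr : r ∈ Set.Icc (1/2:ℝ) (3/2)
        · rw [Set.indicator_of_mem hr, Set.indicator_of_mem (show r ∈ Set.Ioi (0:ℝ) by have := hr.1; rw [Set.mem_Ioi]; linarith)]
          gcongr
          · rw [show (2:ℝ) = (1/2)⁻¹ by norm_num]; exact inv_anti₀ (by norm_num) hr.1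
          · exact VV_le h r
        · refine (Set.indicator_le_self _ _ r).trans ?_
          beta_reduce
          rw [VV_zero h ha]
          · simp
          · by_contra hlt
            push Not at hlt
            rw [abs_le] at hlt
            exact hr ⟨by linarith, by linarith⟩
    _ < ∞ := by
        rw [lintegral_indicator measurableSet_Icc, setLIntegral_const, Real.volume_Icc]
        exact ENNReal.mul_lt_top (ENNReal.mul_lt_top ENNReal.ofReal_lt_top ENNReal.ofReal_lt_top) ENNReal.ofReal_lt_top

lemma cK_pos (h : Bump Φ φ φ' a C) : 0 < cK Φ α := by
  have hc : ∀ᶠ z in nhds (0:ℝ), 1 / 2 < Φ z :=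
    h.cont.continuousAt.eventually_const_lt (by rw [h.zero]; norm_num)
  obtain ⟨δ, hδ, hδΦ⟩ := Metric.eventually_nhds_iff.1 hc
  have hα := abs_nonneg α
  set d := min (δ / (4 + 2 * |α|)) (1 / 2) with hd
  have hd0 : 0 < d := lt_min (by positivity) (by norm_num)
  have hd1 : d * (4 + 2 * |α|) ≤ δ := by
    rw [← le_div_iff₀ (by positivity)]; exact min_le_left _ _
  have hd2 : d ≤ 1 / 2 := min_le_right _ _
  have hV : ∀ r ∈ Set.Icc (1 - d) (1 + d), ENNReal.ofReal (1 / 8) * ENNReal.ofReal (2 * d) ≤ VV Φ α r := by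
    intro r hr
    have hr' : |1 - r| ≤ d := by rw [abs_le]; constructor <;> linarith [hr.1, hr.2]
    unfold VV
    calc ENNReal.ofReal (1 / 8) * ENNReal.ofReal (2 * d) = ∫⁻ w in Set.Icc (-d) d, ENNReal.ofReal (1 / 8) := by
          rw [setLIntegral_const, Real.volume_Icc]; congr 2; ring
      _ ≤ ∫⁻ w in Set.Icc (-d) d, ENNReal.ofReal (Φ (1 - r - α * w) * Φ w * Φ (r - 1 + (α - 1) * w)) := by
          apply setLIntegral_mono' measurableSet_Icc
          intro w hw
          have hw' : |w| ≤ d := abs_le.2 hw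
          have hp : |α| * |w| ≤ |α| * d := by gcongr
          have b1 : |α * w| ≤ |α| * d := by rw [abs_mul]; exact hp
          rw [abs_le] at b1 hr' hw'
          have q1 : 1 / 2 < Φ (1 - r - α * w) := by
            apply hδΦ; rw [Real.dist_eq, sub_zero, abs_lt]; constructor <;> nlinarith
          have q2 : 1 / 2 < Φ w := by
            apply hδΦ; rw [Real.dist_eq, sub_zero, abs_lt]; constructor <;> nlinarith
          have q3 : 1 / 2 < Φ (r - 1 + (α - 1) * w) := by
            apply hδΦ; rw [Real.dist_eq, sub_zero, abs_lt]; constructor <;> nlinarith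
          apply ENNReal.ofReal_le_ofReal
          calc (1:ℝ) / 8 = 1 / 2 * (1 / 2) * (1 / 2) := by norm_num
            _ ≤ _ := by gcongr
      _ ≤ _ := setLIntegral_le_lintegral _ _
  calc (0:ℝ≥0∞) < ENNReal.ofReal (1 / 2) * (ENNReal.ofReal (1 / 8) * ENNReal.ofReal (2 * d)) * ENNReal.ofReal (2 * d) := by
        have : 0 < 2 * d := by linarith
        simp only [← ENNReal.ofReal_mul (show (0:ℝ) ≤ 1 / 8 by norm_num), ← ENNReal.ofReal_mul (show (0:ℝ) ≤ 1 / 2 by norm_num)]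
        rw [← ENNReal.ofReal_mul (by positivity)]
        rw [ENNReal.ofReal_pos]; positivity
    _ = ∫⁻ r in Set.Icc (1 - d) (1 + d), ENNReal.ofReal (1 / 2) * (ENNReal.ofReal (1 / 8) * ENNReal.ofReal (2 * d)) := by
        rw [setLIntegral_const, Real.volume_Icc]; congr 2; ring
    _ ≤ ∫⁻ r in Set.Icc (1 - d) (1 + d), ENNReal.ofReal r⁻¹ * VV Φ α r := by
        apply setLIntegral_mono' measurableSet_Icc
        intro r hr
        have hr0 : 0 < r := by linarith [hr.1]
        have : (1:ℝ) / 2 ≤ r⁻¹ := by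
          rw [one_div]; exact inv_anti₀ hr0 (by linarith [hr.2])
        exact mul_le_mul' (ENNReal.ofReal_le_ofReal this) (hV r hr)
    _ ≤ cK Φ α := by
        apply lintegral_mono_set
        intro r hr
        rw [Set.mem_Ioi]; linarith [hr.1]

/-- total mass of the localized symbol -/
lemma kap_total (h : Bump Φ φ φ' a C) (ha : a * (1 + |α|) ≤ 1 / 2) (ξ1 ξ2 : ℝ) :
    ∫⁻ t in Set.Ioi (0:ℝ), ∫⁻ η, ENNReal.ofReal (kap Φ α t η ξ1 ξ2) = if 0 < ξ1 + α * ξ2 then cK Φ α else 0 := by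
  set σ := ξ1 + α * ξ2 with hσ
  have h1 : ∫⁻ t in Set.Ioi (0:ℝ), ∫⁻ η, ENNReal.ofReal (kap Φ α t η ξ1 ξ2) =
      ∫⁻ t in Set.Ioi (0:ℝ), ENNReal.ofReal t⁻¹ * VV Φ α (t * σ) :=
    setLIntegral_congr_fun measurableSet_Ioi fun t ht => kap_inner h ht ξ1 ξ2
  rw [h1]
  split_ifs with hs
  · rw [← lintegral_indicator measurableSet_Ioi, lintegral_scale _ (inv_pos.2 hs)]
    unfold cK
    rw [← lintegral_const_mul' _ _ ENNReal.ofReal_ne_top, ← lintegral_indicator measurableSet_Ioi]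
    congr 1; ext r
    by_cases hr : r ∈ Set.Ioi (0:ℝ)
    · have hr0 : 0 < r := hr
      rw [Set.indicator_of_mem hr, Set.indicator_of_mem (show σ⁻¹ * r ∈ Set.Ioi (0:ℝ) by rw [Set.mem_Ioi]; positivity),
        ← mul_assoc, ← ENNReal.ofReal_mul (by positivity)]
      congr 2
      · field_simp
      · field_simp
    · rw [Set.indicator_of_notMem hr, Set.indicator_of_notMem, mul_zero]
      intro hc
      apply hr
      rw [Set.mem_Ioi] at hc ⊢
      exact pos_of_mul_pos_right hc (inv_pos.2 hs).le
  · rw [← (lintegral_zero : ∫⁻ _ : ℝ, (0:ℝ≥0∞) ∂((volume : Measure ℝ).restrict (Set.Ioi (0:ℝ))) = 0)]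
    apply setLIntegral_congr_fun measurableSet_Ioi
    intro t ht
    have ht0 : 0 < t := ht
    beta_reduce
    rw [VV_zero h ha, mul_zero]
    push Not at hs
    have : t * σ ≤ 0 := mul_nonpos_of_nonneg_of_nonpos ht0.le hs
    rw [abs_of_nonneg (by linarith)]; linarith

end BHT
end

section
namespace BHT

variable {Φ : ℝ → ℝ} {φ φ' : ℝ → ℂ} {a C α : ℝ}

/-- averaging over a family of localized symbols -/
lemma avg_bound {Ω T : Type*} [MeasurableSpace Ω] [MeasurableSpace T] {μ : Measure Ω} {ν : Measure T}
    [SFinite μ] [SFinite ν] {κ : Ω × T → ℝ} (hκ : Measurable κ) (hκ0 : ∀ q, 0 ≤ κ q)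
    {K : Ω → ℝ≥0∞} {M : ℝ≥0∞} (hM : M ≠ ∞) (hKM : ∀ ω, K ω ≤ M)
    (hK : ∀ ω, ∫⁻ τ, ENNReal.ofReal (κ (ω, τ)) ∂ν = K ω) {A : Ω → ℂ} (hA : Integrable A μ) :
    ‖∫ ω, A ω * ((K ω).toReal : ℂ) ∂μ‖ₑ ≤ ∫⁻ τ, ‖∫ ω, A ω * (κ (ω, τ) : ℂ) ∂μ‖ₑ ∂ν := by
  have hen : ∀ q, ‖(κ q : ℂ)‖ₑ = ENNReal.ofReal (κ q) := fun q => by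
    rw [← ofReal_norm, Complex.norm_real, Real.norm_of_nonneg (hκ0 q)]
  have hsm : AEStronglyMeasurable (fun q : Ω × T => A q.1 * (κ q : ℂ)) (μ.prod ν) :=
    hA.1.comp_fst.mul (Complex.measurable_ofReal.comp hκ).aestronglyMeasurable
  have hintg : Integrable (fun q : Ω × T => A q.1 * (κ q : ℂ)) (μ.prod ν) := by
    refine ⟨hsm, ?_⟩
    unfold HasFiniteIntegral
    rw [lintegral_prod _ hsm.enorm]
    calc ∫⁻ x, ∫⁻ y, ‖A x * (κ (x, y) : ℂ)‖ₑ ∂ν ∂μ = ∫⁻ x, ‖A x‖ₑ * K x ∂μ := by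
          congr 1; ext x
          rw [← hK x, ← lintegral_const_mul _ (by fun_prop)]
          congr 1; ext y
          rw [enorm_mul, hen]
      _ ≤ ∫⁻ x, ‖A x‖ₑ * M ∂μ := lintegral_mono fun x => mul_le_mul' le_rfl (hKM x)
      _ = (∫⁻ x, ‖A x‖ₑ ∂μ) * M := lintegral_mul_const' _ _ hM
      _ < ∞ := ENNReal.mul_lt_top hA.2 hM.lt_top
  have h1 : ∫ ω, A ω * ((K ω).toReal : ℂ) ∂μ = ∫ ω, ∫ τ, A ω * (κ (ω, τ) : ℂ) ∂ν ∂μ := by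
    congr 1; ext ω
    rw [integral_const_mul, integral_complex_ofReal, integral_eq_lintegral_of_nonneg_ae (Eventually.of_forall fun τ => hκ0 (ω, τ))
      (hκ.comp measurable_prodMk_left).aestronglyMeasurable, hK]
  rw [h1, integral_integral_swap hintg]
  exact enorm_integral_le_lintegral_enorm _

lemma E_int {u : ℝ → ℂ} (hu : Integrable u) {m : ℝ → ℝ} (hm : Continuous m) : Integrable fun x => u x * E (m x) := by
  apply hu.mul_bdd (c := 1) (continuous_E.comp hm).aestronglyMeasurable
  exact Eventually.of_forall fun x => (norm_E _).le

lemma conv_int (h : Bump Φ φ φ' a C) {t : ℝ} (ht : 0 < t) (m : ℝ) {u : ℝ → ℂ} (hu : Integrable u) :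
    Integrable (fun q : ℝ × ℝ => u q.1 * kk φ t m (q.2 - q.1)) := by
  exact (hu.convolution_integrand (ContinuousLinearMap.mul ℝ ℂ) (h.kk_int ht m)).swap

/-- third factor -/
lemma third (h : Bump Φ φ φ' a C) {t : ℝ} (ht : 0 < t) (m ν : ℝ) {u : ℝ → ℂ} (hu : Integrable u) :
    ∫ y, (∫ x, u x * kk φ t m (y - x)) * E (y * ν) = (∫ x, u x * E (x * ν)) * Φ (t * (m + ν)) := by
  have hc := conv_int h ht m hu
  have hc2 : Integrable (fun q : ℝ × ℝ => u q.1 * kk φ t m (q.2 - q.1) * E (q.2 * ν)) := by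
    apply hc.mul_bdd (c := 1)
    · have := continuous_E
      exact Continuous.aestronglyMeasurable (by fun_prop)
    · exact Eventually.of_forall fun x => (norm_E _).le
  have h1 : ∀ y, (∫ x, u x * kk φ t m (y - x)) * E (y * ν) = ∫ x, u x * kk φ t m (y - x) * E (y * ν) := fun y =>
    (integral_mul_const _ _).symm
  simp_rw [h1]
  rw [← integral_integral_swap hc2, ← integral_mul_const]
  congr 1; ext x
  rw [← h.kk_four ht, ← integral_const_mul, ← integral_add_right_eq_self _ x]
  congr 1; ext y
  rw [add_sub_cancel_right, add_mul, E_add]; ring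

/-- first two factors -/
lemma first (h : Bump Φ φ φ' a C) {t : ℝ} (ht : 0 < t) (m y : ℝ) {u f : ℝ → ℂ} (hu : Integrable u)
    (hf : ∀ x, f x = ∫ ξ, u ξ * E (ξ * x)) :
    ∫ x, f x * kk φ t m (y - x) = ∫ ξ, u ξ * Φ (t * (m - ξ)) * E (y * ξ) := by
  have hk : Integrable fun x => kk φ t m (y - x) := (h.kk_int ht m).comp_sub_left y
  have hc : Integrable (fun q : ℝ × ℝ => u q.2 * E (q.2 * q.1) * kk φ t m (y - q.1)) := by
    have h2 : Integrable (fun q : ℝ × ℝ => kk φ t m (y - q.1) * u q.2 * E (q.2 * q.1)) := by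
      apply (hk.mul_prod hu).mul_bdd (c := 1)
      · have := continuous_E
        exact Continuous.aestronglyMeasurable (by fun_prop)
      · exact Eventually.of_forall fun x => (norm_E _).le
    convert h2 using 1; ext q; ring
  have h1 : ∀ x, f x * kk φ t m (y - x) = ∫ ξ, u ξ * E (ξ * x) * kk φ t m (y - x) := fun x => by
    rw [hf]; exact (integral_mul_const _ _).symm
  simp_rw [h1]
  rw [integral_integral_swap hc]
  congr 1; ext ξ
  have := h.kk_four_sub ht m (-ξ) y
  rw [mul_assoc, sub_eq_add_neg m ξ, mul_comm _ (E (y * ξ)), show y * ξ = -(y * -ξ) by ring, ← this, ← integral_const_mul]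
  congr 1; ext x
  rw [show -(x * -ξ) = ξ * x by ring]; ring

/-- the trilinear identity -/
lemma trilinear (h : Bump Φ φ φ' a C) {t : ℝ} (ht : 0 < t) (m1 m2 m3 : ℝ) {u v f g hh : ℝ → ℂ} (hu : Integrable u)
    (hv : Integrable v) (hh' : Integrable hh)
    (hf : ∀ x, f x = ∫ ξ, u ξ * E (ξ * x)) (hg : ∀ x, g x = ∫ ξ, v ξ * E (ξ * x)) :
    ∫ ω : (ℝ × ℝ) × ℝ, (u ω.1.1 * v ω.1.2 * (hh ω.2 * E (ω.2 * (ω.1.1 + ω.1.2)))) *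
      ((Φ (t * (m1 - ω.1.1)) * Φ (t * (m2 - ω.1.2)) * Φ (t * (m3 + (ω.1.1 + ω.1.2))) : ℝ) : ℂ) =
    ∫ y, (∫ x, f x * kk φ t m1 (y - x)) * (∫ x, g x * kk φ t m2 (y - x)) * (∫ x, hh x * kk φ t m3 (y - x)) := by
  have hE := continuous_E
  have hΦ := h.cont
  set u' := fun ξ => u ξ * (Φ (t * (m1 - ξ)) : ℂ) with hu'
  set v' := fun ξ => v ξ * (Φ (t * (m2 - ξ)) : ℂ) with hv'
  set F3 := fun y => ∫ x, hh x * kk φ t m3 (y - x) with hF3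
  have nΦ : ∀ z, ‖(Φ z : ℂ)‖ ≤ 1 := fun z => by
    rw [Complex.norm_real, Real.norm_of_nonneg (h.nonneg z)]; exact h.le_one z
  have iu : Integrable u' := hu.mul_bdd (c := 1) (Continuous.aestronglyMeasurable (by fun_prop)) (Eventually.of_forall fun x => nΦ _)
  have iv : Integrable v' := hv.mul_bdd (c := 1) (Continuous.aestronglyMeasurable (by fun_prop)) (Eventually.of_forall fun x => nΦ _)
  have i3 : Integrable F3 := (conv_int h ht m3 hh').integral_prod_right
  have iuv : Integrable (fun q : ℝ × ℝ => u' q.1 * v' q.2) := iu.mul_prod iv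
  have iL : Integrable (fun ω : (ℝ × ℝ) × ℝ => (u ω.1.1 * v ω.1.2 * (hh ω.2 * E (ω.2 * (ω.1.1 + ω.1.2)))) *
      ((Φ (t * (m1 - ω.1.1)) * Φ (t * (m2 - ω.1.2)) * Φ (t * (m3 + (ω.1.1 + ω.1.2))) : ℝ) : ℂ)) := by
    have h2 : Integrable (fun ω : (ℝ × ℝ) × ℝ => (u' ω.1.1 * v' ω.1.2 * hh ω.2) * (E (ω.2 * (ω.1.1 + ω.1.2)) *
      (Φ (t * (m3 + (ω.1.1 + ω.1.2))) : ℂ))) := by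
      apply (iuv.mul_prod hh').mul_bdd (c := 1) (Continuous.aestronglyMeasurable (by fun_prop))
      refine Eventually.of_forall fun x => ?_
      rw [norm_mul, norm_E, one_mul]; exact nΦ _
    convert h2 using 1; ext ω; rw [hu', hv']; push_cast; ring
  have iR : Integrable (fun ω : (ℝ × ℝ) × ℝ => u' ω.1.1 * v' ω.1.2 * F3 ω.2 * E (ω.2 * (ω.1.1 + ω.1.2))) := by
    apply (iuv.mul_prod i3).mul_bdd (c := 1) (Continuous.aestronglyMeasurable (by fun_prop))
    exact Eventually.of_forall fun x => (norm_E _).le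
  rw [Measure.volume_eq_prod, integral_prod _ iL]
  have h3 : ∀ q : ℝ × ℝ, ∫ x, (u q.1 * v q.2 * (hh x * E (x * (q.1 + q.2)))) *
      ((Φ (t * (m1 - q.1)) * Φ (t * (m2 - q.2)) * Φ (t * (m3 + (q.1 + q.2))) : ℝ) : ℂ) =
      ∫ y, u' q.1 * v' q.2 * F3 y * E (y * (q.1 + q.2)) := by
    intro q
    have e1 : ∫ y, u' q.1 * v' q.2 * F3 y * E (y * (q.1 + q.2)) = u' q.1 * v' q.2 * ∫ y, F3 y * E (y * (q.1 + q.2)) := by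
      rw [← integral_const_mul]; congr 1; ext y; ring
    rw [e1, third h ht m3 _ hh', integral_mul_const, integral_const_mul, hu', hv']
    push_cast; ring
  simp only [h3]
  rw [integral_integral_swap iR]
  congr 1; ext y
  rw [first h ht m1 y hu hf, first h ht m2 y hv hg]
  have e2 : ∀ q : ℝ × ℝ, u' q.1 * v' q.2 * F3 y * E (y * (q.1 + q.2)) =
      (u' q.1 * E (y * q.1)) * (v' q.2 * E (y * q.2)) * F3 y := fun q => by
    rw [mul_add, E_add]; ring
  simp only [e2]
  rw [integral_mul_const, Measure.volume_eq_prod, integral_prod_mul (fun ξ => u' ξ * E (y * ξ)) (fun ξ => v' ξ * E (y * ξ))]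

end BHT
end

section
namespace BHT

variable {Φ : ℝ → ℝ} {φ φ' : ℝ → ℂ} {a C α : ℝ}

/-- half-plane indicator -/
noncomputable def hp (α : ℝ) (q : ℝ × ℝ) : ℝ := if 0 < q.1 + α * q.2 then 1 else 0

lemma hp_meas (α : ℝ) : Measurable (hp α) := by
  unfold hp
  exact Measurable.ite (measurableSet_lt measurable_const (by fun_prop)) measurable_const measurable_const

lemma hp_le (α : ℝ) (q : ℝ × ℝ) : ‖(hp α q : ℂ)‖ ≤ 1 := by
  unfold hp; split_ifs <;> simp

/-- half-plane multiplier operator -/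
noncomputable def FF (α : ℝ) (u v : ℝ → ℂ) (x : ℝ) : ℂ :=
  ∫ q : ℝ × ℝ, u q.1 * v q.2 * (hp α q : ℂ) * E (x * (q.1 + q.2))

lemma FF_int {u v : ℝ → ℂ} (hu : Integrable u) (hv : Integrable v) (α : ℝ) :
    Integrable (fun q : ℝ × ℝ => u q.1 * v q.2 * (hp α q : ℂ)) := by
  apply (hu.mul_prod hv).mul_bdd (c := 1)
    (Complex.measurable_ofReal.comp (hp_meas α)).aestronglyMeasurable
  exact Eventually.of_forall fun x => hp_le α x

lemma FF_BM {u v : ℝ → ℂ} (hu : Integrable u) (hv : Integrable v) (α : ℝ) : BM (FF α u v) := by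
  have hE := continuous_E
  have hi := FF_int hu hv α
  refine ⟨?_, ∫ q : ℝ × ℝ, ‖u q.1 * v q.2 * (hp α q : ℂ)‖, fun x => ?_⟩
  · apply Continuous.measurable
    unfold FF
    apply continuous_of_dominated (bound := fun q : ℝ × ℝ => ‖u q.1 * v q.2 * (hp α q : ℂ)‖)
    · intro x
      exact hi.1.mul (Continuous.aestronglyMeasurable (by fun_prop))
    · intro x
      refine Eventually.of_forall fun q => ?_
      rw [norm_mul, norm_E, mul_one]
    · exact hi.norm
    · refine Eventually.of_forall fun q => ?_
      fun_prop
  · unfold FF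
    refine (norm_integral_le_integral_norm _).trans (le_of_eq ?_)
    congr 1; ext q
    rw [norm_mul, norm_E, mul_one]

lemma BM_cpt_int {h : ℝ → ℂ} (hb : BM h) (hc : ∃ R : ℝ, ∀ x, R < |x| → h x = 0) : Integrable h := by
  obtain ⟨hm, B, hB⟩ := hb
  obtain ⟨R, hR⟩ := hc
  have : IntegrableOn h (Set.Icc (-R) R) := by
    apply Measure.integrableOn_of_bounded (M := B) (by simp) hm.aestronglyMeasurable
    exact Eventually.of_forall hB
  rw [← integrable_indicator_iff measurableSet_Icc] at this
  refine this.congr (Eventually.of_forall fun x => ?_)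
  by_cases hx : x ∈ Set.Icc (-R) R
  · rw [Set.indicator_of_mem hx]
  · rw [Set.indicator_of_notMem hx]
    symm; apply hR
    by_contra hlt
    push Not at hlt
    exact hx (abs_le.1 hlt)

theorem red_main (h0 : α ≠ 0) (h1 : α ≠ 1) (r : Fin 3 → ℝ) (hr : ∀ l, 1 < r l) (hr2 : ∀ l, r l < 2)
    (hrs : ∑ l, 1 / r l < 2) : ∃ Cr : ℝ, 0 < Cr ∧ ∀ u v f g : ℝ → ℂ, Integrable u → Integrable v →
      BM f → BM g →
      (∀ x, f x = ∫ ξ, u ξ * E (ξ * x)) → (∀ x, g x = ∫ ξ, v ξ * E (ξ * x)) →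
      Red f g (FF α u v) r Cr := by
  have hE := continuous_E
  obtain ⟨a, C, Φ, φ, φ', hB, ha, hmodel⟩ := model h0 h1
  obtain ⟨Cr, hCr, hm⟩ := hmodel r hr hr2 hrs
  have hc0 := cK_pos (α := α) hB
  have hct := cK_ne_top hB ha
  set c := (cK Φ α).toReal with hc
  have hcpos : 0 < c := ENNReal.toReal_pos hc0.ne' hct
  refine ⟨Cr / c, by positivity, fun u v f g hu hv bf bg hf hg => ?_⟩
  intro h bh hcpt ι G A W hG
  have ih := BM_cpt_int bh hcpt
  have hbm : ∀ i, BM ((![f, g, h] : Fin 3 → ℝ → ℂ) i) := by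
    intro i; fin_cases i
    · exact bf
    · exact bg
    · exact bh
  have hfin := hm ![f, g, h] ι G A W hbm hG
  set A0 : (ℝ × ℝ) × ℝ → ℂ := fun ω => u ω.1.1 * v ω.1.2 * (h ω.2 * E (ω.2 * (ω.1.1 + ω.1.2))) with hA0
  have iA : Integrable A0 := by
    have h2 : Integrable (fun ω : (ℝ × ℝ) × ℝ => (u ω.1.1 * v ω.1.2 * h ω.2) * E (ω.2 * (ω.1.1 + ω.1.2))) := by
      apply ((hu.mul_prod hv).mul_prod ih).mul_bdd (c := 1) (Continuous.aestronglyMeasurable (by fun_prop))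
      exact Eventually.of_forall fun x => (norm_E _).le
    convert h2 using 1; ext ω; rw [hA0]; ring
  have hκm : Measurable (fun q : ((ℝ × ℝ) × ℝ) × (ℝ × ℝ) => kap Φ α q.2.1 q.2.2 q.1.1.1 q.1.1.2) :=
    (kap_meas hB).comp ((measurable_fst.comp measurable_fst).prodMk measurable_snd)
  have hKM : ∀ ω : (ℝ × ℝ) × ℝ, (if 0 < ω.1.1 + α * ω.1.2 then cK Φ α else 0) ≤ cK Φ α := by
    intro ω; split_ifs; exacts [le_rfl, bot_le]
  have hKt : ∀ ω : (ℝ × ℝ) × ℝ, ∫⁻ τ : ℝ × ℝ, ENNReal.ofReal (kap Φ α τ.1 τ.2 ω.1.1 ω.1.2)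
      ∂((volume.restrict (Set.Ioi (0:ℝ))).prod volume) = if 0 < ω.1.1 + α * ω.1.2 then cK Φ α else 0 := by
    intro ω
    have hmm : Measurable (fun τ : ℝ × ℝ => ENNReal.ofReal (kap Φ α τ.1 τ.2 ω.1.1 ω.1.2)) := by
      have := hB.cont.measurable
      unfold kap; fun_prop
    rw [lintegral_prod _ hmm.aemeasurable]
    exact kap_total hB ha ω.1.1 ω.1.2
  have key := avg_bound (Ω := (ℝ × ℝ) × ℝ) (T := ℝ × ℝ) (μ := volume)
    (ν := (volume.restrict (Set.Ioi (0:ℝ))).prod volume)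
    hκm (fun q => kap_nonneg hB _ _ _ _)
    (K := fun ω => if 0 < ω.1.1 + α * ω.1.2 then cK Φ α else 0) hct hKM hKt iA
  have e1 : ∫ ω, A0 ω * (((if 0 < ω.1.1 + α * ω.1.2 then cK Φ α else 0 : ℝ≥0∞).toReal : ℝ) : ℂ) =
      (c : ℂ) * ∫ x, FF α u v x * h x := by
    have i2 : Integrable (fun ω : (ℝ × ℝ) × ℝ => A0 ω * (hp α ω.1 : ℂ)) := by
      apply iA.mul_bdd (c := 1)
        (Complex.measurable_ofReal.comp ((hp_meas α).comp measurable_fst)).aestronglyMeasurable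
      exact Eventually.of_forall fun x => hp_le α x.1
    have e2 : ∫ x, FF α u v x * h x = ∫ x, ∫ q : ℝ × ℝ, A0 (q, x) * (hp α q : ℂ) := by
      congr 1; ext x
      unfold FF
      rw [← integral_mul_const]
      congr 1; ext q
      rw [hA0]; ring
    rw [e2, ← integral_integral_swap i2, ← integral_prod _ i2, ← integral_const_mul]
    congr 1; ext ω
    unfold hp
    split_ifs <;> simp [hc]; ring
  rw [e1] at key
  have e3 : ∫⁻ τ : ℝ × ℝ, ‖∫ ω : (ℝ × ℝ) × ℝ, A0 ω * (kap Φ α τ.1 τ.2 ω.1.1 ω.1.2 : ℂ)‖ₑ ∂((volume.restrict (Set.Ioi (0:ℝ))).prod volume)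
      ≤ ∫⁻ t in Set.Ioi (0:ℝ), ∫⁻ η, ∫⁻ y, ‖∏ i, Fi φ ((![f, g, h] : Fin 3 → ℝ → ℂ) i) (eV α i) (bV i) t η y‖ₑ := by
    refine (lintegral_prod_le _).trans ?_
    apply setLIntegral_mono' measurableSet_Ioi
    intro t ht
    apply lintegral_mono
    intro η
    beta_reduce
    have := trilinear hB ht (eV α 0 * η + bV 0 / t) (eV α 1 * η + bV 1 / t) (eV α 2 * η + bV 2 / t) hu hv ih hf hg
    unfold kap
    rw [hA0]
    rw [this]
    refine (enorm_integral_le_lintegral_enorm _).trans (le_of_eq ?_)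
    congr 1; ext y
    rw [Fin.prod_univ_three]
    rfl
  have h5 := key.trans (e3.trans hfin)
  rw [enorm_mul] at h5
  have h6 : ‖(c : ℂ)‖ₑ = ENNReal.ofReal c := by
    rw [← ofReal_norm, Complex.norm_real, Real.norm_of_nonneg hcpos.le]
  rw [h6] at h5
  rw [ENNReal.ofReal_div_of_pos hcpos, ENNReal.div_eq_inv_mul, mul_assoc]
  have hne : ENNReal.ofReal c ≠ 0 := (ENNReal.ofReal_pos.2 hcpos).ne'
  calc ‖∫ x, FF α u v x * h x‖ₑ = (ENNReal.ofReal c)⁻¹ * (ENNReal.ofReal c * ‖∫ x, FF α u v x * h x‖ₑ) := by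
        rw [← mul_assoc, ENNReal.inv_mul_cancel hne ENNReal.ofReal_ne_top, one_mul]
    _ ≤ _ := mul_le_mul' le_rfl h5

end BHT
end

section
namespace BHT

/-- symmetric sine integral -/
noncomputable def SS (b : ℝ) : ℝ := ∫ u in (-b)..b, Real.sinc u

lemma sinc_ii (b c : ℝ) : IntervalIntegrable Real.sinc volume b c := Real.continuous_sinc.intervalIntegrable _ _

lemma SS_neg (b : ℝ) : SS (-b) = -SS b := by
  unfold SS; rw [neg_neg, intervalIntegral.integral_symm]

lemma SS_eq (b : ℝ) : SS b = 2 * ∫ u in (0:ℝ)..b, Real.sinc u := by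
  unfold SS
  rw [← intervalIntegral.integral_add_adjacent_intervals (sinc_ii (-b) 0) (sinc_ii 0 b)]
  have := intervalIntegral.integral_comp_neg (a := 0) (b := b) Real.sinc
  simp only [Real.sinc_neg, neg_zero] at this
  rw [← this]; ring

lemma SS_cont : Continuous SS := by
  have : SS = fun b => 2 * ∫ u in (0:ℝ)..b, Real.sinc u := funext SS_eq
  rw [this]
  exact continuous_const.mul (intervalIntegral.continuous_primitive sinc_ii 0)

lemma SS_zero : SS 0 = 0 := by rw [SS_eq]; simp

lemma cos_int : IntegrableOn (fun u : ℝ => Real.cos u / u ^ 2) (Set.Ioi 1) := by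
  have h := integrableOn_Ioi_rpow_of_lt (a := -2) (c := 1) (by norm_num) (by norm_num)
  apply Integrable.mono' h
  · exact Measurable.aestronglyMeasurable (by fun_prop)
  · refine (ae_restrict_iff' measurableSet_Ioi).2 (Eventually.of_forall fun u hu => ?_)
    have hu0 : (0:ℝ) < u := lt_trans one_pos hu
    rw [Real.rpow_neg hu0.le, Real.rpow_two, norm_div, Real.norm_eq_abs, Real.norm_eq_abs, abs_of_pos (pow_pos hu0 2), div_eq_mul_inv]
    have := Real.abs_cos_le_one u
    exact mul_le_of_le_one_left (by positivity) this

lemma SS_parts {b : ℝ} (hb : 1 ≤ b) :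
    SS b = 2 * ((∫ u in (0:ℝ)..1, Real.sinc u) + (Real.cos 1 - Real.cos b / b - ∫ u in (1:ℝ)..b, Real.cos u / u ^ 2)) := by
  rw [SS_eq, ← intervalIntegral.integral_add_adjacent_intervals (sinc_ii 0 1) (sinc_ii 1 b)]
  have hpos : ∀ u ∈ Set.uIcc 1 b, u ≠ 0 := fun u hu => by
    rw [Set.uIcc_of_le hb] at hu; linarith [hu.1]
  have hc : IntervalIntegrable (fun u : ℝ => Real.cos u / u ^ 2) volume 1 b := by
    apply ContinuousOn.intervalIntegrable
    apply Real.continuous_cos.continuousOn.div (by fun_prop)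
    intro u hu; exact pow_ne_zero _ (hpos u hu)
  have h := intervalIntegral.integral_eq_sub_of_hasDerivAt (a := 1) (b := b) (f := fun u => -(Real.cos u / u))
    (f' := fun u => Real.sinc u + Real.cos u / u ^ 2) (fun u hu => by
      have hu0 := hpos u hu
      have := ((Real.hasDerivAt_cos u).div (hasDerivAt_id u) hu0).neg
      refine this.congr_deriv ?_
      rw [Real.sinc_of_ne_zero hu0]; simp; field_simp; ring) ((sinc_ii 1 b).add hc)
  rw [intervalIntegral.integral_add (sinc_ii 1 b) hc] at h
  simp only [div_one] at h
  linarith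

lemma SS_tendsto : ∃ d : ℝ, Tendsto SS atTop (nhds d) := by
  have h1 := intervalIntegral_tendsto_integral_Ioi 1 cos_int tendsto_id
  have h2 : Tendsto (fun b : ℝ => Real.cos b / b) atTop (nhds 0) := by
    apply squeeze_zero_norm' (a := fun b => b⁻¹) _ tendsto_inv_atTop_zero
    filter_upwards [eventually_gt_atTop 0] with b hb
    rw [norm_div, Real.norm_eq_abs, Real.norm_eq_abs, abs_of_pos hb, div_eq_mul_inv]
    exact mul_le_of_le_one_left (by positivity) (Real.abs_cos_le_one b)
  have h3 := ((((tendsto_const_nhds (x := Real.cos 1)).sub h2).sub h1).const_add (∫ u in (0:ℝ)..1, Real.sinc u)).const_mul 2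
  refine ⟨_, h3.congr' ?_⟩
  filter_upwards [eventually_ge_atTop 1] with b hb
  rw [SS_parts hb]; rfl

lemma SS_bdd : ∃ B : ℝ, 0 < B ∧ ∀ b, |SS b| ≤ B := by
  obtain ⟨d, hd⟩ := SS_tendsto
  have h1 := hd.abs.eventually_le_const (lt_add_one |d|)
  obtain ⟨N, hN⟩ := eventually_atTop.1 h1
  obtain ⟨B, hB⟩ := (isCompact_Icc (a := (0:ℝ)) (b := N)).exists_bound_of_continuousOn SS_cont.continuousOn
  have h2 : ∀ b, 0 ≤ b → |SS b| ≤ max B (|d| + 1) := by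
    intro b hb
    rcases le_total N b with h | h
    · exact (hN b h).trans (le_max_right _ _)
    · exact (hB b ⟨hb, h⟩).trans (le_max_left _ _)
  refine ⟨max B (|d| + 1), lt_of_lt_of_le (by positivity) (le_max_right _ _), fun b => ?_⟩
  rcases le_total 0 b with h | h
  · exact h2 b h
  · have := h2 (-b) (by linarith)
    rwa [SS_neg, abs_neg] at this

/-- truncation set -/
def ST (ε N : ℝ) : Set ℝ := Set.Icc (-N) N \ Set.Icc (-ε) ε

lemma ST_meas (ε N : ℝ) : MeasurableSet (ST ε N) := measurableSet_Icc.diff measurableSet_Icc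

lemma ST_mem {ε N τ : ℝ} : τ ∈ ST ε N ↔ |τ| ≤ N ∧ ε < |τ| := by
  unfold ST
  rw [Set.mem_sdiff, Set.mem_Icc, Set.mem_Icc, ← abs_le, ← abs_le, not_le]

lemma ST_int {ε N : ℝ} (hε : 0 < ε) : IntegrableOn (fun τ : ℝ => ((τ : ℝ) : ℂ)⁻¹) (ST ε N) := by
  apply Measure.integrableOn_of_bounded (M := ε⁻¹)
  · exact ne_of_lt (lt_of_le_of_lt (measure_mono Set.sdiff_subset) (by simp))
  · exact Measurable.aestronglyMeasurable (by fun_prop)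
  · refine (ae_restrict_iff' (ST_meas ε N)).2 (Eventually.of_forall fun u hu => ?_)
    rw [norm_inv, Complex.norm_real, Real.norm_eq_abs]
    exact inv_anti₀ hε (ST_mem.1 hu).2.le

lemma E_sub_E (z : ℝ) : E (-z) - E z = -2 * I * (Real.sin (2 * π * z) : ℂ) := by
  unfold E
  push_cast
  rw [show 2 * (π:ℂ) * -(z:ℂ) * I = -(2 * π * z) * I by ring]
  rw [Complex.sin]
  linear_combination ((Complex.exp (-(2 * π * z) * I) - Complex.exp (2 * π * z * I))) * Complex.I_sq

lemma J_eq {ε N : ℝ} (hε : 0 < ε) (hN : ε ≤ N) (σ : ℝ) :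
    ∫ τ in ST ε N, E (-(τ * σ)) * ((τ : ℝ) : ℂ)⁻¹ = -I * ((SS (2 * π * σ * N) - SS (2 * π * σ * ε) : ℝ) : ℂ) := by
  have hE := continuous_E
  set J := ∫ τ in ST ε N, E (-(τ * σ)) * ((τ : ℝ) : ℂ)⁻¹ with hJ
  have hI : ∀ s : ℝ, IntegrableOn (fun τ : ℝ => E (τ * s) * ((τ : ℝ) : ℂ)⁻¹) (ST ε N) := by
    intro s
    apply (ST_int hε).bdd_mul (c := 1) (Continuous.aestronglyMeasurable (by fun_prop))
    exact Eventually.of_forall fun x => (norm_E _).le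
  have h1 : J = -∫ τ in ST ε N, E (τ * σ) * ((τ : ℝ) : ℂ)⁻¹ := by
    rw [hJ, ← integral_indicator (ST_meas _ _), ← integral_indicator (ST_meas _ _), ← integral_neg_eq_self, ← integral_neg]
    congr 1; ext τ
    by_cases h : τ ∈ ST ε N
    · have h' : -τ ∈ ST ε N := by rw [ST_mem] at h ⊢; rwa [abs_neg]
      rw [Set.indicator_of_mem h, Set.indicator_of_mem h']
      push_cast
      rw [inv_neg, neg_mul, neg_neg]; ring
    · have h' : -τ ∉ ST ε N := by rw [ST_mem] at h ⊢; rwa [abs_neg]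
      rw [Set.indicator_of_notMem h, Set.indicator_of_notMem h', neg_zero]
  have h2 : 2 * J = ∫ τ in ST ε N, -2 * I * ((2 * π * σ * Real.sinc (2 * π * σ * τ) : ℝ) : ℂ) := by
    have : 2 * J = (∫ τ in ST ε N, E (-(τ * σ)) * ((τ : ℝ) : ℂ)⁻¹) - ∫ τ in ST ε N, E (τ * σ) * ((τ : ℝ) : ℂ)⁻¹ := by
      rw [← hJ]; linear_combination h1
    have hI' : IntegrableOn (fun τ : ℝ => E (-(τ * σ)) * ((τ : ℝ) : ℂ)⁻¹) (ST ε N) := by simpa using hI (-σ)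
    rw [this, ← integral_sub hI' (hI σ)]
    apply setIntegral_congr_fun (ST_meas _ _)
    intro τ hτ
    beta_reduce
    have hτ0 : τ ≠ 0 := by
      intro h0
      have := (ST_mem.1 hτ).2
      rw [h0, abs_zero] at this; linarith
    rw [← sub_mul, E_sub_E, mul_assoc]
    congr 1
    by_cases hs : σ = 0
    · subst hs; simp
    · rw [Real.sinc_of_ne_zero (by have := Real.pi_pos; positivity)]
      rw [← Complex.ofReal_inv, ← Complex.ofReal_mul]
      congr 1
      have := Real.pi_pos
      field_simp
  have h3 : ∫ τ in ST ε N, 2 * π * σ * Real.sinc (2 * π * σ * τ) = SS (2 * π * σ * N) - SS (2 * π * σ * ε) := by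
    have hc : Continuous fun τ : ℝ => 2 * π * σ * Real.sinc (2 * π * σ * τ) := by
      have := Real.continuous_sinc
      fun_prop
    have hSS : ∀ M, 0 ≤ M → ∫ τ in Set.Icc (-M) M, 2 * π * σ * Real.sinc (2 * π * σ * τ) = SS (2 * π * σ * M) := by
      intro M hM
      rw [integral_Icc_eq_integral_Ioc, ← intervalIntegral.integral_of_le (by linarith), intervalIntegral.integral_const_mul,
        intervalIntegral.mul_integral_comp_mul_left]
      unfold SS; congr 1; ring
    unfold ST
    rw [setIntegral_sdiff measurableSet_Icc hc.integrableOn_Icc (Set.Icc_subset_Icc (by linarith) hN), hSS N (by linarith), hSS ε hε.le]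
  rw [integral_const_mul, integral_complex_ofReal, h3] at h2
  linear_combination h2 / 2

end BHT
end

section
namespace BHT

lemma line_null (α : ℝ) : ∀ᵐ q : ℝ × ℝ, q.1 + α * q.2 ≠ 0 := by
  rw [ae_iff]
  simp only [ne_eq, not_not]
  have hm : MeasurableSet {q : ℝ × ℝ | q.1 + α * q.2 = 0} := measurableSet_eq_fun (by fun_prop) measurable_const
  rw [Measure.volume_eq_prod, ← Measure.prod_swap, Measure.map_apply measurable_swap hm,
    Measure.measure_prod_null (measurable_swap hm)]
  refine Eventually.of_forall fun y => ?_
  have : Prod.mk y ⁻¹' (Prod.swap ⁻¹' {q : ℝ × ℝ | q.1 + α * q.2 = 0}) = {-(α * y)} := by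
    ext x
    simp only [Set.mem_preimage, Set.mem_singleton_iff, Set.mem_ofPred_eq, Prod.swap]
    constructor <;> intro h <;> linarith
  beta_reduce; rw [this]; simp

lemma seq_tendsto (d : ℝ) (hd : Tendsto SS atTop (nhds d)) {σ : ℝ} (hσ : σ ≠ 0) :
    Tendsto (fun n : ℕ => SS (2 * π * σ * ((n:ℝ) + 1)) - SS (2 * π * σ * ((n:ℝ) + 1)⁻¹)) atTop
      (nhds (d * (2 * (if 0 < σ then 1 else 0) - 1))) := by
  have hπ := Real.pi_pos
  have hn : Tendsto (fun n : ℕ => (n:ℝ) + 1) atTop atTop := tendsto_natCast_atTop_atTop.atTop_add tendsto_const_nhds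
  have h2 : Tendsto (fun n : ℕ => SS (2 * π * σ * ((n:ℝ) + 1)⁻¹)) atTop (nhds 0) := by
    rw [← SS_zero]
    apply (SS_cont.tendsto 0).comp
    have := (tendsto_inv_atTop_zero.comp hn).const_mul (2 * π * σ)
    rwa [mul_zero] at this
  rcases lt_or_gt_of_ne hσ with h | h
  · have h3 : Tendsto (fun n : ℕ => SS (2 * π * σ * ((n:ℝ) + 1))) atTop (nhds (-d)) := by
      have h4 : Tendsto (fun n : ℕ => (2 * π * (-σ)) * ((n:ℝ) + 1)) atTop atTop :=
        hn.const_mul_atTop (by have : 0 < -σ := by linarith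
                               positivity)
      have := (hd.comp h4).neg
      refine this.congr fun n => ?_
      simp only [Function.comp]
      rw [← SS_neg]; congr 1; ring
    have := h3.sub h2
    rw [if_neg (by linarith)]
    convert this using 2; ring
  · have h3 : Tendsto (fun n : ℕ => SS (2 * π * σ * ((n:ℝ) + 1))) atTop (nhds d) :=
      hd.comp (hn.const_mul_atTop (by positivity))
    have := h3.sub h2
    rw [if_pos h]
    convert this using 2; ring

lemma schwartz_prod (f g : 𝓢(ℝ, ℂ)) (α x τ : ℝ) :
    f (x - τ) * g (x - α * τ) = ∫ q : ℝ × ℝ, (𝓕 f) q.1 * (𝓕 g) q.2 * E (x * (q.1 + q.2)) * E (-(τ * (q.1 + α * q.2))) := by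
  rw [schwartz_inv f, schwartz_inv g, ← integral_prod_mul, ← Measure.volume_eq_prod]
  congr 1; ext q
  have : E (q.1 * (x - τ)) * E (q.2 * (x - α * τ)) = E (x * (q.1 + q.2)) * E (-(τ * (q.1 + α * q.2))) := by
    rw [← E_add, ← E_add]; congr 1; ring
  linear_combination ((𝓕 f) q.1 * (𝓕 g) q.2) * this

/-- the bilinear Hilbert transform as a combination of the half-plane multiplier and the product -/
theorem H_eq (d : ℝ) (hd : Tendsto SS atTop (nhds d)) (α : ℝ) (f g : 𝓢(ℝ, ℂ)) (x : ℝ) (Hx : ℂ)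
    (hH : Tendsto (fun ε : ℝ => ((Real.pi : ℂ))⁻¹ *
            ∫ τ in {τ : ℝ | ε < |τ|}, f (x - τ) * g (x - α * τ) * ((τ : ℝ) : ℂ)⁻¹)
          (nhdsWithin 0 (Set.Ioi 0)) (nhds Hx)) :
    Hx = (π:ℂ)⁻¹ * (-I * d * (2 * FF α (𝓕 f : 𝓢(ℝ, ℂ)) (𝓕 g : 𝓢(ℝ, ℂ)) x - f x * g x)) := by
  have hE := continuous_E
  set u : 𝓢(ℝ, ℂ) := 𝓕 f with hu
  set v : 𝓢(ℝ, ℂ) := 𝓕 g with hv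
  have iu : Integrable u := u.integrable
  have iv : Integrable v := v.integrable
  obtain ⟨B, hB0, hB⟩ := SS_bdd
  set A : ℝ × ℝ → ℂ := fun q => u q.1 * v q.2 * E (x * (q.1 + q.2)) with hA
  have iA : Integrable A := by
    apply (iu.mul_prod iv).mul_bdd (c := 1) (Continuous.aestronglyMeasurable (by fun_prop))
    exact Eventually.of_forall fun x => (norm_E _).le
  set Gf : ℝ → ℂ := fun τ => f (x - τ) * g (x - α * τ) with hGf
  have iG : Integrable Gf := by
    have i1 : Integrable (fun τ => f (x - τ)) := f.integrable.comp_sub_left x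
    obtain ⟨Cg, hCg, hg⟩ := schwartz_decay g
    apply i1.mul_bdd (c := Cg)
    · have := g.continuous
      exact Continuous.aestronglyMeasurable (by fun_prop)
    · refine Eventually.of_forall fun τ => (hg _).trans ?_
      apply mul_le_of_le_one_right hCg.le
      apply inv_le_one_of_one_le₀
      apply one_le_pow₀
      nlinarith [sq_nonneg (x - α * τ)]
  have hn : Tendsto (fun n : ℕ => (n:ℝ) + 1) atTop atTop := tendsto_natCast_atTop_atTop.atTop_add tendsto_const_nhds
  have hpos : ∀ n : ℕ, 0 < ((n:ℝ) + 1)⁻¹ := fun n => by positivity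
  have hle : ∀ n : ℕ, ((n:ℝ) + 1)⁻¹ ≤ (n:ℝ) + 1 := fun n => by
    have : (1:ℝ) ≤ (n:ℝ) + 1 := by linarith [Nat.cast_nonneg (α := ℝ) n]
    exact (inv_le_one_of_one_le₀ this).trans this
  -- truncated integrals
  set T : ℕ → ℂ := fun n => ∫ τ in ST ((n:ℝ) + 1)⁻¹ ((n:ℝ) + 1), Gf τ * ((τ : ℝ) : ℂ)⁻¹ with hT
  have hTeq : ∀ n, T n = ∫ q : ℝ × ℝ, A q * (-I *
      ((SS (2 * π * (q.1 + α * q.2) * ((n:ℝ) + 1)) - SS (2 * π * (q.1 + α * q.2) * ((n:ℝ) + 1)⁻¹) : ℝ) : ℂ)) := by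
    intro n
    have i2 : Integrable (fun p : ℝ × (ℝ × ℝ) => ((p.1 : ℝ) : ℂ)⁻¹ * A p.2 * E (-(p.1 * (p.2.1 + α * p.2.2))))
        ((volume.restrict (ST ((n:ℝ) + 1)⁻¹ ((n:ℝ) + 1))).prod volume) := by
      apply ((ST_int (N := (n:ℝ) + 1) (hpos n)).integrable.mul_prod iA).mul_bdd (c := 1) (Continuous.aestronglyMeasurable (by fun_prop))
      exact Eventually.of_forall fun x => (norm_E _).le
    calc T n = ∫ τ in ST ((n:ℝ) + 1)⁻¹ ((n:ℝ) + 1), ∫ q : ℝ × ℝ, ((τ : ℝ) : ℂ)⁻¹ * A q * E (-(τ * (q.1 + α * q.2))) := by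
          rw [hT]; beta_reduce
          congr 1; ext τ
          rw [hGf]; beta_reduce
          rw [schwartz_prod, ← integral_mul_const]
          congr 1; ext q
          rw [hA]; ring
      _ = ∫ q : ℝ × ℝ, ∫ τ in ST ((n:ℝ) + 1)⁻¹ ((n:ℝ) + 1), ((τ : ℝ) : ℂ)⁻¹ * A q * E (-(τ * (q.1 + α * q.2))) :=
          integral_integral_swap i2
      _ = _ := by
          congr 1; ext q
          rw [← J_eq (hpos n) (hle n), ← integral_const_mul]
          congr 1; ext τ; ring
  have hTlim : Tendsto T atTop (nhds (∫ q : ℝ × ℝ, A q * (-I * ((d * (2 * hp α q - 1) : ℝ) : ℂ)))) := by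
    rw [funext hTeq]
    apply tendsto_integral_of_dominated_convergence (fun q => ‖A q‖ * (2 * B))
    · intro n
      have := SS_cont
      exact iA.1.mul (Continuous.aestronglyMeasurable (by fun_prop))
    · exact iA.norm.mul_const _
    · intro n
      refine Eventually.of_forall fun q => ?_
      rw [norm_mul, norm_mul (-I), norm_neg, Complex.norm_I, one_mul, Complex.norm_real]
      gcongr
      refine (norm_sub_le _ _).trans ?_
      have := hB (2 * π * (q.1 + α * q.2) * ((n:ℝ) + 1))
      have := hB (2 * π * (q.1 + α * q.2) * ((n:ℝ) + 1)⁻¹)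
      simp only [Real.norm_eq_abs]; linarith
    · filter_upwards [line_null α] with q hq
      apply Tendsto.const_mul
      apply Tendsto.const_mul
      exact (Complex.continuous_ofReal.tendsto _).comp (seq_tendsto d hd hq)
  have hlim : ∫ q : ℝ × ℝ, A q * (-I * ((d * (2 * hp α q - 1) : ℝ) : ℂ)) = -I * d * (2 * FF α u v x - f x * g x) := by
    have e0 : f x * g x = ∫ q, A q := by
      have := schwartz_prod f g α x 0
      simp only [sub_zero, mul_zero, zero_mul, neg_zero, E_zero, mul_one] at this
      exact this
    rw [e0]
    unfold FF
    have i3 : Integrable (fun q : ℝ × ℝ => u q.1 * v q.2 * (hp α q : ℂ) * E (x * (q.1 + q.2))) := by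
      apply (FF_int iu iv α).mul_bdd (c := 1) (Continuous.aestronglyMeasurable (by fun_prop))
      exact Eventually.of_forall fun x => (norm_E _).le
    rw [← integral_const_mul, ← integral_sub (i3.const_mul 2) iA, ← integral_const_mul]
    congr 1; ext q
    rw [hA]; push_cast; ring
  -- tails
  have hW : Tendsto (fun n : ℕ => ∫ τ in {τ : ℝ | ((n:ℝ) + 1)⁻¹ < |τ|}, Gf τ * ((τ : ℝ) : ℂ)⁻¹) atTop (nhds (π * Hx)) := by
    have h1 : Tendsto (fun n : ℕ => ((n:ℝ) + 1)⁻¹) atTop (nhdsWithin 0 (Set.Ioi 0)) := by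
      apply tendsto_nhdsWithin_iff.2
      exact ⟨tendsto_inv_atTop_zero.comp hn, Eventually.of_forall hpos⟩
    have h2 := (hH.comp h1).const_mul (π:ℂ)
    refine h2.congr fun n => ?_
    simp only [Function.comp]
    rw [← mul_assoc, mul_inv_cancel₀ (by exact_mod_cast Real.pi_pos.ne'), one_mul]
  have hdiff : Tendsto (fun n : ℕ => (∫ τ in {τ : ℝ | ((n:ℝ) + 1)⁻¹ < |τ|}, Gf τ * ((τ : ℝ) : ℂ)⁻¹) - T n) atTop (nhds 0) := by
    have hb : Tendsto (fun n : ℕ => ((n:ℝ) + 1)⁻¹ * ∫ τ, ‖Gf τ‖) atTop (nhds 0) := by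
      have := (tendsto_inv_atTop_zero.comp hn).mul_const (∫ τ, ‖Gf τ‖)
      rwa [zero_mul] at this
    apply squeeze_zero_norm _ hb
    intro n
    have hmS : MeasurableSet {τ : ℝ | ((n:ℝ) + 1)⁻¹ < |τ|} := measurableSet_lt measurable_const (by fun_prop)
    have hsub : ST ((n:ℝ) + 1)⁻¹ ((n:ℝ) + 1) ⊆ {τ : ℝ | ((n:ℝ) + 1)⁻¹ < |τ|} := fun τ hτ => (ST_mem.1 hτ).2
    have iS : IntegrableOn (fun τ => Gf τ * ((τ : ℝ) : ℂ)⁻¹) {τ : ℝ | ((n:ℝ) + 1)⁻¹ < |τ|} := by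
      apply iG.integrableOn.mul_bdd (c := (n:ℝ) + 1)
      · exact Measurable.aestronglyMeasurable (by fun_prop)
      · refine (ae_restrict_iff' hmS).2 (Eventually.of_forall fun τ hτ => ?_)
        rw [norm_inv, Complex.norm_real, Real.norm_eq_abs]
        exact inv_le_of_inv_le₀ (by positivity) (le_of_lt hτ)
    rw [hT]; beta_reduce
    rw [← setIntegral_sdiff (ST_meas _ _) iS hsub]
    calc ‖∫ τ in {τ : ℝ | ((n:ℝ) + 1)⁻¹ < |τ|} \ ST ((n:ℝ) + 1)⁻¹ ((n:ℝ) + 1), Gf τ * ((τ : ℝ) : ℂ)⁻¹‖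
        ≤ ∫ τ in {τ : ℝ | ((n:ℝ) + 1)⁻¹ < |τ|} \ ST ((n:ℝ) + 1)⁻¹ ((n:ℝ) + 1), ((n:ℝ) + 1)⁻¹ * ‖Gf τ‖ := by
          apply norm_integral_le_of_norm_le (iG.norm.const_mul _).integrableOn
          refine (ae_restrict_iff' (hmS.diff (ST_meas _ _))).2 (Eventually.of_forall fun τ hτ => ?_)
          have h1 : (n:ℝ) + 1 < |τ| := by
            by_contra hlt
            push Not at hlt
            exact hτ.2 (ST_mem.2 ⟨hlt, hτ.1⟩)
          rw [norm_mul, norm_inv, Complex.norm_real, Real.norm_eq_abs, mul_comm]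
          gcongr
      _ ≤ ∫ τ, ((n:ℝ) + 1)⁻¹ * ‖Gf τ‖ := by
          apply setIntegral_le_integral (iG.norm.const_mul _)
          exact Eventually.of_forall fun τ => by positivity
      _ = _ := integral_const_mul _ _
  have h9 := tendsto_nhds_unique hdiff (hW.sub hTlim)
  rw [hlim] at h9
  have hπ : (π:ℂ) ≠ 0 := by exact_mod_cast Real.pi_pos.ne'
  rw [← sub_eq_zero.1 h9.symm, ← mul_assoc, inv_mul_cancel₀ hπ, one_mul]

end BHT
end

section
namespace BHT

lemma schwartz_BM (f : 𝓢(ℝ, ℂ)) : BM f := by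
  obtain ⟨C, hC, h⟩ := schwartz_decay f
  refine ⟨f.continuous.measurable, C, fun x => (h x).trans ?_⟩
  apply mul_le_of_le_one_right hC.le
  apply inv_le_one_of_one_le₀
  apply one_le_pow₀
  nlinarith [sq_nonneg x]

lemma schwartz_zero (f : 𝓢(ℝ, ℂ)) (h : (f : ℝ → ℂ) =ᵐ[volume] 0) (x : ℝ) : f x = 0 := by
  have := Continuous.ae_eq_iff_eq (μ := (volume : Measure ℝ)) f.continuous (continuous_zero : Continuous (0 : ℝ → ℂ)) |>.1 h
  exact congrFun this x

theorem main_bht (α : ℝ) (hα0 : α ≠ 0) (hα1 : α ≠ 1) (p₁ p₂ p₃ : ℝ≥0∞)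
    (h₁ : 1 < p₁) (h₂ : 1 < p₂) (h₃ : 2/3 < p₃) (h₃' : p₃ < ∞)
    (hsum : 1/p₁ + 1/p₂ = 1/p₃) :
    ∃ C : ℝ, 0 < C ∧ ∀ f g : 𝓢(ℝ, ℂ), ∀ H : ℝ → ℂ,
      (∀ x : ℝ, Filter.Tendsto
          (fun ε : ℝ => ((Real.pi : ℂ))⁻¹ *
            ∫ τ in {τ : ℝ | ε < |τ|}, f (x - τ) * g (x - α * τ) * ((τ : ℝ) : ℂ)⁻¹)
          (nhdsWithin 0 (Set.Ioi 0)) (nhds (H x))) →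
      eLpNorm H p₃ volume ≤
        ENNReal.ofReal C *
          (eLpNorm (fun x => f x) p₁ volume * eLpNorm (fun x => g x) p₂ volume) := by
  obtain ⟨r, hr, hr2, hrs, hend⟩ := endgame p₁ p₂ p₃ h₁ h₂ h₃ h₃' hsum
  obtain ⟨Cr, hCr, hred⟩ := red_main hα0 hα1 r hr hr2 hrs
  obtain ⟨C, hC, hmain⟩ := hend Cr hCr
  obtain ⟨d, hd⟩ := SS_tendsto
  have hT : ENNReal.HolderTriple p₁ p₂ p₃ := ⟨by simpa using hsum⟩
  set c1 : ℂ := (π:ℂ)⁻¹ * (-I * d) * 2 with hc1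
  set c2 : ℂ := -((π:ℂ)⁻¹ * (-I * d)) with hc2
  set D : ℝ≥0∞ := ENNReal.LpAddConst p₃ * (‖c1‖ₑ * ENNReal.ofReal C + ‖c2‖ₑ) with hD
  have hDt : D ≠ ∞ := by
    apply ENNReal.mul_ne_top (ENNReal.LpAddConst_lt_top p₃).ne
    exact ENNReal.add_ne_top.2 ⟨ENNReal.mul_ne_top enorm_ne_top ENNReal.ofReal_ne_top, enorm_ne_top⟩
  refine ⟨D.toReal + 1, by positivity, fun f g H hH => ?_⟩
  by_cases hz : (f : ℝ → ℂ) =ᵐ[volume] 0 ∨ (g : ℝ → ℂ) =ᵐ[volume] 0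
  · have hH0 : H = 0 := by
      ext x
      have h0 : ∀ τ : ℝ, f (x - τ) * g (x - α * τ) * ((τ : ℝ) : ℂ)⁻¹ = 0 := by
        intro τ
        rcases hz with h | h
        · rw [schwartz_zero f h]; simp
        · rw [schwartz_zero g h]; simp
      have := hH x
      simp only [h0, integral_zero, mul_zero] at this
      exact tendsto_nhds_unique this tendsto_const_nhds
    rw [hH0]; simp
  · push Not at hz
    have hF := hmain f g (FF α (𝓕 f : 𝓢(ℝ, ℂ)) (𝓕 g : 𝓢(ℝ, ℂ))) (schwartz_BM f) (schwartz_BM g)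
      (FF_BM (𝓕 f : 𝓢(ℝ, ℂ)).integrable (𝓕 g : 𝓢(ℝ, ℂ)).integrable α) hz.1 hz.2
      (hred _ _ f g (𝓕 f : 𝓢(ℝ, ℂ)).integrable (𝓕 g : 𝓢(ℝ, ℂ)).integrable (schwartz_BM f) (schwartz_BM g)
        (schwartz_inv f) (schwartz_inv g))
    have hFm := (FF_BM (𝓕 f : 𝓢(ℝ, ℂ)).integrable (𝓕 g : 𝓢(ℝ, ℂ)).integrable α).1
    set F := FF α (𝓕 f : 𝓢(ℝ, ℂ)) (𝓕 g : 𝓢(ℝ, ℂ)) with hFdef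
    have hHe : H = c1 • F + c2 • ((f : ℝ → ℂ) • (g : ℝ → ℂ)) := by
      ext x
      rw [H_eq d hd α f g x (H x) (hH x)]
      simp only [Pi.add_apply, Pi.smul_apply, smul_eq_mul, Pi.mul_apply, hc1, hc2, hFdef]
      ring
    have hfm : AEStronglyMeasurable (f : ℝ → ℂ) volume := f.continuous.aestronglyMeasurable
    have hgm : AEStronglyMeasurable (g : ℝ → ℂ) volume := g.continuous.aestronglyMeasurable
    have hhol := eLpNorm_smul_le_mul_eLpNorm (μ := volume) (p := p₁) (q := p₂) (r := p₃) hgm hfm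
    set N := eLpNorm (fun x => f x) p₁ volume * eLpNorm (fun x => g x) p₂ volume with hN
    calc eLpNorm H p₃ volume ≤ ENNReal.LpAddConst p₃ * (eLpNorm (c1 • F) p₃ volume + eLpNorm (c2 • ((f : ℝ → ℂ) • (g : ℝ → ℂ))) p₃ volume) := by
          rw [hHe]
          exact eLpNorm_add_le' (hFm.aestronglyMeasurable.const_smul c1) ((hfm.smul hgm).const_smul c2) p₃
      _ ≤ ENNReal.LpAddConst p₃ * (‖c1‖ₑ * (ENNReal.ofReal C * N) + ‖c2‖ₑ * N) := by
          rw [eLpNorm_const_smul, eLpNorm_const_smul]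
          exact mul_le_mul' le_rfl (add_le_add (mul_le_mul' le_rfl hF) (mul_le_mul' le_rfl hhol))
      _ = D * N := by rw [hD]; ring
      _ ≤ ENNReal.ofReal (D.toReal + 1) * N := by
          apply mul_le_mul' _ le_rfl
          rw [← ENNReal.ofReal_toReal hDt, ENNReal.toReal_ofReal ENNReal.toReal_nonneg]
          exact ENNReal.ofReal_le_ofReal (by linarith)

end BHT
end

/-- Lacey–Thiele boundedness of the bilinear Hilbert transforms:
`L^{p₁} × L^{p₂} → L^{p₃}` for `1 < p₁,p₂ ≤ ∞`, `2/3 < p₃ < ∞`, `1/p₁ + 1/p₂ = 1/p₃`. -/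
theorem stmt18 (α : ℝ) (hα0 : α ≠ 0) (hα1 : α ≠ 1) (p₁ p₂ p₃ : ℝ≥0∞)
    (h₁ : 1 < p₁) (h₂ : 1 < p₂) (h₃ : 2/3 < p₃) (h₃' : p₃ < ∞)
    (hsum : 1/p₁ + 1/p₂ = 1/p₃) :
    ∃ C : ℝ, 0 < C ∧ ∀ f g : 𝓢(ℝ, ℂ), ∀ H : ℝ → ℂ,
      (∀ x : ℝ, Filter.Tendsto
          (fun ε : ℝ => ((Real.pi : ℂ))⁻¹ *
            ∫ τ in {τ : ℝ | ε < |τ|}, f (x - τ) * g (x - α * τ) * ((τ : ℝ) : ℂ)⁻¹)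
          (nhdsWithin 0 (Set.Ioi 0)) (nhds (H x))) →
      eLpNorm H p₃ volume ≤
        ENNReal.ofReal C *
          (eLpNorm (fun x => f x) p₁ volume * eLpNorm (fun x => g x) p₂ volume) := by
  exact BHT.main_bht α hα0 hα1 p₁ p₂ p₃ h₁ h₂ h₃ h₃' hsum
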